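/- (Nested Artin approximation for algebraic power series.) Let m ≥ 1 and let n₁,…,nₘ and l₁,…,lₘ be natural numbers; write xᵢ for a block of nᵢ variables and yᵢ for a block of lᵢ variables. For each i = 1,…,m let Fᵢ be an algebraic power series in ℝ[[x₁,…,xᵢ,y₁,…,yᵢ]], and let fᵢ ∈ ℝ[[x₁,…,xᵢ]]^{lᵢ} be a tuple of formal power series with zero constant terms such that substituting yⱼ := fⱼ(x₁,…,xⱼ) for j = 1,…,i into Fᵢ yields the zero power series in ℝ[[x₁,…,xᵢ]]. Then for every c ∈ ℕ there exist tuples f̃ᵢ ∈ ℝ[[x₁,…,xᵢ]]^{lᵢ}, i = 1,…,m, each component of which is an algebraic power series with zero constant term, such that every component of f̃ᵢ − fᵢ has no monomials of total degree less than c, and substituting yⱼ := f̃ⱼ(x₁,…,xⱼ) for j = 1,…,i into Fᵢ yields the zero power series, for every i = 1,…,m. -/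

import Mathlib

noncomputable section

/-- Substitution of power series (with zero constant term) into a multivariate formal
power series, defined coefficientwise: the coefficient of a monomial `d` of the result is
the (finite) sum, over monomials `e` of total degree at most that of `d`, of
`coeff e f * coeff d (∏ s, (a s) ^ (e s))`.  When every `a s` has zero constant
coefficient this is the usual substitution `f(a)`. -/
def psubst {σ τ : Type*} [Fintype σ] [DecidableEq σ]
    (a : σ → MvPowerSeries τ ℝ) (f : MvPowerSeries σ ℝ) : MvPowerSeries τ ℝ :=
  fun d =>
    ∑ e ∈ Finset.Iic (Finsupp.equivFunOnFinite.symm fun _ => d.sum fun _ k => k),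
      MvPowerSeries.coeff e f * MvPowerSeries.coeff d (e.prod fun s k => a s ^ k)

/-- A power series is algebraic if it satisfies a nontrivial polynomial equation over the
polynomial ring, i.e. it is algebraic over `MvPolynomial σ ℝ`. -/
def IsAlgebraicPS {σ : Type} (G : MvPowerSeries σ ℝ) : Prop :=
  IsAlgebraic (MvPolynomial σ ℝ) G

section Part1
open MvPolynomial

/-- rows of `J` are independent modulo `Q`. -/
def IndepMod {Λ κ ι : Type} [CommRing Λ] [Fintype κ] (Q : Ideal Λ) (J : κ → ι → Λ) : Prop :=
  ∀ l : κ → Λ, (∀ i, ∑ k, l k * J k i ∈ Q) → ∀ k, l k ∈ Q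

theorem indepMod_of_rightInv {Λ κ ι : Type} [CommRing Λ] [Fintype κ] [Fintype ι] [DecidableEq κ]
    (Q : Ideal Λ) [hQ : Q.IsPrime] (J : κ → ι → Λ) (δ : Λ) (hδ : δ ∉ Q) (N : ι → κ → Λ)
    (h : ∀ k k', ∑ i, J k i * N i k' - (if k = k' then δ else 0) ∈ Q) : IndepMod Q J := by
  intro l hl k
  have h1 : ∑ i, (∑ k', l k' * J k' i) * N i k ∈ Q :=
    Q.sum_mem fun i _ => Q.mul_mem_right _ (hl i)
  have h2 : ∑ k', l k' * (∑ i, J k' i * N i k - (if k' = k then δ else 0)) ∈ Q :=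
    Q.sum_mem fun i _ => Q.mul_mem_left _ (h _ _)
  have h3 : ∑ i, (∑ k', l k' * J k' i) * N i k
      - ∑ k', l k' * (∑ i, J k' i * N i k - (if k' = k then δ else 0)) = l k * δ := by
    simp only [mul_sub, Finset.sum_sub_distrib, Finset.sum_mul, Finset.mul_sum, mul_ite, mul_zero,
      Finset.sum_ite_eq', Finset.mem_univ, if_true]
    rw [Finset.sum_comm]
    simp [mul_assoc]
  have h4 := Q.sub_mem h1 h2
  rw [h3] at h4
  exact (hQ.mem_or_mem h4).resolve_right hδ

theorem exists_rightInv_of_indepMod {Λ κ ι : Type} [CommRing Λ] [Fintype κ] [Fintype ι]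
    [DecidableEq κ] (Q : Ideal Λ) [hQ : Q.IsPrime] (J : κ → ι → Λ) (hJ : IndepMod Q J) :
    ∃ δ ∉ Q, ∃ N : ι → κ → Λ, ∀ k k', ∑ i, J k i * N i k' = if k = k' then δ else 0 := by
  classical
  let k := FractionRing (Λ ⧸ Q)
  let φ : Λ →+* k := (algebraMap (Λ ⧸ Q) k).comp (Ideal.Quotient.mk Q)
  have hφ : ∀ a, φ a = 0 ↔ a ∈ Q := by
    intro a
    simp only [φ, RingHom.comp_apply]
    rw [FaithfulSMul.algebraMap_eq_zero_iff, Ideal.Quotient.eq_zero_iff_mem]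
  have hclear : ∀ (τ : Type) [Fintype τ] (v : τ → k), ∃ s ∉ Q, ∃ w : τ → Λ,
      ∀ t, φ s * v t = φ (w t) := by
    intro τ _ v
    obtain ⟨b, hb⟩ := IsLocalization.exist_integer_multiples_of_finite (nonZeroDivisors (Λ ⧸ Q)) v
    choose w' hw' using hb
    obtain ⟨s, hs⟩ := Ideal.Quotient.mk_surjective (b : Λ ⧸ Q)
    choose w hw using fun t => Ideal.Quotient.mk_surjective (w' t)
    refine ⟨s, ?_, w, ?_⟩
    · rw [← Ideal.Quotient.eq_zero_iff_mem, hs]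
      exact nonZeroDivisors.coe_ne_zero b
    · intro t
      simp only [φ, RingHom.comp_apply, hs, hw, hw']
      rw [Algebra.smul_def]
  let M : (κ → k) →ₗ[k] (ι → k) :=
    { toFun := fun l i => ∑ x, l x * φ (J x i)
      map_add' := by intro a b; ext i; simp [add_mul, Finset.sum_add_distrib]
      map_smul' := by
        intro a b; ext i; simp only [Pi.smul_apply, smul_eq_mul, mul_assoc, RingHom.id_apply]
        rw [Finset.mul_sum] }
  have hM : LinearMap.ker M = ⊥ := by
    rw [LinearMap.ker_eq_bot']
    intro l hl
    obtain ⟨s, hs, w, hw⟩ := hclear κ l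
    have : ∀ i, ∑ x, w x * J x i ∈ Q := by
      intro i
      rw [← hφ, map_sum]
      have := congrFun hl i
      simp only [M, LinearMap.coe_mk, AddHom.coe_mk, Pi.zero_apply] at this
      calc ∑ x, φ (w x * J x i) = φ s * ∑ x, l x * φ (J x i) := by
            rw [Finset.mul_sum]; refine Finset.sum_congr rfl fun x _ => ?_
            rw [map_mul, ← hw]; ring
        _ = 0 := by rw [this, mul_zero]
    have h2 := hJ w this
    ext x
    have := hw x
    rw [(hφ _).2 (h2 x)] at this
    exact (mul_eq_zero.1 this).resolve_left (fun h => hs ((hφ _).1 h))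
  obtain ⟨G, hG⟩ := M.exists_leftInverse_of_injective hM
  obtain ⟨s, hs, w, hw⟩ := hclear (ι × κ) (fun p => G (Pi.single p.1 1) p.2)
  let A : Matrix κ κ Λ := fun a b => ∑ i, J a i * w (i, b)
  have hA : ∀ a b, φ (A a b) = if a = b then φ s else 0 := by
    intro a b
    have h1 : G (M (Pi.single a 1)) b = (Pi.single a 1 : κ → k) b := by
      have := congrFun (congrArg DFunLike.coe hG) (Pi.single a 1)
      simp only [LinearMap.comp_apply, LinearMap.id_apply] at this
      rw [this]
    have h2 : M (Pi.single a 1) = ∑ i, φ (J a i) • (Pi.single i 1 : ι → k) := by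
      ext i
      simp [M, Pi.single_apply, Finset.sum_apply]
    rw [h2, map_sum, Finset.sum_apply] at h1
    simp only [map_smul, Pi.smul_apply, smul_eq_mul] at h1
    calc φ (A a b) = ∑ i, φ (J a i) * (φ s * G (Pi.single i 1) b) := by
          simp only [A, map_sum, map_mul]
          refine Finset.sum_congr rfl fun i _ => ?_
          rw [← hw (i, b)]
      _ = φ s * ∑ i, φ (J a i) * G (Pi.single i 1) b := by
          rw [Finset.mul_sum]; exact Finset.sum_congr rfl fun i _ => by ring
      _ = _ := by rw [h1]; by_cases h : a = b <;> simp [h, Pi.single_apply, eq_comm]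
  refine ⟨A.det, ?_, fun i b => ∑ c, w (i, c) * A.adjugate c b, ?_⟩
  · rw [← hφ, RingHom.map_det]
    have : φ.mapMatrix A = φ s • (1 : Matrix κ κ k) := by
      ext a b; simp [hA, Matrix.one_apply]
    rw [this, Matrix.det_smul, Matrix.det_one, mul_one]
    exact pow_ne_zero _ (fun h => hs ((hφ _).1 h))
  · intro a b
    have h := congrFun (congrFun (Matrix.mul_adjugate A) a) b
    rw [Matrix.mul_apply] at h
    simp only [A] at h ⊢
    simp only [Finset.sum_mul, Finset.mul_sum] at h ⊢
    rw [Finset.sum_comm]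
    simp only [Matrix.smul_apply, Matrix.one_apply, smul_eq_mul, mul_ite, mul_one, mul_zero] at h
    rw [← h]
    exact Finset.sum_congr rfl fun i _ => Finset.sum_congr rfl fun j _ => by ring

section dv
variable {R Λ ι κ : Type} [CommRing R] [CommRing Λ] [Algebra R Λ]

/-- partial derivative at a point -/
noncomputable def dv (g : ι → Λ) (i : ι) (F : MvPolynomial ι R) : Λ := aeval g (pderiv i F)

variable (g : ι → Λ) (i : ι)

@[simp] theorem dv_add (a b : MvPolynomial ι R) : dv g i (a + b) = dv g i a + dv g i b := by
  simp [dv]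
@[simp] theorem dv_zero : dv g i (0 : MvPolynomial ι R) = 0 := by simp [dv]
@[simp] theorem dv_one : dv g i (1 : MvPolynomial ι R) = 0 := by simp [dv]
@[simp] theorem dv_sub (a b : MvPolynomial ι R) : dv g i (a - b) = dv g i a - dv g i b := by
  simp [dv]
@[simp] theorem dv_neg (a : MvPolynomial ι R) : dv g i (-a) = -dv g i a := by
  simp [dv]
@[simp] theorem dv_C (a : R) : dv g i (C a : MvPolynomial ι R) = 0 := by simp [dv]
@[simp] theorem dv_mul (a b : MvPolynomial ι R) :
    dv g i (a * b) = dv g i a * aeval g b + aeval g a * dv g i b := by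
  simp only [dv, pderiv_mul, map_add, map_mul]
@[simp] theorem dv_pow (a : MvPolynomial ι R) (n : ℕ) :
    dv g i (a ^ n) = n * aeval g a ^ (n - 1) * dv g i a := by
  simp only [dv, pderiv_pow, map_mul, map_pow, map_natCast]
@[simp] theorem dv_sum {τ : Type} (s : Finset τ) (a : τ → MvPolynomial ι R) :
    dv g i (∑ t ∈ s, a t) = ∑ t ∈ s, dv g i (a t) := by
  simp [dv]
theorem dv_X [DecidableEq ι] (j : ι) : dv g i (X j : MvPolynomial ι R) = if j = i then 1 else 0 := by
  simp only [dv, pderiv_X, Pi.single_apply]; split_ifs <;> simp_all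
@[simp] theorem dv_X_self : dv g i (X i : MvPolynomial ι R) = 1 := by simp [dv]
theorem dv_X_ne {j : ι} (h : j ≠ i) : dv g i (X j : MvPolynomial ι R) = 0 := by
  simp [dv, pderiv_X_of_ne h]

theorem aeval_aeval' (φ : κ → MvPolynomial ι R) (F : MvPolynomial κ R) :
    aeval g (aeval φ F) = aeval (fun k => aeval g (φ k)) F := by
  induction F using MvPolynomial.induction_on with
  | C a => simp [MvPolynomial.algebraMap_eq]
  | add p q hp hq => simp only [map_add, hp, hq]
  | mul_X p k hp => simp only [map_mul, aeval_X, hp]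

theorem dv_aeval [Fintype κ] (φ : κ → MvPolynomial ι R) (F : MvPolynomial κ R) :
    dv g i (aeval φ F) = ∑ j, dv (fun k => aeval g (φ k)) j F * dv g i (φ j) := by
  classical
  induction F using MvPolynomial.induction_on with
  | C a => simp [MvPolynomial.algebraMap_eq]
  | add p q hp hq => simp only [map_add, dv_add, hp, hq, add_mul, Finset.sum_add_distrib]
  | mul_X p k hp =>
    simp only [map_mul, aeval_X, dv_mul, hp]
    simp only [add_mul, Finset.sum_add_distrib, dv_X]
    congr 1
    · rw [Finset.sum_mul]; exact Finset.sum_congr rfl fun j _ => by ring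
    · simp only [mul_ite, mul_one, mul_zero, ite_mul, zero_mul, Finset.sum_ite_eq, Finset.mem_univ,
        if_true]
      congr 1
      exact aeval_aeval' g φ p

theorem dv_rename_inj (f : κ → ι) (hf : Function.Injective f) (j : κ) (F : MvPolynomial κ R) :
    dv g (f j) (rename f F) = dv (g ∘ f) j F := by
  simp only [dv]
  rw [pderiv_rename hf, aeval_rename]

theorem dv_rename_ne (f : κ → ι) (h : ∀ k, f k ≠ i) (F : MvPolynomial κ R) :
    dv g i (rename f F) = 0 := by
  induction F using MvPolynomial.induction_on with
  | C a => simp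
  | add p q hp hq => simp only [map_add, dv_add, hp, hq, add_zero]
  | mul_X p k hp => simp only [map_mul, rename_X, dv_mul, hp, dv_X_ne g i (h k)]; simp

/-- First order Taylor estimate. -/
theorem taylor_one [Fintype ι] (m I : Ideal Λ) (g v v' : ι → Λ) (hv : ∀ i, v i - g i ∈ m)
    (hv' : ∀ i, v' i - g i ∈ m) (hI : ∀ i, v i - v' i ∈ I) (F : MvPolynomial ι R) :
    aeval v F - aeval v' F - ∑ i, dv g i F * (v i - v' i) ∈ m * I := by
  classical
  have key : ∀ F : MvPolynomial ι R, aeval v F - aeval g F ∈ m ∧ aeval v' F - aeval g F ∈ m ∧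
      aeval v F - aeval v' F ∈ I := by
    have gen : ∀ (J : Ideal Λ) (a b : ι → Λ), (∀ i, a i - b i ∈ J) → ∀ F : MvPolynomial ι R,
        aeval a F - aeval b F ∈ J := by
      intro J a b h F
      rw [← Ideal.Quotient.eq]
      have : ((Ideal.Quotient.mkₐ R J).comp (aeval a)) F = ((Ideal.Quotient.mkₐ R J).comp (aeval b)) F := by
        congr 1; ext i; simpa using Ideal.Quotient.eq.2 (h i)
      simpa using this
    exact fun F => ⟨gen m v g hv F, gen m v' g hv' F, gen I v v' hI F⟩
  induction F using MvPolynomial.induction_on with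
  | C a => simp
  | add p q hp hq =>
    convert Ideal.add_mem _ hp hq using 1
    simp only [map_add, dv_add, add_mul, Finset.sum_add_distrib]; ring
  | mul_X p k hp =>
    obtain ⟨h1, h2, h3⟩ := key p
    simp only [map_mul, aeval_X, dv_mul, dv_X, add_mul, Finset.sum_add_distrib, mul_ite, mul_one,
      mul_zero, ite_mul, zero_mul, Finset.sum_ite_eq, Finset.mem_univ, if_true]
    have e1 : g k * (aeval v p - aeval v' p - ∑ i, dv g i p * (v i - v' i)) ∈ m * I :=
      Ideal.mul_mem_left _ _ hp
    have e2 : (aeval v' p - aeval g p) * (v k - v' k) ∈ m * I := Ideal.mul_mem_mul h2 (hI k)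
    have e3 : (v k - g k) * (aeval v p - aeval v' p) ∈ m * I := Ideal.mul_mem_mul (hv k) h3
    convert Ideal.add_mem _ (Ideal.add_mem _ e1 e2) e3 using 1
    have : ∑ x, dv g x p * g k * (v x - v' x) = g k * ∑ x, dv g x p * (v x - v' x) := by
      rw [Finset.mul_sum]; exact Finset.sum_congr rfl fun x _ => by ring
    rw [this]; ring

theorem aeval_sub_mem (J : Ideal Λ) (a b : ι → Λ) (h : ∀ i, a i - b i ∈ J) (F : MvPolynomial ι R) :
    aeval a F - aeval b F ∈ J := by
  rw [← Ideal.Quotient.eq]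
  have : ((Ideal.Quotient.mkₐ R J).comp (aeval a)) F = ((Ideal.Quotient.mkₐ R J).comp (aeval b)) F := by
    congr 1; ext i; simpa using Ideal.Quotient.eq.2 (h i)
  simpa using this

end dv

end Part1

section Part2
open MvPolynomial IsLocalRing

section hensel
variable {R Λ κ : Type} [CommRing R] [CommRing Λ] [IsLocalRing Λ] [Algebra R Λ] [Fintype κ]

/-- A square matrix that is independent modulo the maximal ideal has a two sided inverse. -/
theorem exists_inv_of_indepMod [DecidableEq κ] (J : κ → κ → Λ) (hJ : IndepMod (maximalIdeal Λ) J) :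
    ∃ N : κ → κ → Λ, (∀ k k', ∑ i, J k i * N i k' = if k = k' then 1 else 0) ∧
      (∀ k k', ∑ i, N k i * J i k' = if k = k' then 1 else 0) := by
  obtain ⟨δ, hδ, N, hN⟩ := exists_rightInv_of_indepMod (maximalIdeal Λ) J hJ
  have hu : IsUnit δ := by simpa using hδ
  obtain ⟨u, rfl⟩ := hu
  have h1 : (Matrix.of J) * (Matrix.of fun i k => N i k * (↑u⁻¹ : Λ)) = 1 := by
    ext a b
    simp only [Matrix.mul_apply, Matrix.of_apply, Matrix.one_apply, ← mul_assoc]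
    rw [← Finset.sum_mul, hN]
    split_ifs <;> simp
  have h2 := mul_eq_one_comm.1 h1
  refine ⟨fun i k => N i k * (↑u⁻¹ : Λ), fun k k' => ?_, fun k k' => ?_⟩
  · simpa [Matrix.mul_apply, Matrix.one_apply] using congrFun (congrFun h1 k) k'
  · simpa [Matrix.mul_apply, Matrix.one_apply] using congrFun (congrFun h2 k) k'

theorem hensel_unique [IsNoetherianRing Λ] (ψ : κ → MvPolynomial κ R) (g v v' : κ → Λ)
    (hJ : IndepMod (maximalIdeal Λ) (fun k i => dv g i (ψ k)))
    (hv : ∀ i, v i - g i ∈ maximalIdeal Λ) (hv' : ∀ i, v' i - g i ∈ maximalIdeal Λ)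
    (h : ∀ k, aeval v (ψ k) = aeval v' (ψ k)) : v = v' := by
  classical
  obtain ⟨N, -, hN⟩ := exists_inv_of_indepMod _ hJ
  let I : Ideal Λ := Ideal.span (Set.range fun i => v i - v' i)
  have hI : ∀ i, v i - v' i ∈ I := fun i => Ideal.subset_span ⟨i, rfl⟩
  have h1 : ∀ k, ∑ i, dv g i (ψ k) * (v i - v' i) ∈ maximalIdeal Λ * I := by
    intro k
    have := taylor_one (maximalIdeal Λ) I g v v' hv hv' hI (ψ k)
    rw [h, sub_self, zero_sub] at this
    exact (Submodule.neg_mem_iff _).1 this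
  have h2 : I ≤ maximalIdeal Λ • I := by
    rw [Ideal.span_le]
    rintro _ ⟨i, rfl⟩
    have h3 : ∑ k, N i k * ∑ j, dv g j (ψ k) * (v j - v' j) = v i - v' i := by
      simp only [Finset.mul_sum]
      rw [Finset.sum_comm]
      simp only [← mul_assoc, ← Finset.sum_mul, hN]
      simp
    simp only [SetLike.mem_coe, smul_eq_mul]
    rw [← h3]
    exact Ideal.sum_mem _ fun k _ => Ideal.mul_mem_left _ _ (h1 k)
  have h4 := Submodule.eq_bot_of_le_smul_of_le_jacobson_bot (maximalIdeal Λ) I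
    (IsNoetherian.noetherian I) h2 (by rw [IsLocalRing.jacobson_eq_maximalIdeal ⊥ bot_ne_top])
  ext i
  have := hI i
  rw [h4, Ideal.mem_bot] at this
  exact sub_eq_zero.1 this

theorem hensel_exists [IsAdicComplete (maximalIdeal Λ) Λ] (ψ : κ → MvPolynomial κ R) (g : κ → Λ)
    (c : ℕ) (hc : 1 ≤ c) (hg : ∀ k, aeval g (ψ k) ∈ maximalIdeal Λ ^ c)
    (hJ : IndepMod (maximalIdeal Λ) (fun k i => dv g i (ψ k))) :
    ∃ v : κ → Λ, (∀ i, v i - g i ∈ maximalIdeal Λ ^ c) ∧ ∀ k, aeval v (ψ k) = 0 := by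
  classical
  obtain ⟨N, hN', hN⟩ := exists_inv_of_indepMod _ hJ
  set m := maximalIdeal Λ with hm
  let T : (κ → Λ) → κ → Λ := fun v i => v i - ∑ k, N i k * aeval v (ψ k)
  let s : ℕ → κ → Λ := fun j => T^[j] g
  have hs : ∀ j, s (j + 1) = T (s j) := fun j => Function.iterate_succ_apply' T j g
  have hstep : ∀ j, (∀ i, s j i - g i ∈ m ^ c) ∧ ∀ i, s (j + 1) i - s j i ∈ m ^ (c + j) := by
    intro j
    induction j with
    | zero =>
      refine ⟨fun i => by simp [s], fun i => ?_⟩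
      rw [hs]
      simp only [T, s, Function.iterate_zero, id, sub_sub_cancel_left]
      exact (Submodule.neg_mem_iff _).2 (Ideal.sum_mem _ fun k _ => Ideal.mul_mem_left _ _ (hg k))
    | succ j ih =>
      obtain ⟨ih1, ih2⟩ := ih
      have h1 : ∀ i, s (j + 1) i - g i ∈ m ^ c := fun i => by
        have := Ideal.add_mem _ (Ideal.pow_le_pow_right (Nat.le_add_right c j) (ih2 i)) (ih1 i)
        simpa using this
      refine ⟨h1, fun i => ?_⟩
      have hle : m ^ c ≤ m := Ideal.pow_le_self (by omega)
      have h2 : ∀ k, _ := fun k => taylor_one m (m ^ (c + j)) g (s (j + 1)) (s j)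
        (fun i => hle (h1 i)) (fun i => hle (ih1 i)) ih2 (ψ k)
      have h3 : s (j + 2) i - s (j + 1) i = -∑ k, N i k * (aeval (s (j + 1)) (ψ k) -
          aeval (s j) (ψ k) - ∑ l, dv g l (ψ k) * (s (j + 1) l - s j l)) := by
        have e1 : ∑ k, N i k * ∑ l, dv g l (ψ k) * (s (j + 1) l - s j l) = s (j + 1) i - s j i := by
          simp only [Finset.mul_sum]
          rw [Finset.sum_comm]
          simp only [← mul_assoc, ← Finset.sum_mul, hN]
          simp
        simp only [mul_sub, Finset.sum_sub_distrib, e1] at e1 ⊢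
        rw [e1, hs (j + 1)]
        simp only [T]
        conv_lhs => rw [sub_sub_cancel_left]
        have e2 : s (j + 1) i = s j i - ∑ k, N i k * aeval (s j) (ψ k) := by rw [hs j]
        rw [e2]; ring
      rw [h3]
      refine (Submodule.neg_mem_iff _).2 (Ideal.sum_mem _ fun k _ => Ideal.mul_mem_left _ _ ?_)
      have := h2 k
      rw [← pow_succ'] at this
      exact this
  have hcauchy : ∀ i, ∀ {a b : ℕ}, a ≤ b → s a i ≡ s b i [SMOD m ^ a • (⊤ : Submodule Λ Λ)] := by
    intro i a b hab
    induction b, hab using Nat.le_induction with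
    | base => rfl
    | succ b hab ih =>
      refine ih.trans ?_
      rw [SModEq.sub_mem, smul_eq_mul, Ideal.mul_top, ← Submodule.neg_mem_iff, neg_sub]
      exact Ideal.pow_le_pow_right (by omega) ((hstep b).2 i)
  have hlim : ∀ i, ∃ L, ∀ n, s n i ≡ L [SMOD m ^ n • (⊤ : Submodule Λ Λ)] := fun i =>
    IsPrecomplete.prec inferInstance (hcauchy i)
  choose L hL using hlim
  have hL' : ∀ n i, s n i - L i ∈ m ^ n := by
    intro n i
    have := hL i n
    rwa [SModEq.sub_mem, smul_eq_mul, Ideal.mul_top] at this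
  refine ⟨L, fun i => ?_, fun k => ?_⟩
  · have := Ideal.sub_mem _ ((hstep c).1 i) (hL' c i)
    simpa using this
  · refine IsHausdorff.haus (inferInstance : IsHausdorff m Λ) _ fun n => ?_
    rw [SModEq.sub_mem, smul_eq_mul, Ideal.mul_top, sub_zero]
    have h1 : aeval (s n) (ψ k) - aeval L (ψ k) ∈ m ^ n := aeval_sub_mem _ _ _ (hL' n) _
    have h2 : aeval (s n) (ψ k) = -∑ i, dv g i (ψ k) * (s (n + 1) i - s n i) := by
      rw [hs]
      simp only [T, sub_sub_cancel_left, mul_neg, Finset.sum_neg_distrib, neg_neg, Finset.mul_sum]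
      rw [Finset.sum_comm]
      simp only [← mul_assoc, ← Finset.sum_mul, hN']
      simp
    have h3 : aeval (s n) (ψ k) ∈ m ^ n := by
      rw [h2]
      exact (Submodule.neg_mem_iff _).2 (Ideal.sum_mem _ fun i _ => Ideal.mul_mem_left _ _
        (Ideal.pow_le_pow_right (by omega) ((hstep n).2 i)))
    have := Ideal.sub_mem _ h3 h1
    simpa using this
end hensel

section etale
variable (B Λ : Type) [CommRing B] [CommRing Λ] [IsLocalRing Λ] [Algebra B Λ]

/-- `w` is a solution of an étale square system over `B`. -/
def EtTuple {ι : Type} [Fintype ι] (w : ι → Λ) : Prop :=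
  ∃ Φ : ι → MvPolynomial ι B, (∀ i, aeval w (Φ i) = 0) ∧
    IndepMod (maximalIdeal Λ) (fun i j => dv w j (Φ i))

variable {B Λ}
variable {ι κ : Type} [Fintype ι] [Fintype κ]

theorem EtTuple.reindex {w : ι → Λ} (hw : EtTuple B Λ w) (e : κ ≃ ι) : EtTuple B Λ (w ∘ e) := by
  obtain ⟨Φ, h1, h2⟩ := hw
  have he : (w ∘ e) ∘ e.symm = w := by ext i; simp
  refine ⟨fun k => rename e.symm (Φ (e k)), fun k => ?_, fun l hl k => ?_⟩
  · rw [aeval_rename, he, h1]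
  · have := h2 (l ∘ e.symm) (fun i => ?_) (e k)
    · simpa using this
    · have h3 := hl (e.symm i)
      simp only [dv_rename_inj _ _ e.symm.injective, he] at h3
      rw [← e.sum_comp]
      simpa using h3

theorem EtTuple.extend {w : ι → Λ} (hw : EtTuple B Λ w) (v : κ → Λ)
    (Ψ : κ → MvPolynomial (ι ⊕ κ) B) (h0 : ∀ k, aeval (Sum.elim w v) (Ψ k) = 0)
    (hJ : IndepMod (maximalIdeal Λ) (fun k j => dv (Sum.elim w v) (Sum.inr j) (Ψ k))) :
    EtTuple B Λ (Sum.elim w v) := by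
  obtain ⟨Φ, h1, h2⟩ := hw
  have e1 : Sum.elim w v ∘ Sum.inl = w := by ext; simp
  refine ⟨Sum.elim (fun i => rename Sum.inl (Φ i)) Ψ, ?_, ?_⟩
  · rintro (i | k)
    · simp [aeval_rename, e1, h1]
    · simpa using h0 k
  · intro l hl
    have h3 : ∀ k, l (Sum.inr k) ∈ maximalIdeal Λ := by
      refine hJ (fun k => l (Sum.inr k)) fun j => ?_
      have := hl (Sum.inr j)
      simpa [Fintype.sum_sum_type, dv_rename_ne] using this
    have h4 : ∀ k, l (Sum.inl k) ∈ maximalIdeal Λ := by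
      refine h2 (fun k => l (Sum.inl k)) fun j => ?_
      have := hl (Sum.inl j)
      simp only [Fintype.sum_sum_type, Sum.elim_inl, Sum.elim_inr,
        dv_rename_inj _ _ Sum.inl_injective, e1] at this
      refine (Ideal.add_mem_iff_left _ ?_).1 this
      exact Ideal.sum_mem _ fun k _ => Ideal.mul_mem_right _ _ (h3 k)
    rintro (i | k)
    exacts [h4 i, h3 k]

theorem EtTuple.sum {w : ι → Λ} {v : κ → Λ} (hw : EtTuple B Λ w) (hv : EtTuple B Λ v) :
    EtTuple B Λ (Sum.elim w v) := by
  obtain ⟨Φ, h1, h2⟩ := hv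
  have e1 : Sum.elim w v ∘ Sum.inr = v := by ext; simp
  refine hw.extend v (fun k => rename Sum.inr (Φ k)) (fun k => ?_) ?_
  · rw [aeval_rename, e1, h1]
  · simpa only [dv_rename_inj _ _ Sum.inr_injective, e1] using h2

theorem EtTuple.empty (w : Fin 0 → Λ) : EtTuple B Λ w :=
  ⟨fun i => i.elim0, fun i => i.elim0, fun _ _ k => k.elim0⟩

variable (B) in
def IsEt (a : Λ) : Prop := ∃ (n : ℕ) (w : Fin n → Λ), EtTuple B Λ w ∧ ∃ P : MvPolynomial (Fin n) B, aeval w P = a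

theorem IsEt.of {w : ι → Λ} (hw : EtTuple B Λ w) (P : MvPolynomial ι B) : IsEt B (aeval w P) := by
  let e := (Fintype.equivFin ι).symm
  refine ⟨_, w ∘ e, hw.reindex e, rename e.symm P, ?_⟩
  rw [aeval_rename]; congr 2; ext i; simp

theorem IsEt.common {τ : Type} (s : Finset τ) (a : τ → Λ) (ha : ∀ t ∈ s, IsEt B (a t)) :
    ∃ (n : ℕ) (w : Fin n → Λ), EtTuple B Λ w ∧ ∀ t ∈ s, ∃ P : MvPolynomial (Fin n) B, aeval w P = a t := by
  classical
  induction s using Finset.induction_on with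
  | empty => exact ⟨0, fun i => i.elim0, EtTuple.empty _, by simp⟩
  | insert t s ht ih =>
    obtain ⟨n, w, hw, hP⟩ := ih (fun t ht => ha t (Finset.mem_insert_of_mem ht))
    obtain ⟨n', w', hw', P', hP'⟩ := ha t (Finset.mem_insert_self _ _)
    let e : Fin (n + n') ≃ Fin n ⊕ Fin n' := finSumFinEquiv.symm
    refine ⟨n + n', Sum.elim w w' ∘ e, (hw.sum hw').reindex e, ?_⟩
    have e1 : ((Sum.elim w w' ∘ e) ∘ e.symm ∘ Sum.inl) = w := by ext; simp
    have e2 : ((Sum.elim w w' ∘ e) ∘ e.symm ∘ Sum.inr) = w' := by ext; simp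
    intro t' ht'
    rcases Finset.mem_insert.1 ht' with rfl | ht'
    · exact ⟨rename (e.symm ∘ Sum.inr) P', by rw [aeval_rename, e2, hP']⟩
    · obtain ⟨P, hP⟩ := hP t' ht'
      exact ⟨rename (e.symm ∘ Sum.inl) P, by rw [aeval_rename, e1, hP]⟩

theorem IsEt.common' {τ : Type} [Fintype τ] (a : τ → Λ) (ha : ∀ t, IsEt B (a t)) :
    ∃ (n : ℕ) (w : Fin n → Λ), EtTuple B Λ w ∧ ∃ P : τ → MvPolynomial (Fin n) B,
      ∀ t, aeval w (P t) = a t := by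
  obtain ⟨n, w, hw, h⟩ := IsEt.common Finset.univ a (fun t _ => ha t)
  choose P hP using fun t => h t (Finset.mem_univ t)
  exact ⟨n, w, hw, P, hP⟩

variable (B Λ) in
/-- The étale closure of `B` in `Λ`. -/
noncomputable def etAlg : Subalgebra B Λ where
  carrier := {a | IsEt B a}
  mul_mem' := by
    intro a b ha hb
    obtain ⟨n, w, hw, P, hP⟩ := IsEt.common' ![a, b] (by intro t; fin_cases t <;> assumption)
    have := IsEt.of hw (P 0 * P 1)
    simpa [hP] using this
  add_mem' := by
    intro a b ha hb
    obtain ⟨n, w, hw, P, hP⟩ := IsEt.common' ![a, b] (by intro t; fin_cases t <;> assumption)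
    have := IsEt.of hw (P 0 + P 1)
    simpa [hP] using this
  algebraMap_mem' := by
    intro b
    exact ⟨0, fun i => i.elim0, EtTuple.empty _, C b, by simp⟩

theorem mem_etAlg {a : Λ} : a ∈ etAlg B Λ ↔ IsEt B a := Iff.rfl

theorem lift_poly (w : ι → Λ) (p : MvPolynomial κ (etAlg B Λ))
    (hp : ∀ d ∈ p.support, ∃ P : MvPolynomial ι B, aeval w P = ((p.coeff d : etAlg B Λ) : Λ)) :
    ∃ Ψ : MvPolynomial (ι ⊕ κ) B, ∀ v : κ → Λ, aeval (Sum.elim w v) Ψ = aeval v p ∧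
      ∀ k, dv (Sum.elim w v) (Sum.inr k) Ψ = dv v k p := by
  classical
  let Pr : MvPolynomial κ (etAlg B Λ) → Prop := fun p =>
    ∃ Ψ : MvPolynomial (ι ⊕ κ) B, ∀ v : κ → Λ, aeval (Sum.elim w v) Ψ = aeval v p ∧
      ∀ k, dv (Sum.elim w v) (Sum.inr k) Ψ = dv v k p
  have hadd : ∀ a b, Pr a → Pr b → Pr (a + b) := by
    rintro a b ⟨A, hA⟩ ⟨B', hB⟩
    exact ⟨A + B', fun v => ⟨by simp [hA v, hB v], fun k => by simp [(hA v).2, (hB v).2]⟩⟩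
  have hmul : ∀ a b, Pr a → Pr b → Pr (a * b) := by
    rintro a b ⟨A, hA⟩ ⟨B', hB⟩
    exact ⟨A * B', fun v => ⟨by simp [hA v, hB v], fun k => by
      simp [(hA v).2, (hB v).2, (hA v).1, (hB v).1]⟩⟩
  have hone : Pr 1 := ⟨1, fun v => by simp⟩
  have hX : ∀ k, Pr (X k) := fun k => ⟨X (Sum.inr k), fun v => by simp [dv_X]⟩
  rw [p.as_sum]
  have hsum : ∀ s ⊆ p.support, Pr (∑ d ∈ s, monomial d (p.coeff d)) := by
    intro s
    induction s using Finset.induction_on with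
    | empty => exact fun _ => ⟨0, fun v => by simp⟩
    | insert d s hd ih =>
      intro hs
      rw [Finset.sum_insert hd]
      refine hadd _ _ ?_ (ih ((Finset.subset_insert _ _).trans hs))
      rw [monomial_eq]
      refine hmul _ _ ?_ ?_
      · obtain ⟨P, hP⟩ := hp d (hs (Finset.mem_insert_self _ _))
        refine ⟨rename Sum.inl P, fun v => ⟨?_, fun k => ?_⟩⟩
        · rw [aeval_rename]
          have : Sum.elim w v ∘ Sum.inl = w := by ext; simp
          rw [this, hP, aeval_C]; rfl
        · rw [dv_rename_ne _ _ _ (by simp), dv_C]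
      · rw [Finsupp.prod]
        refine Finset.prod_induction _ Pr hmul hone fun k _ => ?_
        induction d k with
        | zero => simpa using hone
        | succ n ih => rw [pow_succ]; exact hmul _ _ ih (hX k)
  exact hsum _ subset_rfl

theorem hensel_mem_etAlg (ψ : κ → MvPolynomial κ (etAlg B Λ)) (v : κ → Λ)
    (h0 : ∀ k, aeval v (ψ k) = 0)
    (hJ : IndepMod (maximalIdeal Λ) (fun k j => dv v j (ψ k))) (k : κ) : v k ∈ etAlg B Λ := by
  classical
  obtain ⟨n, w, hw, hP⟩ := IsEt.common
    (Finset.univ.biUnion fun k => (ψ k).support.image fun d => (((ψ k).coeff d : etAlg B Λ) : Λ)) id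
    (by
      intro t ht
      simp only [Finset.mem_biUnion, Finset.mem_image] at ht
      obtain ⟨k, -, d, -, rfl⟩ := ht
      exact ((ψ k).coeff d).2)
  have h : ∀ k, _ := fun k => lift_poly w (ψ k) (fun d hd => hP _ (by
    simp only [Finset.mem_biUnion, Finset.mem_image]
    exact ⟨k, Finset.mem_univ _, d, hd, rfl⟩))
  choose Ψ hΨ using h
  have := hw.extend v Ψ (fun k => by rw [(hΨ k v).1, h0]) (by simpa only [(hΨ _ v).2] using hJ)
  have h2 := IsEt.of this (X (Sum.inr k))
  rw [aeval_X] at h2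
  exact h2
end etale

end Part2

section Part3
open MvPolynomial IsLocalRing

section krull
variable {B Λ : Type} [CommRing B] [CommRing Λ] [IsLocalRing Λ] [Algebra B Λ]

variable (B Λ) in
structure DenseBase : Prop where
  dense : ∀ (x : Λ) (j : ℕ), ∃ b : B, x - algebraMap B Λ b ∈ maximalIdeal Λ ^ j
  pow : ∀ (b : B) (j : ℕ), algebraMap B Λ b ∈ maximalIdeal Λ ^ j →
    b ∈ ((maximalIdeal Λ).comap (algebraMap B Λ)) ^ j

theorem etAlg_inv {a b : Λ} (ha : a ∈ etAlg B Λ) (hab : a * b = 1) : b ∈ etAlg B Λ := by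
  have hu : IsUnit a := IsUnit.of_mul_eq_one _ hab
  refine hensel_mem_etAlg (B := B) (κ := Unit) (fun _ => C ⟨a, ha⟩ * X () - 1) (fun _ => b) ?_ ?_ ()
  · intro _
    simp only [map_sub, map_mul, aeval_C, aeval_X, map_one]
    exact sub_eq_zero.2 hab
  · intro l hl k
    have := hl ()
    simp only [Finset.univ_unique, PUnit.default_eq_unit, dv_sub, dv_mul, dv_C, zero_mul, aeval_C,
      dv_X_self, mul_one, zero_add, dv_one, sub_zero, Finset.sum_singleton] at this
    exact (Ideal.IsPrime.mem_or_mem inferInstance this).resolve_right (by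
      simpa using hu)

theorem sup_pow_le {C : Type} [CommRing C] (n β : Ideal C) (hβ : β ≤ n) (h : n ≤ β ⊔ n ^ 2) (j : ℕ) :
    n ^ j ≤ β ^ j ⊔ n ^ (j + 1) := by
  induction j with
  | zero => simp
  | succ j ih =>
    calc n ^ (j + 1) = n ^ j * n := pow_succ _ _
      _ ≤ (β ^ j ⊔ n ^ (j + 1)) * (β ⊔ n ^ 2) := Ideal.mul_mono ih h
      _ ≤ _ := by
        rw [Ideal.sup_mul, Ideal.mul_sup]
        refine sup_le (sup_le ?_ ?_) ?_
        · rw [← pow_succ]; exact le_sup_left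
        · refine le_sup_of_le_right ((Ideal.mul_mono_left (Ideal.pow_right_mono hβ j)).trans ?_)
          rw [← pow_add]
        · refine le_sup_of_le_right ((Ideal.mul_mono_right (sup_le hβ (Ideal.pow_le_self two_ne_zero))).trans ?_)
          rw [← pow_succ]

theorem et_pow (hB : DenseBase B Λ) {κ : Type} [Fintype κ] (w : κ → Λ) (hw : EtTuple B Λ w)
    (j : ℕ) (c : (aeval w : MvPolynomial κ B →ₐ[B] Λ).range) (hc : (c : Λ) ∈ maximalIdeal Λ ^ j) :
    c ∈ ((maximalIdeal Λ).comap (aeval w : MvPolynomial κ B →ₐ[B] Λ).range.val) ^ j := by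
  classical
  revert c
  set A := (aeval w : MvPolynomial κ B →ₐ[B] Λ).range with hA
  intro c hc
  set m := maximalIdeal Λ with hm
  set n : Ideal A := m.comap A.val with hn
  set 𝔟 : Ideal B := m.comap (algebraMap B Λ) with h𝔟
  set β : Ideal A := 𝔟.map (algebraMap B A) with hβ
  haveI : 𝔟.IsPrime := Ideal.comap_isPrime _ _
  have hval : ∀ b : B, A.val (algebraMap B A b) = algebraMap B Λ b := fun b => rfl
  have hβn : β ≤ n := by
    rw [hβ, Ideal.map_le_iff_le_comap]
    intro b hb
    exact hb
  obtain ⟨Φ, h0, hJ⟩ := hw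
  choose b hb using fun i => hB.dense (w i) 1
  simp only [pow_one] at hb
  let W : κ → A := fun i => ⟨w i, ⟨X i, by simp⟩⟩
  have hW : ∀ P : MvPolynomial κ B, A.val (aeval W P) = aeval w P := by
    intro P
    rw [MvPolynomial.comp_aeval_apply]; rfl
  let bA : κ → A := fun i => algebraMap B A (b i)
  have hWb : ∀ i, W i - bA i ∈ n := fun i => hb i
  let bb : κ → B := b
  have hbA : ∀ P : MvPolynomial κ B, aeval bA P = algebraMap B A (aeval b P) := by
    intro P
    have := MvPolynomial.aeval_algebraMap_apply A b P
    exact this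
  let JB : Matrix κ κ B := fun k i => dv b i (Φ k)
  have hJB : ∀ k i, algebraMap B Λ (JB k i) - dv w i (Φ k) ∈ m := by
    intro k i
    have h1 : aeval (fun i => algebraMap B Λ (b i)) (pderiv i (Φ k)) = algebraMap B Λ (JB k i) :=
      MvPolynomial.aeval_algebraMap_apply Λ b _
    rw [← h1]
    refine aeval_sub_mem m _ _ (fun i => ?_) _
    rw [← Submodule.neg_mem_iff, neg_sub]; exact hb i
  have hdet : JB.det ∉ 𝔟 := by
    have hI : IndepMod 𝔟 JB := by
      intro l hl k
      refine hJ (fun k => algebraMap B Λ (l k)) (fun i => ?_) k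
      have h1 := hl i
      rw [h𝔟, Ideal.mem_comap, map_sum] at h1
      have h2 : ∑ k, algebraMap B Λ (l k) * (algebraMap B Λ (JB k i) - dv w i (Φ k)) ∈ m :=
        Ideal.sum_mem _ fun k _ => Ideal.mul_mem_left _ _ (hJB k i)
      have h3 := Ideal.sub_mem _ h1 h2
      simp only [mul_sub, Finset.sum_sub_distrib, map_mul] at h3
      rw [sub_sub_cancel] at h3
      exact h3
    obtain ⟨δ, hδ, N, hN⟩ := exists_rightInv_of_indepMod 𝔟 JB hI
    have h1 : JB * Matrix.of N = δ • (1 : Matrix κ κ B) := by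
      ext a c
      simp [Matrix.mul_apply, hN, Matrix.one_apply]
    have h2 := congrArg Matrix.det h1
    rw [Matrix.det_mul, Matrix.det_smul, Matrix.det_one, mul_one] at h2
    intro h3
    apply hδ
    refine Ideal.IsPrime.mem_of_pow_mem inferInstance (Fintype.card κ) ?_
    rw [← h2]
    exact Ideal.mul_mem_right _ _ h3
  have hv : ∀ i, W i - bA i ∈ β ⊔ n ^ 2 := by
    have h1 : ∀ k, ∑ i, algebraMap B A (JB k i) * (W i - bA i) ∈ β ⊔ n ^ 2 := by
      intro k
      have h2 := taylor_one n n bA W bA hWb (fun i => by simp) hWb (Φ k)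
      have h3 : aeval W (Φ k) = 0 := Subtype.ext ((hW (Φ k)).trans (h0 k))
      have h4 : aeval bA (Φ k) ∈ β := by
        rw [hbA]
        refine Ideal.mem_map_of_mem _ ?_
        rw [h𝔟, Ideal.mem_comap, ← hval, ← hbA]
        have h5 : aeval bA (Φ k) - aeval W (Φ k) ∈ n := aeval_sub_mem n _ _ (fun i => by
          rw [← Submodule.neg_mem_iff, neg_sub]; exact hWb i) _
        rw [h3, sub_zero] at h5
        exact h5
      rw [h3, zero_sub, ← pow_two] at h2
      have h6 : ∀ i, dv bA i (Φ k) = algebraMap B A (JB k i) := fun i => hbA _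
      simp only [h6] at h2
      have := Submodule.add_mem_sup h4 h2
      rw [← Submodule.neg_mem_iff]
      convert this using 1
      ring
    intro i
    have h2 : ∑ k, algebraMap B A (JB.adjugate i k) * ∑ j, algebraMap B A (JB k j) * (W j - bA j) =
        algebraMap B A JB.det * (W i - bA i) := by
      simp only [Finset.mul_sum]
      rw [Finset.sum_comm]
      simp only [← mul_assoc, ← Finset.sum_mul, ← map_mul, ← map_sum]
      have h3 : ∀ x, ∑ j, JB.adjugate i j * JB j x = if i = x then JB.det else 0 := fun x => by
        have := congrFun (congrFun (Matrix.adjugate_mul JB) i) x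
        simpa [Matrix.mul_apply, Matrix.one_apply] using this
      simp [h3, apply_ite (algebraMap B A)]
    have h3 : algebraMap B A JB.det * (W i - bA i) ∈ β ⊔ n ^ 2 := by
      rw [← h2]; exact Ideal.sum_mem _ fun k _ => Ideal.mul_mem_left _ _ (h1 k)
    have hu : IsUnit (algebraMap B Λ JB.det) := by
      by_contra hu
      exact hdet hu
    obtain ⟨u, hu⟩ := hu.exists_right_inv
    obtain ⟨e, he⟩ := hB.dense u 1
    rw [pow_one] at he
    have h4 : e * JB.det - 1 ∈ 𝔟 := by
      rw [h𝔟, Ideal.mem_comap, map_sub, map_mul, map_one, ← hu]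
      have := Ideal.mul_mem_left m (-algebraMap B Λ JB.det) he
      convert this using 1; ring
    have h5 : algebraMap B A (e * JB.det - 1) * (W i - bA i) ∈ β ⊔ n ^ 2 :=
      Ideal.mul_mem_right _ _ (Ideal.mem_sup_left (Ideal.mem_map_of_mem _ h4))
    have := Ideal.sub_mem _ (Ideal.mul_mem_left _ (algebraMap B A e) h3) h5
    convert this using 1
    simp only [map_sub, map_mul, map_one]; ring
  have hnle : n ≤ β ⊔ n ^ 2 := by
    rintro ⟨_, P, rfl⟩ hx
    have h1 : aeval W P - aeval bA P ∈ β ⊔ n ^ 2 := aeval_sub_mem _ _ _ hv _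
    have h2 : aeval W P - aeval bA P ∈ n := aeval_sub_mem _ _ _ hWb _
    have h3 : (⟨aeval w P, ⟨P, rfl⟩⟩ : A) = aeval W P := Subtype.ext (hW P).symm
    have h4 : aeval bA P ∈ n := by
      have := Ideal.sub_mem _ hx h2
      change (⟨aeval w P, ⟨P, rfl⟩⟩ : A) - _ ∈ n at this
      rw [h3] at this; simpa using this
    have h5 : aeval bA P ∈ β := by
      rw [hbA] at h4 ⊢
      exact Ideal.mem_map_of_mem _ h4
    have := Ideal.add_mem _ h1 (Ideal.mem_sup_left h5)
    change (⟨aeval w P, ⟨P, rfl⟩⟩ : A) ∈ _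
    rw [h3]; simpa using this
  have hdense1 : ∀ c : A, ∃ b : B, c - algebraMap B A b ∈ n := by
    intro c
    obtain ⟨b, hb⟩ := hB.dense c 1
    rw [pow_one] at hb
    exact ⟨b, hb⟩
  have hdense : ∀ (j : ℕ) (c : A), ∃ b : B, c - algebraMap B A b ∈ n ^ j := by
    intro j
    induction j with
    | zero => intro c; exact ⟨0, by simp⟩
    | succ j ih =>
      intro c
      obtain ⟨b, hb⟩ := ih c
      obtain ⟨y, hy, z, hz, hyz⟩ := Submodule.mem_sup.1 (sup_pow_le n β hβn hnle j hb)
      rw [hβ, ← Ideal.map_pow] at hy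
      have : y ∈ n ^ j ∧ ∃ b : B, y - algebraMap B A b ∈ n ^ (j + 1) := by
        refine Submodule.span_induction (p := fun y _ => y ∈ n ^ j ∧ ∃ b : B, y - algebraMap B A b ∈ n ^ (j + 1))
          ?_ ?_ ?_ ?_ hy
        · rintro _ ⟨b, hb, rfl⟩
          refine ⟨?_, b, by simp⟩
          exact (Ideal.pow_right_mono hβn j) (by rw [hβ, ← Ideal.map_pow]; exact Ideal.mem_map_of_mem _ hb)
        · exact ⟨Ideal.zero_mem _, 0, by simp⟩
        · rintro x y - - ⟨hx, b1, h1⟩ ⟨hy, b2, h2⟩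
          refine ⟨Ideal.add_mem _ hx hy, b1 + b2, ?_⟩
          convert Ideal.add_mem _ h1 h2 using 1; rw [map_add]; ring
        · rintro a x - ⟨hx, b1, h1⟩
          refine ⟨Ideal.mul_mem_left _ _ hx, ?_⟩
          obtain ⟨b2, h2⟩ := hdense1 a
          refine ⟨b2 * b1, ?_⟩
          have e1 : (a - algebraMap B A b2) * x ∈ n ^ (j + 1) := by
            rw [pow_succ']; exact Ideal.mul_mem_mul h2 hx
          have e2 := Ideal.mul_mem_left _ (algebraMap B A b2) h1
          convert Ideal.add_mem _ e1 e2 using 1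
          rw [map_mul, smul_eq_mul]; ring
      obtain ⟨-, b', hb'⟩ := this
      refine ⟨b + b', ?_⟩
      convert Ideal.add_mem _ hb' hz using 1
      have : c = algebraMap B A b + (y + z) := by rw [hyz]; ring
      rw [this, map_add]; ring
  obtain ⟨b, hb⟩ := hdense j c
  have h1 : algebraMap B Λ b ∈ m ^ j := by
    have h2 : A.val (c - algebraMap B A b) ∈ m ^ j := by
      have : n ^ j ≤ (m ^ j).comap A.val := by
        exact Ideal.le_comap_pow _ _
      exact this hb
    rw [map_sub, hval] at h2
    have := Ideal.sub_mem _ hc h2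
    simpa using this
  have h2 := hB.pow b j h1
  have h3 : algebraMap B A b ∈ n ^ j :=
    (Ideal.pow_right_mono hβn j) (by rw [hβ, ← Ideal.map_pow]; exact Ideal.mem_map_of_mem _ h2)
  have := Ideal.add_mem _ hb h3
  simpa using this

theorem krull_et [IsNoetherianRing B] (hB : DenseBase B Λ) {τ : Type} [Fintype τ] (v : τ → Λ) (c : Λ)
    (hv : ∀ t, v t ∈ etAlg B Λ) (hc : c ∈ etAlg B Λ) (h : c ∈ Ideal.span (Set.range v)) :
    ∃ a : τ → Λ, (∀ t, a t ∈ etAlg B Λ) ∧ c = ∑ t, a t * v t := by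
  classical
  obtain ⟨k, w, hw, P, hP⟩ := IsEt.common' (fun o : Option τ => o.elim c v)
    (by rintro (_ | t); exacts [hc, hv t])
  let A := (aeval w : MvPolynomial (Fin k) B →ₐ[B] Λ).range
  have hAet : ∀ a : A, (a : Λ) ∈ etAlg B Λ := by
    rintro ⟨_, Q, rfl⟩; exact IsEt.of hw Q
  haveI : IsNoetherianRing A :=
    isNoetherianRing_of_surjective _ _ (aeval w : MvPolynomial (Fin k) B →ₐ[B] Λ).rangeRestrict.toRingHom
      (AlgHom.rangeRestrict_surjective _)
  let c' : A := ⟨c, P none, hP none⟩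
  let v' : τ → A := fun t => ⟨v t, P (some t), hP (some t)⟩
  let m := maximalIdeal Λ
  let n : Ideal A := m.comap A.val
  let 𝔳 : Ideal A := Ideal.span (Set.range v')
  obtain ⟨a, ha⟩ := (Ideal.mem_span_range_iff_exists_fun).1 h
  have hmem : (Ideal.Quotient.mk 𝔳 c') ∈ (⨅ i : ℕ, n ^ i • (⊤ : Submodule A (A ⧸ 𝔳))) := by
    rw [Submodule.mem_iInf]
    intro j
    choose b hb using fun t => hB.dense (a t) j
    have h1 : c' - ∑ t, algebraMap B A (b t) * v' t ∈ n ^ j := by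
      apply et_pow hB w hw
      have : ((c' - ∑ t, algebraMap B A (b t) * v' t : A) : Λ) = ∑ t, (a t - algebraMap B Λ (b t)) * v t := by
        simp only [sub_mul, Finset.sum_sub_distrib, ha]
        push_cast
        rfl
      erw [this]
      exact Ideal.sum_mem _ fun t _ => Ideal.mul_mem_right _ _ (hb t)
    have h2 : Ideal.Quotient.mk 𝔳 c' = (c' - ∑ t, algebraMap B A (b t) * v' t) • (1 : A ⧸ 𝔳) := by
      change Ideal.Quotient.mk 𝔳 c' = Ideal.Quotient.mk 𝔳 ((c' - ∑ t, algebraMap B A (b t) * v' t) * 1)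
      rw [mul_one, Ideal.Quotient.eq, sub_sub_cancel]
      exact Ideal.sum_mem _ fun t _ => Ideal.mul_mem_left _ _ (Ideal.subset_span ⟨t, rfl⟩)
    rw [h2]
    exact Submodule.smul_mem_smul h1 trivial
  rw [Ideal.mem_iInf_smul_pow_eq_bot_iff] at hmem
  obtain ⟨⟨r, hr⟩, hr'⟩ := hmem
  have h1 : (1 - r) * c' ∈ 𝔳 := by
    rw [← Ideal.Quotient.eq_zero_iff_mem, sub_mul, one_mul, map_sub, sub_eq_zero]
    change Ideal.Quotient.mk 𝔳 (r * c') = _ at hr'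
    exact hr'.symm
  obtain ⟨a', ha'⟩ := (Ideal.mem_span_range_iff_exists_fun).1 h1
  have hu : IsUnit (1 - (r : Λ)) := by
    by_contra hu
    have h2 : (1 - (r : Λ)) ∈ m := hu
    have h3 : (r : Λ) ∈ m := hr
    have := Ideal.add_mem _ h2 h3
    rw [sub_add_cancel] at this
    exact (Ideal.ne_top_iff_one m).1 (Ideal.IsPrime.ne_top inferInstance) this
  obtain ⟨s, hs⟩ := hu.exists_right_inv
  have hset : s ∈ etAlg B Λ := etAlg_inv (hAet (1 - r)) hs
  refine ⟨fun t => s * a' t, fun t => Subalgebra.mul_mem _ hset (hAet _), ?_⟩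
  have h4 : ∑ t, (a' t : Λ) * v t = (1 - (r : Λ)) * c := by
    have := congrArg A.val ha'
    simpa [v', c'] using this
  simp only [mul_assoc, ← Finset.mul_sum, h4]
  rw [← mul_assoc, mul_comm s, hs, one_mul]
end krull

end Part3

section Part4
open MvPolynomial IsLocalRing

section tower
variable (S Θ : Type) [CommRing S] [CommRing Θ] [IsLocalRing Θ] [Algebra S Θ]

/-- a smooth tower over `S` inside `Θ` -/
structure Tw (U : Ideal S) where
  ι : Type
  κ : Type
  fι : Fintype ι
  fκ : Fintype κ
  y : ι → Θ
  G : κ → MvPolynomial ι S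
  h0 : ∀ k, aeval y (G k) = 0
  hJ : IndepMod (maximalIdeal Θ) (fun k i => dv y i (G k))
  h3 : ∀ a : MvPolynomial ι S, aeval y a ∈ maximalIdeal Θ →
    ∃ σ : MvPolynomial ι S, aeval y σ ∉ maximalIdeal Θ ∧
      σ * a ∈ U.map C ⊔ Ideal.span (Set.range G)

attribute [instance] Tw.fι Tw.fκ

variable {S Θ} {U : Ideal S}

def Tw.base (hb : ∀ a : S, algebraMap S Θ a ∈ maximalIdeal Θ →
    ∃ σ : S, algebraMap S Θ σ ∉ maximalIdeal Θ ∧ σ * a ∈ U) : Tw S Θ U where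
  ι := Empty
  κ := Empty
  fι := inferInstance
  fκ := inferInstance
  y := fun i => i.elim
  G := fun i => i.elim
  h0 := fun i => i.elim
  hJ := fun _ _ i => i.elim
  h3 := by
    intro a ha
    obtain ⟨b, rfl⟩ := MvPolynomial.C_surjective (R := S) Empty a
    rw [aeval_C] at ha
    obtain ⟨σ, h1, h2⟩ := hb b ha
    refine ⟨C σ, by rwa [aeval_C], Ideal.mem_sup_left ?_⟩
    rw [← map_mul]
    exact Ideal.mem_map_of_mem _ h2

theorem exists_common_mul {A : Type} [CommRing A] (Q : Ideal A) [Q.IsPrime] (I : Ideal A) {τ : Type} (s : Finset τ)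
    (a : τ → A) (h : ∀ t ∈ s, ∃ σ ∉ Q, σ * a t ∈ I) : ∃ σ ∉ Q, ∀ t ∈ s, σ * a t ∈ I := by
  classical
  induction s using Finset.induction_on with
  | empty => exact ⟨1, (Ideal.ne_top_iff_one Q).1 (Ideal.IsPrime.ne_top inferInstance), by simp⟩
  | insert t s ht ih =>
    obtain ⟨σ, h1, h2⟩ := ih fun t ht => h t (Finset.mem_insert_of_mem ht)
    obtain ⟨σ', h1', h2'⟩ := h t (Finset.mem_insert_self _ _)
    refine ⟨σ * σ', fun hh => (Ideal.IsPrime.mem_or_mem inferInstance hh).elim h1 h1', fun x hx => ?_⟩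
    rcases Finset.mem_insert.1 hx with rfl | hx
    · rw [mul_assoc]; exact I.mul_mem_left _ h2'
    · rw [mul_comm σ, mul_assoc]; exact I.mul_mem_left _ (h2 x hx)

/-- the ideal of polynomials vanishing at `y` mod `m` -/
noncomputable abbrev Tw.Q (w : Tw S Θ U) : Ideal (MvPolynomial w.ι S) := (maximalIdeal Θ).comap (aeval w.y)

/-- partial order-like relation: `w'` sits over `w` -/
def Tw.Le (w w' : Tw S Θ U) : Prop := ∃ χ : w.ι → MvPolynomial w'.ι S, ∀ i, aeval w'.y (χ i) = w.y i

theorem Tw.Le.refl (w : Tw S Θ U) : w.Le w := ⟨X, by simp⟩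
theorem Tw.Le.lift {w w' : Tw S Θ U} (h : w.Le w') (P : MvPolynomial w.ι S) :
    ∃ P' : MvPolynomial w'.ι S, aeval w'.y P' = aeval w.y P := by
  obtain ⟨χ, hχ⟩ := h
  refine ⟨aeval χ P, ?_⟩
  rw [aeval_aeval']; simp [hχ]
theorem Tw.Le.trans {w w' w'' : Tw S Θ U} (h : w.Le w') (h' : w'.Le w'') : w.Le w'' := by
  obtain ⟨χ, hχ⟩ := h
  choose χ' hχ' using fun i => h'.lift (χ i)
  exact ⟨χ', fun i => (hχ' i).trans (hχ i)⟩

theorem aeval_optEquiv {ι : Type} (y : Option ι → Θ) (p : MvPolynomial (Option ι) S) :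
    aeval y p = (optionEquivLeft S ι p).eval₂ (aeval (fun i => y (some i)) : MvPolynomial ι S →ₐ[S] Θ).toRingHom (y none) := by
  induction p using MvPolynomial.induction_on with
  | C a => simp
  | add p q hp hq => simp [hp, hq]
  | mul_X p i hp => cases i <;> simp [hp]

theorem dv_optEquiv {ι : Type} (y : Option ι → Θ) (p : MvPolynomial (Option ι) S) :
    dv y none p = (optionEquivLeft S ι p).derivative.eval₂ (aeval (fun i => y (some i)) : MvPolynomial ι S →ₐ[S] Θ).toRingHom (y none) := by
  classical
  induction p using MvPolynomial.induction_on with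
  | C a => simp
  | add p q hp hq => simp [hp, hq]
  | mul_X p i hp =>
    cases i
    · simp only [dv_mul, hp, aeval_X, dv_X_self, mul_one, map_mul, optionEquivLeft_X_none,
        Polynomial.derivative_mul, Polynomial.derivative_X, Polynomial.eval₂_add, Polynomial.eval₂_mul,
        Polynomial.eval₂_X, aeval_optEquiv, Polynomial.eval₂_one]
      try ring
    · simp only [dv_mul, hp, aeval_X, map_mul, optionEquivLeft_X_some,
        Polynomial.derivative_mul, Polynomial.derivative_C, Polynomial.eval₂_add, Polynomial.eval₂_mul,
        Polynomial.eval₂_C, aeval_optEquiv, Polynomial.eval₂_zero, mul_zero, add_zero]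
      rw [dv_X_ne (h := by simp)]
      simp

/-- rename through `some` corresponds to constants -/
theorem optEquiv_rename {ι : Type} (a : MvPolynomial ι S) :
    optionEquivLeft S ι (rename some a) = Polynomial.C a := by
  induction a using MvPolynomial.induction_on with
  | C a => simp
  | add p q hp hq => simp [hp, hq]
  | mul_X p i hp => simp [hp]

theorem optEquiv_symm_C {ι : Type} (a : MvPolynomial ι S) :
    (optionEquivLeft S ι).symm (Polynomial.C a) = rename some a := by
  rw [← optEquiv_rename, AlgEquiv.symm_apply_apply]

/-- the pushed-forward ideal -/
theorem ideal_push {ι κ : Type} (G : κ → MvPolynomial ι S) (a : MvPolynomial ι S)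
    (ha : a ∈ U.map C ⊔ Ideal.span (Set.range G)) (I : Ideal (MvPolynomial (Option ι) S))
    (hU : U.map C ≤ I) (hG : ∀ k, rename some (G k) ∈ I) : rename some a ∈ I := by
  have : U.map C ⊔ Ideal.span (Set.range G) ≤ I.comap (rename some : MvPolynomial ι S →ₐ[S] _).toRingHom := by
    refine sup_le ?_ ?_
    · rw [Ideal.map_le_iff_le_comap]
      intro u hu
      simp only [Ideal.mem_comap]
      have := hU (Ideal.mem_map_of_mem C hu)
      simpa using this
    · rw [Ideal.span_le]
      rintro _ ⟨k, rfl⟩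
      exact hG k
  exact this ha

/-- if all coefficients of a polynomial are in the kernel, (iii) holds. -/
theorem iii_coeffs (w : Tw S Θ U) (r : Polynomial (MvPolynomial w.ι S))
    (hr : ∀ j, aeval w.y (r.coeff j) ∈ maximalIdeal Θ) (I : Ideal (MvPolynomial (Option w.ι) S))
    (hU : U.map C ≤ I) (hG : ∀ k, rename some (w.G k) ∈ I) :
    ∃ σ : MvPolynomial w.ι S, σ ∉ w.Q ∧ rename some σ * (optionEquivLeft S w.ι).symm r ∈ I := by
  have : w.Q.IsPrime := Ideal.comap_isPrime _ _
  obtain ⟨σ, h1, h2⟩ := exists_common_mul w.Q (U.map C ⊔ Ideal.span (Set.range w.G)) r.support (fun j => r.coeff j)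
    (fun j _ => w.h3 _ (hr j))
  refine ⟨σ, h1, ?_⟩
  have hsum := congrArg (optionEquivLeft S w.ι).symm r.as_sum_support_C_mul_X_pow
  rw [hsum, map_sum, Finset.mul_sum]
  refine Ideal.sum_mem _ fun j hj => ?_
  rw [map_mul, optEquiv_symm_C, ← mul_assoc, ← map_mul]
  exact Ideal.mul_mem_right _ _ (ideal_push _ _ (h2 j hj) I hU hG)

theorem lead_trunc {A : Type} [CommRing A] (Q : Ideal A) (a : Polynomial A) (h : ∃ j, a.coeff j ∉ Q) :
    ∃ b : Polynomial A, b.leadingCoeff ∉ Q ∧ b.natDegree ≤ a.natDegree ∧ ∀ j, a.coeff j - b.coeff j ∈ Q := by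
  classical
  obtain ⟨j0, hj0⟩ := h
  let T := a.support.filter fun j => a.coeff j ∉ Q
  have hT : T.Nonempty := ⟨j0, by
    simp only [T, Finset.mem_filter, Polynomial.mem_support_iff]
    exact ⟨fun h => hj0 (h ▸ Q.zero_mem), hj0⟩⟩
  let b : Polynomial A := ∑ j ∈ T, Polynomial.C (a.coeff j) * Polynomial.X ^ j
  have hb : ∀ j, b.coeff j = if j ∈ T then a.coeff j else 0 := by
    intro j
    simp [b, Polynomial.finsetSum_coeff, Polynomial.coeff_C_mul, Polynomial.coeff_X_pow]
  let d := T.max' hT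
  have hd : d ∈ T := T.max'_mem hT
  have hdQ : a.coeff d ∉ Q := (Finset.mem_filter.1 hd).2
  have hdeg : b.natDegree = d := by
    apply le_antisymm
    · rw [Polynomial.natDegree_le_iff_coeff_eq_zero]
      intro N hN
      rw [hb, if_neg]
      intro h
      exact absurd (T.le_max' N h) (not_le.2 hN)
    · apply Polynomial.le_natDegree_of_ne_zero
      rw [hb, if_pos hd]
      intro h; exact hdQ (h ▸ Q.zero_mem)
  refine ⟨b, ?_, ?_, ?_⟩
  · rw [Polynomial.leadingCoeff, hdeg, hb, if_pos hd]; exact hdQ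
  · rw [hdeg]; exact Polynomial.le_natDegree_of_mem_supp _ (Finset.mem_filter.1 hd).1
  · intro j
    rw [hb]
    split_ifs with h
    · simp
    · rw [sub_zero]
      by_contra hj
      refine h (Finset.mem_filter.2 ⟨?_, hj⟩)
      rw [Polynomial.mem_support_iff]
      intro h; exact hj (h ▸ Q.zero_mem)

theorem eval₂_sub_mem_coeff {A : Type} [CommRing A] (φ : A →+* Θ) (t : Θ) (a b : Polynomial A)
    (h : ∀ j, a.coeff j - b.coeff j ∈ (maximalIdeal Θ).comap φ) :
    a.eval₂ φ t - b.eval₂ φ t ∈ maximalIdeal Θ := by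
  rw [← Polynomial.eval₂_sub, Polynomial.eval₂_eq_sum]
  exact Ideal.sum_mem _ fun j _ => Ideal.mul_mem_right _ _ (by rw [Polynomial.coeff_sub]; exact h j)

theorem eval₂_sub_mem_pt {A : Type} [CommRing A] (φ : A →+* Θ) (t t' : Θ) (a : Polynomial A)
    (h : t - t' ∈ maximalIdeal Θ) :
    a.eval₂ φ t - a.eval₂ φ t' ∈ maximalIdeal Θ := by
  rw [← Polynomial.eval_map, ← Polynomial.eval_map]
  obtain ⟨c, hc⟩ := Polynomial.sub_dvd_eval_sub t t' (a.map φ)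
  rw [hc]
  exact Ideal.mul_mem_right _ _ h

theorem pseudo_div {A : Type} [CommRing A] (a q : Polynomial A) (hq : q.natDegree ≠ 0) :
    ∃ k : ℕ, ∃ b r : Polynomial A, Polynomial.C (q.leadingCoeff ^ k) * a = q * b + r ∧ r.natDegree < q.natDegree := by
  induction hn : a.natDegree using Nat.strong_induction_on generalizing a with
  | _ n ih =>
    by_cases h : n < q.natDegree
    · exact ⟨0, 0, a, by simp, hn ▸ h⟩
    push Not at h
    let a' := Polynomial.C q.leadingCoeff * a - q * (Polynomial.C a.leadingCoeff * Polynomial.X ^ (n - q.natDegree))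
    have hlt : a'.natDegree < n := by
      have hn0 : n ≠ 0 := by omega
      have hle : a'.natDegree ≤ n := by
        refine (Polynomial.natDegree_sub_le _ _).trans (max_le ?_ ?_)
        · exact (Polynomial.natDegree_C_mul_le _ _).trans hn.le
        · refine Polynomial.natDegree_mul_le.trans ?_
          have := Polynomial.natDegree_C_mul_X_pow_le a.leadingCoeff (n - q.natDegree)
          omega
      refine lt_of_le_of_ne hle fun heq => ?_
      have h0 : a'.coeff n = 0 := by
        simp only [a', Polynomial.coeff_sub, Polynomial.coeff_C_mul]
        rw [← mul_assoc, Polynomial.coeff_mul_X_pow', if_pos (by omega)]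
        rw [show n - (n - q.natDegree) = q.natDegree by omega, Polynomial.coeff_mul_C]
        simp only [Polynomial.leadingCoeff, hn]; ring
      rw [← heq] at h0
      have : a' = 0 := Polynomial.leadingCoeff_eq_zero.1 h0
      rw [this] at heq
      simp at heq; exact hn0 heq.symm
    obtain ⟨k, b, r, h1, h2⟩ := ih _ hlt a' rfl
    refine ⟨k + 1, b + Polynomial.C (q.leadingCoeff ^ k) * (Polynomial.C a.leadingCoeff * Polynomial.X ^ (n - q.natDegree)), r, ?_, h2⟩
    have : Polynomial.C q.leadingCoeff * a = a' + q * (Polynomial.C a.leadingCoeff * Polynomial.X ^ (n - q.natDegree)) := by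
      simp [a']
    rw [pow_succ, Polynomial.C_mul, mul_assoc, this, mul_add, h1]; ring
end tower

end Part4

section Part5
open MvPolynomial IsLocalRing

section tower2
variable {S Θ : Type} [CommRing S] [CommRing Θ] [IsLocalRing Θ] [Algebra S Θ] {U : Ideal S}

theorem Tw.adjoin [Algebra ℚ Θ] (hnil : ∀ x ∈ maximalIdeal Θ, IsNilpotent x) (w : Tw S Θ U) (t : Θ) :
    ∃ w' : Tw S Θ U, w.Le w' ∧ ∃ P : MvPolynomial w'.ι S, t - aeval w'.y P ∈ maximalIdeal Θ := by
  classical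
  set m := maximalIdeal Θ with hm
  let φ : MvPolynomial w.ι S →+* Θ := (aeval w.y : MvPolynomial w.ι S →ₐ[S] Θ).toRingHom
  have : w.Q.IsPrime := Ideal.comap_isPrime _ _
  let E := optionEquivLeft S w.ι
  let good : Polynomial (MvPolynomial w.ι S) → Prop := fun q => q.leadingCoeff ∉ w.Q ∧ q.eval₂ φ t ∈ m
  by_cases hex : ∃ q, good q
  swap
  · -- transcendental case
    let y' : Option w.ι → Θ := fun o => o.elim t w.y
    have hy' : y' ∘ some = w.y := rfl
    refine ⟨⟨Option w.ι, w.κ, inferInstance, inferInstance, y', fun k => rename some (w.G k), ?_, ?_, ?_⟩, ?_, ?_⟩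
    · intro k
      rw [aeval_rename, hy', w.h0]
    · intro l hl k
      refine w.hJ l (fun i => ?_) k
      have := hl (some i)
      simpa only [dv_rename_inj _ _ (Option.some_injective _), hy'] using this
    · intro a ha
      have hcoef : ∀ j, (E a).coeff j ∈ w.Q := by
        by_contra hcon
        push Not at hcon
        obtain ⟨b, hb1, -, hb3⟩ := lead_trunc w.Q (E a) hcon
        apply hex
        refine ⟨b, hb1, ?_⟩
        have h1 : (E a).eval₂ φ t ∈ m := by
          have := aeval_optEquiv y' a
          rw [← hm] at ha
          rw [this] at ha; exact ha
        have h2 := eval₂_sub_mem_coeff φ t (E a) b hb3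
        have := Ideal.sub_mem _ h1 h2
        rwa [sub_sub_cancel] at this
      obtain ⟨σ, h1, h2⟩ := iii_coeffs w (E a) hcoef
        (U.map C ⊔ Ideal.span (Set.range fun k => rename some (w.G k))) le_sup_left
        (fun k => Ideal.mem_sup_right (Ideal.subset_span ⟨k, rfl⟩))
      refine ⟨rename some σ, ?_, ?_⟩
      · rw [aeval_rename, hy']; exact h1
      · rw [AlgEquiv.symm_apply_apply] at h2; exact h2
    · exact ⟨fun i => X (some i), fun i => by simp [y']⟩
    · exact ⟨X none, by simp [y']⟩
  · -- algebraic case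
    obtain ⟨q, hq, hmin⟩ : ∃ q, good q ∧ ∀ q', good q' → q.natDegree ≤ q'.natDegree := by
      let n := Nat.find (p := fun n => ∃ q, good q ∧ q.natDegree = n) (by obtain ⟨q, h⟩ := hex; exact ⟨_, q, h, rfl⟩)
      obtain ⟨q, hq, hn⟩ := Nat.find_spec (p := fun n => ∃ q, good q ∧ q.natDegree = n) (by obtain ⟨q, h⟩ := hex; exact ⟨_, q, h, rfl⟩)
      exact ⟨q, hq, fun q' h' => hn ▸ Nat.find_min' _ ⟨q', h', rfl⟩⟩
    have hsmall : ∀ r : Polynomial (MvPolynomial w.ι S), r.natDegree < q.natDegree → r.eval₂ φ t ∈ m →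
        ∀ j, r.coeff j ∈ w.Q := by
      intro r hr hrt
      by_contra hcon
      push Not at hcon
      obtain ⟨b, hb1, hb2, hb3⟩ := lead_trunc w.Q r hcon
      have := hmin b ⟨hb1, by
        have h2 := eval₂_sub_mem_coeff φ t r b hb3
        have := Ideal.sub_mem _ hrt h2
        rwa [sub_sub_cancel] at this⟩
      omega
    have hd0 : q.natDegree ≠ 0 := by
      intro h0
      have hqc := Polynomial.eq_C_of_natDegree_eq_zero h0
      have h1 := hq.2
      rw [hqc, Polynomial.eval₂_C] at h1
      apply hq.1
      rw [Polynomial.leadingCoeff, h0]; exact h1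
    have hder : q.derivative.eval₂ φ t ∉ m := by
      intro h
      have h1 := hsmall _ (Polynomial.natDegree_derivative_lt hd0) h (q.natDegree - 1)
      rw [Polynomial.coeff_derivative, show q.natDegree - 1 + 1 = q.natDegree by omega] at h1
      rcases Ideal.IsPrime.mem_or_mem inferInstance h1 with h2 | h2
      · exact hq.1 h2
      · have h3 : ((q.natDegree : ℕ) : Θ) ∈ m := by
          have h4 : φ (((q.natDegree - 1 : ℕ) : MvPolynomial w.ι S) + 1) ∈ m := h2
          rw [map_add, map_natCast, map_one] at h4
          have : ((q.natDegree : ℕ) : Θ) = ((q.natDegree - 1 : ℕ) : Θ) + 1 := by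
            rw [← Nat.cast_succ]; congr 1; omega
          rw [this]; exact h4
        have hu : IsUnit ((q.natDegree : ℕ) : Θ) := by
          have : ((q.natDegree : ℕ) : Θ) = algebraMap ℚ Θ (q.natDegree : ℚ) := by simp
          rw [this]
          exact (IsUnit.mk0 _ (by exact_mod_cast hd0)).map _
        exact h3 hu
    letI : Algebra (MvPolynomial w.ι S) Θ := φ.toAlgebra
    obtain ⟨t', ⟨ht1, ht2⟩, -⟩ := Polynomial.existsUnique_nilpotent_sub_and_aeval_eq_zero
      (x := t) (P := q) (hnil _ hq.2) (by
        by_contra hu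
        exact hder hu)
    have ht1 : t - t' ∈ m := by
      obtain ⟨n, hn⟩ := ht1
      exact Ideal.IsPrime.mem_of_pow_mem inferInstance n (hn ▸ m.zero_mem)
    replace ht2 : q.eval₂ φ t' = 0 := ht2
    let y' : Option w.ι → Θ := fun o => o.elim t' w.y
    have hy' : y' ∘ some = w.y := rfl
    let G' : Option w.κ → MvPolynomial (Option w.ι) S := fun o => o.elim (E.symm q) (fun k => rename some (w.G k))
    refine ⟨⟨Option w.ι, Option w.κ, inferInstance, inferInstance, y', G', ?_, ?_, ?_⟩, ?_, ?_⟩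
    · rintro (_ | k)
      · have := aeval_optEquiv y' (E.symm q)
        rw [AlgEquiv.apply_symm_apply] at this
        exact this.trans ht2
      · simp only [G', Option.elim]
        rw [aeval_rename, hy', w.h0]
    · intro l hl
      have h1 : l none ∈ m := by
        have h2 := hl none
        simp only [Fintype.sum_option] at h2
        have h3 : ∀ k, dv y' none (G' (some k)) = 0 := fun k => dv_rename_ne _ _ _ (by simp) _
        simp only [h3, mul_zero, Finset.sum_const_zero, add_zero] at h2
        have h4 : dv y' none (G' none) = q.derivative.eval₂ φ t' := by
          have := dv_optEquiv y' (E.symm q)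
          rw [AlgEquiv.apply_symm_apply] at this
          exact this
        rw [h4] at h2
        refine (Ideal.IsPrime.mem_or_mem inferInstance h2).resolve_right fun h5 => hder ?_
        have := Ideal.add_mem _ (eval₂_sub_mem_pt φ t t' q.derivative ht1) h5
        rwa [sub_add_cancel] at this
      rintro (_ | k)
      · exact h1
      · refine w.hJ (fun k => l (some k)) (fun i => ?_) k
        have h2 := hl (some i)
        simp only [Fintype.sum_option] at h2
        have h3 : ∀ k, dv y' (some i) (G' (some k)) = dv w.y i (w.G k) := fun k => by
          simp only [G', Option.elim, dv_rename_inj _ _ (Option.some_injective _), hy']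
        simp only [h3] at h2
        exact (Ideal.add_mem_iff_right _ (Ideal.mul_mem_right _ _ h1)).1 h2
    · intro a ha
      obtain ⟨k, b, r, h1, h2⟩ := pseudo_div (E a) q hd0
      have hat : (E a).eval₂ φ t' ∈ m := by
        have := aeval_optEquiv y' a
        rw [← hm, this] at ha; exact ha
      have hrt' : r.eval₂ φ t' ∈ m := by
        have := congrArg (Polynomial.eval₂ φ t') h1
        rw [Polynomial.eval₂_mul, Polynomial.eval₂_add, Polynomial.eval₂_mul, ht2, zero_mul, zero_add] at this
        rw [← this]; exact Ideal.mul_mem_left _ _ hat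
      have hrt : r.eval₂ φ t ∈ m := by
        have := Ideal.add_mem _ (eval₂_sub_mem_pt φ t t' r ht1) hrt'
        rwa [sub_add_cancel] at this
      obtain ⟨σ, h3, h4⟩ := iii_coeffs w r (hsmall r h2 hrt)
        (U.map C ⊔ Ideal.span (Set.range G')) le_sup_left
        (fun k => Ideal.mem_sup_right (Ideal.subset_span ⟨some k, rfl⟩))
      refine ⟨rename some (σ * q.leadingCoeff ^ k), ?_, ?_⟩
      · rw [aeval_rename, hy']
        intro h5
        have h6 : σ * q.leadingCoeff ^ k ∈ w.Q := h5
        rcases Ideal.IsPrime.mem_or_mem inferInstance h6 with h7 | h7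
        · exact h3 h7
        · exact hq.1 (Ideal.IsPrime.mem_of_pow_mem inferInstance _ h7)
      · have h5 := congrArg E.symm h1
        rw [map_mul, map_add, map_mul, optEquiv_symm_C, AlgEquiv.symm_apply_apply] at h5
        rw [map_mul, mul_assoc, h5, mul_add]
        refine Ideal.add_mem _ (Ideal.mul_mem_left _ _ (Ideal.mul_mem_right _ _ ?_)) h4
        exact Ideal.mem_sup_right (Ideal.subset_span ⟨none, rfl⟩)
    · exact ⟨fun i => X (some i), fun i => by simp [y']⟩
    · refine ⟨X none, ?_⟩
      rw [aeval_X]; exact ht1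

theorem Tw.adjoinFin [Algebra ℚ Θ] (hnil : ∀ x ∈ maximalIdeal Θ, IsNilpotent x) {τ : Type} (s : Finset τ)
    (w : Tw S Θ U) (t : τ → Θ) :
    ∃ w' : Tw S Θ U, w.Le w' ∧ ∀ j ∈ s, ∃ P : MvPolynomial w'.ι S, t j - aeval w'.y P ∈ maximalIdeal Θ := by
  classical
  induction s using Finset.induction_on with
  | empty => exact ⟨w, Tw.Le.refl w, by simp⟩
  | insert j s hj ih =>
    obtain ⟨w1, h1, h2⟩ := ih
    obtain ⟨w2, h3, P, hP⟩ := w1.adjoin hnil (t j)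
    refine ⟨w2, h1.trans h3, fun i hi => ?_⟩
    rcases Finset.mem_insert.1 hi with rfl | hi
    · exact ⟨P, hP⟩
    · obtain ⟨P', hP'⟩ := h2 i hi
      obtain ⟨P'', hP''⟩ := h3.lift P'
      exact ⟨P'', by rw [hP'']; exact hP'⟩

theorem Tw.approx [Algebra ℚ Θ] (hnil : ∀ x ∈ maximalIdeal Θ, IsNilpotent x) {υ : Type} [Fintype υ] (u : υ → S)
    (hu : maximalIdeal Θ = Ideal.span (Set.range fun i => algebraMap S Θ (u i))) (k : ℕ) :
    ∀ {τ : Type} [Fintype τ] (w : Tw S Θ U) (t : τ → Θ), 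
    ∃ w' : Tw S Θ U, w.Le w' ∧ ∃ P : τ → MvPolynomial w'.ι S, ∀ j, t j - aeval w'.y (P j) ∈ maximalIdeal Θ ^ k := by
  induction k with
  | zero => intro τ _ w t; exact ⟨w, Tw.Le.refl w, fun _ => 0, by simp⟩
  | succ k ih =>
    intro τ _ w t
    obtain ⟨w1, h1, h2⟩ := w.adjoinFin hnil Finset.univ t
    choose P hP using fun j => h2 j (Finset.mem_univ j)
    have h3 : ∀ j, ∃ θ : υ → Θ, ∑ i, θ i * algebraMap S Θ (u i) = t j - aeval w1.y (P j) := by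
      intro j
      have := hP j
      rw [hu] at this
      exact (Ideal.mem_span_range_iff_exists_fun).1 this
    choose θ hθ using h3
    obtain ⟨w2, h4, P2, hP2⟩ := ih w1 (fun x : τ × υ => θ x.1 x.2)
    choose P3 hP3 using fun j => h4.lift (P j)
    refine ⟨w2, h1.trans h4, fun j => P3 j + ∑ i, P2 (j, i) * C (u i), fun j => ?_⟩
    have : t j - aeval w2.y (P3 j + ∑ i, P2 (j, i) * C (u i)) =
        ∑ i, (θ j i - aeval w2.y (P2 (j, i))) * algebraMap S Θ (u i) := by
      rw [map_add, hP3, ← sub_sub, ← hθ]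
      simp only [map_sum, map_mul, aeval_C, sub_mul, Finset.sum_sub_distrib]
    rw [this, pow_succ]
    refine Ideal.sum_mem _ fun i _ => Ideal.mul_mem_mul (hP2 (j, i)) ?_
    rw [hu]; exact Ideal.subset_span ⟨i, rfl⟩

theorem exists_homog {A υ : Type} [CommRing A] [Fintype υ] (u : υ → A) (k : ℕ) (x : A)
    (hx : x ∈ Ideal.span (Set.range u) ^ k) : ∃ H : MvPolynomial υ A, H.IsHomogeneous k ∧ aeval u H = x := by
  induction k generalizing x with
  | zero => exact ⟨C x, isHomogeneous_C _ _, by simp⟩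
  | succ k ih =>
    rw [pow_succ] at hx
    refine Submodule.mul_induction_on hx ?_ ?_
    · intro a ha b hb
      obtain ⟨H, h1, h2⟩ := ih a ha
      obtain ⟨c, hc⟩ := (Ideal.mem_span_range_iff_exists_fun).1 hb
      refine ⟨H * ∑ i, C (c i) * X i, h1.mul (IsHomogeneous.sum _ _ _ fun i _ => ?_), ?_⟩
      · have := (isHomogeneous_C υ (c i)).mul (isHomogeneous_X A i)
        rwa [zero_add] at this
      · rw [map_mul, h2, map_sum]; simp only [map_mul, aeval_C, aeval_X, Algebra.algebraMap_self, RingHom.id_apply, hc]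
    · rintro a b ⟨H, h1, h2⟩ ⟨H', h1', h2'⟩
      exact ⟨H + H', h1.add h1', by rw [map_add, h2, h2']⟩

theorem homog_mem {A υ : Type} [CommRing A] [Fintype υ] (u : υ → A) (k : ℕ) (H : MvPolynomial υ A)
    (hH : H.IsHomogeneous k) (I : Ideal A) (hI : ∀ d, H.coeff d ∈ I) :
    aeval u H ∈ I * Ideal.span (Set.range u) ^ k := by
  rw [aeval_def, eval₂_eq']
  refine Ideal.sum_mem _ fun d hd => Ideal.mul_mem_mul (hI d) ?_
  have hdeg : ∑ i, d i = k := by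
    have := hH (mem_support_iff.1 hd)
    rw [← this, Finsupp.weight_apply, Finsupp.sum_fintype _ _ (by simp)]
    simp
  rw [← hdeg]
  rw [← Finset.prod_pow_eq_pow_sum]
  exact Ideal.prod_mem_prod fun i _ => Ideal.pow_mem_pow (Ideal.subset_span (Set.mem_range_self i)) _

/-- if `a(y)` is deep then `a` is locally deep. -/
theorem Tw.deep {υ : Type} [Fintype υ] (u : υ → S) (hu : U = Ideal.span (Set.range u)) (N : ℕ)
    (MI : ∀ k < N, ∀ H : MvPolynomial υ Θ, H.IsHomogeneous k →
      aeval (fun i => algebraMap S Θ (u i)) H ∈ maximalIdeal Θ ^ (k + 1) → ∀ d, H.coeff d ∈ maximalIdeal Θ)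
    (hUm : ∀ i, algebraMap S Θ (u i) ∈ maximalIdeal Θ)
    (w : Tw S Θ U) (k : ℕ) (hk : k ≤ N) (a : MvPolynomial w.ι S) (ha : aeval w.y a ∈ maximalIdeal Θ ^ k) :
    ∃ σ : MvPolynomial w.ι S, aeval w.y σ ∉ maximalIdeal Θ ∧
      σ * a ∈ (U.map C) ^ k ⊔ Ideal.span (Set.range w.G) := by
  induction k with
  | zero => exact ⟨1, by simp, by simp⟩
  | succ k ih =>
    have : w.Q.IsPrime := Ideal.comap_isPrime _ _
    obtain ⟨σ, h1, h2⟩ := ih (by omega) (Ideal.pow_le_pow_right (Nat.le_succ k) ha)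
    obtain ⟨x, hx, g, hg, hxg⟩ := Submodule.mem_sup.1 h2
    have hUC : U.map (C : S →+* MvPolynomial w.ι S) = Ideal.span (Set.range fun i => C (u i)) := by
      have := congrArg (Ideal.map (C : S →+* MvPolynomial w.ι S)) hu
      rw [this, Ideal.map_span]; congr 1; ext z; simp
    have hG0 : ∀ g ∈ Ideal.span (Set.range w.G), aeval w.y g = 0 := by
      intro g hg
      have : Ideal.span (Set.range w.G) ≤ RingHom.ker (aeval w.y : MvPolynomial w.ι S →ₐ[S] Θ) := by
        rw [Ideal.span_le]; rintro _ ⟨k, rfl⟩; exact w.h0 k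
      exact this hg
    rw [hUC] at hx
    obtain ⟨H, hH, rfl⟩ := exists_homog _ k x hx
    have hev : aeval (fun i => algebraMap S Θ (u i)) (map (aeval w.y : MvPolynomial w.ι S →ₐ[S] Θ).toRingHom H) =
        aeval w.y (aeval (fun i => (C (u i) : MvPolynomial w.ι S)) H) := by
      rw [aeval_def, eval₂_map]
      have := hom_eval₂ H (algebraMap (MvPolynomial w.ι S) (MvPolynomial w.ι S)) (aeval w.y : MvPolynomial w.ι S →ₐ[S] Θ).toRingHom
        (fun i => (C (u i) : MvPolynomial w.ι S))
      refine Eq.trans ?_ this.symm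
      congr 1
      ext i; simp
    have h4 := MI k (by omega) (map (aeval w.y : MvPolynomial w.ι S →ₐ[S] Θ).toRingHom H) (hH.map _) (by
      rw [hev]
      have h5 := congrArg (aeval w.y) hxg
      rw [map_add, hG0 g hg, add_zero, map_mul] at h5
      rw [h5]; exact Ideal.mul_mem_left _ _ ha)
    obtain ⟨σ', h5, h6⟩ := exists_common_mul w.Q (U.map C ⊔ Ideal.span (Set.range w.G)) H.support (fun d => H.coeff d)
      (fun d _ => w.h3 _ (by have := h4 d; rw [coeff_map] at this; exact this))
    refine ⟨σ' * σ, fun h => (Ideal.IsPrime.mem_or_mem inferInstance (show σ' * σ ∈ w.Q from h)).elim h5 h1, ?_⟩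
    rw [mul_assoc, ← hxg, mul_add]
    refine Ideal.add_mem _ ?_ (Ideal.mem_sup_right (Ideal.mul_mem_left _ _ hg))
    have h7 : σ' * aeval (fun i => (C (u i) : MvPolynomial w.ι S)) H =
        aeval (fun i => (C (u i) : MvPolynomial w.ι S)) (C σ' * H) := by simp
    rw [h7]
    have h8 := homog_mem (fun i => (C (u i) : MvPolynomial w.ι S)) k (C σ' * H) (by
      have := (isHomogeneous_C υ σ').mul hH; rwa [zero_add] at this) (U.map C ⊔ Ideal.span (Set.range w.G)) (by
        intro d
        rw [coeff_C_mul]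
        by_cases hd : d ∈ H.support
        · exact h6 d hd
        · rw [notMem_support_iff.1 hd, mul_zero]; exact Ideal.zero_mem _)
    rw [← hUC, Ideal.sup_mul, ← pow_succ'] at h8
    obtain ⟨x1, hx1, x2, hx2, h9⟩ := Submodule.mem_sup.1 h8
    rw [← h9]
    exact Submodule.add_mem_sup hx1 (Ideal.mul_le_left hx2)
end tower2

end Part5

section Part6
open MvPolynomial IsLocalRing

section jc
variable {S : Type} [CommRing S]

theorem indepMod_det {κ : Type} [Fintype κ] [DecidableEq κ] (Q : Ideal S) [Q.IsPrime] (J : Matrix κ κ S)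
    (hI : IndepMod Q J) : J.det ∉ Q := by
  obtain ⟨δ, hδ, N, hN⟩ := exists_rightInv_of_indepMod Q J hI
  have h1 : J * Matrix.of N = δ • (1 : Matrix κ κ S) := by
    ext a c
    simp [Matrix.mul_apply, hN, Matrix.one_apply]
  have h2 := congrArg Matrix.det h1
  rw [Matrix.det_mul, Matrix.det_smul, Matrix.det_one, mul_one] at h2
  intro h3
  apply hδ
  refine Ideal.IsPrime.mem_of_pow_mem inferInstance (Fintype.card κ) ?_
  rw [← h2]
  exact Ideal.mul_mem_right _ _ h3

theorem indepMod_card_le {κ ι : Type} [Fintype κ] [Fintype ι] (Q : Ideal S) [Q.IsPrime] (J : κ → ι → S)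
    (hI : IndepMod Q J) : Fintype.card κ ≤ Fintype.card ι := by
  classical
  obtain ⟨δ, hδ, N, hN⟩ := exists_rightInv_of_indepMod Q J hI
  let F := FractionRing (S ⧸ Q)
  let φ : S →+* F := (algebraMap (S ⧸ Q) F).comp (Ideal.Quotient.mk Q)
  have hφ : φ δ ≠ 0 := by
    simp only [φ, RingHom.comp_apply]
    rw [Ne, FaithfulSMul.algebraMap_eq_zero_iff, Ideal.Quotient.eq_zero_iff_mem]
    exact hδ
  have h1 : (Matrix.of J).map φ * (Matrix.of fun i k => N i k).map φ * (φ δ)⁻¹ • (1 : Matrix κ κ F) = 1 := by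
    rw [← Matrix.map_mul]
    ext a c
    have : (Matrix.of J * Matrix.of fun i k => N i k) = δ • (1 : Matrix κ κ S) := by
      ext a c; simp [Matrix.mul_apply, hN, Matrix.one_apply]
    rw [this]
    by_cases hac : a = c
    · subst hac; simp [hφ]
      exact inv_mul_cancel₀ hφ
    · simp [hac]
  have h2 := Matrix.rank_mul_le_left ((Matrix.of J).map φ) ((Matrix.of fun i k => N i k).map φ * (φ δ)⁻¹ • (1 : Matrix κ κ F))
  rw [← Matrix.mul_assoc, h1, Matrix.rank_one] at h2
  exact h2.trans (Matrix.rank_le_card_width _)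

/-- columns may be infinite: still one finds finitely many combos -/
theorem exists_rightInv_inf {κ ι : Type} [Fintype κ] [DecidableEq κ] (Q : Ideal S) [Q.IsPrime] (J : κ → ι → S)
    (hI : IndepMod Q J) : ∃ T : Finset ι, IndepMod Q (fun k (i : T) => J k i) := by
  classical
  let F := FractionRing (S ⧸ Q)
  let φ : S →+* F := (algebraMap (S ⧸ Q) F).comp (Ideal.Quotient.mk Q)
  have hφ : ∀ a, φ a = 0 ↔ a ∈ Q := by
    intro a
    simp only [φ, RingHom.comp_apply]
    rw [FaithfulSMul.algebraMap_eq_zero_iff, Ideal.Quotient.eq_zero_iff_mem]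
  let W : Finset ι → Submodule F (κ → F) := fun T => Submodule.span F ((fun i k => φ (J k i)) '' (T : Set ι))
  let V : Submodule F (κ → F) := Submodule.span F (Set.range fun i k => φ (J k i))
  have hV : ∃ T, W T = V := by
    have hfg : V.FG := IsNoetherian.noetherian V
    obtain ⟨t, ht1, ht2⟩ := (Submodule.fg_span_iff_fg_span_finset_subset _).1 hfg
    obtain ⟨T, hT⟩ : ∃ T : Finset ι, T.image (fun i k => φ (J k i)) = t := by
      obtain ⟨T, -, hT⟩ := Finset.subset_set_image_iff (s := Set.univ) (f := fun i k => φ (J k i)) (t := t) |>.1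
        (by rw [Set.image_univ]; exact ht1)
      exact ⟨T, hT⟩
    refine ⟨T, ?_⟩
    change Submodule.span F _ = _
    rw [← Finset.coe_image, hT]; exact ht2.symm
  obtain ⟨T, hT⟩ := hV
  refine ⟨T, fun l hl k => hI l (fun i => ?_) k⟩
  have h1 : (fun k => φ (J k i)) ∈ W T := by rw [hT]; exact Submodule.subset_span ⟨i, rfl⟩
  rw [← hφ, map_sum]
  simp only [map_mul]
  let L : (κ → F) →ₗ[F] F := ∑ k, φ (l k) • LinearMap.proj k
  have hL : ∀ v, L v = ∑ k, φ (l k) * v k := fun v => by simp [L]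
  have h2 : W T ≤ LinearMap.ker L := by
    rw [Submodule.span_le]
    rintro _ ⟨j, hj, rfl⟩
    have := hl ⟨j, hj⟩
    rw [← hφ, map_sum] at this
    simp only [map_mul] at this
    change L _ = 0
    rw [hL]; exact this
  have := h2 h1
  rw [LinearMap.mem_ker, hL] at this
  exact this

abbrev Der (S : Type) [CommRing S] := Derivation ℤ S S

/-- gradients independent at `P` -/
def GInd {υ : Type} [Fintype υ] (P : Ideal S) (u : υ → S) : Prop :=
  IndepMod P (fun i (D : Der S) => D (u i))

theorem GInd.dual {υ : Type} [Fintype υ] [DecidableEq υ] {P : Ideal S} [P.IsPrime] {u : υ → S} (h : GInd P u) :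
    ∃ δ ∉ P, ∃ D : υ → Der S, ∀ i j, D j (u i) = if i = j then δ else 0 := by
  classical
  obtain ⟨T, hT⟩ := exists_rightInv_inf P _ h
  obtain ⟨δ, hδ, N, hN⟩ := exists_rightInv_of_indepMod P _ hT
  refine ⟨δ, hδ, fun j => ∑ i, N i j • (i : Der S), fun i j => ?_⟩
  rw [← hN]
  have : ∀ (s : Finset T), (∑ x ∈ s, N x j • (x : Der S)) (u i) = ∑ x ∈ s, (x : Der S) (u i) * N x j := by
    intro s
    induction s using Finset.induction_on with
    | empty => simp
    | insert a s ha ih => rw [Finset.sum_insert ha, Finset.sum_insert ha, Derivation.add_apply, ih]; simp [mul_comm]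
  exact this _

theorem GInd.of_dual {υ : Type} [Fintype υ] [DecidableEq υ] {P : Ideal S} [hP : P.IsPrime] {u : υ → S} (δ : S) (hδ : δ ∉ P)
    (D : υ → Der S) (h : ∀ i j, D j (u i) = if i = j then δ else 0) : GInd P u := by
  intro l hl k
  have := hl (D k)
  simp only [h, mul_ite, mul_zero, Finset.sum_ite_eq', Finset.mem_univ, if_true] at this
  exact (hP.mem_or_mem this).resolve_right hδ

variable (S) in
/-- Jacobian criterion -/
def JC : Prop := ∀ P : Ideal S, P.IsPrime → ∃ (h : ℕ) (q : Fin h → S), P.height = h ∧ (∀ i, q i ∈ P) ∧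
  GInd P q ∧ ∃ σ ∉ P, ∀ x ∈ P, σ * x ∈ Ideal.span (Set.range q)

theorem GInd.rows {υ : Type} [Fintype υ] {P : Ideal S} [hP : P.IsPrime] {u : υ → S} (hu : GInd P u)
    {h : ℕ} (q : Fin h → S) (hq : ∀ i, q i ∈ P) (σ : S) (hσ : σ ∉ P) (huP : ∀ i, u i ∈ P)
    (a : υ → Fin h → S) (ha : ∀ i, ∑ j, a i j * q j = σ * u i) : IndepMod P a := by
  intro l hl
  refine hu l fun D => ?_
  refine (hP.mem_or_mem (x := σ) ?_).resolve_left hσ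
  have h1 : ∀ i, σ * D (u i) - ∑ j, a i j * D (q j) ∈ P := by
    intro i
    have h2 := congrArg D (ha i)
    rw [map_sum] at h2
    simp only [Derivation.leibniz, smul_eq_mul, Finset.sum_add_distrib] at h2
    have : σ * D (u i) - ∑ j, a i j * D (q j) = ∑ j, q j * D (a i j) - u i * D σ := by
      linear_combination -h2
    rw [this]
    exact Ideal.sub_mem _ (Ideal.sum_mem _ fun j _ => Ideal.mul_mem_right _ _ (hq j)) (Ideal.mul_mem_right _ _ (huP i))
  have h2 : ∑ i, l i * (σ * D (u i) - ∑ j, a i j * D (q j)) ∈ P :=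
    Ideal.sum_mem _ fun i _ => Ideal.mul_mem_left _ _ (h1 i)
  have h3 : ∑ j, (∑ i, l i * a i j) * D (q j) ∈ P := Ideal.sum_mem _ fun j _ => Ideal.mul_mem_right _ _ (hl j)
  have := Ideal.add_mem _ h2 h3
  convert this using 1
  simp only [mul_sub, Finset.sum_sub_distrib, Finset.mul_sum, Finset.sum_mul]
  rw [Finset.sum_comm (f := fun j i => l i * a i j * D (q j))]
  simp only [mul_assoc, sub_add_cancel]
  exact Finset.sum_congr rfl fun i _ => by ring

theorem GInd.card_le (hS : JC S) {υ : Type} [Fintype υ] {P : Ideal S} [hP : P.IsPrime] {u : υ → S} (hu : GInd P u)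
    (huP : ∀ i, u i ∈ P) : (Fintype.card υ : ℕ∞) ≤ P.height := by
  obtain ⟨h, q, hh, hq, -, σ, hσ, hσP⟩ := hS P hP
  choose a ha using fun i => (Ideal.mem_span_range_iff_exists_fun).1 (hσP _ (huP i))
  have := indepMod_card_le P a (hu.rows q hq σ hσ huP a ha)
  rw [hh]; simpa using this

theorem GInd.gen (hS : JC S) {υ : Type} [Fintype υ] {P : Ideal S} [hP : P.IsPrime] {u : υ → S} (hu : GInd P u)
    (huP : ∀ i, u i ∈ P) (hc : P.height = Fintype.card υ) : ∃ σ ∉ P, ∀ x ∈ P, σ * x ∈ Ideal.span (Set.range u) := by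
  classical
  obtain ⟨h, q, hh, hq, -, σ, hσ, hσP⟩ := hS P hP
  have hcard : Fintype.card υ = Fintype.card (Fin h) := by
    rw [hh] at hc; simpa using (by exact_mod_cast hc.symm : Fintype.card υ = h)
  choose a ha using fun i => (Ideal.mem_span_range_iff_exists_fun).1 (hσP _ (huP i))
  have hI := hu.rows q hq σ hσ huP a ha
  let e := Fintype.equivOfCardEq hcard
  let A : Matrix υ υ S := fun i j => a i (e j)
  have hA : A.det ∉ P := indepMod_det P A fun l hl => hI l fun j => by
    have := hl (e.symm j); simpa [A] using this
  refine ⟨A.det * σ, fun hh => (hP.mem_or_mem hh).elim hA hσ, fun x hx => ?_⟩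
  have hqu : ∀ j, A.det * q j ∈ Ideal.span (Set.range u) := by
    intro j
    have h1 : ∑ i, A.adjugate (e.symm j) i * (σ * u i) = A.det * q j := by
      simp only [← ha]
      have : ∀ i, ∑ j, a i j * q j = ∑ j, A i j * q (e j) := fun i => by
        rw [← e.sum_comp]
      simp only [this, Finset.mul_sum]
      rw [Finset.sum_comm]
      simp only [← mul_assoc, ← Finset.sum_mul]
      have h3 : ∀ x, ∑ i, A.adjugate (e.symm j) i * A i x = if e.symm j = x then A.det else 0 := fun x => by
        have := congrFun (congrFun (Matrix.adjugate_mul A) (e.symm j)) x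
        simpa [Matrix.mul_apply, Matrix.one_apply] using this
      simp [h3]
    rw [← h1]
    exact Ideal.sum_mem _ fun i _ => Ideal.mul_mem_left _ _ (Ideal.mul_mem_left _ _ (Ideal.subset_span ⟨i, rfl⟩))
  obtain ⟨c, hc⟩ := (Ideal.mem_span_range_iff_exists_fun).1 (hσP _ hx)
  rw [mul_assoc, ← hc, Finset.mul_sum]
  refine Ideal.sum_mem _ fun j _ => ?_
  have := Ideal.mul_mem_left _ (c j) (hqu j)
  convert this using 1; ring

theorem der_aeval {υ : Type} [Fintype υ] (D : Der S) (u : υ → S) (H : MvPolynomial υ S) :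
    ∃ H' : MvPolynomial υ S, (∀ d, H'.coeff d = D (H.coeff d)) ∧
      D (aeval u H) = aeval u H' + ∑ i, dv u i H * D (u i) := by
  classical
  induction H using MvPolynomial.induction_on with
  | C a =>
    refine ⟨C (D a), fun d => ?_, ?_⟩
    · simp only [coeff_C]; split_ifs <;> simp
    · simp only [algHom_C, Algebra.algebraMap_self, RingHom.id_apply, dv_C, zero_mul, Finset.sum_const_zero, add_zero]
  | add p q hp hq =>
    obtain ⟨p', h1, h2⟩ := hp
    obtain ⟨q', h3, h4⟩ := hq
    refine ⟨p' + q', fun d => by simp [h1, h3], ?_⟩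
    simp only [map_add, dv_add, add_mul, Finset.sum_add_distrib] at *
    rw [h2, h4]; ring
  | mul_X p i hp =>
    obtain ⟨p', h1, h2⟩ := hp
    refine ⟨p' * X i, fun d => ?_, ?_⟩
    · simp only [coeff_mul_X']; split_ifs <;> simp [h1]
    · simp only [map_mul, aeval_X, Derivation.leibniz, smul_eq_mul, dv_mul, add_mul, Finset.sum_add_distrib] at *
      rw [h2]
      have : ∑ x, aeval u p * dv u x (X i : MvPolynomial υ S) * D (u x) = aeval u p * D (u i) := by
        rw [Finset.sum_eq_single i]
        · simp
        · intro b _ hb; rw [dv_X_ne (h := hb.symm)]; simp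
        · simp
      rw [this, mul_add, Finset.mul_sum]
      have : ∀ x, dv u x p * u i * D (u x) = u i * (dv u x p * D (u x)) := fun x => by ring
      simp only [this]
      ring

theorem MI_aux [Algebra ℚ S] {υ : Type} [Fintype υ] {P : Ideal S} [hP : P.IsPrime] {u : υ → S}
    (hu : GInd P u) (huP : ∀ i, u i ∈ P) (k : ℕ) (H : MvPolynomial υ S) (hH : H.IsHomogeneous k)
    (h : aeval u H ∈ P ^ (k + 1)) (d) : H.coeff d ∈ P := by
  classical
  obtain ⟨δ, hδ, D, hD⟩ := hu.dual
  have hspan : Ideal.span (Set.range u) ≤ P := by rw [Ideal.span_le]; rintro _ ⟨i, rfl⟩; exact huP i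
  have hderpow : ∀ (E : Der S) (k : ℕ) (x : S), x ∈ P ^ (k + 1) → E x ∈ P ^ k := by
    intro E k
    induction k with
    | zero => intro x _; simp
    | succ k ih =>
      intro x hx
      rw [pow_succ] at hx
      refine Submodule.mul_induction_on hx ?_ ?_
      · intro a ha b hb
        rw [Derivation.leibniz]
        refine Ideal.add_mem _ (Ideal.mul_mem_right _ _ ha) ?_
        rw [smul_eq_mul, pow_succ']
        exact Ideal.mul_mem_mul hb (ih a ha)
      · intro a b ha hb; rw [map_add]; exact Ideal.add_mem _ ha hb
  induction k generalizing H d with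
  | zero =>
    rw [totalDegree_eq_zero_iff_eq_C.1 (Nat.le_zero.1 hH.totalDegree_le)] at h ⊢
    rw [algHom_C, zero_add, pow_one] at h
    rw [coeff_C]; split_ifs
    · exact h
    · exact P.zero_mem
  | succ k ih =>
    by_cases hd : H.coeff d = 0
    · rw [hd]; exact P.zero_mem
    have hdeg : ∑ i, d i = k + 1 := by
      have := hH hd
      rw [← this, Finsupp.weight_apply, Finsupp.sum_fintype _ _ (by simp)]
      simp
    obtain ⟨j, hj⟩ : ∃ j, d j ≠ 0 := by
      by_contra hcon; push Not at hcon; simp [hcon] at hdeg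
    obtain ⟨H', h1, h2⟩ := der_aeval (D j) u H
    have h3 : aeval u H' ∈ P ^ (k + 1) := by
      have := homog_mem u (k + 1) H' (by
        intro e he
        apply hH
        intro h0; rw [h1, h0, map_zero] at he; exact he rfl) ⊤ (fun _ => trivial)
      rw [Ideal.top_mul] at this
      exact Ideal.pow_right_mono hspan _ this
    have h4 := hderpow (D j) (k + 1) _ h
    rw [h2, Ideal.add_mem_iff_right _ h3] at h4
    simp only [hD, mul_ite, mul_zero, Finset.sum_ite_eq', Finset.mem_univ, if_true] at h4
    have h5 := ih (C δ * pderiv j H) (by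
      have := (isHomogeneous_C υ δ).mul (hH.pderiv (i := j))
      simpa using this) (by
      rw [map_mul, algHom_C]; simpa [dv, mul_comm] using h4) (d - Finsupp.single j 1)
    rw [coeff_C_mul] at h5
    have h6 := (hP.mem_or_mem h5).resolve_left hδ
    rw [coeff_pderiv] at h6
    have hdd : d - Finsupp.single j 1 + Finsupp.single j 1 = d := by
      apply tsub_add_cancel_of_le
      rw [Finsupp.single_le_iff]; omega
    rw [hdd] at h6
    refine (hP.mem_or_mem h6).resolve_right fun h7 => ?_
    generalize (d - (Finsupp.single j 1 : υ →₀ ℕ)) j = n at h7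
    have : IsUnit ((n : S) + 1) := by
      have : ((n : S) + 1) = algebraMap ℚ S ((n : ℚ) + 1) := by simp
      rw [this]
      exact (IsUnit.mk0 _ (by positivity)).map _
    exact hP.ne_top (Ideal.eq_top_of_isUnit_mem _ h7 this)
end jc

end Part6

section Part7
open MvPolynomial IsLocalRing

section CM
open LinearMap RingTheory.Sequence Ideal CategoryTheory Abelian Limits Pointwise IsSMulRegular

/-- depth at least `d` -/
def Dp (Λ : Type) [CommRing Λ] [IsLocalRing Λ] (d : ℕ) (M : Type) [AddCommGroup M] [Module Λ M] : Prop :=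
  ∃ rs : List Λ, rs.length = d ∧ (∀ r ∈ rs, r ∈ maximalIdeal Λ) ∧ IsRegular M rs

variable {Λ : Type} [CommRing Λ] [IsLocalRing Λ] [IsNoetherianRing Λ]

lemma smul_top_ne (M : Type) [AddCommGroup M] [Module Λ M] [Module.Finite Λ M] [Nontrivial M] :
    maximalIdeal Λ • (⊤ : Submodule Λ M) < ⊤ := by
  refine lt_top_iff_ne_top.mpr fun h => ?_
  have := Submodule.eq_bot_of_le_smul_of_le_jacobson_bot (maximalIdeal Λ) (⊤ : Submodule Λ M)
    Module.Finite.fg_top h.ge (IsLocalRing.maximalIdeal_le_jacobson _)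
  exact top_ne_bot this

lemma Dp.quot {d : ℕ} {M : Type} [AddCommGroup M] [Module Λ M] [Module.Finite Λ M]
    (h : Dp Λ (d+1) M) {x : Λ} (hx : x ∈ maximalIdeal Λ) (hreg : IsSMulRegular M x) :
    Dp Λ d (QuotSMulTop x M) := by
  obtain ⟨rs, hl, hm, hr⟩ := h
  have : Nontrivial M := hr.nontrivial
  have hnt : Nontrivial (QuotSMulTop x M) := nontrivial_quotSMulTop_of_mem_maximalIdeal _ hx
  have hsupp : Module.support Λ (ModuleCat.of Λ (Λ ⧸ maximalIdeal Λ)) = PrimeSpectrum.zeroLocus (maximalIdeal Λ) := by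
    show Module.support Λ (Λ ⧸ maximalIdeal Λ) = _
    rw [Module.support_eq_zeroLocus, annihilator_quotient]
  have h_ext := ModuleCat.subsingleton_ext_of_exists_isRegular (maximalIdeal Λ)
    (ModuleCat.of Λ (Λ ⧸ maximalIdeal Λ)) hsupp.subset (ModuleCat.of Λ M) (smul_top_ne M) rs hm hr
  rw [hl] at h_ext
  refine ModuleCat.exists_isRegular_of_exists_subsingleton_ext (maximalIdeal Λ) d
    (ModuleCat.of Λ (QuotSMulTop x M)) (smul_top_ne _) (ModuleCat.of Λ (Λ ⧸ maximalIdeal Λ)) hsupp ?_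
  intro i hi
  have zero1 := AddCommGrpCat.isZero_of_iff_subsingleton.mpr (h_ext i (by omega))
  have zero2 := AddCommGrpCat.isZero_of_iff_subsingleton.mpr (h_ext (i + 1) (by omega))
  exact AddCommGrpCat.subsingleton_of_isZero <| ShortComplex.Exact.isZero_of_both_zeros
        ((Ext.covariant_sequence_exact₃' _ (IsSMulRegular.smulShortComplex_shortExact (M := ModuleCat.of Λ M) hreg)) i (i + 1) rfl)
        (zero1.eq_zero_of_src _) (zero2.eq_zero_of_tgt _)

lemma ischebeck {M : Type} [AddCommGroup M] [Module Λ M] [Module.Finite Λ M] {Q : Ideal Λ}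
    (hQ : Q ∈ associatedPrimes Λ M) {x : Λ} (hx : x ∈ maximalIdeal Λ) (hreg : IsSMulRegular M x) :
    ∃ Q' ∈ associatedPrimes Λ (QuotSMulTop x M), Q ≤ Q' ∧ x ∈ Q' := by
  rw [AssociatedPrimes.mem_iff, isAssociatedPrime_iff] at hQ
  obtain ⟨hp, z, hz⟩ := hQ
  let N : Submodule Λ M :=
    { carrier := {z | ∀ q ∈ Q, q • z = 0}
      add_mem' := fun {a b} ha hb q hq => by rw [smul_add, ha q hq, hb q hq, add_zero]
      zero_mem' := fun q _ => smul_zero q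
      smul_mem' := fun c a ha q hq => by rw [smul_comm, ha q hq, smul_zero] }
  have hzN : z ∈ N := fun q hq => by
    rw [hz] at hq
    simpa [Submodule.mem_colon_singleton] using hq
  have hz0 : z ≠ 0 := by
    rintro rfl
    exact hp.ne_top (by rw [hz]; ext; simp [Submodule.mem_colon_singleton])
  have hN : ¬ N ≤ x • (⊤ : Submodule Λ M) := by
    intro hle
    have hfg : N.FG := IsNoetherian.noetherian N
    have : N ≤ maximalIdeal Λ • N := by
      intro a ha
      obtain ⟨b, -, rfl⟩ := (Submodule.mem_smul_pointwise_iff_exists _ _ _).mp (hle ha)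
      refine Submodule.smul_mem_smul hx ?_
      intro q hq
      apply hreg
      show x • (q • b) = x • (0 : M)
      rw [smul_zero, smul_comm]
      exact ha q hq
    have := Submodule.eq_bot_of_le_smul_of_le_jacobson_bot (maximalIdeal Λ) N hfg this
      (IsLocalRing.maximalIdeal_le_jacobson _)
    rw [this] at hzN
    exact hz0 (by simpa using hzN)
  obtain ⟨a, haN, ha⟩ := Set.not_subset.mp hN
  obtain ⟨Q', hQ', hle⟩ := exists_le_isAssociatedPrime_of_isNoetherianRing Λ
    (M := QuotSMulTop x M) (Submodule.Quotient.mk a) (by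
      intro h
      exact ha ((Submodule.Quotient.mk_eq_zero _).mp h))
  refine ⟨Q', hQ', fun q hq => hle ?_, hle ?_⟩
  · rw [Submodule.mem_colon_singleton, ← Submodule.Quotient.mk_smul, haN q hq]
    simp
  · rw [Submodule.mem_colon_singleton, ← Submodule.Quotient.mk_smul]
    simp only [Submodule.mem_bot]
    rw [Submodule.Quotient.mk_eq_zero]
    exact Submodule.smul_mem_pointwise_smul _ _ _ trivial

lemma Dp.le_dim {d : ℕ} : ∀ {M : Type} [AddCommGroup M] [Module Λ M] [Module.Finite Λ M]
    (_ : Dp Λ d M) {Q : Ideal Λ} (_ : Q ∈ associatedPrimes Λ M), (d : WithBot ℕ∞) ≤ ringKrullDim (Λ ⧸ Q) := by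
  induction d with
  | zero =>
    intro M _ _ _ _ Q hQ
    have : Q.IsPrime := hQ.isPrime
    have := Ideal.Quotient.nontrivial_iff.mpr this.ne_top
    simpa using ringKrullDim_nonneg_of_nontrivial (R := Λ ⧸ Q)
  | succ d ih =>
    intro M _ _ _ h Q hQ
    have hp : Q.IsPrime := hQ.isPrime
    obtain ⟨rs, hl, hm, hr⟩ := h
    match rs, hl with
    | x :: rs', hl =>
      rw [isRegular_cons_iff] at hr
      have hx := hm x (by simp)
      obtain ⟨Q', hQ', hle, hxQ'⟩ := ischebeck hQ hx hr.1
      have := ih ⟨rs', by simpa using hl, fun r h => hm r (by simp [h]), hr.2⟩ hQ'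
      have hxQ : x ∉ Q := by
        intro hxQ
        have : x ∈ ⋃ p ∈ associatedPrimes Λ M, (p : Set Λ) := Set.mem_iUnion₂_of_mem hQ hxQ
        rw [biUnion_associatedPrimes_eq_compl_regular] at this
        exact this hr.1
      have h2 := ringKrullDim_succ_le_of_surjective (Ideal.Quotient.factor hle)
        (Ideal.Quotient.factor_surjective hle) (r := Ideal.Quotient.mk Q x)
        (mem_nonZeroDivisors_of_ne_zero (by rwa [Ne, Ideal.Quotient.eq_zero_iff_mem]))
        (by simpa [Ideal.Quotient.eq_zero_iff_mem] using hxQ')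
      refine le_trans ?_ h2
      push_cast
      gcongr

lemma dim_quot_le (Q : Ideal Λ) [Q.IsPrime] (s : List Λ) (hs : ∀ r ∈ s, r ∈ maximalIdeal Λ)
    (h : ∀ Q' : Ideal Λ, Q'.IsPrime → Q ≤ Q' → (∀ r ∈ s, r ∈ Q') → Q' = maximalIdeal Λ) :
    ringKrullDim (Λ ⧸ Q) ≤ s.length := by
  classical
  have : IsLocalRing (Λ ⧸ Q) := IsLocalRing.of_surjective' (Ideal.Quotient.mk Q) Ideal.Quotient.mk_surjective
  have hloc : IsLocalHom (Ideal.Quotient.mk Q) := IsLocalHom.of_surjective _ Ideal.Quotient.mk_surjective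
  rw [← IsLocalRing.maximalIdeal_height_eq_ringKrullDim]
  let t : Finset (Λ ⧸ Q) := (s.map (Ideal.Quotient.mk Q)).toFinset
  have hmin : maximalIdeal (Λ ⧸ Q) ∈ (Ideal.span (t : Set (Λ ⧸ Q))).minimalPrimes := by
    refine ⟨⟨inferInstance, ?_⟩, ?_⟩
    · rw [Ideal.span_le]
      intro a ha
      obtain ⟨r, hr, rfl⟩ : ∃ r ∈ s, Ideal.Quotient.mk Q r = a := by simpa [t] using ha
      exact (map_mem_nonunits_iff _ _ ).mpr (hs r hr)
    · rintro P ⟨hP, hle⟩ -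
      have hc : (P.comap (Ideal.Quotient.mk Q)) = maximalIdeal Λ := by
        refine h _ inferInstance (fun q hq => ?_) (fun r hr => ?_)
        · simp [Ideal.mem_comap, Ideal.Quotient.eq_zero_iff_mem.mpr hq]
        · exact hle (Ideal.subset_span (by simp only [t, List.coe_toFinset]; simpa using ⟨r, hr, rfl⟩))
      intro a ha
      obtain ⟨b, rfl⟩ := Ideal.Quotient.mk_surjective a
      rw [← Ideal.mem_comap, hc]
      exact (map_mem_nonunits_iff _ _ ).mp ha
  have h1 := Ideal.height_le_card_of_mem_minimalPrimes_span_finset hmin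
  have h2 : t.card ≤ s.length := by
    have := List.toFinset_card_le (s.map (Ideal.Quotient.mk Q))
    simpa [t] using this
  have h3 := h1.trans (Nat.cast_le.mpr h2)
  exact_mod_cast h3

lemma Dp.regular_of_primary (s : List Λ) : ∀ {M : Type} [AddCommGroup M] [Module Λ M] [Module.Finite Λ M]
    (_ : Dp Λ s.length M) (_ : ∀ r ∈ s, r ∈ maximalIdeal Λ)
    (_ : ∀ Q' : Ideal Λ, Q'.IsPrime → Module.annihilator Λ M ≤ Q' → (∀ r ∈ s, r ∈ Q') → Q' = maximalIdeal Λ),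
    IsWeaklyRegular M s := by
  induction s with
  | nil => intros; exact IsWeaklyRegular.nil _ _
  | cons x s ih =>
    intro M _ _ _ hd hs h
    have hx := hs x (by simp)
    have hreg : IsSMulRegular M x := by
      by_contra hc
      have : x ∈ ⋃ p ∈ associatedPrimes Λ M, (p : Set Λ) := by
        rw [biUnion_associatedPrimes_eq_compl_regular]; exact hc
      obtain ⟨Q, hQ, hxQ⟩ := Set.mem_iUnion₂.mp this
      have hp : Q.IsPrime := hQ.isPrime
      have h1 := hd.le_dim hQ
      have h2 := dim_quot_le Q s (fun r h => hs r (by simp [h])) (by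
        intro Q' hQ'p hQQ' hsQ'
        refine h Q' hQ'p (le_trans (by rw [← Submodule.annihilator_top]; exact hQ.annihilator_le) hQQ') ?_
        intro r hr
        rcases List.mem_cons.mp hr with rfl | hr
        · exact hQQ' hxQ
        · exact hsQ' r hr)
      have h3 := h1.trans h2
      simp only [List.length_cons] at h3
      have : s.length + 1 ≤ s.length := by exact_mod_cast h3
      omega
    rw [isWeaklyRegular_cons_iff]
    refine ⟨hreg, ih (hd.quot hx hreg) (fun r h => hs r (by simp [h])) ?_⟩
    intro Q' hp hann hs'
    refine h Q' hp (le_trans ?_ hann) ?_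
    · intro a ha
      rw [Module.mem_annihilator] at ha ⊢
      intro m
      obtain ⟨m, rfl⟩ := Submodule.Quotient.mk_surjective _ m
      rw [← Submodule.Quotient.mk_smul, ha, Submodule.Quotient.mk_zero]
    · intro r hr
      rcases List.mem_cons.mp hr with rfl | hr
      · exact hann (QuotSMulTop.mem_annihilator _ r)
      · exact hs' r hr


def CMp (Λ : Type) [CommRing Λ] [IsLocalRing Λ] : Prop :=
  ∀ (ι : Type) [Finite ι] (v : ι → Λ) (t : Λ), (∀ i, v i ∈ maximalIdeal Λ) → t ∈ maximalIdeal Λ →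
    (∀ Q : Ideal Λ, Q.IsPrime → (∀ i, v i ∈ Q) → t ∈ Q → ((Nat.card ι + 1 : ℕ) : ℕ∞) ≤ Q.height) →
    ∃ c : ℕ, ∀ (v' : ι → Λ) (t' : Λ), (∀ i, v' i - v i ∈ maximalIdeal Λ ^ c) → t' - t ∈ maximalIdeal Λ ^ c →
      ∀ x, t' * x ∈ Ideal.span (Set.range v') → x ∈ Ideal.span (Set.range v')

lemma extend_sop (n : ℕ) (hn : (maximalIdeal Λ).height = n) (k : ℕ) : ∀ (s : List Λ), s.length + k = n →
    (∀ r ∈ s, r ∈ maximalIdeal Λ) →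
    (∀ Q : Ideal Λ, Q.IsPrime → (∀ r ∈ s, r ∈ Q) → (s.length : ℕ∞) ≤ Q.height) →
    ∃ s' : List Λ, s'.length = k ∧ (∀ r ∈ s', r ∈ maximalIdeal Λ) ∧
      ∀ Q : Ideal Λ, Q.IsPrime → (∀ r ∈ s ++ s', r ∈ Q) → Q = maximalIdeal Λ := by
  induction k with
  | zero =>
    intro s hl hs h
    refine ⟨[], rfl, by simp, fun Q hQ hsQ => ?_⟩
    have h1 := h Q hQ (by simpa using hsQ)
    by_contra hne
    have hlt : Q < maximalIdeal Λ := lt_of_le_of_ne (IsLocalRing.le_maximalIdeal hQ.ne_top) hne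
    have hfin : Q.FiniteHeight := inferInstance
    have h2 := Ideal.height_strict_mono_of_isPrime hlt
    rw [hn] at h2
    have := h1.trans_lt h2
    have : s.length < n := by exact_mod_cast this
    omega
  | succ k ih =>
    intro s hl hs h
    classical
    let J := Ideal.ofList s
    have hfin : J.minimalPrimes.Finite := Ideal.finite_minimalPrimes_of_isNoetherianRing Λ J
    have hsQ : ∀ Q : Ideal Λ, J ≤ Q ↔ ∀ r ∈ s, r ∈ Q := by
      intro Q; show Ideal.span {r | r ∈ s} ≤ Q ↔ _
      rw [Ideal.span_le]; rfl
    obtain ⟨x, hxm, hx⟩ : ∃ x ∈ maximalIdeal Λ, ∀ Q ∈ J.minimalPrimes, x ∉ Q := by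
      by_contra hc
      push Not at hc
      have hsub : ((maximalIdeal Λ : Ideal Λ) : Set Λ) ⊆ ⋃ Q ∈ (hfin.toFinset : Set (Ideal Λ)), (Q : Set Λ) := by
        intro x hx
        obtain ⟨Q, hQ, hxQ⟩ := hc x hx
        exact Set.mem_iUnion₂_of_mem (by simpa using hQ) hxQ
      rw [Ideal.subset_union_prime (R := Λ) (s := hfin.toFinset) (f := fun Q => Q) ⊥ ⊥ (by
        intro i hi _ _; exact (show i ∈ J.minimalPrimes by simpa using hi).1.1)] at hsub
      obtain ⟨Q, hQ, hle⟩ := hsub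
      have hQ' : Q ∈ J.minimalPrimes := by simpa using hQ
      have heq : Q = maximalIdeal Λ := le_antisymm (IsLocalRing.le_maximalIdeal hQ'.1.1.ne_top) hle
      have := Ideal.height_le_card_of_mem_minimalPrimes_span_finset (p := Q) (s := s.toFinset) (by
        convert hQ' using 2
        simp [J, Ideal.ofList])
      rw [heq, hn] at this
      have h2 := List.toFinset_card_le s
      have : n ≤ s.toFinset.card := by exact_mod_cast this
      omega
    obtain ⟨s', hl', hs', hQ'⟩ := ih (s ++ [x]) (by simp; omega) (by
        intro r hr
        rcases List.mem_append.mp hr with hr | hr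
        · exact hs r hr
        · simp at hr; exact hr ▸ hxm) (by
        intro Q hQ hr
        have hJQ : J ≤ Q := (hsQ Q).mpr fun r h => hr r (by simp [h])
        obtain ⟨P, hP, hPQ⟩ := Ideal.exists_minimalPrimes_le hJQ
        have hPp := hP.1.1
        have hlt : P < Q := lt_of_le_of_ne hPQ (by rintro rfl; exact hx _ hP (hr x (by simp)))
        have h1 := h P hP.1.1 ((hsQ P).mp hP.1.2)
        have hfin : P.FiniteHeight := inferInstance
        have h2 := Ideal.height_strict_mono_of_isPrime hlt
        have h3 := Order.add_one_le_of_lt (h1.trans_lt h2)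
        simpa using h3)
    refine ⟨x :: s', by simp [hl'], ?_, ?_⟩
    · intro r hr
      rcases List.mem_cons.mp hr with rfl | hr
      · exact hxm
      · exact hs' r hr
    · intro Q hQ hr
      exact hQ' Q hQ (by simpa using hr)

theorem cmp_of_dp (n : ℕ) (hn : (maximalIdeal Λ).height = n) (hd : Dp Λ n Λ) : CMp Λ := by
  classical
  intro ι _ v t hv ht h
  have := Fintype.ofFinite ι
  let e := Fintype.equivFin ι
  let k := Fintype.card ι
  let L : (ι → Λ) → Λ → List Λ := fun v t => (List.ofFn fun i => v (e.symm i)) ++ [t]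
  have hL : ∀ v t r, r ∈ L v t ↔ ((∃ i, v i = r) ∨ r = t) := by
    intro v t r
    simp only [L, List.mem_append, List.mem_ofFn', Set.mem_range, List.mem_singleton]
    constructor
    · rintro (⟨i, rfl⟩ | rfl)
      · exact Or.inl ⟨_, rfl⟩
      · exact Or.inr rfl
    · rintro (⟨i, rfl⟩ | rfl)
      · exact Or.inl ⟨e i, by simp⟩
      · exact Or.inr rfl
  have hLl : ∀ v t, (L v t).length = k + 1 := by intro v t; simp [L, k]
  have hcard : Nat.card ι = k := Nat.card_eq_fintype_card
  have hkn : k + 1 ≤ n := by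
    have := h (maximalIdeal Λ) inferInstance hv ht
    rw [hn, hcard] at this
    exact_mod_cast this
  obtain ⟨s', hl', hs', hQ'⟩ := extend_sop n hn (n - (k+1)) (L v t) (by rw [hLl]; omega) (by
      intro r hr
      rcases (hL _ _ _).mp hr with ⟨i, rfl⟩ | rfl
      · exact hv i
      · exact ht) (by
      intro Q hQ hr
      rw [hLl, ← hcard]
      exact h Q hQ (fun i => hr _ ((hL _ _ _).mpr (Or.inl ⟨i, rfl⟩))) (hr _ ((hL _ _ _).mpr (Or.inr rfl))))
  let J := Ideal.ofList (L v t ++ s')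
  have hJ : ∀ (l : List Λ) (Q : Ideal Λ), Ideal.ofList l ≤ Q ↔ ∀ r ∈ l, r ∈ Q := by
    intro l Q; show Ideal.span {r | r ∈ l} ≤ Q ↔ _
    rw [Ideal.span_le]; rfl
  have hrad : maximalIdeal Λ ≤ J.radical := by
    rw [Ideal.radical_eq_sInf]
    refine le_sInf fun Q hQ => ?_
    rw [hQ' Q hQ.2 ((hJ _ _).mp hQ.1)]
  obtain ⟨N, hN⟩ := Ideal.exists_pow_le_of_le_radical_of_fg hrad (IsNoetherian.noetherian _)
  refine ⟨N + 1, fun v' t' hv' ht' x hx => ?_⟩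
  have hsub : maximalIdeal Λ ^ (N+1) ≤ maximalIdeal Λ := Ideal.pow_le_self (by omega)
  have hmem : ∀ r ∈ L v' t' ++ s', r ∈ maximalIdeal Λ := by
    intro r hr
    rcases List.mem_append.mp hr with hr | hr
    · rcases (hL _ _ _).mp hr with ⟨i, rfl⟩ | rfl
      · simpa using add_mem (hsub (hv' i)) (hv i)
      · simpa using add_mem (hsub ht') ht
    · exact hs' r hr
  let J' := Ideal.ofList (L v' t' ++ s')
  have hJJ' : J ≤ J' := by
    have h1 : J ≤ J' ⊔ maximalIdeal Λ • J := by
      have h2 : maximalIdeal Λ ^ (N+1) ≤ maximalIdeal Λ • J := by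
        rw [pow_succ', smul_eq_mul]
        exact Ideal.mul_mono le_rfl hN
      refine (hJ _ _).mpr ?_
      have hm' : ∀ r ∈ L v' t' ++ s', r ∈ J' := fun r hr => Ideal.subset_span hr
      intro r hr
      rcases List.mem_append.mp hr with hr | hr
      · rcases (hL _ _ _).mp hr with ⟨i, rfl⟩ | rfl
        · have := sub_mem (Ideal.mem_sup_left (T := maximalIdeal Λ • J) (hm' (v' i) (by
            rw [List.mem_append]; exact Or.inl ((hL _ _ _).mpr (Or.inl ⟨i, rfl⟩)))))
            (Ideal.mem_sup_right (h2 (hv' i)))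
          simpa using this
        · have := sub_mem (Ideal.mem_sup_left (T := maximalIdeal Λ • J) (hm' t' (by
            rw [List.mem_append]; exact Or.inl ((hL _ _ _).mpr (Or.inr rfl)))))
            (Ideal.mem_sup_right (h2 ht'))
          simpa using this
      · exact Ideal.mem_sup_left (hm' r (by simp [hr]))
    exact Submodule.le_of_le_smul_of_le_jacobson_bot (IsNoetherian.noetherian J)
      (IsLocalRing.maximalIdeal_le_jacobson _) h1
  have hW := Dp.regular_of_primary (L v' t' ++ s') (M := Λ) (by
      rw [List.length_append, hLl, hl']
      rwa [show k + 1 + (n - (k+1)) = n by omega]) hmem (by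
      intro Q hQ _ hr
      have h1 : J' ≤ Q := (hJ _ _).mpr hr
      exact hQ' Q hQ ((hJ _ _).mp (hJJ'.trans h1)))
  rw [isWeaklyRegular_append_iff] at hW
  have h1 := hW.1
  simp only [L] at h1
  rw [isWeaklyRegular_append_iff, isWeaklyRegular_singleton_iff] at h1
  have h2 := h1.2
  rw [isSMulRegular_quotient_iff_mem_of_smul_mem] at h2
  have h3 : Ideal.ofList (List.ofFn fun i => v' (e.symm i)) • (⊤ : Submodule Λ Λ) = Ideal.span (Set.range v') := by
    rw [smul_eq_mul]
    show _ * (⊤ : Ideal Λ) = _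
    rw [Ideal.mul_top]
    show Ideal.span _ = _
    congr 1
    ext r
    simp only [List.mem_ofFn', Set.mem_range, Set.mem_ofPred_eq]
    constructor
    · rintro ⟨i, rfl⟩; exact ⟨_, rfl⟩
    · rintro ⟨i, rfl⟩; exact ⟨e i, by simp⟩
  rw [h3] at h2
  exact h2 x hx

end CM

end Part7

section Part8
open MvPolynomial IsLocalRing

/-- the abstract properties of `Λ_P / P^N` -/
structure Theta {Λ Θ : Type} [CommRing Λ] [CommRing Θ] [IsLocalRing Θ] (P : Ideal Λ) (N : ℕ) (φ : Λ →+* Θ) : Prop where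
  frac : ∀ θ, ∃ x, ∃ s ∉ P, φ s * θ = φ x
  mem : ∀ k ≤ N, ∀ x, φ x ∈ maximalIdeal Θ ^ k ↔ ∃ s ∉ P, s * x ∈ P ^ k
  nil : maximalIdeal Θ ^ N = ⊥

theorem exists_theta {Λ : Type} [CommRing Λ] [Algebra ℚ Λ] (P : Ideal Λ) [P.IsPrime] (N : ℕ) (hN : 1 ≤ N) :
    ∃ (Θ : Type) (_ : CommRing Θ) (_ : IsLocalRing Θ) (_ : Algebra ℚ Θ) (φ : Λ →+* Θ), Theta P N φ := by
  let L := Localization.AtPrime P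
  let I : Ideal L := maximalIdeal L ^ N
  have hI : I ≠ ⊤ := fun h => (Ideal.IsPrime.ne_top inferInstance : maximalIdeal L ≠ ⊤)
    (top_le_iff.mp (h ▸ Ideal.pow_le_self (by omega)))
  have : Nontrivial (L ⧸ I) := Ideal.Quotient.nontrivial_iff.mpr hI
  have hloc : IsLocalRing (L ⧸ I) := IsLocalRing.of_surjective' (Ideal.Quotient.mk I) Ideal.Quotient.mk_surjective
  have hlh : IsLocalHom (Ideal.Quotient.mk I) := IsLocalHom.of_surjective _ Ideal.Quotient.mk_surjective
  have hmap : maximalIdeal (L ⧸ I) = (maximalIdeal L).map (Ideal.Quotient.mk I) := by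
    apply le_antisymm
    · intro x hx
      obtain ⟨y, rfl⟩ := Ideal.Quotient.mk_surjective x
      exact Ideal.mem_map_of_mem _ ((map_mem_nonunits_iff (Ideal.Quotient.mk I) _).mp hx)
    · rw [Ideal.map_le_iff_le_comap]
      intro x hx
      exact (map_mem_nonunits_iff (Ideal.Quotient.mk I) _).mpr hx
  refine ⟨L ⧸ I, inferInstance, hloc, inferInstance, (Ideal.Quotient.mk I).comp (algebraMap Λ L), ?_, ?_, ?_⟩
  · intro θ
    obtain ⟨l, rfl⟩ := Ideal.Quotient.mk_surjective θ
    obtain ⟨x, s, rfl⟩ := IsLocalization.exists_mk'_eq P.primeCompl l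
    refine ⟨x, s, s.2, ?_⟩
    rw [RingHom.comp_apply, RingHom.comp_apply, ← map_mul, IsLocalization.mk'_spec'_mk]
  · intro k hk x
    rw [hmap, ← Ideal.map_pow, RingHom.comp_apply, ← Ideal.mem_comap,
      Ideal.comap_map_of_surjective' _ Ideal.Quotient.mk_surjective, Ideal.mk_ker,
      sup_eq_left.mpr (Ideal.pow_le_pow_right hk), ← IsLocalization.AtPrime.map_eq_maximalIdeal P, ← Ideal.map_pow,
      IsLocalization.algebraMap_mem_map_algebraMap_iff P.primeCompl]
    constructor
    · rintro ⟨s, hs, h⟩; exact ⟨s, hs, h⟩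
    · rintro ⟨s, hs, h⟩; exact ⟨s, hs, h⟩
  · rw [hmap, ← Ideal.map_pow]
    exact Ideal.map_quotient_self I

section
variable {Λ Θ : Type} [CommRing Λ] [CommRing Θ] [IsLocalRing Θ] {P : Ideal Λ} [hP : P.IsPrime] {N : ℕ} {φ : Λ →+* Θ}

theorem Theta.mem_one (h : Theta P N φ) (hN : 1 ≤ N) (x : Λ) : φ x ∈ maximalIdeal Θ ↔ x ∈ P := by
  have := h.mem 1 hN x
  rw [pow_one, pow_one] at this
  rw [this]
  exact ⟨fun ⟨s, hs, h⟩ => (hP.mem_or_mem h).resolve_left hs, fun h => ⟨1, fun h1 => hP.ne_top ((Ideal.eq_top_iff_one _).mpr h1), by simpa using h⟩⟩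

theorem Theta.unit (h : Theta P N φ) (hN : 1 ≤ N) {x : Λ} (hx : x ∉ P) : IsUnit (φ x) := by
  have := mt (h.mem_one hN x).mp hx
  simpa using this

theorem Theta.zero (h : Theta P N φ) (x : Λ) : φ x = 0 ↔ ∃ s ∉ P, s * x ∈ P ^ N := by
  rw [← h.mem N le_rfl x, h.nil, Ideal.mem_bot]

theorem Theta.fracs (h : Theta P N φ) {τ : Type} [Finite τ] (θ : τ → Θ) :
    ∃ x : τ → Λ, ∃ s ∉ P, ∀ t, φ s * θ t = φ (x t) := by
  classical
  have := Fintype.ofFinite τ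
  choose x s hs hx using fun t => h.frac (θ t)
  refine ⟨fun t => x t * ∏ t' ∈ Finset.univ.erase t, s t', ∏ t, s t, ?_, ?_⟩
  · intro hc
    obtain ⟨t, -, ht⟩ := (Ideal.IsPrime.prod_mem_iff).mp hc
    exact hs t ht
  · intro t
    rw [← Finset.mul_prod_erase Finset.univ s (Finset.mem_univ t), map_mul, map_mul, ← hx]
    ring

theorem Theta.gen (h : Theta P N φ) (hN : 1 ≤ N) {υ : Type} [Fintype υ] (u : υ → Λ) (huP : ∀ i, u i ∈ P)
    (hσ : ∃ σ ∉ P, ∀ x ∈ P, σ * x ∈ Ideal.span (Set.range u)) :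
    maximalIdeal Θ = Ideal.span (Set.range fun i => φ (u i)) := by
  obtain ⟨σ, hσP, hσ⟩ := hσ
  have hsp : Ideal.span (Set.range fun i => φ (u i)) = (Ideal.span (Set.range u)).map φ := by
    rw [Ideal.map_span, ← Set.range_comp]; rfl
  apply le_antisymm
  · intro θ hθ
    obtain ⟨x, s, hs, hx⟩ := h.frac θ
    have hxP : x ∈ P := by
      rw [← h.mem_one hN, ← hx]; exact Ideal.mul_mem_left _ _ hθ
    have h1 := Ideal.mem_map_of_mem φ (hσ x hxP)
    rw [map_mul, ← hx, ← mul_assoc] at h1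
    rw [hsp]
    exact (Ideal.unit_mul_mem_iff_mem _ ((h.unit hN hσP).mul (h.unit hN hs))).mp h1
  · rw [Ideal.span_le]
    rintro _ ⟨i, rfl⟩
    exact (h.mem_one hN _).mpr (huP i)

theorem Theta.MI (h : Theta P N φ) (hN : 1 ≤ N) [Algebra ℚ Λ] {υ : Type} [Fintype υ] (u : υ → Λ) (hu : GInd P u)
    (huP : ∀ i, u i ∈ P) (k : ℕ) (hk : k < N) (H : MvPolynomial υ Θ) (hH : H.IsHomogeneous k)
    (hmem : aeval (fun i => φ (u i)) H ∈ maximalIdeal Θ ^ (k + 1)) (d) : H.coeff d ∈ maximalIdeal Θ := by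
  classical
  obtain ⟨x, s, hs, hx⟩ := h.fracs (fun d : H.support => H.coeff d)
  let H0 : MvPolynomial υ Λ := ∑ d : H.support, monomial d.1 (x d)
  have hH0 : MvPolynomial.map φ H0 = C (φ s) * H := by
    conv_rhs => rw [H.as_sum, Finset.mul_sum, ← Finset.sum_coe_sort]
    simp only [H0, map_sum, map_monomial]
    refine Finset.sum_congr rfl fun d _ => ?_
    rw [C_mul_monomial, hx]
  have hhom : H0.IsHomogeneous k := by
    refine IsHomogeneous.sum _ _ _ fun d _ => isHomogeneous_monomial _ ?_
    have := hH (mem_support_iff.mp d.2)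
    rw [Finsupp.degree_eq_weight_one]; exact this
  have h1 : φ (aeval u H0) ∈ maximalIdeal Θ ^ (k+1) := by
    have : φ (aeval u H0) = φ s * aeval (fun i => φ (u i)) H := by
      have h2 : ∀ H0, aeval (fun i => φ (u i)) (MvPolynomial.map φ H0) = φ (aeval u H0) := by
        intro H0
        induction H0 using MvPolynomial.induction_on with
        | C a => simp
        | add p q hp hq => simp only [map_add, hp, hq]
        | mul_X p j hp => simp only [map_mul, hp, map_X, aeval_X]
      rw [← h2 H0, hH0, map_mul, aeval_C]; rfl
    rw [this]; exact Ideal.mul_mem_left _ _ hmem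
  obtain ⟨s', hs', h2⟩ := (h.mem (k+1) hk _).mp h1
  have h3 := MI_aux hu huP k (C s' * H0) (by simpa using (isHomogeneous_C υ s').mul hhom) (by
    rwa [map_mul, aeval_C]) d
  rw [coeff_C_mul] at h3
  have h4 : φ (H0.coeff d) = φ s * H.coeff d := by
    rw [← coeff_map, hH0, coeff_C_mul]
  have h5 := (h.mem_one hN _).mpr ((hP.mem_or_mem h3).resolve_left hs')
  rw [h4] at h5
  exact ((inferInstance : (maximalIdeal Θ).IsPrime).mem_or_mem h5).resolve_left (mt (h.mem_one hN s).mp hs)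

end

/-- homogenization -/
theorem exists_homogenization {S ι : Type} [CommRing S] (p : MvPolynomial ι S) :
    ∃ M₀ : ℕ, ∀ M ≥ M₀, ∃ q : MvPolynomial (Option ι) S, q.IsHomogeneous M ∧
      ∀ (A : Type) [CommRing A] [Algebra S A] (y : ι → A) (s : A),
        aeval (fun o : Option ι => o.elim s (fun i => s * y i)) q = s ^ M * aeval y p ∧
        ∀ i, s * dv (fun o : Option ι => o.elim s (fun i => s * y i)) (some i) q = s ^ M * dv y i p := by
  classical
  induction p using MvPolynomial.induction_on with
  | C a =>
    refine ⟨0, fun M _ => ⟨C a * X none ^ M, ?_, ?_⟩⟩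
    · simpa using (isHomogeneous_C (Option ι) a).mul (isHomogeneous_X_pow (R := S) (none : Option ι) M)
    · intro A _ _ y s
      refine ⟨by simp [mul_comm], fun i => ?_⟩
      simp [dv]
  | add p q hp hq =>
    obtain ⟨M, hM⟩ := hp
    obtain ⟨M', hM'⟩ := hq
    refine ⟨max M M', fun L hL => ?_⟩
    obtain ⟨a, ha, ha'⟩ := hM L (le_trans (le_max_left _ _) hL)
    obtain ⟨b, hb, hb'⟩ := hM' L (le_trans (le_max_right _ _) hL)
    refine ⟨a + b, ha.add hb, fun A _ _ y s => ⟨?_, fun i => ?_⟩⟩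
    · rw [map_add, map_add, (ha' A y s).1, (hb' A y s).1, mul_add]
    · rw [dv_add, dv_add, mul_add, (ha' A y s).2, (hb' A y s).2, mul_add]
  | mul_X p j hp =>
    obtain ⟨M, hM⟩ := hp
    refine ⟨M + 1, fun L hL => ?_⟩
    obtain ⟨a, ha, ha'⟩ := hM (L - 1) (by omega)
    obtain ⟨L, rfl⟩ : ∃ L', L = L' + 1 := ⟨L - 1, by omega⟩
    refine ⟨a * X (some j), ha.mul (isHomogeneous_X _ _), fun A _ _ y s => ⟨?_, fun i => ?_⟩⟩
    · rw [map_mul, map_mul, (ha' A y s).1, aeval_X, aeval_X]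
      simp; ring
    · rw [dv_mul, dv_mul, (ha' A y s).1, aeval_X, aeval_X]
      have h2 := (ha' A y s).2 i
      simp only [Nat.add_sub_cancel] at h2 ⊢
      by_cases hij : i = j
      · subst hij
        rw [dv_X_self, dv_X_self]
        generalize dv (fun o : Option ι => o.elim s (fun i => s * y i)) (some i) a = D at h2 ⊢
        simp only [Option.elim]
        linear_combination (s * y i) * h2
      · rw [dv_X_ne (h := fun h => hij (by simpa using h.symm)), dv_X_ne (h := fun h => hij h.symm)]
        generalize dv (fun o : Option ι => o.elim s (fun i => s * y i)) (some i) a = D at h2 ⊢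
        simp only [Option.elim]
        linear_combination (s * y j) * h2

theorem homog_scale {S ι A : Type} [CommRing S] [CommRing A] [Algebra S A] {M : ℕ} (q : MvPolynomial ι S)
    (hq : q.IsHomogeneous M) (b : ι → A) (t : A) : aeval (fun o => t * b o) q = t ^ M * aeval b q := by
  rw [aeval_def, eval₂_eq, aeval_def, eval₂_eq, Finset.mul_sum]
  refine Finset.sum_congr rfl fun d hd => ?_
  have := hq (mem_support_iff.mp hd)
  have h2 : ∑ i ∈ d.support, d i = M := by
    rw [← Finsupp.degree_apply, Finsupp.degree_eq_weight_one]; exact this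
  simp_rw [mul_pow, Finset.prod_mul_distrib, Finset.prod_pow_eq_pow_sum, h2]
  ring

end Part8

section Part9
open MvPolynomial IsLocalRing

theorem taylor_two {A Λ ι : Type} [CommRing A] [CommRing Λ] [Algebra A Λ] [Fintype ι] (z : ι → A) (F : MvPolynomial ι A) :
    ∃ E : ι → ι → MvPolynomial ι A, ∀ h : ι → Λ, aeval (fun a => algebraMap A Λ (z a) + h a) F =
      algebraMap A Λ (aeval z F) + ∑ a, algebraMap A Λ (dv z a F) * h a + ∑ a, ∑ b, h a * h b * aeval h (E a b) := by
  classical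
  induction F using MvPolynomial.induction_on with
  | C r => exact ⟨fun _ _ => 0, fun h => by simp⟩
  | add p q hp hq =>
    obtain ⟨E, hE⟩ := hp
    obtain ⟨E', hE'⟩ := hq
    refine ⟨fun a b => E a b + E' a b, fun h => ?_⟩
    simp only [map_add, hE, hE', dv_add, mul_add, add_mul, Finset.sum_add_distrib]
    ring
  | mul_X p j hp =>
    obtain ⟨E, hE⟩ := hp
    refine ⟨fun a b => E a b * (C (z j) + X j) + if b = j then C (dv z a p) else 0, fun h => ?_⟩
    have e1 : ∀ a, dv z a (p * X j) = dv z a p * z j + if a = j then aeval z p else 0 := by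
      intro a
      rw [dv_mul, aeval_X]
      by_cases haj : a = j
      · subst haj; rw [dv_X_self, if_pos rfl]; ring
      · rw [dv_X_ne (h := fun h => haj h.symm), if_neg haj]; ring
    have e2 : ∀ a b, h a * h b * aeval h (E a b * (C (z j) + X j) + if b = j then C (dv z a p) else 0)
        = (h a * h b * aeval h (E a b)) * (algebraMap A Λ (z j) + h j) + if b = j then h a * h b * algebraMap A Λ (dv z a p) else 0 := by
      intro a b
      split_ifs with hb <;> simp <;> ring
    simp only [e1, e2]
    simp only [map_mul, hE, aeval_X, map_add, Finset.sum_add_distrib, add_mul, ← Finset.sum_mul, Finset.sum_ite_eq', Finset.mem_univ, if_true, apply_ite (algebraMap A Λ), map_zero, ite_mul, zero_mul]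
    have e3 : ∑ a, algebraMap A Λ (dv z a p) * algebraMap A Λ (z j) * h a = (∑ a, algebraMap A Λ (dv z a p) * h a) * algebraMap A Λ (z j) := by
      rw [Finset.sum_mul]; exact Finset.sum_congr rfl fun _ _ => by ring
    have e4 : ∑ a, h a * h j * algebraMap A Λ (dv z a p) = (∑ a, algebraMap A Λ (dv z a p) * h a) * h j := by
      rw [Finset.sum_mul]; exact Finset.sum_congr rfl fun _ _ => by ring
    rw [e3, e4]
    ring

theorem indepMod_of_near_one {Λ κ : Type} [CommRing Λ] [Fintype κ] [DecidableEq κ] (Q : Ideal Λ) (J : κ → κ → Λ)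
    (h : ∀ k i, J k i - (if k = i then 1 else 0) ∈ Q) : IndepMod Q J := by
  intro l hl k
  have h1 : ∑ i, l i * (J i k - if i = k then 1 else 0) ∈ Q := Ideal.sum_mem _ fun i _ => Ideal.mul_mem_left _ _ (h i k)
  have h2 := Ideal.sub_mem _ (hl k) h1
  rw [← Finset.sum_sub_distrib] at h2
  simp only [mul_sub, sub_sub_cancel, mul_ite, mul_one, mul_zero, Finset.sum_ite_eq', Finset.mem_univ, if_true] at h2
  exact h2

section
variable {B Λ : Type} [CommRing B] [CommRing Λ] [IsLocalRing Λ] [Algebra B Λ] [IsAdicComplete (maximalIdeal Λ) Λ]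
variable {ι κ τ : Type} [Fintype ι] [Fintype κ] [Fintype τ]

open Classical in
theorem lemmaT (c : ℕ) (hc : 1 ≤ c) (F : κ → MvPolynomial ι (etAlg B Λ)) (Z : ι → etAlg B Λ)
    (V : τ → ι → κ → etAlg B Λ) (u : τ → etAlg B Λ) (β : κ → τ → etAlg B Λ) (ε : τ → τ → κ → κ → etAlg B Λ)
    (hβ : ∀ k j, (β k j : Λ) ∈ maximalIdeal Λ ^ c) (hε : ∀ i j k k', (ε i j k k' : Λ) ∈ maximalIdeal Λ)
    (hF : ∀ k, aeval Z (F k) = ∑ j, u j * u j * β k j)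
    (hJ : ∀ j k k', ∑ i, dv Z i (F k) * V j i k' = (if k = k' then u j else 0) + ∑ i, u i * ε i j k k') :
    ∃ f : ι → Λ, (∀ i, f i ∈ etAlg B Λ) ∧ (∀ i, f i - Z i ∈ maximalIdeal Λ ^ c) ∧ ∀ k, aeval f (F k) = 0 := by
  choose E hE using fun k => taylor_two (Λ := Λ) Z (F k)
  let A := etAlg B Λ
  let W := τ × τ × κ
  let H : ι → τ → MvPolynomial W A := fun a t => ∑ j, ∑ k, C (V j a k) * X (j, t, k)
  let h : ι → MvPolynomial W A := fun a => ∑ t, C (u t) * H a t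
  let ψ : W → MvPolynomial W A := fun x => X x + (if x.1 = x.2.1 then C (β x.2.2 x.1) else 0)
    + ∑ j', ∑ k', C (ε x.1 j' x.2.2 k') * X (j', x.2.1, k')
    + ∑ a, ∑ b, H a x.1 * H b x.2.1 * aeval h (E x.2.2 a b)
  have hHm : ∀ v : W → Λ, (∀ i, v i ∈ maximalIdeal Λ) → ∀ a t, aeval v (H a t) ∈ maximalIdeal Λ := by
    intro v hv a t
    simp only [H, map_sum, map_mul, aeval_X]
    exact Ideal.sum_mem _ fun j _ => Ideal.sum_mem _ fun k _ => Ideal.mul_mem_left _ _ (hv _)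
  have hJψ : ∀ v : W → Λ, (∀ i, v i ∈ maximalIdeal Λ) → IndepMod (maximalIdeal Λ) (fun x y => dv v y (ψ x)) := by
    intro v hv
    refine indepMod_of_near_one _ _ fun x y => ?_
    have e0 : dv v y (X x : MvPolynomial W A) = if x = y then 1 else 0 := by
      split_ifs with hxy
      · subst hxy; simp [dv]
      · rw [dv_X_ne _ _ hxy]
    have hs : ∀ (γ : Type) [Fintype γ] (g : γ → MvPolynomial W A), dv v y (∑ i, g i) = ∑ i, dv v y (g i) := by
      intro γ _ g
      simp [dv]
    simp only [ψ, dv_add, e0, hs, dv_mul, dv_C]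
    have e1 : dv v y (if x.1 = x.2.1 then C (β x.2.2 x.1) else 0 : MvPolynomial W A) = 0 := by
      split_ifs <;> simp [dv]
    rw [e1]
    have e2 : ∀ p q r : Λ, (if x = y then 1 else 0) + p + q + r - (if x = y then 1 else 0) = p + q + r := by
      intros; ring
    rw [e2]
    refine Ideal.add_mem _ (Ideal.add_mem _ (Ideal.zero_mem _) ?_) ?_
    · refine Ideal.sum_mem _ fun j _ => Ideal.sum_mem _ fun k _ => ?_
      rw [aeval_C]
      refine Ideal.add_mem _ ?_ ?_
      · simp
      · exact Ideal.mul_mem_right _ _ (hε _ _ _ _)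
    · refine Ideal.sum_mem _ fun a _ => Ideal.sum_mem _ fun b _ => ?_
      have m1 := hHm v hv a x.1
      have m2 := hHm v hv b x.2.1
      have : ∀ {p q : Λ}, p ∈ maximalIdeal Λ ∨ q ∈ maximalIdeal Λ → p * q ∈ maximalIdeal Λ := by
        rintro p q (h | h)
        · exact Ideal.mul_mem_right _ _ h
        · exact Ideal.mul_mem_left _ _ h
      simp only [map_mul]
      refine Ideal.add_mem _ ?_ ?_
      · exact this (.inl (Ideal.add_mem _ (this (.inr m2)) (this (.inl m1))))
      · exact this (.inl (this (.inl m1)))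
  obtain ⟨v, hv, hv0⟩ := hensel_exists ψ (fun _ => (0:Λ)) c hc (fun x => by
    have : ∀ a t, aeval (fun _ => (0:Λ)) (H a t) = 0 := by intro a t; simp [H]
    simp only [ψ, map_add, map_sum, map_mul, this, aeval_X, mul_zero, zero_mul, Finset.sum_const_zero, add_zero, zero_add]
    split_ifs
    · rw [aeval_C]; exact hβ _ _
    · simp) (hJψ _ (fun _ => Ideal.zero_mem _))
  have hvm : ∀ i, v i ∈ maximalIdeal Λ := fun i => by
    have := Ideal.pow_le_self (by omega) (hv i); simpa using this
  have hvA := hensel_mem_etAlg ψ v hv0 (hJψ v hvm)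
  have hvc : ∀ i, v i ∈ maximalIdeal Λ ^ c := fun i => by simpa using hv i
  let hh : ι → Λ := fun a => aeval v (h a)
  have hhv : ∀ a, hh a = ∑ t, (u t : Λ) * aeval v (H a t) := by
    intro a; simp only [hh, h, map_sum, map_mul, aeval_C]; rfl
  have hHv : ∀ a t, aeval v (H a t) = ∑ j, ∑ k, (V j a k : Λ) * v (j, t, k) := by
    intro a t; simp only [H, map_sum, map_mul, aeval_C, aeval_X]; rfl
  refine ⟨fun a => Z a + hh a, fun a => ?_, fun a => ?_, fun k => ?_⟩
  · refine add_mem (Z a).2 ?_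
    rw [hhv]
    refine sum_mem fun t _ => mul_mem (u t).2 ?_
    rw [hHv]
    exact sum_mem fun j _ => sum_mem fun k _ => mul_mem (V j a k).2 (hvA _)
  · rw [add_sub_cancel_left, hhv]
    refine Ideal.sum_mem _ fun t _ => Ideal.mul_mem_left _ _ ?_
    rw [hHv]
    exact Ideal.sum_mem _ fun j _ => Ideal.sum_mem _ fun k _ => Ideal.mul_mem_left _ _ (hvc _)
  · have key : ∀ j t, v (j, t, k) + (if j = t then (β k j : Λ) else 0) + ∑ j', ∑ k', (ε j j' k k' : Λ) * v (j', t, k')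
        + ∑ a, ∑ b, aeval v (H a j) * aeval v (H b t) * aeval hh (E k a b) = 0 := by
      intro j t
      have := hv0 (j, t, k)
      simp only [ψ, map_add, map_sum, map_mul, aeval_X, aeval_C, aeval_aeval'] at this
      refine Eq.trans ?_ this
      congr 3
      split_ifs
      · rw [aeval_C]; rfl
      · exact (map_zero _).symm
    have e1 := hE k hh
    refine Eq.trans e1 ?_
    have f1 : algebraMap A Λ (aeval Z (F k)) = ∑ j, ∑ t, (u j : Λ) * u t * (if j = t then (β k j : Λ) else 0) := by
      rw [hF k, map_sum]
      refine Finset.sum_congr rfl fun j _ => ?_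
      simp only [mul_ite, mul_zero, Finset.sum_ite_eq, Finset.mem_univ, if_true]
      rfl
    have f2 : ∑ a, algebraMap A Λ (dv Z a (F k)) * hh a = ∑ j, ∑ t, (u j : Λ) * u t * v (j,t,k)
        + ∑ j, ∑ t, (u j : Λ) * u t * ∑ j', ∑ k', (ε j j' k k' : Λ) * v (j', t, k') := by
      have g1 : ∀ j k', ∑ a, ((dv Z a (F k) : etAlg B Λ) : Λ) * (V j a k' : Λ) = (if k = k' then (u j : Λ) else 0) + ∑ i, (u i : Λ) * ε i j k k' := by
        intro j k'
        have := congrArg (algebraMap A Λ) (hJ j k k')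
        simp only [map_sum, map_add, map_mul, apply_ite (algebraMap A Λ), map_zero] at this
        exact this
      have g2 : ∑ a, algebraMap A Λ (dv Z a (F k)) * hh a = ∑ t, ∑ j, ∑ k', (u t : Λ) * v (j,t,k') * ∑ a, ((dv Z a (F k) : etAlg B Λ) : Λ) * (V j a k' : Λ) := by
        simp only [hhv, hHv, Finset.mul_sum]
        rw [Finset.sum_comm]
        refine Finset.sum_congr rfl fun t _ => ?_
        rw [Finset.sum_comm]
        refine Finset.sum_congr rfl fun j _ => ?_
        rw [Finset.sum_comm]
        refine Finset.sum_congr rfl fun k' _ => Finset.sum_congr rfl fun a _ => ?_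
        change ((dv Z a (F k) : etAlg B Λ) : Λ) * _ = _
        ring
      rw [g2]
      simp only [g1, mul_add, Finset.sum_add_distrib]
      congr 1
      · rw [Finset.sum_comm]
        refine Finset.sum_congr rfl fun j _ => Finset.sum_congr rfl fun t _ => ?_
        simp only [mul_ite, mul_zero, Finset.sum_ite_eq, Finset.mem_univ, if_true]
        ring
      · simp only [Finset.mul_sum]
        rw [Finset.sum_comm' (t' := Finset.univ) (s' := fun _ => Finset.univ) (by simp)]
        have : ∀ (G : τ → τ → κ → τ → Λ), ∑ j, ∑ t, ∑ k', ∑ i, G j t k' i = ∑ i, ∑ t, ∑ j, ∑ k', G j t k' i := by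
          intro G
          simp only [← Fintype.sum_prod_type']
          refine Fintype.sum_equiv ⟨fun x => (x.2.2.2, x.2.1, x.1, x.2.2.1), fun x => (x.2.2.1, x.2.1, x.2.2.2, x.1), fun _ => rfl, fun _ => rfl⟩ _ _ fun _ => rfl
        rw [this]
        refine Finset.sum_congr rfl fun i _ => Finset.sum_congr rfl fun t _ => Finset.sum_congr rfl fun j _ => Finset.sum_congr rfl fun k' _ => ?_
        ring
    have f3 : ∑ a, ∑ b, hh a * hh b * aeval hh (E k a b) = ∑ j, ∑ t, (u j : Λ) * u t * ∑ a, ∑ b, aeval v (H a j) * aeval v (H b t) * aeval hh (E k a b) := by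
      have : ∀ a b, hh a * hh b = ∑ j, ∑ t, (u j : Λ) * u t * (aeval v (H a j) * aeval v (H b t)) := by
        intro a b
        rw [hhv, hhv, Finset.sum_mul_sum]
        refine Finset.sum_congr rfl fun j _ => Finset.sum_congr rfl fun t _ => ?_
        ring
      simp only [this, Finset.sum_mul, Finset.mul_sum]
      have : ∀ (G : ι → ι → τ → τ → Λ), ∑ j, ∑ t, ∑ k', ∑ i, G j t k' i = ∑ k', ∑ i, ∑ j, ∑ t, G j t k' i := by
        intro G
        simp only [← Fintype.sum_prod_type']
        refine Fintype.sum_equiv ⟨fun x => (x.2.2.1, x.2.2.2, x.1, x.2.1), fun x => (x.2.2.1, x.2.2.2, x.1, x.2.1), fun _ => rfl, fun _ => rfl⟩ _ _ fun _ => rfl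
      rw [this]
      refine Finset.sum_congr rfl fun i _ => Finset.sum_congr rfl fun t _ => Finset.sum_congr rfl fun j _ => Finset.sum_congr rfl fun k' _ => ?_
      ring
    rw [f1, f2, f3]
    simp only [← Finset.sum_add_distrib]
    refine Finset.sum_eq_zero fun j _ => Finset.sum_eq_zero fun t _ => ?_
    linear_combination ((u j : Λ) * u t) * key j t
end

end Part9

section Part10
open MvPolynomial IsLocalRing

section
variable {S : Type} [CommRing S]

theorem avoid (𝔞 U : Ideal S) (hU : ¬ 𝔞 ≤ U) (T : Set (Ideal S)) (hT : T.Finite) (hp : ∀ Q ∈ T, Q.IsPrime)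
    (hn : ∀ Q ∈ T, ¬ 𝔞 ≤ Q) : ∃ b ∈ 𝔞, b ∉ U ∧ ∀ Q ∈ T, b ∉ Q := by
  classical
  by_contra hc
  push Not at hc
  have hsub : (𝔞 : Set S) ⊆ ((fun Q : Ideal S => Q) U : Ideal S) ∪ ((fun Q : Ideal S => Q) U : Ideal S) ∪ ⋃ i ∈ (↑hT.toFinset : Set (Ideal S)), ((fun Q : Ideal S => Q) i : Ideal S) := by
    intro x hx
    by_cases hxU : x ∈ U
    · exact Or.inl (Or.inl hxU)
    · obtain ⟨Q, hQ, hxQ⟩ := hc x hx hxU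
      exact Or.inr (Set.mem_iUnion₂_of_mem (by simpa using hQ) hxQ)
  have hsub' := (Ideal.subset_union_prime' (s := hT.toFinset) (f := fun Q : Ideal S => Q) (a := U) (b := U) (I := 𝔞)
    (by intro i hi; exact hp i (by simpa using hi))).mp hsub
  rcases hsub' with h | h | ⟨Q, hQ, h⟩
  · exact hU h
  · exact hU h
  · exact hn Q (by simpa using hQ) h

theorem span_range_le {υ : Type} {u : υ → S} {Q : Ideal S} : Ideal.span (Set.range u) ≤ Q ↔ ∀ i, u i ∈ Q := by
  rw [Ideal.span_le, Set.range_subset_iff]; rfl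

variable [IsNoetherianRing S]

theorem minht {υ : Type} [Fintype υ] (u : υ → S) (Q : Ideal S) (hQ : Q ∈ (Ideal.span (Set.range u)).minimalPrimes) :
    Q.height ≤ Fintype.card υ := by
  refine (Ideal.height_le_card_of_mem_minimalPrimes_span (Set.finite_range u) hQ).trans ?_
  have := Set.ncard_image_le (f := u) (s := Set.univ) Set.finite_univ
  rw [Set.image_univ, Set.ncard_univ, Nat.card_eq_fintype_card] at this
  exact_mod_cast this

theorem ht_succ {υ : Type} (u : υ → S) (b : S) (k : ℕ) (h : ∀ Q : Ideal S, Q.IsPrime → (∀ i, u i ∈ Q) → (k : ℕ∞) ≤ Q.height)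
    (hb : ∀ Q ∈ (Ideal.span (Set.range u)).minimalPrimes, b ∉ Q) (Q : Ideal S) (hQ : Q.IsPrime) (hu : ∀ i, u i ∈ Q) (hbQ : b ∈ Q) :
    ((k + 1 : ℕ) : ℕ∞) ≤ Q.height := by
  obtain ⟨P, hP, hPQ⟩ := Ideal.exists_minimalPrimes_le (span_range_le.mpr hu)
  have hPp := hP.1.1
  have hlt : P < Q := lt_of_le_of_ne hPQ (by rintro rfl; exact hb _ hP hbQ)
  have h1 := h P hP.1.1 (span_range_le.mp hP.1.2)
  have hfin : P.FiniteHeight := inferInstance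
  have h3 := Order.add_one_le_of_lt (h1.trans_lt (Ideal.height_strict_mono_of_isPrime hlt))
  simpa using h3

theorem genseq_one (hS : JC S) (p 𝔞 : Ideal S) [hp : p.IsPrime] (h𝔞 : 𝔞 ≤ p) (c0 : S) (hc0 : c0 ∉ p)
    (hc : ∀ x ∈ p, c0 * x ∈ 𝔞) (a : ℕ) (ha : p.height = a) (h𝔞h : ∀ Q : Ideal S, Q.IsPrime → 𝔞 ≤ Q → (a : ℕ∞) ≤ Q.height)
    {υ : Type} [Fintype υ] (u : υ → S) (hG : GInd p u)
    (hlt : Fintype.card υ < a) :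
    ∃ b ∈ 𝔞, (∀ (l : υ → S) (l0 : S), (∀ D : Der S, ∑ i, l i * D (u i) + l0 * D b ∈ p) → (∀ i, l i ∈ p) ∧ l0 ∈ p) ∧
      ∀ Q ∈ (Ideal.span (Set.range u)).minimalPrimes, b ∉ Q := by
  classical
  obtain ⟨δ, hδ, D, hD⟩ := hG.dual
  let E : Der S → S → S := fun D' x => δ * D' x - ∑ i, D' (u i) * D i x
  have hEadd : ∀ D' x y, E D' (x + y) = E D' x + E D' y := by
    intro D' x y
    simp only [E, map_add, mul_add, Finset.sum_add_distrib]; ring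
  have hEmul : ∀ D' x y, E D' (x * y) = x * E D' y + y * E D' x := by
    intro D' x y
    simp only [E, Derivation.leibniz, smul_eq_mul, mul_add, Finset.sum_add_distrib, mul_sub, Finset.mul_sum]
    have : ∀ z w : S, ∑ i, D' (u i) * (z * D i w) = ∑ i, z * (D' (u i) * D i w) := fun z w => Finset.sum_congr rfl fun _ _ => by ring
    rw [this, this]; ring
  let U : Ideal S := 
    { carrier := {b | b ∈ p ∧ ∀ D', E D' b ∈ p}
      add_mem' := fun {x y} hx hy => ⟨p.add_mem hx.1 hy.1, fun D' => by rw [hEadd]; exact p.add_mem (hx.2 D') (hy.2 D')⟩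
      zero_mem' := ⟨p.zero_mem, fun D' => by simp [E]⟩
      smul_mem' := fun c x hx => ⟨p.mul_mem_left _ hx.1, fun D' => by
        rw [smul_eq_mul, hEmul]; exact p.add_mem (p.mul_mem_left _ (hx.2 D')) (p.mul_mem_right _ hx.1)⟩ }
  have hU : ¬ 𝔞 ≤ U := by
    intro hle
    obtain ⟨h, q, hh, hq, hqG, -⟩ := hS p hp
    have h1 : ∀ D' j, E D' (q j) ∈ p := by
      intro D' j
      have := (hle (hc _ (hq j))).2 D'
      rw [hEmul] at this
      have h2 := p.sub_mem this (p.mul_mem_right (E D' c0) (hq j))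
      rw [add_sub_cancel_right] at h2
      exact (hp.mem_or_mem h2).resolve_left hc0
    have h2 : IndepMod p (fun (j : Fin h) (i : υ) => D i (q j)) := by
      intro l hl
      refine hqG l fun D' => ?_
      refine (hp.mem_or_mem (x := δ) ?_).resolve_left hδ
      have e : δ * ∑ k, l k * D' (q k) = ∑ k, l k * E D' (q k) + ∑ i, D' (u i) * ∑ k, l k * D i (q k) := by
        simp only [E, mul_sub, Finset.sum_sub_distrib, Finset.mul_sum]
        rw [Finset.sum_comm (s := Finset.univ (α := υ))]
        rw [← Finset.sum_sub_distrib, ← Finset.sum_add_distrib]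
        refine Finset.sum_congr rfl fun k _ => ?_
        have : ∑ i, l k * (D' (u i) * D i (q k)) = ∑ i, D' (u i) * (l k * D i (q k)) := Finset.sum_congr rfl fun _ _ => by ring
        rw [this]; ring
      rw [e]
      exact p.add_mem (p.sum_mem fun k _ => p.mul_mem_left _ (h1 _ _)) (p.sum_mem fun i _ => p.mul_mem_left _ (hl i))
    have h3 := indepMod_card_le p _ h2
    rw [hh] at ha
    have : h = a := by exact_mod_cast ha
    simp at h3
    omega
  have hfin : (Ideal.span (Set.range u)).minimalPrimes.Finite := Ideal.finite_minimalPrimes_of_isNoetherianRing S _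
  obtain ⟨b, hb, hbU, hbQ⟩ := avoid 𝔞 U hU _ hfin (fun Q hQ => hQ.1.1) (fun Q hQ hle => by
    have h1 := h𝔞h Q hQ.1.1 hle
    have h2 := minht u Q hQ
    have : a ≤ Fintype.card υ := by exact_mod_cast h1.trans h2
    omega)
  refine ⟨b, hb, fun l l0 hl => ?_, hbQ⟩
  obtain ⟨D', hD'⟩ : ∃ D', E D' b ∉ p := by
    by_contra hcon
    push Not at hcon
    exact hbU ⟨h𝔞 hb, hcon⟩
  have hl0 : l0 ∈ p := by
    have h1 := hl (δ • D' - ∑ i, D' (u i) • D i)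
    have e1 : ∀ x, (δ • D' - ∑ i, D' (u i) • D i : Der S) x = E D' x := by
      intro x
      have : (∑ i, D' (u i) • D i : Der S) x = ∑ i, D' (u i) * D i x := by
        have : ∀ (s : Finset υ), (∑ i ∈ s, D' (u i) • D i : Der S) x = ∑ i ∈ s, D' (u i) * D i x := by
          intro s
          induction s using Finset.induction_on with
          | empty => simp
          | insert i s hi ih => rw [Finset.sum_insert hi, Finset.sum_insert hi, Derivation.add_apply, ih]; rfl
        exact this _
      rw [Derivation.sub_apply, this]; rfl
    have e2 : ∀ i, E D' (u i) = 0 := by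
      intro i
      simp [E, hD, mul_comm]
    simp only [e1, e2, mul_zero, Finset.sum_const_zero, zero_add] at h1
    exact (hp.mem_or_mem h1).resolve_right hD'
  refine ⟨hG l fun D => ?_, hl0⟩
  have := p.sub_mem (hl D) (p.mul_mem_right (D b) hl0)
  rwa [add_sub_cancel_right] at this

theorem genseq (hS : JC S) (p 𝔞 : Ideal S) [hp : p.IsPrime] (h𝔞 : 𝔞 ≤ p) (c0 : S) (hc0 : c0 ∉ p)
    (hc : ∀ x ∈ p, c0 * x ∈ 𝔞) (a : ℕ) (ha : p.height = a) (h𝔞h : ∀ Q : Ideal S, Q.IsPrime → 𝔞 ≤ Q → (a : ℕ∞) ≤ Q.height)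
    {υ : Type} [Fintype υ] (u : υ → S) (hG : GInd p u)
    (huh : ∀ Q : Ideal S, Q.IsPrime → (∀ i, u i ∈ Q) → (Fintype.card υ : ℕ∞) ≤ Q.height) (k : ℕ)
    (hlt : Fintype.card υ + k ≤ a) :
    ∃ z : Fin k → S, (∀ i, z i ∈ 𝔞) ∧ GInd p (Sum.elim u z) ∧
      ∀ Q : Ideal S, Q.IsPrime → (∀ i, u i ∈ Q) → (∀ i, z i ∈ Q) → ((Fintype.card υ + k : ℕ) : ℕ∞) ≤ Q.height := by
  induction k with
  | zero =>
    refine ⟨fun i => i.elim0, fun i => i.elim0, ?_, fun Q hQ h _ => huh Q hQ h⟩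
    intro l hl
    have := hG (fun i => l (.inl i)) (fun D => by simpa using hl D)
    rintro (i | i)
    · exact this i
    · exact i.elim0
  | succ k ih =>
    obtain ⟨z, hz, hzG, hzh⟩ := ih (by omega)
    obtain ⟨b, hb, hbG, hbQ⟩ := genseq_one hS p 𝔞 h𝔞 c0 hc0 hc a ha h𝔞h (Sum.elim u z) hzG (by simp; omega)
    refine ⟨Fin.snoc z b, ?_, ?_, ?_⟩
    · intro i
      refine Fin.lastCases ?_ (fun i => ?_) i
      · simpa using hb
      · simpa using hz i
    · intro l hl
      obtain ⟨h1, h2⟩ := hbG (Sum.elim (fun i => l (.inl i)) (fun i => l (.inr i.castSucc))) (l (.inr (Fin.last k))) (fun D => by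
        have := hl D
        simp only [Fintype.sum_sum_type, Fin.sum_univ_castSucc, Sum.elim_inl, Sum.elim_inr, Fin.snoc_castSucc, Fin.snoc_last] at this ⊢
        rwa [← add_assoc] at this)
      rintro (i | i)
      · exact h1 (.inl i)
      · refine Fin.lastCases h2 (fun i => h1 (.inr i)) i
    · intro Q hQ hu hzQ
      refine ht_succ (Sum.elim u z) b (Fintype.card υ + k) (fun Q hQ h => hzh Q hQ (fun i => h (.inl i)) (fun i => h (.inr i))) hbQ Q hQ ?_ ?_
      · rintro (i | i)
        · exact hu i
        · simpa using hzQ i.castSucc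
      · simpa using hzQ (Fin.last k)
end

end Part10

section Part11
open MvPolynomial IsLocalRing

/-- the elimination lemma -/
theorem finLemma {S A : Type} [CommRing S] [CommRing A] [Algebra S A] {ι κ ιw κw : Type}
    (F : κ → MvPolynomial ι S) (ψ : ι → MvPolynomial ιw S) (G : κw → MvPolynomial ιw S) (σ : MvPolynomial ιw S)
    (U : Ideal S) (N : ℕ) (hrel : ∀ k, σ * aeval ψ (F k) ∈ (U.map (C : S →+* MvPolynomial ιw S)) ^ N ⊔ Ideal.span (Set.range G))
    (M : ℕ) (ψh : ι → MvPolynomial (Option ιw) S) (Gh : κw → MvPolynomial (Option ιw) S) (σh : MvPolynomial (Option ιw) S)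
    (hψh : ∀ i, ∀ (A : Type) [CommRing A] [Algebra S A] (y : ιw → A) (s : A),
        aeval (fun o : Option ιw => o.elim s (fun i => s * y i)) (ψh i) = s ^ M * aeval y (ψ i))
    (hGh : ∀ i, ∀ (A : Type) [CommRing A] [Algebra S A] (y : ιw → A) (s : A),
        aeval (fun o : Option ιw => o.elim s (fun i => s * y i)) (Gh i) = s ^ M * aeval y (G i))
    (hσh : ∀ (A : Type) [CommRing A] [Algebra S A] (y : ιw → A) (s : A),
        aeval (fun o : Option ιw => o.elim s (fun i => s * y i)) σh = s ^ M * aeval y σ)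
    (V : Ideal A) (a0 : A) (hV : ∀ x ∈ U ^ N, a0 * algebraMap S A x ∈ V)
    (b : ιw → A) (s1 s2 : A) (Z : ι → A) (q1 : κ → A) (q2 : ι → A) (q3 : κw → A)
    (d1 : ∀ k, s1 * q1 k + s2 * aeval Z (F k) ∈ V)
    (d2 : ∀ i, s1 * (s1 ^ M * Z i - aeval (fun o : Option ιw => o.elim s1 b) (ψh i)) + s2 * q2 i ∈ V)
    (d3 : ∀ k, s1 * aeval (fun o : Option ιw => o.elim s1 b) (Gh k) + s2 * q3 k ∈ V)
    (d4 : s1 * s2 ∈ V) (k : κ) :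
    ∃ L : ℕ, (s1 * (a0 * aeval (fun o : Option ιw => o.elim s1 b) σh) + s2) ^ L * aeval Z (F k) ∈ V := by
  classical
  let A1 := A ⧸ V
  let L := Localization.Away (Ideal.Quotient.mk V s1)
  let θ : A →ₐ[S] L := (IsScalarTower.toAlgHom S A1 L).comp (Ideal.Quotient.mkₐ S V)
  have hθV : ∀ x ∈ V, θ x = 0 := by
    intro x hx
    show algebraMap A1 L (Ideal.Quotient.mk V x) = 0
    rw [Ideal.Quotient.eq_zero_iff_mem.mpr hx, map_zero]
  have hu : IsUnit (θ s1) := IsLocalization.Away.algebraMap_isUnit (Ideal.Quotient.mk V s1)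
  obtain ⟨v, hv⟩ := hu
  let y : ιw → L := fun i => ↑v⁻¹ * θ (b i)
  have hy : ∀ i, θ s1 * y i = θ (b i) := by intro i; simp [y, ← hv]
  have hfun : (fun o : Option ιw => θ (o.elim s1 b)) = fun o => o.elim (θ s1) (fun i => θ s1 * y i) := by
    funext o; cases o with
    | none => rfl
    | some i => exact (hy i).symm
  have hθae : ∀ {τ : Type} (q : MvPolynomial τ S) (g : τ → A), θ (aeval g q) = aeval (fun o => θ (g o)) q := by
    intro τ q g
    have := DFunLike.congr_fun (aeval_unique (θ.comp (aeval g))) q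
    simpa [Function.comp_def] using this
  have hs2 : θ s2 = 0 := by
    have := hθV _ d4
    rw [map_mul, ← hv] at this
    simpa using this
  have hG0 : ∀ k, aeval y (G k) = 0 := by
    intro k
    have := hθV _ (d3 k)
    rw [map_add, map_mul, map_mul, hs2, hθae, hfun, hGh, ← hv] at this
    simpa [-map_pow, ← Units.val_pow_eq_pow_val] using this
  have hZ : (fun i => θ (Z i)) = fun i => aeval y (ψ i) := by
    funext i
    have := hθV _ (d2 i)
    rw [map_add, map_mul, map_mul, map_sub, map_mul, map_pow, hs2, hθae, hfun, hψh, ← hv, ← mul_sub] at this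
    simp only [zero_mul, add_zero, ← Units.val_pow_eq_pow_val, Units.mul_right_eq_zero] at this
    exact sub_eq_zero.mp this
  have hF : θ (a0 * aeval (fun o : Option ιw => o.elim s1 b) σh * aeval Z (F k)) = 0 := by
    have h1 : ∀ x ∈ (U.map (C : S →+* MvPolynomial ιw S)) ^ N ⊔ Ideal.span (Set.range G), θ a0 * aeval y x = 0 := by
      intro x hx
      have : (U.map (C : S →+* MvPolynomial ιw S)) ^ N ⊔ Ideal.span (Set.range G) ≤
          RingHom.ker ((Ideal.Quotient.mk (Module.annihilator L (Ideal.span {θ a0}))).comp (aeval y : MvPolynomial ιw S →ₐ[S] L).toRingHom) := by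
        refine sup_le ?_ ?_
        · rw [← Ideal.map_pow, Ideal.map_le_iff_le_comap]
          intro x hx
          rw [Ideal.mem_comap, RingHom.mem_ker]
          show Ideal.Quotient.mk _ (aeval y (C x)) = 0
          rw [Ideal.Quotient.eq_zero_iff_mem, aeval_C, Submodule.mem_annihilator_span_singleton]
          have := hθV _ (hV x hx)
          rw [map_mul, AlgHom.commutes] at this
          rw [smul_eq_mul, mul_comm]; exact this
        · rw [span_range_le]
          intro k
          rw [RingHom.mem_ker]
          show Ideal.Quotient.mk _ (aeval y (G k)) = 0
          rw [hG0, map_zero]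
      have h2 := this hx
      rw [RingHom.mem_ker] at h2
      have h3 : Ideal.Quotient.mk (Module.annihilator L (Ideal.span {θ a0})) (aeval y x) = 0 := h2
      rw [Ideal.Quotient.eq_zero_iff_mem, Submodule.mem_annihilator_span_singleton, smul_eq_mul, mul_comm] at h3
      exact h3
    have h2 := h1 _ (hrel k)
    rw [map_mul, aeval_aeval', ← hZ, ← hθae] at h2
    rw [map_mul, map_mul, hθae σh, hfun, hσh]
    linear_combination (θ s1 ^ M) * h2
  obtain ⟨⟨w, n, rfl⟩, hn⟩ := (IsLocalization.map_eq_zero_iff (Submonoid.powers (Ideal.Quotient.mk V s1)) L _).mp hF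
  have hn' : s1 ^ n * (a0 * aeval (fun o : Option ιw => o.elim s1 b) σh * aeval Z (F k)) ∈ V := by
    rw [← Ideal.Quotient.eq_zero_iff_mem, map_mul, map_pow]; exact hn
  set α := a0 * aeval (fun o : Option ιw => o.elim s1 b) σh with hα
  set x := aeval Z (F k)
  have h2 : s2 ^ 2 * x ∈ V := by
    have e : s2 ^ 2 * x = s2 * (s1 * q1 k + s2 * x) - q1 k * (s1 * s2) := by ring
    rw [e]; exact V.sub_mem (V.mul_mem_left _ (d1 k)) (V.mul_mem_left _ d4)
  have h3 : ∀ m, (s1 * α + s2) ^ (m + 1) - (s1 * α) ^ (m + 1) - s2 ^ (m + 1) ∈ V := by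
    intro m
    induction m with
    | zero => simp
    | succ m ih =>
      have e : (s1 * α + s2) ^ (m + 1 + 1) - (s1 * α) ^ (m + 1 + 1) - s2 ^ (m + 1 + 1) =
        (s1 * α + s2) * ((s1 * α + s2) ^ (m + 1) - (s1 * α) ^ (m + 1) - s2 ^ (m + 1)) +
        (α * (s1 * α) ^ m * α + α * s2 ^ m) * (s1 * s2) + ((s1 * α) ^ (m+1) - (s1 * α ^ 2) * (s1 * α) ^ m) * s2 := by ring
      have e2 : ((s1 * α) ^ (m+1) - (s1 * α ^ 2) * (s1 * α) ^ m) * s2 = (α * (s1 * α) ^ m - α ^ 2 * (s1 * α) ^ m) * (s1 * s2) := by ring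
      rw [e, e2]
      exact V.add_mem (V.add_mem (V.mul_mem_left _ ih) (V.mul_mem_left _ d4)) (V.mul_mem_left _ d4)
  refine ⟨n + 1 + 1, ?_⟩
  have e : (s1 * α + s2) ^ (n + 1 + 1) * x = ((s1 * α + s2) ^ (n + 1 + 1) - (s1 * α) ^ (n + 1 + 1) - s2 ^ (n + 1 + 1)) * x +
    (s1 ^ 2 * α ^ (n + 1)) * (s1 ^ n * (α * x)) + s2 ^ n * (s2 ^ 2 * x) := by ring
  rw [e]
  exact V.add_mem (V.add_mem (V.mul_mem_right _ (h3 _)) (V.mul_mem_left _ hn')) (V.mul_mem_left _ h2)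

end Part11

section Part12
open MvPolynomial IsLocalRing

theorem pow_sub_mem {A : Type} [CommRing A] (J : Ideal A) {a b : A} (h : a - b ∈ J) (M : ℕ) : a ^ M - b ^ M ∈ J := by
  obtain ⟨c, hc⟩ := sub_dvd_pow_sub_pow a b M
  rw [hc]; exact J.mul_mem_right _ h

theorem nzLemma {Λ : Type} [CommRing Λ] [IsLocalRing Λ] [IsNoetherianRing Λ] (hCM : CMp Λ) {υ ζ : Type} [Fintype υ] [Fintype ζ]
    (π : υ → Λ) (z : ζ → Λ) (a0 τ : Λ) (M : ℕ) (hM : 1 ≤ M) (hπm : ∀ i, π i ∈ maximalIdeal Λ) (hzm : ∀ i, z i ∈ maximalIdeal Λ)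
    (h1 : ∀ Q : Ideal Λ, Q.IsPrime → (∀ i, π i ∈ Q) → a0 ∈ Q → ((Fintype.card υ + 1 : ℕ) : ℕ∞) ≤ Q.height)
    (h2 : ∀ Q : Ideal Λ, Q.IsPrime → (∀ i, π i ∈ Q) → a0 ∈ Q → τ ∈ Q → ((Fintype.card υ + 1 + 1 : ℕ) : ℕ∞) ≤ Q.height)
    (h3 : ∀ Q : Ideal Λ, Q.IsPrime → (∀ i, π i ∈ Q) → (∀ i, z i ∈ Q) → τ ∈ Q → ((Fintype.card υ + Fintype.card ζ + 1 : ℕ) : ℕ∞) ≤ Q.height) :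
    ∃ c, 1 ≤ c ∧ ∀ (z' : ζ → Λ) (τ' : Λ), (∀ i, z' i - z i ∈ maximalIdeal Λ ^ c) → τ' - τ ∈ maximalIdeal Λ ^ c →
      ∀ x, τ' * x ∈ Ideal.span (Set.range (Sum.elim (fun i => π i ^ M) (fun j => (a0 * z' j) ^ M))) →
        x ∈ Ideal.span (Set.range (Sum.elim (fun i => π i ^ M) (fun j => (a0 * z' j) ^ M))) := by
  classical
  have key1 : ∀ x, a0 ^ M * x ∈ Ideal.span (Set.range fun i => π i ^ M) → x ∈ Ideal.span (Set.range fun i => π i ^ M) := by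
    by_cases ha : IsUnit a0
    · intro x hx
      exact (Ideal.unit_mul_mem_iff_mem _ (ha.pow M)).mp hx
    · obtain ⟨c, hc⟩ := hCM υ (fun i => π i ^ M) (a0 ^ M) (fun i => Ideal.pow_mem_of_mem _ (hπm i) _ hM) (Ideal.pow_mem_of_mem _ ha _ hM)
        (fun Q hQ h h' => by
          rw [Nat.card_eq_fintype_card]
          exact h1 Q hQ (fun i => hQ.mem_of_pow_mem _ (h i)) (hQ.mem_of_pow_mem _ h'))
      exact hc _ _ (fun i => by simp) (by simp)
  by_cases hτ : IsUnit τ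
  · refine ⟨1, le_rfl, fun z' τ' _ hτ' x hx => (Ideal.unit_mul_mem_iff_mem _ ?_).mp hx⟩
    by_contra hc
    have h4 := Ideal.sub_mem _ (show τ' ∈ maximalIdeal Λ from hc) (by simpa using hτ')
    rw [sub_sub_cancel] at h4
    exact h4 hτ
  have key2 : ∃ c, ∀ τ', τ' - τ ∈ maximalIdeal Λ ^ c → ∀ x, τ' * x ∈ Ideal.span (Set.range (Sum.elim (fun i => π i ^ M) (fun _ : Unit => a0 ^ M))) →
      x ∈ Ideal.span (Set.range (Sum.elim (fun i => π i ^ M) (fun _ : Unit => a0 ^ M))) := by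
    by_cases ha : IsUnit a0
    · refine ⟨0, fun τ' _ x _ => ?_⟩
      have : Ideal.span (Set.range (Sum.elim (fun i => π i ^ M) (fun _ : Unit => a0 ^ M))) = ⊤ :=
        Ideal.eq_top_of_isUnit_mem _ (Ideal.subset_span ⟨.inr (), rfl⟩) (ha.pow M)
      rw [this]; trivial
    · obtain ⟨c, hc⟩ := hCM (υ ⊕ Unit) (Sum.elim (fun i => π i ^ M) (fun _ : Unit => a0 ^ M)) τ (by
          rintro (i | i)
          · exact Ideal.pow_mem_of_mem _ (hπm i) _ hM
          · exact Ideal.pow_mem_of_mem _ ha _ hM) hτ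
        (fun Q hQ h h' => by
          rw [Nat.card_eq_fintype_card, Fintype.card_sum, Fintype.card_unit]
          exact h2 Q hQ (fun i => hQ.mem_of_pow_mem _ (h (.inl i))) (hQ.mem_of_pow_mem _ (h (.inr ()))) h')
      exact ⟨c, fun τ' h => hc _ _ (fun i => by simp) h⟩
  obtain ⟨c2, key2⟩ := key2
  obtain ⟨c3, key3⟩ := hCM (υ ⊕ ζ) (Sum.elim (fun i => π i ^ M) (fun i => z i ^ M)) τ (by
          rintro (i | i)
          · exact Ideal.pow_mem_of_mem _ (hπm i) _ hM
          · exact Ideal.pow_mem_of_mem _ (hzm i) _ hM) hτ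
        (fun Q hQ h h' => by
          rw [Nat.card_eq_fintype_card, Fintype.card_sum]
          exact h3 Q hQ (fun i => hQ.mem_of_pow_mem _ (h (.inl i))) (fun i => hQ.mem_of_pow_mem _ (h (.inr i))) h')
  refine ⟨c2 + c3 + 1, by omega, fun z' τ' hz' hτ' x hx => ?_⟩
  set I := Ideal.span (Set.range (Sum.elim (fun i => π i ^ M) (fun j => (a0 * z' j) ^ M))) with hI
  set Iπ := Ideal.span (Set.range fun i => π i ^ M) with hIπ
  set Iz := Ideal.span (Set.range fun j => z' j ^ M) with hIz
  have eI : ∀ y, y ∈ I ↔ ∃ p ∈ Iπ, ∃ q ∈ Iz, y = p + a0 ^ M * q := by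
    intro y
    rw [hI, Set.Sum.elim_range, Ideal.span_union, Submodule.mem_sup]
    constructor
    · rintro ⟨p, hp, q, hq, rfl⟩
      refine ⟨p, hp, ?_⟩
      obtain ⟨g, hg⟩ := (Ideal.mem_span_range_iff_exists_fun).mp hq
      refine ⟨∑ j, g j * z' j ^ M, Ideal.sum_mem _ fun j _ => Ideal.mul_mem_left _ _ (Ideal.subset_span ⟨j, rfl⟩), ?_⟩
      rw [← hg, Finset.mul_sum]
      congr 1
      exact Finset.sum_congr rfl fun j _ => by rw [mul_pow]; ring
    · rintro ⟨p, hp, q, hq, rfl⟩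
      refine ⟨p, hp, a0 ^ M * q, ?_, rfl⟩
      obtain ⟨g, hg⟩ := (Ideal.mem_span_range_iff_exists_fun).mp hq
      rw [← hg, Finset.mul_sum]
      refine Ideal.sum_mem _ fun j _ => ?_
      have : a0 ^ M * (g j * z' j ^ M) = g j * (a0 * z' j) ^ M := by rw [mul_pow]; ring
      rw [this]; exact Ideal.mul_mem_left _ _ (Ideal.subset_span ⟨j, rfl⟩)
  have ha : ∀ y, y ∈ Ideal.span (Set.range (Sum.elim (fun i => π i ^ M) (fun _ : Unit => a0 ^ M))) ↔ ∃ p ∈ Iπ, ∃ q, y = p + a0 ^ M * q := by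
    intro y
    rw [Set.Sum.elim_range, Ideal.span_union, Submodule.mem_sup]
    simp only [Set.range_const, Ideal.mem_span_singleton]
    constructor
    · rintro ⟨p, hp, _, ⟨q, rfl⟩, rfl⟩; exact ⟨p, hp, q, rfl⟩
    · rintro ⟨p, hp, q, rfl⟩; exact ⟨p, hp, _, ⟨q, rfl⟩, rfl⟩
  have hpz : ∀ y, y ∈ Ideal.span (Set.range (Sum.elim (fun i => π i ^ M) (fun i => z' i ^ M))) ↔ ∃ p ∈ Iπ, ∃ q ∈ Iz, y = p + q := by
    intro y
    rw [Set.Sum.elim_range, Ideal.span_union, Submodule.mem_sup]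
    constructor
    · rintro ⟨p, hp, q, hq, rfl⟩; exact ⟨p, hp, q, hq, rfl⟩
    · rintro ⟨p, hp, q, hq, rfl⟩; exact ⟨p, hp, q, hq, rfl⟩
  obtain ⟨p, hp, q, hq, e⟩ := (eI _).mp hx
  obtain ⟨p', hp', x', rfl⟩ := (ha x).mp (key2 τ' (Ideal.pow_le_pow_right (by omega) hτ') x ((ha _).mpr ⟨p, hp, q, e⟩))
  have h4 : τ' * x' - q ∈ Iπ := by
    apply key1
    have : a0 ^ M * (τ' * x' - q) = p - τ' * p' := by linear_combination e
    rw [this]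
    exact Ideal.sub_mem _ hp (Ideal.mul_mem_left _ _ hp')
  have h5 := key3 (Sum.elim (fun i => π i ^ M) (fun i => z' i ^ M)) τ' (by
    rintro (i | i)
    · simp
    · exact Ideal.pow_le_pow_right (by omega) (pow_sub_mem _ (hz' i) M)) (Ideal.pow_le_pow_right (by omega) hτ') x'
    ((hpz _).mpr ⟨_, h4, q, hq, by ring⟩)
  obtain ⟨p2, hp2, q2, hq2, rfl⟩ := (hpz _).mp h5
  exact (eI _).mpr ⟨p' + a0 ^ M * p2, Ideal.add_mem _ hp' (Ideal.mul_mem_left _ _ hp2), q2, hq2, by ring⟩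

/-- flattening of iterated polynomials -/
theorem exists_flat {R ρ V : Type} [CommRing R] (p : MvPolynomial V (MvPolynomial ρ R)) :
    ∃ q : MvPolynomial (ρ ⊕ V) R, ∀ (A : Type) [CommRing A] [Algebra R A] [Algebra (MvPolynomial ρ R) A] (z : ρ → A)
      (_ : ∀ s, algebraMap (MvPolynomial ρ R) A s = aeval z s) (v : V → A),
       aeval (Sum.elim z v) q = aeval v p ∧ ∀ i, dv (Sum.elim z v) (.inr i) q = dv v i p := by
  induction p using MvPolynomial.induction_on with
  | C a =>
    refine ⟨rename Sum.inl a, fun A _ _ _ z hz v => ⟨?_, fun i => ?_⟩⟩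
    · rw [aeval_rename, Sum.elim_comp_inl, aeval_C, hz]
    · rw [dv_rename_ne _ _ _ (by simp), dv_C]
  | add p q hp hq =>
    obtain ⟨p', hp⟩ := hp
    obtain ⟨q', hq⟩ := hq
    refine ⟨p' + q', fun A _ _ _ z hz v => ⟨?_, fun i => ?_⟩⟩
    · rw [map_add, (hp A z hz v).1, (hq A z hz v).1, map_add]
    · rw [dv_add, (hp A z hz v).2, (hq A z hz v).2, dv_add]
  | mul_X p j hp =>
    obtain ⟨p', hp⟩ := hp
    refine ⟨p' * X (.inr j), fun A _ _ _ z hz v => ⟨?_, fun i => ?_⟩⟩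
    · rw [map_mul, (hp A z hz v).1, map_mul, aeval_X, aeval_X]; rfl
    · classical
      rw [dv_mul, (hp A z hz v).2, (hp A z hz v).1, dv_mul, aeval_X, aeval_X, dv_X, dv_X]
      simp

end Part12

section Part13
open MvPolynomial IsLocalRing

section
variable {R Λ : Type} [CommRing R] [CommRing Λ] [Algebra R Λ]

/-- derivations extend -/
def DerExt (R Λ : Type) [CommRing R] [CommRing Λ] [Algebra R Λ] : Prop :=
  ∀ D : Der R, ∃ D' : Der Λ, ∀ x, D' (algebraMap R Λ x) = algebraMap R Λ (D x)

theorem GInd.ext (hder : DerExt R Λ) {υ : Type} [Fintype υ] (Q : Ideal Λ) [hQ : Q.IsPrime] {u : υ → R}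
    (h : GInd (Q.comap (algebraMap R Λ)) u) : GInd Q (fun i => algebraMap R Λ (u i)) := by
  classical
  obtain ⟨δ, hδ, D, hD⟩ := h.dual
  choose D' hD' using hder
  refine GInd.of_dual (algebraMap R Λ δ) hδ (fun j => D' (D j)) fun i j => ?_
  rw [hD', hD]; split_ifs <;> simp

theorem ht_comap_le (hR : JC R) (hΛ : JC Λ) (hder : DerExt R Λ) (Q : Ideal Λ) [hQ : Q.IsPrime] :
    (Q.comap (algebraMap R Λ)).height ≤ Q.height := by
  obtain ⟨h, q, hh, hq, hG, -⟩ := hR (Q.comap (algebraMap R Λ)) inferInstance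
  have := GInd.card_le hΛ (GInd.ext hder Q hG) (fun i => hq i)
  rw [hh]; simpa using this

theorem exists_c0 {S : Type} [CommRing S] (T : Finset (Ideal S)) (p : Ideal S) [hp : p.IsPrime]
    (h : ∀ q ∈ T, p ≤ q ∨ ¬ q ≤ p) : ∃ c0 ∉ p, ∀ x ∈ p, c0 * x ∈ T.inf id := by
  classical
  have : ∀ q : Ideal S, ∃ c ∉ p, q ∈ T → ∀ x ∈ p, c * x ∈ q := by
    intro q
    by_cases hq : q ∈ T
    · rcases h q hq with h' | h'
      · exact ⟨1, (Ideal.ne_top_iff_one _).1 hp.ne_top, fun _ x hx => by simpa using h' hx⟩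
      · obtain ⟨c, hc, hcp⟩ := SetLike.not_le_iff_exists.1 h'
        exact ⟨c, hcp, fun _ x hx => q.mul_mem_right _ hc⟩
    · exact ⟨1, (Ideal.ne_top_iff_one _).1 hp.ne_top, fun h => absurd h hq⟩
  choose c hc hcq using this
  refine ⟨∏ q ∈ T, c q, fun hm => ?_, fun x hx => ?_⟩
  · obtain ⟨q, hq, h'⟩ := (hp.prod_mem_iff).1 hm
    exact hc q h'
  · rw [Submodule.mem_finsetInf]
    intro q hq
    obtain ⟨d, hd⟩ := Finset.dvd_prod_of_mem c hq
    rw [hd, mul_comm (c q), mul_assoc]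
    exact q.mul_mem_left _ (hcq q hq x hx)

theorem le_of_ht {S : Type} [CommRing S] [IsNoetherianRing S] {p q : Ideal S} [hp : p.IsPrime] [hq : q.IsPrime]
    (h : p.height ≤ q.height) : p ≤ q ∨ ¬ q ≤ p := by
  by_cases hqp : q ≤ p
  · left
    rcases hqp.lt_or_eq with h' | h'
    · have hfin : q.FiniteHeight := inferInstance
      exact absurd (Ideal.height_strict_mono_of_isPrime h') (not_lt.2 h)
    · exact h'.ge
  · exact Or.inr hqp

theorem prime_inf_le {S : Type} [CommRing S] {T : Finset (Ideal S)} {Q : Ideal S} (hQ : Q.IsPrime) (h : T.inf id ≤ Q) :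
    ∃ q ∈ T, q ≤ Q := (hQ.inf_le').1 h

theorem geom [IsNoetherianRing R] [IsNoetherianRing Λ] (hR : JC R) (hΛ : JC Λ) (hder : DerExt R Λ)
    (PP : Finset (Ideal Λ)) (hprime : ∀ Q ∈ PP, Q.IsPrime) (P : Ideal Λ) (hP : P ∈ PP) (a h : ℕ)
    (ha : (P.comap (algebraMap R Λ)).height = a) (hh : P.height = h)
    (h1 : ∀ Q ∈ PP, (a : ℕ∞) ≤ (Ideal.comap (algebraMap R Λ) Q).height)
    (h2 : ∀ Q ∈ PP, (Ideal.comap (algebraMap R Λ) Q).height = a → (h : ℕ∞) ≤ Q.height) :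
    ∃ (r : ℕ) (π : Fin a → R) (z : Fin r → Λ) (a0 : R), h = a + r ∧
      (∀ Q ∈ PP, ∀ i, algebraMap R Λ (π i) ∈ Q) ∧
      (∀ Q ∈ PP, ∀ i, algebraMap R Λ a0 * z i ∈ Q) ∧ (∀ i, z i ∈ P) ∧
      GInd (P.comap (algebraMap R Λ)) π ∧ GInd P (Sum.elim (fun i => algebraMap R Λ (π i)) z) ∧
      (∀ q : Ideal R, q.IsPrime → (∀ i, π i ∈ q) → (a : ℕ∞) ≤ q.height) ∧
      (∀ q : Ideal Λ, q.IsPrime → (∀ i, algebraMap R Λ (π i) ∈ q) → (∀ i, z i ∈ q) → (h : ℕ∞) ≤ q.height) ∧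
      a0 ∉ P.comap (algebraMap R Λ) ∧
      (∀ q : Ideal R, q.IsPrime → (∀ i, π i ∈ q) → a0 ∈ q → ((a + 1 : ℕ) : ℕ∞) ≤ q.height) ∧
      (r = 0 → a0 = 1) := by
  classical
  have hPp : P.IsPrime := hprime P hP
  have hah : a ≤ h := by
    have := ht_comap_le hR hΛ hder P
    rw [ha, hh] at this; exact_mod_cast this
  let p := P.comap (algebraMap R Λ)
  have hpp : p.IsPrime := inferInstance
  let T1 : Finset (Ideal R) := PP.image (Ideal.comap (algebraMap R Λ))
  have hT1 : ∀ q ∈ T1, q.IsPrime ∧ (a : ℕ∞) ≤ q.height := by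
    intro q hq
    obtain ⟨Q, hQ, rfl⟩ := Finset.mem_image.1 hq
    have := hprime Q hQ
    exact ⟨inferInstance, h1 Q hQ⟩
  have hpT1 : p ∈ T1 := Finset.mem_image_of_mem _ hP
  obtain ⟨c0, hc0, hc0'⟩ := exists_c0 T1 p (fun q hq => by
    have := (hT1 q hq).1
    exact le_of_ht (ha.le.trans (hT1 q hq).2))
  obtain ⟨π, hπ1, hπ2, hπ3⟩ := genseq hR p (T1.inf id) (Finset.inf_le hpT1) c0 hc0 hc0' a ha
    (fun Q hQ hle => by
      obtain ⟨q, hq, hqQ⟩ := prime_inf_le hQ hle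
      exact (hT1 q hq).2.trans (Ideal.height_mono hqQ)) (υ := Fin 0) (fun i => i.elim0)
    (fun l hl i => i.elim0) (fun Q hQ _ => by simp) a (by simp)
  have hπG : GInd p π := by
    intro l hl k
    exact hπ2 (Sum.elim (fun i => i.elim0) l) (fun D => by simpa using hl D) (.inr k)
  have hπh : ∀ q : Ideal R, q.IsPrime → (∀ i, π i ∈ q) → (a : ℕ∞) ≤ q.height := fun q hq hm => by
    simpa using hπ3 q hq (fun i => i.elim0) hm
  have hπQ : ∀ Q ∈ PP, ∀ i, algebraMap R Λ (π i) ∈ Q := by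
    intro Q hQ i
    have := hπ1 i
    rw [Submodule.mem_finsetInf] at this
    exact this _ (Finset.mem_image_of_mem _ hQ)
  let T2 : Finset (Ideal Λ) := PP.filter (fun Q => (Ideal.comap (algebraMap R Λ) Q).height = a)
  have hT2 : ∀ q ∈ T2, q.IsPrime ∧ (h : ℕ∞) ≤ q.height := fun q hq =>
    ⟨hprime q (Finset.mem_filter.1 hq).1, h2 q (Finset.mem_filter.1 hq).1 (Finset.mem_filter.1 hq).2⟩
  have hPT2 : P ∈ T2 := Finset.mem_filter.2 ⟨hP, ha⟩
  obtain ⟨d0, hd0, hd0'⟩ := exists_c0 T2 P (fun q hq => by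
    have := (hT2 q hq).1
    exact le_of_ht (hh.le.trans (hT2 q hq).2))
  obtain ⟨z, hz1, hz2, hz3⟩ := genseq hΛ P (T2.inf id) (Finset.inf_le hPT2) d0 hd0 hd0' h hh
    (fun Q hQ hle => by
      obtain ⟨q, hq, hqQ⟩ := prime_inf_le hQ hle
      exact (hT2 q hq).2.trans (Ideal.height_mono hqQ)) (fun i => algebraMap R Λ (π i))
    (GInd.ext hder P hπG) (fun Q hQ hm => by
      have h3 := hπh (Q.comap (algebraMap R Λ)) inferInstance hm
      simpa using h3.trans (ht_comap_le hR hΛ hder Q)) (h - a) (by simp; omega)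
  have hzh : ∀ q : Ideal Λ, q.IsPrime → (∀ i, algebraMap R Λ (π i) ∈ q) → (∀ i, z i ∈ q) → (h : ℕ∞) ≤ q.height := by
    intro q hq h4 h5
    have := hz3 q hq h4 h5
    rwa [Fintype.card_fin, Nat.add_sub_cancel' hah] at this
  have hzT : ∀ Q ∈ T2, ∀ i, z i ∈ Q := by
    intro Q hQ i
    have := hz1 i
    rw [Submodule.mem_finsetInf] at this
    exact this _ hQ
  by_cases hr : h - a = 0
  · refine ⟨h - a, π, z, 1, by omega, hπQ, fun Q _ i => absurd i.2 (by omega), fun i => hzT P hPT2 i, hπG, hz2, hπh, hzh,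
      (Ideal.ne_top_iff_one _).1 hpp.ne_top, fun q hq _ h1 => absurd h1 ((Ideal.ne_top_iff_one _).1 hq.ne_top), fun _ => rfl⟩
  · let T3 : Finset (Ideal R) := T1.filter (fun q => (a : ℕ∞) < q.height)
    have hT3 : ∀ Q : Ideal R, Q.IsPrime → Q.height ≤ a → ¬ T3.inf id ≤ Q := by
      intro Q hQ hQa hle
      obtain ⟨q, hq, hqQ⟩ := prime_inf_le hQ hle
      exact absurd ((Finset.mem_filter.1 hq).2.trans_le (Ideal.height_mono hqQ)) (not_lt.2 hQa)
    obtain ⟨a0, ha0, ha0p, ha0'⟩ := avoid (T3.inf id) p (hT3 p hpp ha.le) (Ideal.span (Set.range π)).minimalPrimes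
      (Ideal.finite_minimalPrimes_of_isNoetherianRing _ _) (fun Q hQ => hQ.1.1) (fun Q hQ =>
        hT3 Q hQ.1.1 (by simpa using minht π Q hQ))
    refine ⟨h - a, π, z, a0, by omega, hπQ, ?_, fun i => hzT P hPT2 i, hπG, hz2, hπh, hzh, ha0p,
      fun q hq hm h0 => ht_succ π a0 a hπh ha0' q hq hm h0, fun h => absurd h hr⟩
    intro Q hQ i
    rcases (h1 Q hQ).lt_or_eq with hlt | heq
    · rw [Submodule.mem_finsetInf] at ha0
      exact Q.mul_mem_right _ (ha0 _ (Finset.mem_filter.2 ⟨Finset.mem_image_of_mem _ hQ, hlt⟩))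
    · exact Q.mul_mem_left _ (hzT Q (Finset.mem_filter.2 ⟨hQ, heq.symm⟩) i)
end

end Part13

section Part14
open MvPolynomial IsLocalRing

section
variable {S Λ : Type} [CommRing S] [CommRing Λ] [Algebra S Λ]

structure Pre {ι κ : Type} (F : κ → MvPolynomial ι S) (f : ι → Λ) (U : Ideal S) (N : ℕ)
    (P V : Ideal Λ) (T : Finset (Ideal Λ)) where
  ιw : Type
  κw : Type
  fι : Fintype ιw
  fκ : Fintype κw
  ψ : ι → MvPolynomial ιw S
  G : κw → MvPolynomial ιw S
  σ : MvPolynomial ιw S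
  hrel : ∀ k, σ * aeval ψ (F k) ∈ (U.map (C : S →+* MvPolynomial ιw S)) ^ N ⊔ Ideal.span (Set.range G)
  M : ℕ
  ψh : ι → MvPolynomial (Option ιw) S
  Gh : κw → MvPolynomial (Option ιw) S
  σh : MvPolynomial (Option ιw) S
  hψh : ∀ i, ∀ (A : Type) [CommRing A] [Algebra S A] (y : ιw → A) (s : A),
    aeval (fun o : Option ιw => o.elim s (fun i => s * y i)) (ψh i) = s ^ M * aeval y (ψ i)
  hGh : ∀ i, ∀ (A : Type) [CommRing A] [Algebra S A] (y : ιw → A) (s : A),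
    aeval (fun o : Option ιw => o.elim s (fun i => s * y i)) (Gh i) = s ^ M * aeval y (G i)
  hσh : ∀ (A : Type) [CommRing A] [Algebra S A] (y : ιw → A) (s : A),
    aeval (fun o : Option ιw => o.elim s (fun i => s * y i)) σh = s ^ M * aeval y σ
  b : ιw → Λ
  s1 : Λ
  s2 : Λ
  hs1 : s1 ∉ P
  hs1T : ∀ Q ∈ T, s1 ∈ Q
  hs2 : s2 ∈ P
  hs2T : ∀ Q ∈ T, s2 ∉ Q
  e2 : ∀ i, s1 * (s1 ^ M * f i - aeval (fun o : Option ιw => o.elim s1 b) (ψh i)) ∈ V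
  e3 : ∀ k, s1 * aeval (fun o : Option ιw => o.elim s1 b) (Gh k) ∈ V
  e4 : s1 * s2 ∈ V
  hσ : aeval (fun o : Option ιw => o.elim s1 b) σh ∉ P
  hJ : IndepMod P (fun k i => dv (fun o : Option ιw => o.elim s1 b) (some i) (Gh k))

attribute [instance] Pre.fι Pre.fκ

theorem exists_pre [IsNoetherianRing Λ] [Algebra ℚ Λ] {ι κ : Type} [Fintype ι] [Fintype κ] (F : κ → MvPolynomial ι S) (f : ι → Λ)
    (hF : ∀ k, aeval f (F k) = 0) {υ : Type} [Fintype υ] (u : υ → S) (N : ℕ) (hN : 1 ≤ N)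
    (P V : Ideal Λ) [hP : P.IsPrime] (T : Finset (Ideal Λ))
    (hG : GInd P (fun i => algebraMap S Λ (u i))) (huP : ∀ i, algebraMap S Λ (u i) ∈ P)
    (hgen : ∃ σ ∉ P, ∀ x ∈ P, σ * x ∈ Ideal.span (Set.range fun i => algebraMap S Λ (u i)))
    (hb : ∀ a : S, algebraMap S Λ a ∈ P → ∃ σ : S, algebraMap S Λ σ ∉ P ∧ σ * a ∈ Ideal.span (Set.range u))
    (a0 : Λ) (ha0 : a0 ∉ P) (hV : ∀ x ∈ (Ideal.span (Set.range fun i => algebraMap S Λ (u i))) ^ N, a0 * x ∈ V)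
    (hT : ∀ Q ∈ T, Q.IsPrime ∧ ¬ Q ≤ P ∧ ¬ P ≤ Q)
    (hVT : ∀ x, x ∈ P → (∀ Q ∈ T, x ∈ Q) → ∃ E, x ^ E ∈ V) :
    Nonempty (Pre F f (Ideal.span (Set.range u)) N P V T) := by
  classical
  obtain ⟨Θ, _, _, _, φ, hφ⟩ := exists_theta P N hN
  letI : Algebra S Θ := (φ.comp (algebraMap S Λ)).toAlgebra
  have hal : ∀ s, algebraMap S Θ s = φ (algebraMap S Λ s) := fun s => rfl
  let φa : Λ →ₐ[S] Θ := { φ with commutes' := fun s => rfl }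
  have hφa : ∀ x, φa x = φ x := fun x => rfl
  have hae : ∀ {γ : Type} (g : γ → Λ) (p : MvPolynomial γ S), φ (aeval g p) = aeval (fun i => φ (g i)) p := by
    intro γ g p
    have := MvPolynomial.comp_aeval_apply (f := g) φa p
    simpa [hφa] using this
  have h1 := fun x => hφ.mem_one hN x
  have hmax : maximalIdeal Θ = Ideal.span (Set.range fun i => algebraMap S Θ (u i)) := hφ.gen hN _ huP hgen
  have hnil : ∀ x ∈ maximalIdeal Θ, IsNilpotent x := fun x hx => ⟨N, by
    have := Ideal.pow_mem_pow hx N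
    rwa [hφ.nil, Ideal.mem_bot] at this⟩
  let w0 : Tw S Θ (Ideal.span (Set.range u)) := Tw.base (fun a ha => by
    obtain ⟨σ, h2, h3⟩ := hb a ((h1 _).1 ha)
    exact ⟨σ, fun h => h2 ((h1 _).1 h), h3⟩)
  obtain ⟨w, -, ψ, hψ⟩ := Tw.approx hnil u hmax N w0 (fun i => φ (f i))
  have hψ' : ∀ i, aeval w.y (ψ i) = φ (f i) := by
    intro i
    have := hψ i
    rw [hφ.nil, Ideal.mem_bot, sub_eq_zero] at this
    exact this.symm
  have hFz : ∀ k, aeval w.y (aeval ψ (F k)) = 0 := by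
    intro k
    rw [aeval_aeval']
    simp only [hψ']
    rw [← hae, hF, map_zero]
  have hQp : w.Q.IsPrime := Ideal.comap_isPrime _ _
  obtain ⟨σ, hσ, hσ'⟩ := exists_common_mul w.Q (((Ideal.span (Set.range u)).map (C : S →+* MvPolynomial w.ι S)) ^ N ⊔ Ideal.span (Set.range w.G))
    Finset.univ (fun k => aeval ψ (F k)) (fun k _ => by
      obtain ⟨σ, h2, h3⟩ := Tw.deep u rfl N (fun k hk H hH hm d => hφ.MI hN _ hG huP k hk H hH hm d)
        (fun i => (h1 _).2 (huP i)) w N le_rfl (aeval ψ (F k)) (by rw [hFz]; exact zero_mem _)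
      exact ⟨σ, h2, h3⟩)
  choose M1 hM1 using fun i => exists_homogenization (ψ i)
  choose M2 hM2 using fun i => exists_homogenization (w.G i)
  obtain ⟨M3, hM3⟩ := exists_homogenization σ
  let M := ∑ i, M1 i + ∑ i, M2 i + M3 + 1
  choose ψh hψh1 hψh2 using fun i => hM1 i M (by
    have := Finset.single_le_sum (f := M1) (fun _ _ => Nat.zero_le _) (Finset.mem_univ i)
    simp only [M]; omega)
  choose Gh hGh1 hGh2 using fun i => hM2 i M (by
    have := Finset.single_le_sum (f := M2) (fun _ _ => Nat.zero_le _) (Finset.mem_univ i)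
    simp only [M]; omega)
  obtain ⟨σh, hσh1, hσh2⟩ := hM3 M (by simp only [M]; omega)
  obtain ⟨b0, s0, hs0, hb0⟩ := hφ.fracs w.y
  have hval : ∀ (b : w.ι → Λ) (s : Λ), (∀ i, φ (b i) = φ s * w.y i) → ∀ q : MvPolynomial (Option w.ι) S,
      φ (aeval (fun o : Option w.ι => o.elim s b) q) = aeval (fun o : Option w.ι => o.elim (φ s) (fun i => φ s * w.y i)) q := by
    intro b s hbs q
    rw [hae]
    congr 2
    funext o; cases o <;> simp [hbs]
  let X0 : ι ⊕ w.κ → Λ := Sum.elim (fun i => s0 ^ M * f i - aeval (fun o : Option w.ι => o.elim s0 b0) (ψh i))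
    (fun k => aeval (fun o : Option w.ι => o.elim s0 b0) (Gh k))
  have hX0 : ∀ x, φ (X0 x) = 0 := by
    rintro (i | k)
    · simp only [X0, Sum.elim_inl, map_sub, map_mul, map_pow]
      rw [hval b0 s0 (fun i => (hb0 i).symm), (hψh2 i Θ w.y (φ s0)).1, hψ', sub_self]
    · simp only [X0, Sum.elim_inr]
      rw [hval b0 s0 (fun i => (hb0 i).symm), (hGh2 k Θ w.y (φ s0)).1, w.h0, mul_zero]
  obtain ⟨σ0, hσ0, hσ0'⟩ := hgen
  have hPN : ∀ x ∈ P ^ N, (σ0 ^ N * a0) * x ∈ V := by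
    intro x hx
    have h2 : ∀ n, ∀ x ∈ P ^ n, σ0 ^ n * x ∈ (Ideal.span (Set.range fun i => algebraMap S Λ (u i))) ^ n := by
      intro n
      induction n with
      | zero => intro x _; simp
      | succ n ih =>
        intro x hx
        rw [pow_succ] at hx
        refine Submodule.mul_induction_on hx ?_ ?_
        · intro a ha c hc
          rw [pow_succ, pow_succ, show σ0 ^ n * σ0 * (a * c) = (σ0 ^ n * a) * (σ0 * c) by ring]
          exact Ideal.mul_mem_mul (ih a ha) (hσ0' c hc)
        · intro a c ha hc
          rw [mul_add]; exact add_mem ha hc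
    rw [mul_comm (σ0 ^ N), mul_assoc]
    exact hV _ (h2 N x hx)
  obtain ⟨t, ht, ht'⟩ := exists_common_mul P V Finset.univ X0 (fun x _ => by
    obtain ⟨s, hs, hs'⟩ := (hφ.zero (X0 x)).1 (hX0 x)
    refine ⟨(σ0 ^ N * a0) * s, ?_, ?_⟩
    · exact fun h => (hP.mem_or_mem h).elim (fun h => (hP.mem_or_mem h).elim (fun h => hσ0 (hP.mem_of_pow_mem _ h)) ha0) hs
    · rw [mul_assoc]; exact hPN _ hs')
  obtain ⟨g, hg, hgP⟩ : ∃ g, (∀ Q ∈ T, g ∈ Q) ∧ g ∉ P := by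
    have : ¬ T.inf id ≤ P := fun h => by
      obtain ⟨q, hq, hqP⟩ := prime_inf_le hP h
      exact (hT q hq).2.1 hqP
    obtain ⟨g, hg, hgP⟩ := SetLike.not_le_iff_exists.1 this
    rw [Submodule.mem_finsetInf] at hg
    exact ⟨g, hg, hgP⟩
  obtain ⟨s2, hs2P, hs2T⟩ : ∃ s2 ∈ P, ∀ Q ∈ T, s2 ∉ Q := by
    by_cases hTe : T.Nonempty
    · obtain ⟨Q0, hQ0⟩ := hTe
      obtain ⟨s2, hs2P, -, hs2T⟩ := avoid P Q0 (hT Q0 hQ0).2.2 (↑T) T.finite_toSet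
        (fun Q hQ => (hT Q hQ).1) (fun Q hQ => (hT Q hQ).2.2)
      exact ⟨s2, hs2P, hs2T⟩
    · exact ⟨0, zero_mem _, fun Q hQ => absurd ⟨Q, hQ⟩ hTe⟩
  let s := t * g
  have hsP : s ∉ P := fun h => (hP.mem_or_mem h).elim ht hgP
  obtain ⟨E0, hE0⟩ := hVT (s * s0 * s2) (P.mul_mem_left _ hs2P) (fun Q hQ =>
    Q.mul_mem_right _ (Q.mul_mem_right _ (Q.mul_mem_left _ (hg Q hQ))))
  let s' := s ^ (E0 + 1) * s0 ^ E0
  have hs' : s' * s0 = (s * s0) ^ (E0 + 1) := by simp only [s']; ring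
  have hs'P : s' * s0 ∉ P := by
    rw [hs']; exact fun h => (hP.mem_or_mem (hP.mem_of_pow_mem _ h)).elim hsP hs0
  have hs't : ∃ c, s' = c * t := ⟨g * s ^ E0 * s0 ^ E0, by simp only [s', s]; ring⟩
  have hbs : ∀ i, φ (s' * b0 i) = φ (s' * s0) * w.y i := by
    intro i; rw [map_mul, ← hb0, map_mul φ s' s0]; ring
  have hfun : (fun o : Option w.ι => o.elim (s' * s0) (fun i => s' * b0 i)) = fun o => s' * (o.elim s0 b0) := by
    funext o; cases o <;> rfl
  have hsc : ∀ x, t * x ∈ V → ∀ y : Λ, y * (s' ^ M * x) ∈ V := by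
    intro x hx y
    obtain ⟨c, hc⟩ := hs't
    have : s' ^ M * x = (s' ^ (∑ i, M1 i + ∑ i, M2 i + M3) * c) * (t * x) := by
      have : s' ^ M = s' ^ (∑ i, M1 i + ∑ i, M2 i + M3) * s' := pow_succ _ _
      rw [this]; nth_rewrite 2 [hc]; ring
    rw [this]
    exact V.mul_mem_left _ (V.mul_mem_left _ hx)
  have hunit : IsUnit (φ (s' * s0)) := hφ.unit hN hs'P
  refine ⟨{ ιw := w.ι, κw := w.κ, fι := inferInstance, fκ := inferInstance, ψ := ψ, G := w.G, σ := σ,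
            hrel := fun k => hσ' k (Finset.mem_univ k), M := M, ψh := ψh, Gh := Gh, σh := σh,
            hψh := fun i A _ _ y s => (hψh2 i A y s).1, hGh := fun i A _ _ y s => (hGh2 i A y s).1,
            hσh := fun A _ _ y s => (hσh2 A y s).1, b := fun i => s' * b0 i, s1 := s' * s0, s2 := s2 ^ (E0 + 1),
            hs1 := hs'P, hs1T := ?_, hs2 := ?_, hs2T := ?_, e2 := ?_, e3 := ?_, e4 := ?_, hσ := ?_, hJ := ?_ }⟩
  · intro Q hQ
    rw [hs', pow_succ]
    exact Q.mul_mem_left _ (Q.mul_mem_right _ (Q.mul_mem_left _ (hg Q hQ)))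
  · exact P.pow_mem_of_mem hs2P _ (Nat.succ_pos _)
  · exact fun Q hQ h => hs2T Q hQ ((hT Q hQ).1.mem_of_pow_mem _ h)
  · intro i
    rw [hfun, homog_scale _ (hψh1 i)]
    have h2 := hsc _ (ht' (.inl i) (Finset.mem_univ _)) (s' * s0)
    simp only [X0, Sum.elim_inl] at h2
    convert h2 using 1; ring
  · intro k
    rw [hfun, homog_scale _ (hGh1 k)]
    exact hsc _ (ht' (.inr k) (Finset.mem_univ _)) (s' * s0)
  · rw [hs', ← mul_pow, pow_succ]
    exact V.mul_mem_right _ hE0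
  · intro h
    rw [← h1, hval _ _ hbs, (hσh2 Θ w.y _).1] at h
    exact hσ ((Ideal.unit_mul_mem_iff_mem _ (hunit.pow M)).1 h)
  · intro l hl k
    rw [← h1]
    refine w.hJ (fun k => φ (l k)) (fun i => ?_) k
    have h2 := (h1 _).2 (hl i)
    have h3 := Ideal.mul_mem_left _ (φ (s' * s0)) h2
    have h4 : φ (s' * s0) * φ (∑ k, l k * dv (fun o : Option w.ι => o.elim (s' * s0) (fun i => s' * b0 i)) (some i) (Gh k))
        = φ (s' * s0) ^ M * ∑ k, φ (l k) * dv w.y i (w.G k) := by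
      rw [map_sum, Finset.mul_sum, Finset.mul_sum]
      refine Finset.sum_congr rfl fun k _ => ?_
      rw [map_mul φ (l k), dv, hval _ _ hbs]
      have := (hGh2 k Θ w.y (φ (s' * s0))).2 i
      rw [dv] at this
      rw [mul_left_comm, this]; ring
    rw [h4] at h3
    exact (Ideal.unit_mul_mem_iff_mem _ (hunit.pow M)).1 h3
end

end Part14

section Part15
open MvPolynomial IsLocalRing

section aug
variable {S Λ : Type} [CommRing S] [CommRing Λ] [Algebra S Λ] {ι κ υ : Type} [Fintype ι] [Fintype κ]

open Classical in
/-- adjoin the Jacobian relations -/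
noncomputable def augF (F : κ → MvPolynomial ι S) (c : υ → S) : κ ⊕ (υ × κ × κ) → MvPolynomial (ι ⊕ (υ × ι × κ)) S
  | .inl k => rename Sum.inl (F k)
  | .inr t => ∑ i, rename Sum.inl (pderiv i (F t.2.1)) * X (Sum.inr (t.1, i, t.2.2)) - (if t.2.1 = t.2.2 then C (c t.1) else 0)

theorem aeval_augF_inl (F : κ → MvPolynomial ι S) (c : υ → S) (g : ι ⊕ (υ × ι × κ) → Λ) (k : κ) :
    aeval g (augF F c (.inl k)) = aeval (fun i => g (.inl i)) (F k) := by
  simp only [augF, aeval_rename]; rfl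

open Classical in
theorem aeval_augF_inr (F : κ → MvPolynomial ι S) (c : υ → S) (g : ι ⊕ (υ × ι × κ) → Λ) (j : υ) (k k' : κ) :
    aeval g (augF F c (.inr (j, k, k'))) = ∑ i, dv (fun i => g (.inl i)) i (F k) * g (.inr (j, i, k')) -
      (if k = k' then algebraMap S Λ (c j) else 0) := by
  simp only [augF, map_sub, map_sum, map_mul, aeval_rename, aeval_X, dv]
  congr 1
  split_ifs <;> simp

theorem augF_indep [Fintype υ] (F : κ → MvPolynomial ι S) (c : υ → S) (g : ι ⊕ (υ × ι × κ) → Λ) (Q : Ideal Λ)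
    (h : IndepMod Q (fun k i => dv (fun i => g (.inl i)) i (F k))) :
    IndepMod Q (fun k i => dv g i (augF F c k)) := by
  classical
  have e1 : ∀ k i, dv g (.inl i) (augF F c (.inl k)) = dv (fun i => g (.inl i)) i (F k) := by
    intro k i
    simp only [augF]
    rw [dv_rename_inj _ _ Sum.inl_injective]; rfl
  have e2 : ∀ k t, dv g (.inr t) (augF F c (.inl k)) = 0 := by
    intro k t
    simp only [augF]
    rw [dv_rename_ne]; simp
  have e3 : ∀ t u, dv g (.inr u) (augF F c (.inr t)) = if u.1 = t.1 ∧ u.2.2 = t.2.2 then dv (fun i => g (.inl i)) u.2.1 (F t.2.1) else 0 := by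
    intro t u
    obtain ⟨j, k, k'⟩ := t
    obtain ⟨j2, i2, k2⟩ := u
    have h0 : ∀ i, dv g (.inr (j2, i2, k2)) (rename Sum.inl (pderiv i (F k)) : MvPolynomial (ι ⊕ (υ × ι × κ)) S) = 0 := by
      intro i
      rw [dv_rename_ne]; simp
    have h1 : dv g (.inr (j2, i2, k2)) ((if k = k' then C (c j) else 0 : MvPolynomial (ι ⊕ (υ × ι × κ)) S)) = 0 := by
      split_ifs <;> simp [dv]
    have h2 : ∀ (p q : MvPolynomial (ι ⊕ (υ × ι × κ)) S) v, dv g v (p - q) = dv g v p - dv g v q := by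
      intro p q v; simp [dv]
    have h3 : ∀ (p : ι → MvPolynomial (ι ⊕ (υ × ι × κ)) S) v, dv g v (∑ i, p i) = ∑ i, dv g v (p i) := by
      intro p v; simp [dv]
    simp only [augF]
    rw [h2, h1, h3, sub_zero]
    simp only [dv_mul, h0, zero_mul, dv_X, aeval_rename, mul_ite, mul_one, mul_zero, add_zero, zero_add]
    by_cases hc : j2 = j ∧ k2 = k'
    · obtain ⟨rfl, rfl⟩ := hc
      simp [dv, Function.comp_def]
    · simp only [hc, if_false]
      refine Finset.sum_eq_zero fun i _ => ?_
      rw [if_neg]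
      intro he
      simp only [Sum.inr.injEq, Prod.mk.injEq] at he
      exact hc ⟨he.1.symm, he.2.2.symm⟩
  intro l hl
  have hr : ∀ t, l (.inr t) ∈ Q := by
    rintro ⟨j, k, k'⟩
    refine h (fun k => l (.inr (j, k, k'))) (fun i => ?_) k
    have := hl (.inr (j, i, k'))
    simp only [Fintype.sum_sum_type, e2, e3, mul_zero, Finset.sum_const_zero, zero_add] at this
    rw [Fintype.sum_prod_type, Finset.sum_eq_single j] at this
    · rw [Fintype.sum_prod_type] at this
      convert this using 1
      refine Finset.sum_congr rfl fun k _ => ?_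
      rw [Finset.sum_eq_single k']
      · simp
      · intro b _ hb; simp [hb.symm]
      · simp
    · intro b _ hb
      refine Finset.sum_eq_zero fun x _ => ?_
      simp [hb.symm]
    · simp
  have hlft : ∀ k, l (.inl k) ∈ Q := by
    refine h (fun k => l (.inl k)) (fun i => ?_)
    have := hl (.inl i)
    simp only [Fintype.sum_sum_type, e1] at this
    exact (Ideal.add_mem_iff_left _ (Q.sum_mem fun t _ => Q.mul_mem_right _ (hr t))).1 this
  rintro (k | t)
  · exact hlft k
  · exact hr t
end aug

section dsys
inductive DV (ιw ι κ κw ε τ : Type) : Type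
  | B (w : ιw) | Z (i : ι) | S1 | S2 | Q1 (k : κ) | Q2 (i : ι) | Q3 (k : κw) | T (e : ε) (t : τ)

instance {ιw ι κ κw ε τ : Type} [Finite ιw] [Finite ι] [Finite κ] [Finite κw] [Finite ε] [Finite τ] :
    Finite (DV ιw ι κ κw ε τ) := by
  let f : DV ιw ι κ κw ε τ → ιw ⊕ ι ⊕ Unit ⊕ Unit ⊕ κ ⊕ ι ⊕ κw ⊕ (ε × τ) := fun x => match x with
    | .B w => .inl w | .Z i => .inr (.inl i) | .S1 => .inr (.inr (.inl ())) | .S2 => .inr (.inr (.inr (.inl ())))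
    | .Q1 k => .inr (.inr (.inr (.inr (.inl k)))) | .Q2 k => .inr (.inr (.inr (.inr (.inr (.inl k)))))
    | .Q3 k => .inr (.inr (.inr (.inr (.inr (.inr (.inl k)))))) | .T e t => .inr (.inr (.inr (.inr (.inr (.inr (.inr (e, t)))))))
  refine Finite.of_injective f ?_
  intro x y h
  cases x <;> cases y <;> simp_all [f]

variable {S Λ : Type} [CommRing S] [CommRing Λ] [Algebra S Λ] {ιw ι κ κw τ : Type} [Fintype ι] [Fintype κ] [Fintype κw] [Fintype τ]

abbrev DE (ι κ κw : Type) := κ ⊕ ι ⊕ κw ⊕ Unit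
abbrev DV' (ιw ι κ κw τ : Type) := DV ιw ι κ κw (DE ι κ κw) τ

def eB : Option ιw → DV' ιw ι κ κw τ := fun o => o.elim .S1 .B

/-- the desingularising system -/
noncomputable def dsys (F : κ → MvPolynomial ι S) (M : ℕ) (ψh : ι → MvPolynomial (Option ιw) S)
    (Gh : κw → MvPolynomial (Option ιw) S) (ν : τ → S) : DE ι κ κw → MvPolynomial (DV' ιw ι κ κw τ) S
  | .inl k => X .S1 * X (.Q1 k) + X .S2 * rename .Z (F k) - ∑ t, C (ν t) * X (.T (.inl k) t)
  | .inr (.inl i) => X .S1 * (X .S1 ^ M * X (.Z i) - rename eB (ψh i)) + X .S2 * X (.Q2 i) - ∑ t, C (ν t) * X (.T (.inr (.inl i)) t)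
  | .inr (.inr (.inl k)) => X .S1 * rename eB (Gh k) + X .S2 * X (.Q3 k) - ∑ t, C (ν t) * X (.T (.inr (.inr (.inl k))) t)
  | .inr (.inr (.inr u)) => X .S1 * X .S2 - ∑ t, C (ν t) * X (.T (.inr (.inr (.inr u))) t)

theorem dv_sub' {γ : Type} (g : γ → Λ) (v : γ) (p q : MvPolynomial γ S) : dv g v (p - q) = dv g v p - dv g v q := by simp [dv]
theorem dv_sum' {γ δ : Type} [Fintype δ] (g : γ → Λ) (v : γ) (p : δ → MvPolynomial γ S) :
  dv g v (∑ i, p i) = ∑ i, dv g v (p i) := by simp [dv]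

theorem eB_inj : Function.Injective (eB : Option ιw → DV' ιw ι κ κw τ) := by
  intro x y h; cases x <;> cases y <;> simp_all [eB]

theorem dsys_indep_nu (F : κ → MvPolynomial ι S) (M : ℕ) (ψh : ι → MvPolynomial (Option ιw) S)
    (Gh : κw → MvPolynomial (Option ιw) S) (ν : τ → S) (g : DV' ιw ι κ κw τ → Λ) (Q : Ideal Λ) [hQ : Q.IsPrime]
    (t : τ) (ht : algebraMap S Λ (ν t) ∉ Q) : IndepMod Q (fun k i => dv g i (dsys F M ψh Gh ν k)) := by
  classical
  have h1 : ∀ e e' , dv g (.T e t) (dsys F M ψh Gh ν e') = if e' = e then - algebraMap S Λ (ν t) else 0 := by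
    have hZ : ∀ e (p : MvPolynomial ι S), dv g (.T e t) (rename DV.Z p) = 0 := fun e p => by
      rw [dv_rename_ne]; simp
    have hB : ∀ e (p : MvPolynomial (Option ιw) S), dv g (.T e t) (rename eB p) = 0 := fun e p => by
      rw [dv_rename_ne]; intro o; cases o <;> simp [eB]
    rintro e (k | i | k | u) <;>
    simp [dsys, dv_sub', dv_sum', dv_X, hZ, hB]
    all_goals
      split_ifs with h
      · simp [h]
      · simp [h]
  intro l hl e
  have := hl (.T e t)
  simp only [h1, mul_ite, mul_zero, Finset.sum_ite_eq', Finset.mem_univ, if_true] at this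
  rw [mul_neg, neg_mem_iff] at this
  exact (hQ.mem_or_mem this).resolve_right ht

theorem dsys_indep_P (F : κ → MvPolynomial ι S) (M : ℕ) (ψh : ι → MvPolynomial (Option ιw) S)
    (Gh : κw → MvPolynomial (Option ιw) S) (ν : τ → S) (g : DV' ιw ι κ κw τ → Λ) (Q : Ideal Λ) [hQ : Q.IsPrime]
    (hs1 : g .S1 ∉ Q) (hF : ∀ k, aeval (fun i => g (.Z i)) (F k) = 0) (hq2 : ∀ i, g (.Q2 i) = 0) (hq3 : ∀ i, g (.Q3 i) = 0)
    (hJ : IndepMod Q (fun k i => dv (fun o => g (eB o)) (some i) (Gh k))) :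
    IndepMod Q (fun k i => dv g i (dsys F M ψh Gh ν k)) := by
  classical
  intro l hl
  have c1 : ∀ k, l (.inl k) ∈ Q := by
    intro k
    have := hl (.Q1 k)
    have hZ : ∀ (p : MvPolynomial ι S), dv g (.Q1 k) (rename DV.Z p) = 0 := fun p => by
      rw [dv_rename_ne]; simp
    have hB : ∀ (p : MvPolynomial (Option ιw) S), dv g (.Q1 k) (rename eB p) = 0 := fun p => by
      rw [dv_rename_ne]; intro o; cases o <;> simp [eB]
    simp [Fintype.sum_sum_type, dsys, dv_sub', dv_sum', dv_X, hZ, hB] at this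
    exact (hQ.mem_or_mem this).resolve_right hs1
  have c4 : l (.inr (.inr (.inr ()))) ∈ Q := by
    have := hl .S2
    have hZ : ∀ (p : MvPolynomial ι S), dv g .S2 (rename DV.Z p) = 0 := fun p => by
      rw [dv_rename_ne]; simp
    have hB : ∀ (p : MvPolynomial (Option ιw) S), dv g .S2 (rename eB p) = 0 := fun p => by
      rw [dv_rename_ne]; intro o; cases o <;> simp [eB]
    simp [Fintype.sum_sum_type, dsys, dv_sub', dv_sum', dv_X, hZ, hB, aeval_rename, Function.comp_def, hF, hq2, hq3] at this
    exact (hQ.mem_or_mem this).resolve_right hs1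
  have c2 : ∀ i, l (.inr (.inl i)) ∈ Q := by
    intro i
    have := hl (.Z i)
    have hB : ∀ (p : MvPolynomial (Option ιw) S), dv g (.Z i) (rename eB p) = 0 := fun p => by
      rw [dv_rename_ne]; intro o; cases o <;> simp [eB]
    simp [Fintype.sum_sum_type, dsys, dv_sub', dv_sum', dv_X, hB] at this
    rw [Ideal.add_mem_iff_right _ (Q.sum_mem fun k _ => Q.mul_mem_right _ (c1 k))] at this
    exact (hQ.mem_or_mem this).resolve_right (fun h => (hQ.mem_or_mem h).elim hs1 (fun h => hs1 (hQ.mem_of_pow_mem _ h)))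
  have c3 : ∀ k, l (.inr (.inr (.inl k))) ∈ Q := by
    refine hJ _ (fun w => ?_)
    have := hl (.B w)
    have hZ : ∀ (p : MvPolynomial ι S), dv g (.B w) (rename DV.Z p) = 0 := fun p => by
      rw [dv_rename_ne]; simp
    have hB : ∀ (p : MvPolynomial (Option ιw) S), dv g (.B w) (rename eB p) = dv (fun o => g (eB o)) (some w) p := fun p => by
      have := dv_rename_inj (g := g) _ (eB_inj (ιw := ιw) (ι := ι) (κ := κ) (κw := κw) (τ := τ)) (some w) p
      exact this
    simp only [Fintype.sum_sum_type] at this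
    rw [Ideal.add_mem_iff_right _ (Q.sum_mem fun k _ => Q.mul_mem_right _ (c1 k)),
      Ideal.add_mem_iff_right _ (Q.sum_mem fun k _ => Q.mul_mem_right _ (c2 k)),
      Ideal.add_mem_iff_left _ (Q.sum_mem fun k _ => Q.mul_mem_right _ c4)] at this
    simp [dsys, dv_sub', dv_sum', dv_X, hZ, hB] at this
    simp_rw [mul_left_comm] at this
    rw [← Finset.mul_sum] at this
    exact (hQ.mem_or_mem this).resolve_left hs1
  rintro (k | i | k | u)
  exacts [c1 k, c2 i, c3 k, c4]

theorem dsys_indep_Q (F : κ → MvPolynomial ι S) (M : ℕ) (ψh : ι → MvPolynomial (Option ιw) S)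
    (Gh : κw → MvPolynomial (Option ιw) S) (ν : τ → S) (g : DV' ιw ι κ κw τ → Λ) (Q : Ideal Λ) [hQ : Q.IsPrime]
    (hs2 : g .S2 ∉ Q) (hq1 : ∀ i, g (.Q1 i) = 0)
    (hJ : IndepMod Q (fun k i => dv (fun i => g (.Z i)) i (F k))) :
    IndepMod Q (fun k i => dv g i (dsys F M ψh Gh ν k)) := by
  classical
  intro l hl
  have c2 : ∀ i, l (.inr (.inl i)) ∈ Q := by
    intro k
    have := hl (.Q2 k)
    have hZ : ∀ (p : MvPolynomial ι S), dv g (.Q2 k) (rename DV.Z p) = 0 := fun p => by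
      rw [dv_rename_ne]; simp
    have hB : ∀ (p : MvPolynomial (Option ιw) S), dv g (.Q2 k) (rename eB p) = 0 := fun p => by
      rw [dv_rename_ne]; intro o; cases o <;> simp [eB]
    simp [Fintype.sum_sum_type, dsys, dv_sub', dv_sum', dv_X, hZ, hB] at this
    exact (hQ.mem_or_mem this).resolve_right hs2
  have c3 : ∀ k, l (.inr (.inr (.inl k))) ∈ Q := by
    intro k
    have := hl (.Q3 k)
    have hZ : ∀ (p : MvPolynomial ι S), dv g (.Q3 k) (rename DV.Z p) = 0 := fun p => by
      rw [dv_rename_ne]; simp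
    have hB : ∀ (p : MvPolynomial (Option ιw) S), dv g (.Q3 k) (rename eB p) = 0 := fun p => by
      rw [dv_rename_ne]; intro o; cases o <;> simp [eB]
    simp [Fintype.sum_sum_type, dsys, dv_sub', dv_sum', dv_X, hZ, hB] at this
    exact (hQ.mem_or_mem this).resolve_right hs2
  have c1 : ∀ k, l (.inl k) ∈ Q := by
    refine hJ _ (fun i => ?_)
    have := hl (.Z i)
    have hZ : ∀ (p : MvPolynomial ι S), dv g (.Z i) (rename DV.Z p) = dv (fun i => g (.Z i)) i p := fun p => by
      have := dv_rename_inj (g := g) (DV.Z : ι → DV' ιw ι κ κw τ) (fun x y h => by simpa using h) i p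
      exact this
    simp only [Fintype.sum_sum_type] at this
    rw [Ideal.add_mem_iff_left] at this
    · simp [dsys, dv_sub', dv_sum', dv_X, hZ] at this
      simp_rw [mul_left_comm] at this
      rw [← Finset.mul_sum] at this
      exact (hQ.mem_or_mem this).resolve_left hs2
    · refine add_mem (Q.sum_mem fun k _ => Q.mul_mem_right _ (c2 k)) (add_mem (Q.sum_mem fun k _ => Q.mul_mem_right _ (c3 k)) ?_)
      simp [dsys, dv_sub', dv_sum', dv_X]
  have c4 : l (.inr (.inr (.inr ()))) ∈ Q := by
    have := hl .S1
    simp only [Fintype.sum_sum_type] at this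
    rw [Ideal.add_mem_iff_right _ (Q.sum_mem fun k _ => Q.mul_mem_right _ (c1 k)),
      Ideal.add_mem_iff_right _ (Q.sum_mem fun k _ => Q.mul_mem_right _ (c2 k)),
      Ideal.add_mem_iff_right _ (Q.sum_mem fun k _ => Q.mul_mem_right _ (c3 k))] at this
    simp [dsys, dv_sub', dv_sum', dv_X] at this
    exact (hQ.mem_or_mem this).resolve_right hs2
  rintro (k | i | k | u)
  exacts [c1 k, c2 i, c3 k, c4]

theorem aeval_dsys (F : κ → MvPolynomial ι S) (M : ℕ) (ψh : ι → MvPolynomial (Option ιw) S)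
    (Gh : κw → MvPolynomial (Option ιw) S) (ν : τ → S) (g : DV' ιw ι κ κw τ → Λ) :
    (∀ k, aeval g (dsys F M ψh Gh ν (.inl k)) = g .S1 * g (.Q1 k) + g .S2 * aeval (fun i => g (.Z i)) (F k) - ∑ t, algebraMap S Λ (ν t) * g (.T (.inl k) t)) ∧
    (∀ i, aeval g (dsys F M ψh Gh ν (.inr (.inl i))) = g .S1 * (g .S1 ^ M * g (.Z i) - aeval (fun o => g (eB o)) (ψh i)) + g .S2 * g (.Q2 i) - ∑ t, algebraMap S Λ (ν t) * g (.T (.inr (.inl i)) t)) ∧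
    (∀ k, aeval g (dsys F M ψh Gh ν (.inr (.inr (.inl k)))) = g .S1 * aeval (fun o => g (eB o)) (Gh k) + g .S2 * g (.Q3 k) - ∑ t, algebraMap S Λ (ν t) * g (.T (.inr (.inr (.inl k))) t)) ∧
    (∀ u, aeval g (dsys F M ψh Gh ν (.inr (.inr (.inr u)))) = g .S1 * g .S2 - ∑ t, algebraMap S Λ (ν t) * g (.T (.inr (.inr (.inr u))) t)) := by
  refine ⟨?_, ?_, ?_, ?_⟩ <;> intro x <;> simp [dsys, aeval_rename, Function.comp_def]
end dsys

end Part15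

section Part16
open MvPolynomial IsLocalRing

section
variable {S B Λ : Type} [CommRing S] [CommRing B] [CommRing Λ] [IsLocalRing Λ] [Algebra S Λ] [Algebra B Λ]
  [IsNoetherianRing Λ] [IsAdicComplete (maximalIdeal Λ) Λ] [IsNoetherianRing B] 

theorem aeval_map_et {ι : Type} (θ : S →+* etAlg B Λ) (hθ : ∀ s, (θ s : Λ) = algebraMap S Λ s) (f : ι → Λ) (p : MvPolynomial ι S) :
    aeval f (MvPolynomial.map θ p) = aeval f p := by
  rw [aeval_def, eval₂_map, aeval_def]
  congr 1
  ext s; exact hθ s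

theorem coe_aeval_et {ι : Type} (f : ι → etAlg B Λ) (p : MvPolynomial ι (etAlg B Λ)) :
    ((aeval f p : etAlg B Λ) : Λ) = aeval (fun i => (f i : Λ)) p := by
  have := MvPolynomial.aeval_algebraMap_apply Λ f p
  exact this.symm

theorem stepFinal (hB : DenseBase B Λ) {ι κ υ : Type} [Fintype ι] [Fintype κ] [Fintype υ] (θ : S →+* etAlg B Λ)
    (hθ : ∀ s, (θ s : Λ) = algebraMap S Λ s) (F : κ → MvPolynomial ι S) (U : υ → S) (hU : ∀ j, algebraMap S Λ (U j) ∈ maximalIdeal Λ)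
    (e M c : ℕ) (hc : 1 ≤ c) (hM : 2 * e + c ≤ M) (Z : ι ⊕ (υ × ι × κ) → Λ) (hZ : ∀ i, Z i ∈ etAlg B Λ)
    (h : ∀ k, aeval Z (augF F (fun j => U j ^ e) k) ∈ Ideal.span (Set.range fun j => algebraMap S Λ (U j) ^ M)) :
    ∃ f : ι → Λ, (∀ i, f i ∈ etAlg B Λ) ∧ (∀ i, f i - Z (.inl i) ∈ maximalIdeal Λ ^ c) ∧ ∀ k, aeval f (F k) = 0 := by
  classical
  have hUet : ∀ j, algebraMap S Λ (U j) ∈ etAlg B Λ := fun j => by rw [← hθ]; exact (θ _).2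
  let Z' : ι ⊕ (υ × ι × κ) → etAlg B Λ := fun i => ⟨Z i, hZ i⟩
  have hval : ∀ {γ : Type} (p : MvPolynomial γ S) (g : γ → etAlg B Λ), ((aeval g (MvPolynomial.map θ p) : etAlg B Λ) : Λ) = aeval (fun i => (g i : Λ)) p := by
    intro γ p g
    rw [coe_aeval_et, aeval_map_et θ hθ]
  have hk : ∀ k, ∃ a : υ → Λ, (∀ t, a t ∈ etAlg B Λ) ∧ aeval Z (augF F (fun j => U j ^ e) k) = ∑ t, a t * algebraMap S Λ (U t) ^ M := by
    intro k
    refine krull_et hB _ _ (fun t => pow_mem (hUet t) M) ?_ (h k)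
    rw [← hval (augF F (fun j => U j ^ e) k) Z']
    exact Subtype.mem _
  choose a ha ha' using hk
  let u' : υ → etAlg B Λ := fun j => ⟨algebraMap S Λ (U j), hUet j⟩
  let a' : (κ ⊕ (υ × κ × κ)) → υ → etAlg B Λ := fun k j => ⟨a k j, ha k j⟩
  have key := lemmaT c hc (fun k => MvPolynomial.map θ (F k)) (fun i => Z' (.inl i))
    (fun j i k => Z' (.inr (j, i, k))) (fun j => u' j ^ e) (fun k j => u' j ^ (M - 2 * e) * a' (.inl k) j)
    (fun i j k k' => u' i ^ (M - e) * a' (.inr (j, k, k')) i)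
  have hx := key ?_ ?_ ?_ ?_
  · obtain ⟨f, hf1, hf2, hf3⟩ := hx
    refine ⟨f, hf1, hf2, fun k => ?_⟩
    have := hf3 k
    rwa [aeval_map_et θ hθ] at this
  · intro k j
    have h1 : (algebraMap S Λ (U j)) ^ (M - 2 * e) ∈ maximalIdeal Λ ^ c :=
      Ideal.pow_le_pow_right (by omega) (Ideal.pow_mem_pow (hU j) _)
    exact Ideal.mul_mem_right _ _ h1
  · intro i j k k'
    have h1 : (algebraMap S Λ (U i)) ^ (M - e) ∈ maximalIdeal Λ := Ideal.pow_mem_of_mem _ (hU i) _ (by omega)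
    exact Ideal.mul_mem_right _ _ h1
  · intro k
    apply Subtype.ext
    rw [hval]
    have h1 := ha' (.inl k)
    rw [aeval_augF_inl] at h1
    refine h1.trans ?_
    rw [AddSubmonoidClass.coe_finset_sum]
    refine Finset.sum_congr rfl fun j _ => ?_
    simp only [MulMemClass.coe_mul, SubmonoidClass.coe_pow, u', a']
    rw [← mul_assoc, ← pow_add, ← pow_add, mul_comm]
    congr 2; omega
  · intro j k k'
    apply Subtype.ext
    have h1 := ha' (.inr (j, k, k'))
    rw [aeval_augF_inr, sub_eq_iff_eq_add] at h1
    rw [AddMemClass.coe_add, AddSubmonoidClass.coe_finset_sum, AddSubmonoidClass.coe_finset_sum]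
    have h2 : ∀ i, ((dv (fun i => Z' (.inl i)) i (MvPolynomial.map θ (F k)) : etAlg B Λ) : Λ) = dv (fun i => Z (.inl i)) i (F k) := by
      intro i
      rw [dv, pderiv_map, hval]; rfl
    simp only [MulMemClass.coe_mul, h2]
    refine h1.trans ?_
    rw [add_comm]
    congr 1
    · split_ifs <;> simp [u']
    · refine Finset.sum_congr rfl fun i _ => ?_
      simp only [SubmonoidClass.coe_pow, u', a']
      rw [← mul_assoc, ← pow_add, mul_comm]
      congr 2; omega
end

end Part16

section Part17
open MvPolynomial IsLocalRing

section
variable {Λ κ ι : Type} [CommRing Λ] [Fintype κ] [Fintype ι]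
open Classical in
/-- the ideal of scalars for which the matrix has a right inverse -/
noncomputable def jacI (J : κ → ι → Λ) : Ideal Λ where
  carrier := {δ | ∃ N : ι → κ → Λ, ∀ k k', ∑ i, J k i * N i k' = if k = k' then δ else 0}
  zero_mem' := ⟨0, by simp⟩
  add_mem' := by
    rintro a b ⟨N, hN⟩ ⟨N', hN'⟩
    refine ⟨fun i k => N i k + N' i k, fun k k' => ?_⟩
    simp only [mul_add, Finset.sum_add_distrib, hN, hN']
    split_ifs <;> simp
  smul_mem' := by
    rintro c a ⟨N, hN⟩
    refine ⟨fun i k => c * N i k, fun k k' => ?_⟩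
    simp only [mul_left_comm _ c, ← Finset.mul_sum, hN]
    split_ifs <;> simp

open Classical in
theorem mem_jacI {J : κ → ι → Λ} {δ : Λ} :
    δ ∈ jacI J ↔ ∃ N : ι → κ → Λ, ∀ k k', ∑ i, J k i * N i k' = if k = k' then δ else 0 := Iff.rfl

theorem indep_iff_jacI (J : κ → ι → Λ) (Q : Ideal Λ) [hQ : Q.IsPrime] : IndepMod Q J ↔ ¬ jacI J ≤ Q := by
  classical
  constructor
  · intro h hle
    obtain ⟨δ, hδ, N, hN⟩ := exists_rightInv_of_indepMod Q J h
    exact hδ (hle (mem_jacI.2 ⟨N, fun k k' => by rw [hN]⟩))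
  · intro h
    obtain ⟨δ, ⟨N, hN⟩, hδ⟩ := SetLike.not_le_iff_exists.1 h
    exact indepMod_of_rightInv Q J δ hδ N (fun k k' => by rw [hN]; convert Q.zero_mem using 1; split_ifs <;> simp)

theorem jacI_pow (J : κ → ι → Λ) (x : Λ) (h : ∀ Q : Ideal Λ, Q.IsPrime → ¬ IndepMod Q J → x ∈ Q) : ∃ e, x ^ e ∈ jacI J := by
  have : x ∈ (jacI J).radical := by
    rw [Ideal.radical_eq_sInf, Ideal.mem_sInf]
    rintro Q ⟨h1, h2⟩
    exact h Q h2 (by rw [indep_iff_jacI]; simpa using h1)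
  exact this
end

section
variable {S Λ : Type} [CommRing S] [CommRing Λ] [Algebra S Λ] {ι κ τ : Type} [Fintype ι] [Fintype κ] [Fintype τ]

theorem stepFwd (F : κ → MvPolynomial ι S) (f : ι → Λ) (hF : ∀ k, aeval f (F k) = 0) (U : Ideal S) (N : ℕ) (P : Ideal Λ) [hP : P.IsPrime]
    (T : Finset (Ideal Λ)) (ν : τ → S)
    (pr : Pre F f U N P (Ideal.span (Set.range fun t => algebraMap S Λ (ν t))) T) :
    ∃ g : DV' pr.ιw ι κ pr.κw τ → Λ, (∀ k, aeval g (dsys F pr.M pr.ψh pr.Gh ν k) = 0) ∧ (∀ i, g (.Z i) = f i) ∧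
      g .S1 = pr.s1 ∧ g .S2 = pr.s2 ∧ (∀ o, g (eB o) = o.elim pr.s1 pr.b) ∧
      ∀ Q : Ideal Λ, Q.IsPrime → ¬ IndepMod Q (fun k i => dv g i (dsys F pr.M pr.ψh pr.Gh ν k)) →
        (∀ t, algebraMap S Λ (ν t) ∈ Q) ∧ Q ≠ P ∧ (pr.s2 ∉ Q → ¬ IndepMod Q (fun k i => dv f i (F k))) := by
  classical
  choose a2 ha2 using fun i => Ideal.mem_span_range_iff_exists_fun.1 (pr.e2 i)
  choose a3 ha3 using fun i => Ideal.mem_span_range_iff_exists_fun.1 (pr.e3 i)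
  obtain ⟨a4, ha4⟩ := Ideal.mem_span_range_iff_exists_fun.1 pr.e4
  let g : DV' pr.ιw ι κ pr.κw τ → Λ := fun x => match x with
    | .B w => pr.b w | .Z i => f i | .S1 => pr.s1 | .S2 => pr.s2
    | .Q1 _ => 0 | .Q2 _ => 0 | .Q3 _ => 0
    | .T (.inl _) _ => 0
    | .T (.inr (.inl i)) t => a2 i t
    | .T (.inr (.inr (.inl k))) t => a3 k t
    | .T (.inr (.inr (.inr _))) t => a4 t
  have hgB : ∀ o, g (eB o) = o.elim pr.s1 pr.b := by intro o; cases o <;> rfl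
  have hgB' : (fun o => g (eB o)) = fun o => o.elim pr.s1 pr.b := funext hgB
  have hgZ : (fun i => g (.Z i)) = f := rfl
  obtain ⟨d1, d2, d3, d4⟩ := aeval_dsys F pr.M pr.ψh pr.Gh ν g
  refine ⟨g, ?_, fun i => rfl, rfl, rfl, hgB, ?_⟩
  · rintro (k | i | k | u)
    · rw [d1, hgZ, hF]; simp [g]
    · rw [d2, hgB']; simp only [g, mul_zero, add_zero]
      rw [← ha2, sub_eq_zero]; simp [mul_comm]
    · rw [d3, hgB']; simp only [g, mul_zero, add_zero]
      rw [← ha3, sub_eq_zero]; simp [mul_comm]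
    · rw [d4]; simp only [g]
      rw [← ha4, sub_eq_zero]; simp [mul_comm]
  · intro Q hQ hbad
    refine ⟨fun t => ?_, ?_, ?_⟩
    · by_contra h
      exact hbad (dsys_indep_nu F pr.M pr.ψh pr.Gh ν g Q t h)
    · rintro rfl
      refine hbad (dsys_indep_P F pr.M pr.ψh pr.Gh ν g Q pr.hs1 (by rw [hgZ]; exact hF) (fun i => rfl) (fun i => rfl) ?_)
      rw [hgB']; exact pr.hJ
    · intro h2 hI
      exact hbad (dsys_indep_Q F pr.M pr.ψh pr.Gh ν g Q h2 (fun i => rfl) hI)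
end

section
variable {S B Λ : Type} [CommRing S] [CommRing B] [CommRing Λ] [IsLocalRing Λ] [Algebra S Λ] [Algebra B Λ]
  [IsNoetherianRing Λ] [IsAdicComplete (maximalIdeal Λ) Λ] [IsNoetherianRing B]

theorem pow_mul_reg {V : Ideal Λ} {τ : Λ} (h : ∀ x, τ * x ∈ V → x ∈ V) (L : ℕ) : ∀ x, τ ^ L * x ∈ V → x ∈ V := by
  induction L with
  | zero => intro x hx; simpa using hx
  | succ L ih => intro x hx; exact h x (ih _ (by rwa [← mul_assoc, ← pow_succ]))

theorem stepBack (hB : DenseBase B Λ) {ι κ υ ιw κw : Type} [Fintype ι] [Fintype κ] [Fintype υ] [Fintype κw] (θ : S →+* etAlg B Λ)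
    (hθ : ∀ s, (θ s : Λ) = algebraMap S Λ s) (F0 : κ → MvPolynomial ι S) (u : υ → S) (hu : ∀ j, algebraMap S Λ (u j) ∈ maximalIdeal Λ)
    (e m c : ℕ) (hc : 1 ≤ c) (hm : 2 * e + c ≤ m)
    (ψ : ι ⊕ (υ × ι × κ) → MvPolynomial ιw S) (G : κw → MvPolynomial ιw S) (σ : MvPolynomial ιw S)
    (U : Ideal S) (N : ℕ) (hrel : ∀ k, σ * aeval ψ (augF F0 (fun j => u j ^ e) k) ∈ (U.map (C : S →+* MvPolynomial ιw S)) ^ N ⊔ Ideal.span (Set.range G))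
    (M : ℕ) (ψh : ι ⊕ (υ × ι × κ) → MvPolynomial (Option ιw) S) (Gh : κw → MvPolynomial (Option ιw) S) (σh : MvPolynomial (Option ιw) S)
    (hψh : ∀ i, ∀ (A : Type) [CommRing A] [Algebra S A] (y : ιw → A) (s : A),
        aeval (fun o : Option ιw => o.elim s (fun i => s * y i)) (ψh i) = s ^ M * aeval y (ψ i))
    (hGh : ∀ i, ∀ (A : Type) [CommRing A] [Algebra S A] (y : ιw → A) (s : A),
        aeval (fun o : Option ιw => o.elim s (fun i => s * y i)) (Gh i) = s ^ M * aeval y (G i))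
    (hσh : ∀ (A : Type) [CommRing A] [Algebra S A] (y : ιw → A) (s : A),
        aeval (fun o : Option ιw => o.elim s (fun i => s * y i)) σh = s ^ M * aeval y σ)
    (a0 : Λ) (hV : ∀ x ∈ U ^ N, a0 * algebraMap S Λ x ∈ Ideal.span (Set.range fun j => algebraMap S Λ (u j ^ m)))
    (g : DV' ιw (ι ⊕ (υ × ι × κ)) (κ ⊕ (υ × κ × κ)) κw υ → Λ) (hg : ∀ i, g i ∈ etAlg B Λ)
    (hd : ∀ k, aeval g (dsys (augF F0 (fun j => u j ^ e)) M ψh Gh (fun j => u j ^ m) k) = 0)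
    (hreg : ∀ x, (g .S1 * (a0 * aeval (fun o => g (eB o)) σh) + g .S2) * x ∈ Ideal.span (Set.range fun j => algebraMap S Λ (u j ^ m)) →
      x ∈ Ideal.span (Set.range fun j => algebraMap S Λ (u j ^ m))) :
    ∃ f : ι → Λ, (∀ i, f i ∈ etAlg B Λ) ∧ (∀ i, f i - g (.Z (.inl i)) ∈ maximalIdeal Λ ^ c) ∧ ∀ k, aeval f (F0 k) = 0 := by
  obtain ⟨d1, d2, d3, d4⟩ := aeval_dsys (augF F0 (fun j => u j ^ e)) M ψh Gh (fun j => u j ^ m) g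
  have hgB' : (fun o => g (eB o)) = fun o : Option ιw => o.elim (g .S1) (fun i => g (.B i)) := by funext o; cases o <;> rfl
  have hsum : ∀ t : υ → Λ, ∑ j, algebraMap S Λ (u j ^ m) * t j ∈ Ideal.span (Set.range fun j => algebraMap S Λ (u j ^ m)) := fun t =>
    Ideal.sum_mem _ fun j _ => Ideal.mul_mem_right _ _ (Ideal.subset_span ⟨j, rfl⟩)
  have key : ∀ k, aeval (fun i => g (.Z i)) (augF F0 (fun j => u j ^ e) k) ∈ Ideal.span (Set.range fun j => algebraMap S Λ (u j ^ m)) := by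
    intro k
    obtain ⟨L, hL⟩ := finLemma (augF F0 (fun j => u j ^ e)) ψ G σ U N hrel M ψh Gh σh hψh hGh hσh
      (Ideal.span (Set.range fun j => algebraMap S Λ (u j ^ m))) a0 hV (fun i => g (.B i)) (g .S1) (g .S2) (fun i => g (.Z i))
      (fun k => g (.Q1 k)) (fun k => g (.Q2 k)) (fun k => g (.Q3 k))
      (fun k => by have := d1 k; rw [hd, eq_comm, sub_eq_zero] at this; rw [this]; exact hsum _)
      (fun k => by have := d2 k; rw [hd, eq_comm, sub_eq_zero, hgB'] at this; rw [this]; exact hsum _)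
      (fun k => by have := d3 k; rw [hd, eq_comm, sub_eq_zero, hgB'] at this; rw [this]; exact hsum _)
      (by have := d4 (); rw [hd, eq_comm, sub_eq_zero] at this; rw [this]; exact hsum _) k
    rw [hgB'] at hreg
    exact pow_mul_reg hreg L _ hL
  refine stepFinal hB θ hθ F0 u hu e m c hc hm (fun i => g (.Z i)) (fun i => hg _) ?_
  simpa only [map_pow] using key
end

end Part17

section Part18
open MvPolynomial IsLocalRing

/-- auxiliary algebra structure by evaluation -/
@[reducible] noncomputable def algZ {R Λ ρ : Type} [CommRing R] [CommRing Λ] [Algebra R Λ] (z : ρ → Λ) : Algebra (MvPolynomial ρ R) Λ :=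
  (aeval z : MvPolynomial ρ R →ₐ[R] Λ).toRingHom.toAlgebra

theorem algZ_map {R Λ ρ : Type} [CommRing R] [CommRing Λ] [Algebra R Λ] (z : ρ → Λ) (s : MvPolynomial ρ R) :
  @algebraMap _ _ _ _ (algZ (R := R) z) s = aeval z s := rfl

theorem aeval_map_algZ {R Λ ρ : Type} [CommRing R] [CommRing Λ] [Algebra R Λ] (z : ρ → Λ) {ι : Type} (g : ι → Λ) (p : MvPolynomial ι R) :
    letI := algZ (R := R) z
    aeval g (MvPolynomial.map (C : R →+* MvPolynomial ρ R) p) = aeval g p := by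
  letI := algZ (R := R) z
  rw [aeval_def, eval₂_map, aeval_def]
  congr 1
  ext s
  show algebraMap (MvPolynomial ρ R) Λ (C s) = _
  rw [algZ_map, aeval_C]

theorem dv_map_algZ {R Λ ρ : Type} [CommRing R] [CommRing Λ] [Algebra R Λ] (z : ρ → Λ) {ι : Type} (g : ι → Λ) (i : ι) (p : MvPolynomial ι R) :
    letI := algZ (R := R) z
    dv g i (MvPolynomial.map (C : R →+* MvPolynomial ρ R) p) = dv g i p := by
  letI := algZ (R := R) z
  rw [dv, pderiv_map]
  exact aeval_map_algZ z g _

theorem height_lt' {Λ : Type} [CommRing Λ] [IsNoetherianRing Λ] {P Q : Ideal Λ} [P.IsPrime] [Q.IsPrime] (k : ℕ) (hk : (k : ℕ∞) ≤ P.height) (h : P < Q) :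
    ((k + 1 : ℕ) : ℕ∞) ≤ Q.height := by
  have hfin : P.FiniteHeight := inferInstance
  have h1 := Ideal.height_strict_mono_of_isPrime h
  have h2 := hk.trans_lt h1
  push_cast
  exact Order.add_one_le_of_lt h2

theorem stepT {Λ υ ζ : Type} [CommRing Λ] [IsNoetherianRing Λ] [Fintype υ] [Fintype ζ] (π : υ → Λ) (z : ζ → Λ) (a0 : Λ) (P : Ideal Λ) [hP : P.IsPrime]
    (hh : P.height = (Fintype.card υ + Fintype.card ζ : ℕ)) (hπ : ∀ i, π i ∈ P) (hz : ∀ i, z i ∈ P) (ha0 : a0 ∉ P)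
    (h1 : ∀ q : Ideal Λ, q.IsPrime → (∀ i, π i ∈ q) → (∀ i, z i ∈ q) → ((Fintype.card υ + Fintype.card ζ : ℕ) : ℕ∞) ≤ q.height)
    (h2 : ∀ q : Ideal Λ, q.IsPrime → (∀ i, π i ∈ q) → a0 ∈ q → ((Fintype.card υ + 1 : ℕ) : ℕ∞) ≤ q.height)
    (h3 : Fintype.card ζ = 0 → a0 = 1) (M : ℕ) :
    ∃ T : Finset (Ideal Λ), (∀ Q ∈ T, Q.IsPrime ∧ ¬ Q ≤ P ∧ ¬ P ≤ Q) ∧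
      (∀ x ∈ P, (∀ Q ∈ T, x ∈ Q) → ∃ E, x ^ E ∈ Ideal.span (Set.range (Sum.elim (fun i => π i ^ M) (fun j => (a0 * z j) ^ M)))) ∧
      (∀ s, (∀ Q ∈ T, s ∉ Q) → ∀ Q : Ideal Λ, Q.IsPrime → (∀ i, π i ∈ Q) → (∀ i, z i ∈ Q) → s ∈ Q → Q ≠ P →
        ((Fintype.card υ + Fintype.card ζ + 1 : ℕ) : ℕ∞) ≤ Q.height) ∧
      (∀ s, (∀ Q ∈ T, s ∉ Q) → ∀ Q : Ideal Λ, Q.IsPrime → (∀ i, π i ∈ Q) → a0 ∈ Q → s ∈ Q →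
        ((Fintype.card υ + 1 + 1 : ℕ) : ℕ∞) ≤ Q.height) := by
  classical
  let w1 : υ ⊕ ζ → Λ := Sum.elim π z
  let w2 : υ ⊕ Unit → Λ := Sum.elim π (fun _ => a0)
  have hw1 : ∀ Q : Ideal Λ, (∀ i, w1 i ∈ Q) ↔ (∀ i, π i ∈ Q) ∧ (∀ i, z i ∈ Q) := fun Q => by simp [w1]
  have hw2 : ∀ Q : Ideal Λ, (∀ i, w2 i ∈ Q) ↔ (∀ i, π i ∈ Q) ∧ a0 ∈ Q := fun Q => by simp [w2]
  let T1 := (Ideal.finite_minimalPrimes_of_isNoetherianRing Λ (Ideal.span (Set.range w1))).toFinset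
  let T2 := (Ideal.finite_minimalPrimes_of_isNoetherianRing Λ (Ideal.span (Set.range w2))).toFinset
  have hT1 : ∀ Q, Q ∈ T1 ↔ Q ∈ (Ideal.span (Set.range w1)).minimalPrimes := fun Q => by simp [T1]
  have hT2 : ∀ Q, Q ∈ T2 ↔ Q ∈ (Ideal.span (Set.range w2)).minimalPrimes := fun Q => by simp [T2]
  have mem1 : ∀ Q ∈ T1, Q.IsPrime ∧ (∀ i, π i ∈ Q) ∧ (∀ i, z i ∈ Q) := fun Q hQ => by
    have := (hT1 Q).1 hQ
    exact ⟨this.1.1, (hw1 Q).1 (span_range_le.1 this.1.2)⟩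
  have mem2 : ∀ Q ∈ T2, Q.IsPrime ∧ (∀ i, π i ∈ Q) ∧ a0 ∈ Q := fun Q hQ => by
    have := (hT2 Q).1 hQ
    exact ⟨this.1.1, (hw2 Q).1 (span_range_le.1 this.1.2)⟩
  have le1 : ∀ Q : Ideal Λ, Q.IsPrime → (∀ i, π i ∈ Q) → (∀ i, z i ∈ Q) → ∃ Q0 ∈ T1, Q0 ≤ Q := fun Q hQ ha hb => by
    obtain ⟨Q0, h, h'⟩ := Ideal.exists_minimalPrimes_le (span_range_le.2 ((hw1 Q).2 ⟨ha, hb⟩))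
    exact ⟨Q0, (hT1 _).2 h, h'⟩
  have le2 : ∀ Q : Ideal Λ, Q.IsPrime → (∀ i, π i ∈ Q) → a0 ∈ Q → ∃ Q0 ∈ T2, Q0 ≤ Q := fun Q hQ ha hb => by
    obtain ⟨Q0, h, h'⟩ := Ideal.exists_minimalPrimes_le (span_range_le.2 ((hw2 Q).2 ⟨ha, hb⟩))
    exact ⟨Q0, (hT2 _).2 h, h'⟩
  have hne2 : ∀ Q ∈ T2, Q ≠ P := by rintro Q hQ rfl; exact ha0 (mem2 _ hQ).2.2
  refine ⟨(T1 ∪ T2).erase P, ?_, ?_, ?_, ?_⟩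
  · intro Q hQ
    obtain ⟨hne, hQ⟩ := Finset.mem_erase.1 hQ
    rcases Finset.mem_union.1 hQ with hQ | hQ
    · obtain ⟨hp, hm⟩ := mem1 Q hQ
      have ht1 := h1 Q hp hm.1 hm.2
      have ht2 := minht w1 Q ((hT1 _).1 hQ)
      rw [Fintype.card_sum] at ht2
      refine ⟨hp, fun hle => ?_, fun hle => ?_⟩
      · have := height_lt' _ ht1 (lt_of_le_of_ne hle hne)
        rw [hh] at this
        have : _ ≤ _ := Nat.cast_le.1 this
        omega
      · have := height_lt' _ hh.ge (lt_of_le_of_ne hle hne.symm)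
        have : _ ≤ _ := Nat.cast_le.1 (this.trans ht2)
        omega
    · obtain ⟨hp, hm⟩ := mem2 Q hQ
      refine ⟨hp, fun hle => ha0 (hle hm.2), fun hle => ?_⟩
      have ht2 := minht w2 Q ((hT2 _).1 hQ)
      rw [Fintype.card_sum, Fintype.card_unit] at ht2
      have := height_lt' _ hh.ge (lt_of_le_of_ne hle hne.symm)
      have : _ ≤ _ := Nat.cast_le.1 (this.trans ht2)
      have h0 := h3 (by omega)
      rw [h0] at hm
      exact hp.ne_top ((Ideal.eq_top_iff_one _).2 hm.2)
  · intro x hxP hxT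
    have : x ∈ (Ideal.span (Set.range (Sum.elim (fun i => π i ^ M) (fun j => (a0 * z j) ^ M)))).radical := by
      rw [Ideal.radical_eq_sInf, Ideal.mem_sInf]
      rintro Q ⟨hQ1, hQ⟩
      have hQ2 := span_range_le.1 hQ1
      have hπ : ∀ i, π i ∈ Q := fun i => hQ.mem_of_pow_mem _ (hQ2 (.inl i))
      have hT' : ∀ Q0 ∈ T1 ∪ T2, x ∈ Q0 := by
        intro Q0 h0
        by_cases h : Q0 = P
        · rwa [h]
        · exact hxT _ (Finset.mem_erase.2 ⟨h, h0⟩)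
      by_cases ha : a0 ∈ Q
      · obtain ⟨Q0, h0, hle⟩ := le2 Q hQ hπ ha
        exact hle (hT' _ (Finset.mem_union_right _ h0))
      · obtain ⟨Q0, h0, hle⟩ := le1 Q hQ hπ (fun j => (hQ.mem_or_mem (hQ.mem_of_pow_mem _ (hQ2 (.inr j)))).resolve_left ha)
        exact hle (hT' _ (Finset.mem_union_left _ h0))
    exact this
  · intro s hs Q hQ ha hb hsQ hne
    obtain ⟨Q0, h0, hle⟩ := le1 Q hQ ha hb
    have hp := (mem1 _ h0).1
    refine height_lt' _ (h1 Q0 hp (mem1 _ h0).2.1 (mem1 _ h0).2.2) (lt_of_le_of_ne hle ?_)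
    rintro rfl
    exact hs _ (Finset.mem_erase.2 ⟨hne, Finset.mem_union_left _ h0⟩) hsQ
  · intro s hs Q hQ ha hb hsQ
    obtain ⟨Q0, h0, hle⟩ := le2 Q hQ ha hb
    have hp := (mem2 _ h0).1
    refine height_lt' _ (h2 Q0 hp (mem2 _ h0).2.1 (mem2 _ h0).2.2) (lt_of_le_of_ne hle ?_)
    rintro rfl
    exact hs _ (Finset.mem_erase.2 ⟨hne2 _ h0, Finset.mem_union_right _ h0⟩) hsQ

theorem sub_const_mem {R ρ : Type} [CommRing R] (p : MvPolynomial ρ R) :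
    p - C (constantCoeff p) ∈ Ideal.span (Set.range (X : ρ → MvPolynomial ρ R)) := by
  induction p using MvPolynomial.induction_on with
  | C a => simp
  | add p q hp hq =>
    have := Ideal.add_mem _ hp hq
    rw [map_add, C_add]; convert this using 1; ring
  | mul_X p i hp =>
    rw [map_mul, constantCoeff_X, mul_zero, C_0, sub_zero]
    exact Ideal.mul_mem_left _ _ (Ideal.subset_span ⟨i, rfl⟩)

theorem step_hb {R Λ : Type} [CommRing R] [CommRing Λ] [Algebra R Λ] {υ ρ : Type} [Fintype υ] (hR : JC R) (P : Ideal Λ) [hP : P.IsPrime]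
    (π : υ → R) (z : ρ → Λ) (hz : ∀ i, z i ∈ P) (hπ : ∀ i, algebraMap R Λ (π i) ∈ P) (hG : GInd (P.comap (algebraMap R Λ)) π)
    (ht : (P.comap (algebraMap R Λ)).height = Fintype.card υ) (s : MvPolynomial ρ R) (hs : aeval z s ∈ P) :
    ∃ σ : MvPolynomial ρ R, aeval z σ ∉ P ∧ σ * s ∈ Ideal.span (Set.range (Sum.elim (fun i => C (π i)) X : υ ⊕ ρ → MvPolynomial ρ R)) := by
  obtain ⟨σ, hσ, h⟩ := GInd.gen hR hG hπ ht
  have hX : Ideal.span (Set.range (X : ρ → MvPolynomial ρ R)) ≤ P.comap (aeval z : MvPolynomial ρ R →ₐ[R] Λ) := by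
    rw [span_range_le]; intro i; rw [Ideal.mem_comap, aeval_X]; exact hz i
  have h0 := hX (sub_const_mem s)
  rw [Ideal.mem_comap, map_sub, aeval_C] at h0
  have h1 : constantCoeff s ∈ P.comap (algebraMap R Λ) := by
    rw [Ideal.mem_comap]
    have := P.sub_mem hs h0
    simpa using this
  have h2 := h _ h1
  refine ⟨C σ, by rw [aeval_C]; exact hσ, ?_⟩
  have hI1 : Ideal.span (Set.range (X : ρ → MvPolynomial ρ R)) ≤ Ideal.span (Set.range (Sum.elim (fun i => C (π i)) X : υ ⊕ ρ → MvPolynomial ρ R)) := by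
    rw [span_range_le]; intro i; exact Ideal.subset_span ⟨.inr i, rfl⟩
  have hI2 : Ideal.span (Set.range π) ≤ (Ideal.span (Set.range (Sum.elim (fun i => C (π i)) X : υ ⊕ ρ → MvPolynomial ρ R))).comap C := by
    rw [span_range_le]; intro i; exact Ideal.subset_span ⟨.inl i, rfl⟩
  have e : C σ * s = C σ * (s - C (constantCoeff s)) + C (σ * constantCoeff s) := by rw [C_mul]; ring
  rw [e]
  exact Ideal.add_mem _ (Ideal.mul_mem_left _ _ (hI1 (sub_const_mem s))) (hI2 h2)

theorem step_N {R : Type} [CommRing R] {υ ρ : Type} [Fintype υ] [Fintype ρ] (π : υ → R) (a0 : R) (m : ℕ) :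
    ∃ N, 1 ≤ N ∧ ∀ x ∈ (Ideal.span (Set.range (Sum.elim (fun i => C (π i)) X : υ ⊕ ρ → MvPolynomial ρ R))) ^ N,
      C (a0 ^ m) * x ∈ Ideal.span (Set.range fun j => (Sum.elim (fun i => C (π i)) (fun i => C a0 * X i) : υ ⊕ ρ → MvPolynomial ρ R) j ^ m) := by
  set u : υ ⊕ ρ → MvPolynomial ρ R := Sum.elim (fun i => C (π i)) X with hu
  have : Ideal.span (Set.range u) ≤ (Ideal.span (Set.range fun j => u j ^ m)).radical := by
    rw [span_range_le]; intro i; exact ⟨m, Ideal.subset_span ⟨i, rfl⟩⟩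
  obtain ⟨N, hN⟩ := Ideal.exists_pow_le_of_le_radical_of_fg this (Submodule.fg_span (Set.finite_range _))
  refine ⟨N + 1, by omega, fun x hx => ?_⟩
  have h1 := hN (Ideal.pow_le_pow_right (Nat.le_succ N) hx)
  obtain ⟨c, hc⟩ := Ideal.mem_span_range_iff_exists_fun.1 h1
  rw [← hc, Finset.mul_sum]
  refine Ideal.sum_mem _ fun j _ => ?_
  rw [mul_left_comm]
  refine Ideal.mul_mem_left _ _ ?_
  rcases j with j | j
  · exact Ideal.mul_mem_left _ _ (Ideal.subset_span ⟨.inl j, rfl⟩)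
  · refine Ideal.subset_span ⟨.inr j, ?_⟩
    simp [u, mul_pow]

end Part18

section Part19
open MvPolynomial IsLocalRing

section
variable {R Λ : Type} (B : Type) [CommRing R] [CommRing B] [CommRing Λ] [IsLocalRing Λ] [Algebra R Λ] [Algebra B Λ]

/-- the system can be approximated to order `c` -/
def Approx {ι κ : Type} (F : κ → MvPolynomial ι R) (f : ι → Λ) (c : ℕ) : Prop :=
  ∃ f' : ι → Λ, (∀ i, f' i ∈ etAlg B Λ) ∧ (∀ i, f' i - f i ∈ maximalIdeal Λ ^ c) ∧ ∀ k, aeval f' (F k) = 0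
end

section
variable {R B Λ : Type} [CommRing R] [CommRing B] [CommRing Λ] [IsLocalRing Λ] [Algebra R B] [Algebra R Λ] [Algebra B Λ] [IsScalarTower R B Λ]
  [IsNoetherianRing R] [IsNoetherianRing Λ] [IsAdicComplete (maximalIdeal Λ) Λ] [IsNoetherianRing B] [Algebra ℚ Λ]

theorem step (hB : DenseBase B Λ) (hR : JC R) (hΛ : JC Λ) (hCM : CMp Λ) (hder : DerExt R Λ) {ι κ : Type} [Fintype ι] [Fintype κ]
    (F : κ → MvPolynomial ι R) (f : ι → Λ) (hF : ∀ k, aeval f (F k) = 0)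
    (PP : Finset (Ideal Λ)) (hprime : ∀ Q ∈ PP, Q.IsPrime)
    (hPP : ∀ Q : Ideal Λ, Q.IsPrime → ¬ IndepMod Q (fun k i => dv f i (F k)) → ∃ Q' ∈ PP, Q' ≤ Q)
    (P : Ideal Λ) (hP : P ∈ PP) (a h : ℕ)
    (ha : (P.comap (algebraMap R Λ)).height = a) (hh : P.height = h)
    (h1 : ∀ Q ∈ PP, (a : ℕ∞) ≤ (Ideal.comap (algebraMap R Λ) Q).height)
    (h2 : ∀ Q ∈ PP, (Ideal.comap (algebraMap R Λ) Q).height = a → (h : ℕ∞) ≤ Q.height) (c : ℕ) (hc : 1 ≤ c) :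
    ∃ (ι' κ' : Type) (_ : Fintype ι') (_ : Fintype κ') (F' : κ' → MvPolynomial ι' R) (f' : ι' → Λ), (∀ k, aeval f' (F' k) = 0) ∧
      (∀ Q : Ideal Λ, Q.IsPrime → ¬ IndepMod Q (fun k i => dv f' i (F' k)) →
        (¬ IndepMod Q (fun k i => dv f i (F k)) ∧ Q ≠ P) ∨ ((a + 1 : ℕ) : ℕ∞) ≤ (Q.comap (algebraMap R Λ)).height ∨
        ((a : ℕ∞) ≤ (Q.comap (algebraMap R Λ)).height ∧ ((h + 1 : ℕ) : ℕ∞) ≤ Q.height)) ∧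
      ∃ c', Approx B F' f' c' → Approx B F f c := by
  classical
  obtain ⟨r, π, z, a0, har, hg1, hg2, hzP, hG1, hG2, ht1, ht2, ha0, ht3, hr0⟩ := geom hR hΛ hder PP hprime P hP a h ha hh h1 h2
  have hPp : P.IsPrime := hprime P hP
  have hPm : P ≤ maximalIdeal Λ := IsLocalRing.le_maximalIdeal hPp.ne_top
  have hπP : ∀ i, algebraMap R Λ (π i) ∈ P := hg1 P hP
  let S := MvPolynomial (Fin r) R
  let u : Fin a ⊕ Fin r → S := Sum.elim (fun i => C (π i)) (fun i => C a0 * X i)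
  let u' : Fin a ⊕ Fin r → S := Sum.elim (fun i => C (π i)) X
  let J : κ → ι → Λ := fun k i => dv f i (F k)
  have hrad : ∀ j, ∃ e, (aeval z (u j)) ^ e ∈ jacI J := by
    intro j
    refine jacI_pow J _ fun Q hQ hbad => ?_
    obtain ⟨Q', hQ', hle⟩ := hPP Q hQ hbad
    refine hle ?_
    rcases j with j | j
    · simpa [u] using hg1 Q' hQ' j
    · simpa [u] using hg2 Q' hQ' j
  choose e' he' using hrad
  let e := ∑ j, e' j
  have he : ∀ j, (aeval z (u j)) ^ e ∈ jacI J := fun j =>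
    Ideal.pow_mem_of_pow_mem _ (he' j) (Finset.single_le_sum (f := e') (fun _ _ => Nat.zero_le _) (Finset.mem_univ j))
  choose Nm hNm using fun j => mem_jacI.1 (he j)
  let F1 : κ → MvPolynomial ι S := fun k => MvPolynomial.map C (F k)
  let F2 := augF F1 (fun j => u j ^ e)
  let f2 : ι ⊕ ((Fin a ⊕ Fin r) × ι × κ) → Λ := Sum.elim f (fun t => Nm t.1 t.2.1 t.2.2)
  have hF2 : letI := algZ (R := R) z; ∀ k, aeval f2 (F2 k) = 0 := by
    letI := algZ (R := R) z
    rintro (k | ⟨j, k, k'⟩)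
    · rw [aeval_augF_inl]
      show aeval f (F1 k) = 0
      rw [aeval_map_algZ]; exact hF k
    · rw [aeval_augF_inr, sub_eq_zero]
      refine Eq.trans ?_ ((hNm j k k').trans ?_)
      · refine Finset.sum_congr rfl fun i _ => ?_
        congr 1
        exact dv_map_algZ z f i (F k)
      · rw [map_pow, algZ_map]
  let m := 2 * e + c
  let ν : Fin a ⊕ Fin r → S := fun j => u j ^ m
  obtain ⟨N, hN, hNV⟩ := step_N (ρ := Fin r) π a0 m
  let U : Ideal S := Ideal.span (Set.range u')
  have hpcard : P.height = (Fintype.card (Fin a) + Fintype.card (Fin r) : ℕ) := by rw [hh]; simp [har]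
  have hcardht : ∀ q : Ideal Λ, q.IsPrime → (∀ i, algebraMap R Λ (π i) ∈ q) → algebraMap R Λ a0 ∈ q → ((Fintype.card (Fin a) + 1 : ℕ) : ℕ∞) ≤ q.height := by
    intro q hq hp h0
    rw [Fintype.card_fin]
    exact (ht3 (q.comap (algebraMap R Λ)) inferInstance hp h0).trans (ht_comap_le hR hΛ hder q)
  obtain ⟨T, hT1, hT2, hT3, hT4⟩ := stepT (fun i => algebraMap R Λ (π i)) z (algebraMap R Λ a0) P hpcard hπP hzP ha0
    (by rw [Fintype.card_fin, Fintype.card_fin, ← har]; exact ht2) hcardht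
    (by intro h0; rw [hr0 (by simpa using h0), map_one]) m
  have hνeq : ∀ z' : Fin r → Λ, (fun j => aeval z' (ν j)) = Sum.elim (fun i => algebraMap R Λ (π i) ^ m) (fun j => (algebraMap R Λ a0 * z' j) ^ m) := by
    intro z'
    funext j
    rcases j with j | j <;> simp [ν, u]
  have hVgen : ∀ z' : Fin r → Λ, ∀ x ∈ U ^ N, algebraMap R Λ a0 ^ m * aeval z' x ∈ Ideal.span (Set.range fun j => aeval z' (ν j)) := by
    intro z' x hx
    have h0 := Ideal.mem_map_of_mem (aeval z' : S →ₐ[R] Λ) (hNV x hx)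
    rw [Ideal.map_span, ← Set.range_comp, map_mul, aeval_C, map_pow] at h0
    exact h0
  obtain ⟨ιw, κw, fι, fκ, ψ, G, σ, hrel, M, ψh, Gh, σh, hψh, hGh, hσh, b, s1, s2, hs1, hs1T, hs2, hs2T, hσ, g, hgF, hgZ, hgS1, hgS2, hgB, hgbad⟩ :
    letI := algZ (R := R) z
    ∃ (ιw κw : Type) (_ : Fintype ιw) (_ : Fintype κw) (ψ : ι ⊕ ((Fin a ⊕ Fin r) × ι × κ) → MvPolynomial ιw S) (G : κw → MvPolynomial ιw S) (σ : MvPolynomial ιw S)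
    (_ : ∀ k, σ * aeval ψ (F2 k) ∈ (U.map (C : S →+* MvPolynomial ιw S)) ^ N ⊔ Ideal.span (Set.range G)) (M : ℕ)
    (ψh : ι ⊕ ((Fin a ⊕ Fin r) × ι × κ) → MvPolynomial (Option ιw) S) (Gh : κw → MvPolynomial (Option ιw) S) (σh : MvPolynomial (Option ιw) S)
    (_ : ∀ i, ∀ (A : Type) [CommRing A] [Algebra S A] (y : ιw → A) (s : A),
      aeval (fun o : Option ιw => o.elim s (fun i => s * y i)) (ψh i) = s ^ M * aeval y (ψ i))
    (_ : ∀ i, ∀ (A : Type) [CommRing A] [Algebra S A] (y : ιw → A) (s : A),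
      aeval (fun o : Option ιw => o.elim s (fun i => s * y i)) (Gh i) = s ^ M * aeval y (G i))
    (_ : ∀ (A : Type) [CommRing A] [Algebra S A] (y : ιw → A) (s : A),
      aeval (fun o : Option ιw => o.elim s (fun i => s * y i)) σh = s ^ M * aeval y σ)
    (b : ιw → Λ) (s1 s2 : Λ), s1 ∉ P ∧ (∀ Q ∈ T, s1 ∈ Q) ∧ s2 ∈ P ∧ (∀ Q ∈ T, s2 ∉ Q) ∧ aeval (fun o : Option ιw => o.elim s1 b) σh ∉ P ∧
    ∃ g : DV' ιw (ι ⊕ ((Fin a ⊕ Fin r) × ι × κ)) (κ ⊕ ((Fin a ⊕ Fin r) × κ × κ)) κw (Fin a ⊕ Fin r) → Λ,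
      (∀ k, aeval g (dsys F2 M ψh Gh ν k) = 0) ∧ (∀ i, g (.Z i) = f2 i) ∧
      g .S1 = s1 ∧ g .S2 = s2 ∧ (∀ o, g (eB o) = o.elim s1 b) ∧
      ∀ Q : Ideal Λ, Q.IsPrime → ¬ IndepMod Q (fun k i => dv g i (dsys F2 M ψh Gh ν k)) →
        (∀ t, algebraMap S Λ (ν t) ∈ Q) ∧ Q ≠ P ∧ (s2 ∉ Q → ¬ IndepMod Q (fun k i => dv f2 i (F2 k))) := by
    letI := algZ (R := R) z
    have hu' : (fun i => algebraMap S Λ (u' i)) = Sum.elim (fun i => algebraMap R Λ (π i)) z := by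
      funext i
      rw [algZ_map]
      rcases i with i | i <;> simp [u']
    have hu'P : ∀ i, algebraMap S Λ (u' i) ∈ P := by
      intro i
      have := congrFun hu' i
      rw [show algebraMap S Λ (u' i) = _ from this]
      rcases i with i | i
      · exact hπP i
      · exact hzP i
    obtain ⟨pr⟩ : Nonempty (Pre F2 f2 U N P (Ideal.span (Set.range fun j => algebraMap S Λ (ν j))) T) := by
     refine exists_pre F2 f2 hF2 u' N hN P _ T ?_ hu'P ?_ ?_ (algebraMap R Λ a0 ^ m) ?_ ?_ hT1 ?_
     · rw [hu']; exact hG2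
     · rw [hu']
       refine GInd.gen hΛ hG2 ?_ (by rw [hpcard]; simp)
       rw [← hu']; exact hu'P
     · intro s hs
       obtain ⟨σ, h3, h4⟩ := step_hb hR P π z hzP hπP hG1 (by rw [ha]; simp) s hs
       exact ⟨σ, h3, h4⟩
     · exact fun h0 => ha0 (hPp.mem_of_pow_mem _ h0)
     · have : Ideal.span (Set.range fun i => algebraMap S Λ (u' i)) ^ N = (U ^ N).map (algebraMap S Λ) := by
         rw [Ideal.map_pow, Ideal.map_span, ← Set.range_comp]; rfl
       rw [this]
       have hle : (U ^ N).map (algebraMap S Λ) ≤ Submodule.comap (LinearMap.mulLeft Λ (algebraMap R Λ a0 ^ m)) (Ideal.span (Set.range fun j => aeval z (ν j))) := by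
         rw [Ideal.map_le_iff_le_comap]
         intro x hx
         exact hVgen z x hx
       exact fun x hx => hle hx
     · intro x hx hxT
       have := hT2 x hx hxT
       rw [← hνeq] at this
       exact this
    obtain ⟨g, hgF, hgZ, hgS1, hgS2, hgB, hgbad⟩ := stepFwd F2 f2 hF2 U N P T ν pr
    exact ⟨pr.ιw, pr.κw, pr.fι, pr.fκ, pr.ψ, pr.G, pr.σ, pr.hrel, pr.M, pr.ψh, pr.Gh, pr.σh, pr.hψh, pr.hGh, pr.hσh, pr.b, pr.s1, pr.s2,
      pr.hs1, pr.hs1T, pr.hs2, pr.hs2T, pr.hσ, g, hgF, hgZ, hgS1, hgS2, hgB, hgbad⟩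
  choose q hq using fun k => exists_flat (dsys F2 M ψh Gh ν k)
  obtain ⟨σq, hσq⟩ := exists_flat σh
  have fin1 : Finite (DV' ιw (ι ⊕ ((Fin a ⊕ Fin r) × ι × κ)) (κ ⊕ ((Fin a ⊕ Fin r) × κ × κ)) κw (Fin a ⊕ Fin r)) := inferInstance
  have fin2 := Fintype.ofFinite (DV' ιw (ι ⊕ ((Fin a ⊕ Fin r) × ι × κ)) (κ ⊕ ((Fin a ⊕ Fin r) × κ × κ)) κw (Fin a ⊕ Fin r))
  refine ⟨_, _, inferInstanceAs (Fintype (Fin r ⊕ (DV' ιw (ι ⊕ ((Fin a ⊕ Fin r) × ι × κ)) (κ ⊕ ((Fin a ⊕ Fin r) × κ × κ)) κw (Fin a ⊕ Fin r)))),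
    inferInstance, q, Sum.elim z g, ?_, ?_, ?_⟩
  · intro k
    rw [(@hq k Λ _ _ (algZ (R := R) z) z (fun s => rfl) g).1]; exact hgF k
  · intro Q hQ hbad
    have hbad' : letI := algZ (R := R) z; ¬ IndepMod Q (fun k i => dv g i (dsys F2 M ψh Gh ν k)) := by
      intro hI
      refine hbad fun l hl => hI l fun i => ?_
      have := hl (.inr i)
      simpa only [fun k => (@hq k Λ _ _ (algZ (R := R) z) z (fun s => rfl) g).2] using this
    obtain ⟨b1, b2, b3⟩ := hgbad Q hQ hbad'
    have b1' : ∀ j, aeval z (u j) ∈ Q := fun j => hQ.mem_of_pow_mem m (by have := b1 j; rw [algZ_map] at this; simpa [ν] using this)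
    have hπQ : ∀ i, algebraMap R Λ (π i) ∈ Q := fun i => by simpa [u] using b1' (.inl i)
    by_cases ha0Q : algebraMap R Λ a0 ∈ Q
    · exact Or.inr (Or.inl (ht3 _ inferInstance hπQ ha0Q))
    have hzQ : ∀ i, z i ∈ Q := fun i => (hQ.mem_or_mem (show algebraMap R Λ a0 * z i ∈ Q by simpa [u] using b1' (.inr i))).resolve_left ha0Q
    by_cases hs2 : s2 ∈ Q
    · right; right
      refine ⟨ht1 (Q.comap (algebraMap R Λ)) inferInstance hπQ, ?_⟩
      have := hT3 s2 hs2T Q hQ hπQ hzQ hs2 b2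
      rwa [Fintype.card_fin, Fintype.card_fin, ← har] at this
    · left
      refine ⟨fun hI => b3 hs2 ?_, b2⟩
      letI := algZ (R := R) z
      refine augF_indep F1 _ f2 Q ?_
      have : (fun k i => dv (fun i => f2 (.inl i)) i (F1 k)) = fun k i => dv f i (F k) := by
        funext k i; exact dv_map_algZ z f i (F k)
      rw [this]; exact hI
  · -- the way back
    let sv : Option ιw → Λ := fun o => o.elim s1 b
    let τ : Λ := s1 * (algebraMap R Λ a0 ^ m * aeval (Sum.elim z sv) σq) + s2
    have hσqz : aeval (Sum.elim z sv) σq = @aeval _ _ _ _ _ (algZ (R := R) z) sv σh := (@hσq Λ _ _ (algZ (R := R) z) z (fun s => rfl) sv).1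
    have hτT : ∀ Q ∈ T, τ ∉ Q := by
      intro Q hQ h0
      have := (Ideal.add_mem_iff_right _ (Q.mul_mem_right (algebraMap R Λ a0 ^ m * aeval (Sum.elim z sv) σq) (hs1T Q hQ))).1 h0
      exact hs2T Q hQ this
    have hτP : τ ∉ P := by
      intro h0
      have := (Ideal.add_mem_iff_left _ hs2).1 h0
      rcases hPp.mem_or_mem this with h | h
      · exact hs1 h
      · rcases hPp.mem_or_mem h with h | h
        · exact ha0 (hPp.mem_of_pow_mem _ h)
        · rw [hσqz] at h; exact hσ h
    obtain ⟨c0, hc0, hnz⟩ := nzLemma hCM (fun i => algebraMap R Λ (π i)) z (algebraMap R Λ a0) τ m (by omega) (fun i => hPm (hπP i))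
      (fun i => hPm (hzP i)) hcardht (hT4 τ hτT) (fun Q hQ hp hz' hτ => hT3 τ hτT Q hQ hp hz' hτ (by rintro rfl; exact hτP hτ))
    refine ⟨c0 + c, ?_⟩
    rintro ⟨f', hf1, hf2, hf3⟩
    let z' : Fin r → Λ := fun i => f' (.inl i)
    let g' := fun i => f' (.inr i)
    have hf' : f' = Sum.elim z' g' := by funext i; cases i <;> rfl
    have hz'c : ∀ i, z' i - z i ∈ maximalIdeal Λ ^ (c0 + c) := fun i => hf2 (.inl i)
    have hg'c : ∀ i, g' i - g i ∈ maximalIdeal Λ ^ (c0 + c) := fun i => hf2 (.inr i)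
    let sv' : Option ιw → Λ := fun o => g' (eB o)
    have hsv : ∀ o, sv' o - sv o ∈ maximalIdeal Λ ^ (c0 + c) := by
      intro o
      have := hg'c (eB o)
      rwa [hgB o] at this
    have hσc : aeval (Sum.elim z' sv') σq - aeval (Sum.elim z sv) σq ∈ maximalIdeal Λ ^ (c0 + c) := by
      refine aeval_sub_mem _ _ _ ?_ _
      rintro (i | o)
      · exact hz'c i
      · exact hsv o
    letI := algZ (R := R) z'
    have hσqz' : aeval (Sum.elim z' sv') σq = aeval sv' σh := (hσq Λ z' (fun s => rfl) sv').1
    let τ' : Λ := g' .S1 * (algebraMap R Λ a0 ^ m * aeval sv' σh) + g' .S2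
    have hτc : τ' - τ ∈ maximalIdeal Λ ^ (c0 + c) := by
      have h1 := hg'c .S1
      have h2 := hg'c .S2
      rw [hgS1] at h1
      rw [hgS2] at h2
      rw [hσqz'] at hσc
      have : τ' - τ = (g' .S1 - s1) * (algebraMap R Λ a0 ^ m * aeval sv' σh) +
          s1 * algebraMap R Λ a0 ^ m * (aeval sv' σh - aeval (Sum.elim z sv) σq) + (g' .S2 - s2) := by
        simp only [τ', τ]; ring
      rw [this]
      exact Ideal.add_mem _ (Ideal.add_mem _ (Ideal.mul_mem_right _ _ h1) (Ideal.mul_mem_left _ _ hσc)) h2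
    let θ : S →+* etAlg B Λ := eval₂Hom ((algebraMap B (etAlg B Λ)).comp (algebraMap R B)) (fun i => ⟨z' i, hf1 (.inl i)⟩)
    have hθ : ∀ s, (θ s : Λ) = algebraMap S Λ s := by
      have : ((etAlg B Λ).val : etAlg B Λ →+* Λ).comp θ = (aeval z' : S →ₐ[R] Λ).toRingHom := by
        refine MvPolynomial.ringHom_ext (fun x => ?_) (fun i => ?_)
        · simp only [RingHom.comp_apply, θ, eval₂Hom_C]
          simp [IsScalarTower.algebraMap_apply R B Λ]
        · simp [θ]
      exact fun s => congrArg (fun φ : S →+* Λ => φ s) this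
    have hle : maximalIdeal Λ ^ (c0 + c) ≤ maximalIdeal Λ ^ c0 := Ideal.pow_le_pow_right (by omega)
    have hle1 : maximalIdeal Λ ^ (c0 + c) ≤ maximalIdeal Λ := Ideal.pow_le_self (by omega)
    have hνalg : (fun j => algebraMap S Λ (u j ^ m)) = fun j => aeval z' (ν j) := rfl
    obtain ⟨fr, k1, k2, k3⟩ := stepBack hB θ hθ F1 u (by
        rintro (j | j)
        · rw [algZ_map]; simpa [u] using hPm (hπP j)
        · rw [algZ_map]
          have := Ideal.add_mem _ (hle1 (hz'c j)) (hPm (hzP j))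
          rw [sub_add_cancel] at this
          simpa [u] using Ideal.mul_mem_left _ _ this) e m c hc le_rfl ψ G σ U N hrel M ψh Gh σh hψh hGh hσh
      (algebraMap R Λ a0 ^ m) (hVgen z') g' (fun i => hf1 _)
      (fun k => by
        have := hf3 k
        rw [hf', (hq k Λ z' (fun s => rfl) g').1] at this
        exact this)
      (by
        rw [hνalg, hνeq z']
        exact hnz z' τ' (fun i => hle (hz'c i)) (hle hτc))
    refine ⟨fr, k1, fun i => ?_, fun k => ?_⟩
    · have h5 := Ideal.add_mem _ (k2 i) (Ideal.pow_le_pow_right (show c ≤ c0 + c by omega) (hg'c (.Z (.inl i))))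
      rw [hgZ] at h5
      simpa [f2] using h5
    · have := k3 k
      rwa [aeval_map_algZ] at this
end

end Part19

section Part20
open MvPolynomial IsLocalRing

section
variable {R B Λ : Type} [CommRing R] [CommRing B] [CommRing Λ] [IsLocalRing Λ] [Algebra R B] [Algebra R Λ] [Algebra B Λ] [IsScalarTower R B Λ]
  [IsNoetherianRing R] [IsNoetherianRing Λ] [IsAdicComplete (maximalIdeal Λ) Λ] [IsNoetherianRing B]

theorem approx_base (hB : DenseBase B Λ) {ι κ : Type} [Fintype ι] [Fintype κ]
    (F : κ → MvPolynomial ι R) (f : ι → Λ) (hF : ∀ k, aeval f (F k) = 0)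
    (hI : IndepMod (maximalIdeal Λ) (fun k i => dv f i (F k))) (c : ℕ) (hc : 1 ≤ c) : Approx B F f c := by
  classical
  obtain ⟨δ, hδ, N, hN⟩ := exists_rightInv_of_indepMod _ _ hI
  have hδu : IsUnit δ := by simpa using hδ
  obtain ⟨δ', hδ'⟩ := hδu.exists_right_inv
  choose z hz using fun i => hB.dense (f i) c
  choose v hv using fun i k => hB.dense (N i k * δ') 1
  have hmem : ∀ b : B, algebraMap B Λ b ∈ etAlg B Λ := fun b => (etAlg B Λ).algebraMap_mem b
  let Z : ι → etAlg B Λ := fun i => ⟨algebraMap B Λ (z i), hmem _⟩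
  let V : Unit → ι → κ → etAlg B Λ := fun _ i k => ⟨algebraMap B Λ (v i k), hmem _⟩
  let θ : R →+* etAlg B Λ := (algebraMap B (etAlg B Λ)).comp (algebraMap R B)
  have hθ : ∀ s, (θ s : Λ) = algebraMap R Λ s := fun s => by
    rw [IsScalarTower.algebraMap_apply R B Λ]; rfl
  have hval : ∀ {γ : Type} (p : MvPolynomial γ R) (g : γ → etAlg B Λ), ((aeval g (MvPolynomial.map θ p) : etAlg B Λ) : Λ) = aeval (fun i => (g i : Λ)) p := by
    intro γ p g
    rw [coe_aeval_et, aeval_map_et θ hθ]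
  have hZf : ∀ i, (Z i : Λ) - f i ∈ maximalIdeal Λ ^ c := fun i => by
    have := Ideal.neg_mem_iff _ |>.2 (hz i)
    rwa [neg_sub] at this
  have hle1 : maximalIdeal Λ ^ c ≤ maximalIdeal Λ := Ideal.pow_le_self (by omega)
  let F1 : κ → MvPolynomial ι (etAlg B Λ) := fun k => MvPolynomial.map θ (F k)
  have h2 : ∀ k i, ((dv Z i (F1 k) : etAlg B Λ) : Λ) = dv (fun i => (Z i : Λ)) i (F k) := by
    intro k i
    simp only [F1, dv]
    rw [pderiv_map, hval]
  obtain ⟨f', h1, h3, h4⟩ := lemmaT c hc F1 Z V (fun _ => 1) (fun k _ => aeval Z (F1 k))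
    (fun _ j k k' => ∑ i, dv Z i (F1 k) * V j i k' - if k = k' then 1 else 0)
    (by
      intro k j
      rw [hval]
      have := aeval_sub_mem (maximalIdeal Λ ^ c) _ _ hZf (F k)
      rwa [hF, sub_zero] at this)
    (by
      intro _ j k k'
      have e1 : (((∑ i, dv Z i (F1 k) * V j i k' - if k = k' then 1 else 0 : etAlg B Λ)) : Λ) =
          ∑ i, (dv (fun i => (Z i : Λ)) i (F k) - dv f i (F k)) * algebraMap B Λ (v i k') -
          ∑ i, dv f i (F k) * (N i k' * δ' - algebraMap B Λ (v i k')) := by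
        rw [AddSubgroupClass.coe_sub, AddSubmonoidClass.coe_finset_sum]
        have e2 : (∑ i, dv f i (F k) * (N i k' * δ')) = if k = k' then 1 else 0 := by
          simp only [← mul_assoc, ← Finset.sum_mul]
          rw [hN]; split_ifs <;> simp [hδ']
        have e3 : (((if k = k' then 1 else 0 : etAlg B Λ)) : Λ) = if k = k' then 1 else 0 := by split_ifs <;> simp
        rw [e3, ← e2, ← Finset.sum_sub_distrib, ← Finset.sum_sub_distrib]
        refine Finset.sum_congr rfl fun i _ => ?_
        rw [MulMemClass.coe_mul, h2]
        simp only [V]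
        ring
      rw [e1]
      refine Ideal.sub_mem _ (Ideal.sum_mem _ fun i _ => Ideal.mul_mem_right _ _ ?_) (Ideal.sum_mem _ fun i _ => Ideal.mul_mem_left _ _ ?_)
      · exact aeval_sub_mem _ _ _ (fun i => hle1 (hZf i)) _
      · simpa using hv i k')
    (by intro k; simp) (by intro j k k'; simp)
  refine ⟨f', h1, fun i => ?_, fun k => ?_⟩
  · have := Ideal.add_mem _ (h3 i) (hZf i)
    simpa using this
  · have := h4 k
    rwa [aeval_map_et θ hθ] at this

theorem Approx.mono {ι κ : Type} {F : κ → MvPolynomial ι R} {f : ι → Λ} {c c' : ℕ} (h : c ≤ c') (H : Approx B F f c') : Approx B F f c := by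
  obtain ⟨f', h1, h2, h3⟩ := H
  exact ⟨f', h1, fun i => Ideal.pow_le_pow_right h (h2 i), h3⟩

/-- the weight of a prime -/
noncomputable def wgt (R : Type) {Λ : Type} [CommRing R] [CommRing Λ] [Algebra R Λ] (n : ℕ) (Q : Ideal Λ) : ℕ :=
  (n + 1) * (Q.comap (algebraMap R Λ)).height.toNat + Q.height.toNat

variable [Algebra ℚ Λ]
theorem thmA (hB : DenseBase B Λ) (hR : JC R) (hΛ : JC Λ) (hCM : CMp Λ) (hder : DerExt R Λ) {ι κ : Type} [Fintype ι] [Fintype κ]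
    (F : κ → MvPolynomial ι R) (f : ι → Λ) (hF : ∀ k, aeval f (F k) = 0) (c : ℕ) : Approx B F f c := by
  classical
  have hfin : (maximalIdeal Λ).FiniteHeight := inferInstance
  have hntop : (maximalIdeal Λ).height ≠ ⊤ := Ideal.height_ne_top (Ideal.IsPrime.ne_top inferInstance)
  obtain ⟨n, hn⟩ := ENat.ne_top_iff_exists.1 hntop
  have hQn : ∀ Q : Ideal Λ, Q.IsPrime → ∃ a h : ℕ, (Q.comap (algebraMap R Λ)).height = a ∧ Q.height = h ∧ h ≤ n ∧ wgt R n Q = (n + 1) * a + h := by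
    intro Q hQ
    have h1 : Q.height ≤ n := hn ▸ Ideal.height_mono (IsLocalRing.le_maximalIdeal hQ.ne_top)
    have h2 := (ht_comap_le hR hΛ hder Q).trans h1
    obtain ⟨h, hh⟩ := ENat.ne_top_iff_exists.1 (ne_top_of_le_ne_top (ENat.coe_ne_top n) h1)
    obtain ⟨a, ha⟩ := ENat.ne_top_iff_exists.1 (ne_top_of_le_ne_top (ENat.coe_ne_top n) h2)
    refine ⟨a, h, ha.symm, hh.symm, ?_, ?_⟩
    · rw [← hh] at h1; exact_mod_cast h1
    · rw [wgt, ← hh, ← ha]; simp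
  have hcn : ∀ Q : Ideal Λ, Q.IsPrime → (Q.comap (algebraMap R Λ)).height ≤ n := by
    intro Q hQ
    have h1 : Q.height ≤ n := hn ▸ Ideal.height_mono (IsLocalRing.le_maximalIdeal hQ.ne_top)
    exact (ht_comap_le hR hΛ hder Q).trans h1
  have hmin : ∀ {ι κ : Type} [Fintype ι] [Fintype κ] (J : κ → ι → Λ) (P : Ideal Λ), P.IsPrime → ¬ IndepMod P J →
      (∀ Q : Ideal Λ, Q.IsPrime → ¬ IndepMod Q J → wgt R n P ≤ wgt R n Q) → P ∈ (jacI J).minimalPrimes := by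
    intro ι κ _ _ J P hP hbad hle
    have h0 : jacI J ≤ P := by rw [indep_iff_jacI] at hbad; simpa using hbad
    obtain ⟨P0, hP0, hPle⟩ := Ideal.exists_minimalPrimes_le h0
    have hp0 := hP0.1.1
    rcases hPle.lt_or_eq with hlt | heq
    · exfalso
      have h1 := hle P0 hp0 (by rw [indep_iff_jacI]; simpa using hP0.1.2)
      obtain ⟨a, h, ha, hh, -, hw⟩ := hQn P hP
      obtain ⟨a', h', ha', hh', -, hw'⟩ := hQn P0 hp0
      have h2 := height_lt' h' hh'.ge hlt
      rw [hh] at h2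
      have h2' : h' + 1 ≤ h := by exact_mod_cast h2
      have h3 : (P0.comap (algebraMap R Λ)).height ≤ (P.comap (algebraMap R Λ)).height := Ideal.height_mono (Ideal.comap_mono hPle)
      rw [ha, ha'] at h3
      have h3' : a' ≤ a := by exact_mod_cast h3
      rw [hw, hw'] at h1
      have := Nat.mul_le_mul_left (n + 1) h3'
      omega
    · rwa [← heq]
  have main : ∀ d W : ℕ, W + d = (n + 1) * n + n + 1 → ∀ k : ℕ, ∀ (ι κ : Type) [Fintype ι] [Fintype κ] (F : κ → MvPolynomial ι R) (f : ι → Λ)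
      (T : Finset (Ideal Λ)) (c : ℕ), (∀ k, aeval f (F k) = 0) → 1 ≤ c → T.card = k →
      (∀ Q : Ideal Λ, Q.IsPrime → ¬ IndepMod Q (fun k i => dv f i (F k)) → W ≤ wgt R n Q ∧ (wgt R n Q = W → Q ∈ T)) → Approx B F f c := by
    intro d
    induction d with
    | zero =>
      intro W hW k ι κ _ _ F f T c hF hc _ hbad
      refine approx_base hB F f hF ?_ c hc
      by_contra hI
      have h1 := (hbad _ inferInstance hI).1
      obtain ⟨a, h, ha, hh, hhn, hw⟩ := hQn (maximalIdeal Λ) inferInstance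
      have h2 := hcn (maximalIdeal Λ) inferInstance
      rw [ha] at h2
      have h2' : a ≤ n := by exact_mod_cast h2
      have := Nat.mul_le_mul_left (n + 1) h2'
      omega
    | succ d ihd =>
      intro W hW k
      induction k using Nat.strong_induction_on with
      | _ k ihk =>
      intro ι κ _ _ F f T c hF hc hTk hbad
      let J : κ → ι → Λ := fun k i => dv f i (F k)
      let PP := (Ideal.finite_minimalPrimes_of_isNoetherianRing Λ (jacI J)).toFinset
      have hPPmem : ∀ Q, Q ∈ PP ↔ Q ∈ (jacI J).minimalPrimes := fun Q => by simp [PP]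
      have hPPbad : ∀ Q ∈ PP, Q.IsPrime ∧ ¬ IndepMod Q J := by
        intro Q hQ
        have h0 := (hPPmem Q).1 hQ
        have := h0.1.1
        exact ⟨this, by rw [indep_iff_jacI]; simpa using h0.1.2⟩
      have hPPle : ∀ Q : Ideal Λ, Q.IsPrime → ¬ IndepMod Q J → ∃ Q' ∈ PP, Q' ≤ Q := by
        intro Q hQ hb
        have h0 : jacI J ≤ Q := by rw [indep_iff_jacI] at hb; simpa using hb
        obtain ⟨P0, hP0, hPle⟩ := Ideal.exists_minimalPrimes_le h0
        exact ⟨P0, (hPPmem _).2 hP0, hPle⟩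
      by_cases hex : ∃ P : Ideal Λ, P.IsPrime ∧ ¬ IndepMod P J ∧ wgt R n P = W
      · obtain ⟨P, hP, hPb, hPW⟩ := hex
        have hPPP : P ∈ PP := (hPPmem _).2 (hmin J P hP hPb fun Q hQ hb => hPW ▸ (hbad Q hQ hb).1)
        obtain ⟨a, h, ha, hh, hhn, hw⟩ := hQn P hP
        obtain ⟨ι', κ', fi, fk, F', f', hF', hb', c', hc'⟩ := step hB hR hΛ hCM hder F f hF PP (fun Q hQ => (hPPbad Q hQ).1) hPPle P hPPP a h ha hh
          (by
            intro Q hQ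
            obtain ⟨a', h', ha', hh', hhn', hw'⟩ := hQn Q (hPPbad Q hQ).1
            have h1 := (hbad Q (hPPbad Q hQ).1 (hPPbad Q hQ).2).1
            rw [ha']
            have : a ≤ a' := by
              by_contra hlt
              have := Nat.mul_le_mul_left (n + 1) (show a' + 1 ≤ a by omega)
              rw [mul_add] at this
              omega
            exact_mod_cast this)
          (by
            intro Q hQ haa
            obtain ⟨a', h', ha', hh', hhn', hw'⟩ := hQn Q (hPPbad Q hQ).1
            have h1 := (hbad Q (hPPbad Q hQ).1 (hPPbad Q hQ).2).1
            rw [ha'] at haa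
            have haa' : a' = a := by exact_mod_cast haa
            subst haa'
            rw [hh']
            have : h ≤ h' := by omega
            exact_mod_cast this) c hc
        have hPT := (hbad P hP hPb).2 hPW
        refine hc' (Approx.mono (c' := c' + 1) (by omega) ?_)
        refine ihk (k - 1) ?_ ι' κ' F' f' (T.erase P) (c' + 1) hF' (by omega) ?_ ?_
        · have := Finset.card_pos.2 ⟨P, hPT⟩; omega
        · rw [Finset.card_erase_of_mem hPT, hTk]
        · intro Q hQ hb
          obtain ⟨a', h', ha', hh', hhn', hw'⟩ := hQn Q hQ
          rcases hb' Q hQ hb with ⟨h1, h2⟩ | h1 | ⟨h1, h2⟩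
          · exact ⟨(hbad Q hQ h1).1, fun h3 => Finset.mem_erase.2 ⟨h2, (hbad Q hQ h1).2 h3⟩⟩
          · rw [ha'] at h1
            have h1' : a + 1 ≤ a' := by exact_mod_cast h1
            have := Nat.mul_le_mul_left (n + 1) h1'
            rw [mul_add] at this
            exact ⟨by omega, fun h3 => by omega⟩
          · rw [ha'] at h1
            rw [hh'] at h2
            have h1' : a ≤ a' := by exact_mod_cast h1
            have h2' : h + 1 ≤ h' := by exact_mod_cast h2
            have := Nat.mul_le_mul_left (n + 1) h1'
            exact ⟨by omega, fun h3 => by omega⟩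
      · push Not at hex
        refine ihd (W + 1) (by omega) _ ι κ F f PP c hF hc rfl ?_
        have hW1 : ∀ Q : Ideal Λ, Q.IsPrime → ¬ IndepMod Q J → W + 1 ≤ wgt R n Q := fun Q hQ hb =>
          lt_of_le_of_ne (hbad Q hQ hb).1 (hex Q hQ hb).symm
        intro Q hQ hb
        exact ⟨hW1 Q hQ hb, fun h => (hPPmem _).2 (hmin J Q hQ hb fun Q' hQ' hb' => h ▸ hW1 Q' hQ' hb')⟩
  refine Approx.mono (c' := c + 1) (by omega) ?_
  let J : κ → ι → Λ := fun k i => dv f i (F k)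
  refine main _ 0 (zero_add _) _ ι κ F f (Ideal.finite_minimalPrimes_of_isNoetherianRing Λ (jacI J)).toFinset (c + 1) hF (by omega) rfl ?_
  intro Q hQ hb
  refine ⟨Nat.zero_le _, fun h => ?_⟩
  rw [Set.Finite.mem_toFinset]
  exact hmin J Q hQ hb fun Q' _ _ => h ▸ Nat.zero_le _
end

end Part20

section Part21
open MvPolynomial IsLocalRing

section derext
variable {B Λ : Type} [CommRing B] [CommRing Λ] [IsLocalRing Λ] [Algebra B Λ]

theorem der_pow {S : Type} [CommRing S] (P : Ideal S) (E : Der S) (k : ℕ) (x : S) (hx : x ∈ P ^ (k + 1)) : E x ∈ P ^ k := by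
  induction k generalizing x with
  | zero => simp
  | succ k ih =>
    rw [pow_succ] at hx
    refine Submodule.mul_induction_on hx ?_ ?_
    · intro a ha b hb
      rw [Derivation.leibniz, smul_eq_mul, smul_eq_mul]
      refine add_mem (Ideal.mul_mem_right _ _ ha) ?_
      rw [pow_succ, mul_comm b]
      exact Ideal.mul_mem_mul (ih a ha) hb
    · intro a b ha hb
      rw [map_add]
      exact add_mem ha hb

theorem adic_lim [IsAdicComplete (maximalIdeal Λ) Λ] (a : ℕ → Λ)
    (h : ∀ i j, i ≤ j → a i - a j ∈ maximalIdeal Λ ^ i) : ∃ L, ∀ i, a i - L ∈ maximalIdeal Λ ^ i := by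
  obtain ⟨L, hL⟩ := IsPrecomplete.prec (I := maximalIdeal Λ) inferInstance (f := a) (by
    intro m n hmn
    rw [SModEq.sub_mem, smul_eq_mul, Ideal.mul_top]
    exact h m n hmn)
  refine ⟨L, fun i => ?_⟩
  have := hL i
  rwa [SModEq.sub_mem, smul_eq_mul, Ideal.mul_top] at this

theorem adic_zero [IsAdicComplete (maximalIdeal Λ) Λ] (a : Λ)
    (h : ∀ i, a ∈ maximalIdeal Λ ^ i) : a = 0 := by
  refine IsHausdorff.haus (I := maximalIdeal Λ) inferInstance a fun n => ?_
  rw [SModEq.sub_mem, smul_eq_mul, Ideal.mul_top, sub_zero]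
  exact h n

theorem derExt_of_dense [IsAdicComplete (maximalIdeal Λ) Λ] (hB : DenseBase B Λ) : DerExt B Λ := by
  intro D
  set m := maximalIdeal Λ with hm
  have key : ∀ (b : B) (k : ℕ), algebraMap B Λ b ∈ m ^ (k + 1) → algebraMap B Λ (D b) ∈ m ^ k := by
    intro b k hb
    have h1 := der_pow _ D k b (hB.pow b _ hb)
    have h2 := Ideal.mem_map_of_mem (algebraMap B Λ) h1
    rw [Ideal.map_pow] at h2
    exact Ideal.pow_right_mono Ideal.map_comap_le k h2
  have ex : ∀ x : Λ, ∃ y : Λ, ∀ (k : ℕ) (b : B), x - algebraMap B Λ b ∈ m ^ (k + 1) → y - algebraMap B Λ (D b) ∈ m ^ k := by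
    intro x
    choose b hb using fun j => hB.dense x (j + 1)
    obtain ⟨L, hL⟩ := adic_lim (fun j => algebraMap B Λ (D (b j))) (by
      intro i j hij
      rw [← map_sub, ← map_sub]
      apply key
      rw [map_sub]
      have h1 := Ideal.pow_le_pow_right (Nat.succ_le_succ hij) (hb j)
      have := sub_mem h1 (hb i)
      simpa using this)
    refine ⟨L, fun k c hc => ?_⟩
    have h1 : algebraMap B Λ (D (b k)) - algebraMap B Λ (D c) ∈ m ^ k := by
      rw [← map_sub, ← map_sub]
      apply key
      rw [map_sub]
      have := sub_mem hc (hb k)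
      simpa using this
    have := sub_mem h1 (hL k)
    simpa using this
  choose E hE using ex
  have uniq : ∀ x y, (∀ k, ∃ b : B, x - algebraMap B Λ b ∈ m ^ (k + 1) ∧ y - algebraMap B Λ (D b) ∈ m ^ k) → E x = y := by
    intro x y h
    rw [← sub_eq_zero]
    refine adic_zero _ fun k => ?_
    obtain ⟨b, h1, h2⟩ := h k
    have := sub_mem (hE x k b h1) h2
    simpa using this
  refine ⟨Derivation.mk' ({ toFun := E, map_add' := ?_, map_smul' := ?_ } : Λ →ₗ[ℤ] Λ) ?_, ?_⟩
  · intro x y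
    refine uniq _ _ fun k => ?_
    obtain ⟨b, hb⟩ := hB.dense x (k + 1)
    obtain ⟨c, hc⟩ := hB.dense y (k + 1)
    refine ⟨b + c, ?_, ?_⟩
    · rw [map_add, add_sub_add_comm]; exact add_mem hb hc
    · rw [map_add, map_add, add_sub_add_comm]; exact add_mem (hE _ _ _ hb) (hE _ _ _ hc)
  · intro z x
    refine uniq _ _ fun k => ?_
    obtain ⟨b, hb⟩ := hB.dense x (k + 1)
    refine ⟨z • b, ?_, ?_⟩
    · rw [map_zsmul, ← smul_sub]; exact zsmul_mem hb z
    · rw [map_zsmul, map_zsmul, eq_intCast, Int.cast_id, ← smul_sub]; exact zsmul_mem (hE _ _ _ hb) z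
  · intro x y
    simp only [LinearMap.coe_mk, AddHom.coe_mk, smul_eq_mul]
    refine uniq _ _ fun k => ?_
    obtain ⟨b, hb⟩ := hB.dense x (k + 1)
    obtain ⟨c, hc⟩ := hB.dense y (k + 1)
    refine ⟨b * c, ?_, ?_⟩
    · have : x * y - algebraMap B Λ (b * c) = x * (y - algebraMap B Λ c) + algebraMap B Λ c * (x - algebraMap B Λ b) := by
        rw [map_mul]; ring
      rw [this]
      exact add_mem (Ideal.mul_mem_left _ _ hc) (Ideal.mul_mem_left _ _ hb)
    · have h0 : m ^ (k + 1) ≤ m ^ k := Ideal.pow_le_pow_right (Nat.le_succ k)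
      rw [Derivation.leibniz, smul_eq_mul, smul_eq_mul, map_add, map_mul, map_mul]
      have : x * E y + y * E x - (algebraMap B Λ b * algebraMap B Λ (D c) + algebraMap B Λ c * algebraMap B Λ (D b))
          = x * (E y - algebraMap B Λ (D c)) + (x - algebraMap B Λ b) * algebraMap B Λ (D c) +
            (y * (E x - algebraMap B Λ (D b)) + (y - algebraMap B Λ c) * algebraMap B Λ (D b)) := by ring
      rw [this]
      exact add_mem (add_mem (Ideal.mul_mem_left _ _ (hE _ _ _ hc)) (Ideal.mul_mem_right _ _ (h0 hb)))
        (add_mem (Ideal.mul_mem_left _ _ (hE _ _ _ hb)) (Ideal.mul_mem_right _ _ (h0 hc)))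
  · intro b
    exact uniq _ _ fun k => ⟨b, by simp, by simp⟩

/-- Theorem A with `R = B`. -/
theorem thmB [IsNoetherianRing B] [IsNoetherianRing Λ] [IsAdicComplete (maximalIdeal Λ) Λ] [Algebra ℚ Λ]
    (hB : DenseBase B Λ) (hJB : JC B) (hJΛ : JC Λ) (hCM : CMp Λ) {ι κ : Type} [Fintype ι] [Fintype κ]
    (F : κ → MvPolynomial ι B) (f : ι → Λ) (hF : ∀ k, aeval f (F k) = 0) (c : ℕ) : Approx B F f c :=
  thmA hB hJB hJΛ hCM (derExt_of_dense hB) F f hF c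

end derext

end Part21

section Part22
open IsLocalRing

section jcgen
theorem jc_unif {S : Type} [CommRing S] {P I : Ideal S} [hP : P.IsPrime] (hfg : P.FG)
    (h : ∀ x ∈ P, ∃ s ∉ P, s * x ∈ I) : ∃ s ∉ P, ∀ x ∈ P, s * x ∈ I := by
  classical
  obtain ⟨T, hT⟩ := hfg
  have hTP : ∀ t ∈ T, t ∈ P := fun t ht => hT ▸ Ideal.subset_span ht
  choose! s hs hs' using h
  refine ⟨∏ t ∈ T, s t, ?_, ?_⟩
  · rw [Ideal.IsPrime.prod_mem_iff]
    rintro ⟨t, ht, h⟩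
    exact hs t (hTP t ht) h
  · intro x hx
    rw [← hT] at hx
    refine Submodule.span_induction ?_ ?_ ?_ ?_ hx
    · intro t ht
      rw [← Finset.mul_prod_erase T s ht, mul_comm (s t), mul_assoc]
      exact Ideal.mul_mem_left _ _ (hs' t (hTP t ht))
    · simp
    · intro a b _ _ ha hb
      rw [mul_add]; exact add_mem ha hb
    · intro a b _ hb
      rw [smul_eq_mul, mul_left_comm]; exact Ideal.mul_mem_left _ _ hb

theorem height_le_of_gen {S : Type} [CommRing S] [IsNoetherianRing S] {P : Ideal S} [hP : P.IsPrime] {h : ℕ} (q : Fin h → S)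
    (hq : ∀ i, q i ∈ P) (s : S) (hs : s ∉ P) (hsP : ∀ x ∈ P, s * x ∈ Ideal.span (Set.range q)) :
    P.height ≤ h := by
  have hmin : P ∈ (Ideal.span (Set.range q)).minimalPrimes := by
    refine ⟨⟨hP, ?_⟩, ?_⟩
    · rw [Ideal.span_le]; rintro _ ⟨i, rfl⟩; exact hq i
    · rintro Q ⟨hQ, hQ'⟩ hQP x hx
      exact (hQ.mem_or_mem (hQ' (hsP x hx))).resolve_left fun h => hs (hQP h)
  refine (Ideal.height_le_card_of_mem_minimalPrimes_span (Set.finite_range q) hmin).trans ?_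
  have := Set.ncard_image_le (f := q) (s := Set.univ) Set.finite_univ
  rw [Set.image_univ, Set.ncard_univ, Nat.card_eq_fintype_card, Fintype.card_fin] at this
  exact_mod_cast this

theorem height_le_strictMono {A S : Type} [CommRing A] [CommRing S] (φ : Ideal A → Ideal S)
    (hφ : ∀ p : Ideal A, p.IsPrime → (φ p).IsPrime)
    (hlt : ∀ p q : Ideal A, p.IsPrime → q.IsPrime → p < q → φ p < φ q)
    (p : Ideal A) [hp : p.IsPrime] : p.height ≤ (φ p).height := by
  have := Order.height_le_height_apply_of_strictMono
    (fun p : PrimeSpectrum A => (⟨φ p.asIdeal, hφ _ p.2⟩ : PrimeSpectrum S))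
    (fun p q hpq => hlt p.asIdeal q.asIdeal p.2 q.2 hpq) ⟨p, hp⟩
  rw [← PrimeSpectrum.height_eq_orderHeight, ← PrimeSpectrum.height_eq_orderHeight] at this
  exact this

def JCat {S : Type} [CommRing S] (P : Ideal S) : Prop := ∃ (h : ℕ) (q : Fin h → S), P.height = h ∧ (∀ i, q i ∈ P) ∧
  GInd P q ∧ ∃ σ ∉ P, ∀ x ∈ P, σ * x ∈ Ideal.span (Set.range q)

theorem JCat.of_equiv {S T : Type} [CommRing S] [CommRing T] (e : S ≃+* T) (P : Ideal T) (hP : P.IsPrime)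
    (hS : JCat (P.comap e)) : JCat P := by
  have hP' : (P.comap e).IsPrime := Ideal.comap_isPrime _ _
  obtain ⟨h, q, hh, hq, hG, s, hs, hsP⟩ := hS
  refine ⟨h, fun i => e (q i), ?_, hq, ?_, e s, hs, ?_⟩
  · rw [← hh]; exact (e.height_comap P).symm
  · obtain ⟨δ, hδ, D, hD⟩ := hG.dual
    have key : ∀ D : Der S, ∃ D' : Der T, ∀ x, D' (e x) = e (D x) := by
      intro D
      refine ⟨Derivation.mk' ({ toFun := fun t => e (D (e.symm t)), map_add' := by simp, map_smul' := by simp } : T →ₗ[ℤ] T) ?_, ?_⟩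
      · intro a b
        simp [Derivation.leibniz]
      · intro x
        simp
    choose E hE using fun j => key (D j)
    refine GInd.of_dual (e δ) hδ E ?_
    intro i j
    rw [hE, hD]
    split <;> simp
  · intro x hx
    have h1 := hsP (e.symm x) (by rw [Ideal.mem_comap, e.apply_symm_apply]; exact hx)
    have h2 := Ideal.mem_map_of_mem e h1
    rw [Ideal.map_span, ← Set.range_comp] at h2
    rw [map_mul, e.apply_symm_apply] at h2
    exact h2

theorem JC.of_equiv {S T : Type} [CommRing S] [CommRing T] (e : S ≃+* T) (hS : JC S) : JC T :=
  fun P hP => JCat.of_equiv e P hP (hS _ (Ideal.comap_isPrime _ _))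
end jcgen

open Polynomial

theorem exists_polyDer {R : Type} [CommRing R] (D : Der R) :
    ∃ D' : Der R[X], ∀ r, D' (C r) = C (D r) := by
  refine ⟨PolynomialModule.equivPolynomialSelf.toLinearMap.compDer (D.mapCoeffs), fun r => ?_⟩
  show PolynomialModule.equivPolynomialSelf (D.mapCoeffs (C r)) = _
  rw [Derivation.mapCoeffs_C]
  rw [PolynomialModule.equivPolynomialSelf_apply_eq]
  erw [PolynomialModule.equivPolynomial_single]

theorem gind_snoc {S : Type} [CommRing S] {P : Ideal S} [hP : P.IsPrime] {h : ℕ} {q : Fin h → S} {f δ : S} (hδ : δ ∉ P)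
   (D : Fin h → Der S) (hD : ∀ i j, D j (q i) = if i = j then δ else 0) (E : Der S) (hE : ∀ i, E (q i) = 0)
   (hf : E f ∉ P) : GInd P (Fin.snoc q f : Fin (h + 1) → S) := by
  refine GInd.of_dual (δ * E f) (fun h => (hP.mem_or_mem h).elim hδ hf)
    (Fin.snoc (fun j => E f • D j - D j f • E) (δ • E) : Fin (h + 1) → Der S) ?_
  intro i j
  refine Fin.lastCases ?_ (fun i => ?_) i <;> refine Fin.lastCases ?_ (fun j => ?_) j
  · simp
  · have : Fin.last h ≠ j.castSucc := (Fin.castSucc_lt_last j).ne'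
    simp [this, mul_comm]
  · have : i.castSucc ≠ Fin.last h := (Fin.castSucc_lt_last i).ne
    simp [this, hE]
  · simp [hE, hD, mul_comm]

theorem JC_poly_aux {R : Type} [CommRing R] [IsNoetherianRing R] [Algebra ℚ R] (hR : JC R) (P : Ideal R[X]) (hP : P.IsPrime) :
    (∃ (h : ℕ) (q : Fin h → R[X]), P.height = h ∧ (∀ i, q i ∈ P) ∧
      GInd P q ∧ ∃ σ ∉ P, ∀ x ∈ P, σ * x ∈ Ideal.span (Set.range q)) ∧ P.height ≤ (P.comap C).height + 1 := by
  classical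
  set p := P.comap (C : R →+* R[X]) with hp
  have hpp : p.IsPrime := Ideal.comap_isPrime _ _
  obtain ⟨h, q, hh, hq, hG, s, hs, hsP⟩ := hR p hpp
  obtain ⟨δ, hδ, D, hD⟩ := hG.dual
  choose E hE using fun j => exists_polyDer (D j)
  have hmapP : p.map (C : R →+* R[X]) ≤ P := Ideal.map_comap_le
  have hprime : (p.map (C : R →+* R[X])).IsPrime := Ideal.isPrime_map_C_of_isPrime
  have hht : (h : ℕ∞) ≤ (p.map (C : R →+* R[X])).height := by
    rw [← hh]
    refine height_le_strictMono (fun p => p.map (C : R →+* R[X])) (fun p hp => Ideal.isPrime_map_C_of_isPrime) ?_ p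
    intro a b _ _ hab
    refine lt_of_le_of_ne (Ideal.map_mono hab.le) fun h => hab.ne ?_
    have h' : (a.map (C : R →+* R[X])).comap C = (b.map (C : R →+* R[X])).comap C := by rw [h]
    ext x
    have := congrArg (x ∈ ·) h'
    simp only [Ideal.mem_comap, Ideal.mem_map_C_iff, coeff_C, eq_iff_iff] at this
    constructor
    · intro hx
      have := (this.1 fun n => by split <;> simp [hx]) 0
      simpa using this
    · intro hx
      have := (this.2 fun n => by split <;> simp [hx]) 0
      simpa using this
  have hsmap : ∀ x ∈ p.map (C : R →+* R[X]), C s * x ∈ Ideal.span (Set.range fun i => C (q i)) := by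
    intro x hx
    refine Submodule.span_induction ?_ ?_ ?_ ?_ hx
    · rintro _ ⟨r, hr, rfl⟩
      rw [← C_mul]
      have := Ideal.mem_map_of_mem (C : R →+* R[X]) (hsP r hr)
      rw [Ideal.map_span, ← Set.range_comp] at this
      exact this
    · simp
    · intro a b _ _ ha hb
      rw [mul_add]; exact add_mem ha hb
    · intro a b _ hb
      rw [smul_eq_mul, mul_left_comm]; exact Ideal.mul_mem_left _ _ hb
  have hqP : ∀ i, C (q i) ∈ P := hq
  by_cases hcase : P = p.map C
  · have hle : P.height ≤ h := height_le_of_gen (fun i => C (q i)) hqP (C s) hs (fun x hx => hsmap x (hcase ▸ hx))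
    have heq : P.height = h := le_antisymm hle (hht.trans (Ideal.height_mono hmapP))
    refine ⟨⟨h, fun i => C (q i), heq, hqP, ?_, C s, hs, fun x hx => hsmap x (hcase ▸ hx)⟩, ?_⟩
    · refine GInd.of_dual (C δ) hδ E fun i j => ?_
      rw [hE, hD]; split <;> simp
    · rw [heq, hh]; exact le_self_add
  have hlt : p.map C < P := lt_of_le_of_ne hmapP (Ne.symm hcase)
  obtain ⟨f0, hf0, hf0'⟩ := SetLike.exists_of_lt hlt
  have hmem : ∀ a n, a ∈ p → C a * X ^ n ∈ P := fun a n ha => Ideal.mul_mem_right _ _ ha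
  have her : ∀ g ∈ P, g.leadingCoeff ∈ p → g.eraseLead ∈ P := by
    intro g hg hl
    have h1 := eraseLead_add_C_mul_X_pow g
    have := sub_mem hg (hmem g.leadingCoeff g.natDegree hl)
    rwa [← eq_sub_iff_add_eq.2 h1] at this
  have hex : ∀ (N : ℕ) (g : R[X]), g.degree < N → g ∈ P → g ∉ p.map C → ∃ g' ∈ P, g'.leadingCoeff ∉ p := by
    intro N
    induction N with
    | zero =>
      intro g hg _ hgp
      rw [Nat.cast_zero, ← not_le, zero_le_degree_iff, not_not] at hg
      exact (hgp (hg ▸ zero_mem _)).elim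
    | succ N ih =>
      intro g hg hgP hgp
      by_cases hl : g.leadingCoeff ∈ p
      · have hg0 : g ≠ 0 := fun h => hgp (h ▸ zero_mem _)
        refine ih g.eraseLead ?_ (her g hgP hl) ?_
        · have := degree_eraseLead_lt hg0
          exact lt_of_lt_of_le this (degree_le_of_natDegree_le (Nat.lt_succ_iff.1 ((natDegree_lt_iff_degree_lt hg0).2 hg)))
        · intro h
          apply hgp
          rw [← eraseLead_add_C_mul_X_pow g]
          exact add_mem h (Ideal.mul_mem_right _ _ (Ideal.mem_map_of_mem _ hl))
      · exact ⟨g, hgP, hl⟩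
  have hex' : ∃ n, ∃ g ∈ P, g.leadingCoeff ∉ p ∧ g.natDegree = n := by
    obtain ⟨g, h1, h2⟩ := hex (f0.natDegree + 1) f0 (lt_of_le_of_lt degree_le_natDegree (by exact_mod_cast Nat.lt_succ_self _)) hf0 hf0'
    exact ⟨_, g, h1, h2, rfl⟩
  obtain ⟨f, hfP, hfl, hfd⟩ := Nat.find_spec hex'
  have hmin : ∀ g ∈ P, g.leadingCoeff ∉ p → f.natDegree ≤ g.natDegree := by
    intro g h1 h2
    rw [hfd]
    exact Nat.find_min' hex' ⟨g, h1, h2, rfl⟩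
  have hd : 1 ≤ f.natDegree := by
    by_contra hlt
    have h0 : f.natDegree = 0 := by omega
    rw [natDegree_eq_zero] at h0
    obtain ⟨a, rfl⟩ := h0
    rw [leadingCoeff_C] at hfl
    exact hfl hfP
  have main : ∀ (N : ℕ) (g : R[X]), g.degree < N → g ∈ P → ∃ t ∉ p, C t * g ∈ Ideal.span {f} ⊔ p.map C := by
    intro N
    induction N with
    | zero =>
      intro g hg _
      rw [Nat.cast_zero, ← not_le, zero_le_degree_iff, not_not] at hg
      exact ⟨1, fun h => hpp.ne_top ((Ideal.eq_top_iff_one _).2 h), by simp [hg]⟩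
    | succ N ih =>
      intro g hg hgP
      by_cases hg0 : g = 0
      · exact ih g (by simp [hg0]) hgP
      have hg' : g.degree ≤ N := degree_le_of_natDegree_le (Nat.lt_succ_iff.1 ((natDegree_lt_iff_degree_lt hg0).2 hg))
      by_cases hl : g.leadingCoeff ∈ p
      · obtain ⟨t, ht, htI⟩ := ih g.eraseLead (lt_of_lt_of_le (degree_eraseLead_lt hg0) hg') (her g hgP hl)
        refine ⟨t, ht, ?_⟩
        rw [← eraseLead_add_C_mul_X_pow g, mul_add]
        exact add_mem htI (Ideal.mul_mem_left _ _ (Ideal.mem_sup_right (Ideal.mul_mem_right _ _ (Ideal.mem_map_of_mem _ hl))))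
      · have hdg := hmin g hgP hl
        have hf0 : f ≠ 0 := by rintro rfl; simp at hd
        set g' := C f.leadingCoeff * g - C g.leadingCoeff * X ^ (g.natDegree - f.natDegree) * f with hg'd
        have hP' : g' ∈ P := sub_mem (Ideal.mul_mem_left _ _ hgP) (Ideal.mul_mem_left _ _ hfP)
        have hdeg : g'.degree < g.degree := by
          rw [degree_eq_natDegree hg0, degree_lt_iff_coeff_zero]
          intro k hk
          have hk' : g.natDegree ≤ k := by exact_mod_cast hk
          rw [hg'd, coeff_sub, coeff_C_mul, mul_assoc, coeff_C_mul, coeff_X_pow_mul', if_pos (by omega)]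
          rcases hk'.eq_or_lt with h | h
          · rw [← h, show g.natDegree - (g.natDegree - f.natDegree) = f.natDegree by omega]
            simp only [coeff_natDegree]; ring
          · rw [coeff_eq_zero_of_natDegree_lt h, coeff_eq_zero_of_natDegree_lt (p := f) (by omega)]; simp
        obtain ⟨t, ht, htI⟩ := ih g' (lt_of_lt_of_le hdeg hg') hP'
        refine ⟨t * f.leadingCoeff, fun h => (hpp.mem_or_mem h).elim ht hfl, ?_⟩
        have : C (t * f.leadingCoeff) * g = C t * g' + C t * (C g.leadingCoeff * X ^ (g.natDegree - f.natDegree)) * f := by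
          rw [hg'd, C_mul]; ring
        rw [this]
        exact add_mem htI (Ideal.mem_sup_left (Ideal.mul_mem_left _ _ (Ideal.mem_span_singleton_self f)))
  set Q : Fin (h + 1) → R[X] := Fin.snoc (fun i => C (q i)) f with hQ
  have hQP : ∀ i, Q i ∈ P := by
    intro i
    refine Fin.lastCases ?_ (fun i => ?_) i
    · simpa [hQ] using hfP
    · simpa [hQ] using hqP i
  have hspan : ∀ x ∈ Ideal.span {f} ⊔ p.map C, C s * x ∈ Ideal.span (Set.range Q) := by
    intro x hx
    obtain ⟨a, ha, b, hb, rfl⟩ := Submodule.mem_sup.1 hx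
    rw [mul_add]
    refine add_mem (Ideal.mul_mem_left _ _ ?_) ?_
    · refine (Ideal.span_mono ?_) ha
      rintro _ rfl
      exact ⟨Fin.last h, by simp [hQ]⟩
    · refine (Ideal.span_mono ?_) (hsmap b hb)
      rintro _ ⟨i, rfl⟩
      exact ⟨i.castSucc, by simp [hQ]⟩
  obtain ⟨σ, hσ, hσP⟩ : ∃ σ ∉ P, ∀ x ∈ P, σ * x ∈ Ideal.span (Set.range Q) := by
    refine jc_unif (IsNoetherian.noetherian P) fun x hx => ?_
    obtain ⟨t, ht, htI⟩ := main (x.natDegree + 1) x (lt_of_le_of_lt degree_le_natDegree (by exact_mod_cast Nat.lt_succ_self _)) hx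
    refine ⟨C s * C t, fun h => (hP.mem_or_mem h).elim hs ht, ?_⟩
    rw [mul_assoc]; exact hspan _ htI
  have hle : P.height ≤ (h + 1 : ℕ) := height_le_of_gen Q hQP σ hσ hσP
  have hge : ((h + 1 : ℕ) : ℕ∞) ≤ P.height := by
    have := Ideal.height_add_one_le_of_lt_of_isPrime hlt
    refine le_trans ?_ this
    push_cast
    gcongr
  refine ⟨⟨h + 1, Q, le_antisymm hle hge, hQP, ?_, σ, hσ, hσP⟩, ?_⟩
  · have hder : derivative f ∉ P := by
      intro hmemd
      have hnat : f.coeff f.natDegree * (f.natDegree : R) ∉ p := by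
        intro h
        rcases hpp.mem_or_mem h with h | h
        · exact hfl h
        · have := Ideal.mul_mem_left p (algebraMap ℚ R (f.natDegree : ℚ)⁻¹) h
          rw [← map_natCast (algebraMap ℚ R), ← map_mul, inv_mul_cancel₀ (by positivity), map_one] at this
          exact hpp.ne_top ((Ideal.eq_top_iff_one _).2 this)
      have hc : (derivative f).coeff (f.natDegree - 1) = f.coeff f.natDegree * (f.natDegree : R) := by
        rw [coeff_derivative, Nat.sub_add_cancel hd]
        congr 1
        have := Nat.sub_add_cancel hd
        exact_mod_cast congrArg (Nat.cast : ℕ → R) this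
      have hnd : (derivative f).natDegree = f.natDegree - 1 := by
        refine le_antisymm (natDegree_derivative_le f) (le_natDegree_of_ne_zero ?_)
        rw [hc]; intro h; exact hnat (h ▸ zero_mem _)
      have := hmin _ hmemd (by rw [leadingCoeff, hnd, hc]; exact hnat)
      omega
    refine gind_snoc (δ := C δ) hδ E (fun i j => ?_) (derivative'.restrictScalars ℤ) ?_ ?_
    · rw [hE, hD]; split <;> simp
    · intro i; exact derivative_C
    · exact hder
  · rw [hh]; exact_mod_cast hle

theorem JC_poly {R : Type} [CommRing R] [IsNoetherianRing R] [Algebra ℚ R] (hR : JC R) : JC R[X] :=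
  fun P hP => (JC_poly_aux hR P hP).1

theorem JC_field {K : Type} [Field K] : JC K := by
  intro P hP
  have hP0 : P = ⊥ := (Ideal.eq_bot_or_top P).resolve_right hP.ne_top
  subst hP0
  refine ⟨0, fun i => 0, by simp, fun i => i.elim0, fun l _ k => k.elim0, 1, by simp, ?_⟩
  intro x hx
  rw [(Submodule.mem_bot K).1 hx]; simp

theorem JC_mvpoly_fin {K : Type} [Field K] [Algebra ℚ K] (n : ℕ) : JC (MvPolynomial (Fin n) K) := by
  induction n with
  | zero => exact JC_field.of_equiv (MvPolynomial.isEmptyRingEquiv K (Fin 0)).symm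
  | succ n ih => exact (JC_poly ih).of_equiv (MvPolynomial.finSuccEquiv K n).toRingEquiv.symm

theorem JC_mvpoly {K : Type} [Field K] [Algebra ℚ K] (s : Type) [Fintype s] : JC (MvPolynomial s K) :=
  (JC_mvpoly_fin (Fintype.card s)).of_equiv (MvPolynomial.renameEquiv K (Fintype.equivFin s).symm).toRingEquiv

end Part22

section Part23
open IsLocalRing PowerSeries

section ps
variable {A : Type} [CommRing A]

theorem mem_maxIdeal_ps [IsLocalRing A] (f : A⟦X⟧) : f ∈ maximalIdeal A⟦X⟧ ↔ constantCoeff f ∈ maximalIdeal A := by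
  rw [mem_maximalIdeal, mem_maximalIdeal, mem_nonunits_iff, mem_nonunits_iff, isUnit_iff_constantCoeff]

theorem coeff_mem_of_mem_pow [IsLocalRing A] (j : ℕ) : ∀ f ∈ (maximalIdeal A⟦X⟧) ^ j, ∀ i, coeff i f ∈ maximalIdeal A ^ (j - i) := by
  induction j with
  | zero => intro f _ i; simp
  | succ j ih =>
    intro f hf
    rw [pow_succ] at hf
    refine Submodule.mul_induction_on hf ?_ ?_
    · intro a ha b hb i
      rw [coeff_mul]
      refine sum_mem fun x hx => ?_
      have hx' := Finset.HasAntidiagonal.mem_antidiagonal.1 hx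
      have h1 := ih a ha x.1
      rcases Nat.eq_zero_or_pos x.2 with h | h
      · have h2 : coeff x.2 b ∈ maximalIdeal A := by
          rw [h, coeff_zero_eq_constantCoeff_apply]; exact (mem_maxIdeal_ps b).1 hb
        have := Ideal.mul_mem_mul h1 h2
        rw [← pow_succ] at this
        exact Ideal.pow_le_pow_right (by omega) this
      · exact Ideal.mul_mem_right _ _ (Ideal.pow_le_pow_right (by omega) h1)
    · intro a b ha hb i
      rw [map_add]; exact add_mem (ha i) (hb i)

theorem densePS [IsLocalRing A] : DenseBase (Polynomial A) A⟦X⟧ where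
  dense f j := by
    refine ⟨trunc j f, ?_⟩
    have hX : (X : A⟦X⟧) ∈ maximalIdeal A⟦X⟧ := by rw [mem_maxIdeal_ps]; simp
    have : (X : A⟦X⟧) ^ j ∣ f - (trunc j f : Polynomial A) := by
      rw [X_pow_dvd_iff]
      intro k hk
      rw [map_sub, Polynomial.coeff_coe, coeff_trunc, if_pos hk, sub_self]
    obtain ⟨g, hg⟩ := this
    change f - (trunc j f : Polynomial A) ∈ _
    rw [hg]
    exact Ideal.mul_mem_right _ _ (Ideal.pow_mem_pow hX j)
  pow b j hb := by
    have h1 := coeff_mem_of_mem_pow j _ hb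
    set n := (maximalIdeal A⟦X⟧).comap (algebraMap (Polynomial A) A⟦X⟧) with hn
    have hX : (Polynomial.X : Polynomial A) ∈ n := by
      rw [hn, Ideal.mem_comap, mem_maxIdeal_ps]
      change constantCoeff ((Polynomial.X : Polynomial A) : A⟦X⟧) ∈ _
      simp
    have hC : (maximalIdeal A).map Polynomial.C ≤ n := by
      rw [Ideal.map_le_iff_le_comap]
      intro a ha
      rw [hn, Ideal.mem_comap, Ideal.mem_comap, mem_maxIdeal_ps]
      change constantCoeff ((Polynomial.C a : Polynomial A) : A⟦X⟧) ∈ _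
      simpa using ha
    rw [Polynomial.as_sum_range_C_mul_X_pow b]
    refine sum_mem fun i _ => ?_
    have h2 : b.coeff i ∈ maximalIdeal A ^ (j - i) := by
      have := h1 i
      rwa [show algebraMap (Polynomial A) A⟦X⟧ b = (b : A⟦X⟧) from rfl, Polynomial.coeff_coe] at this
    have h3 := Ideal.mem_map_of_mem Polynomial.C h2
    rw [Ideal.map_pow] at h3
    have h4 := Ideal.mul_mem_mul (Ideal.pow_right_mono hC _ h3) (Ideal.pow_mem_pow hX i)
    rw [← pow_add] at h4
    exact Ideal.pow_le_pow_right (by omega) h4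

/-- coefficientwise extension -/
theorem ker_map_le {P : Ideal A⟦X⟧} {p : Ideal A} (hfg : p.FG) (hp : ∀ a ∈ p, C a ∈ P) :
    RingHom.ker (PowerSeries.map (Ideal.Quotient.mk p)) ≤ P := by
  intro f hf
  have hf' : ∀ i, coeff i f ∈ p := by
    intro i
    have := congrArg (coeff i) (RingHom.mem_ker.1 hf)
    rw [coeff_map, map_zero] at this
    exact Ideal.Quotient.eq_zero_iff_mem.1 this
  obtain ⟨n, g, hg⟩ := Submodule.fg_iff_exists_fin_generating_family.1 hfg
  have : ∀ i, ∃ c : Fin n → A, ∑ k, c k * g k = coeff i f := by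
    intro i
    have := hf' i
    rw [← hg] at this
    exact Ideal.mem_span_range_iff_exists_fun.1 this
  choose c hc using this
  have : f = ∑ k, PowerSeries.mk (fun i => c i k) * C (g k) := by
    ext i
    rw [map_sum, ← hc i]
    refine Finset.sum_congr rfl fun k _ => ?_
    rw [coeff_mul_C, coeff_mk]
  rw [this]
  refine sum_mem fun k _ => Ideal.mul_mem_left _ _ (hp _ ?_)
  rw [← hg]
  exact Ideal.subset_span ⟨k, rfl⟩

theorem height_ker_map (p : Ideal A) [hp : p.IsPrime] :
    p.height ≤ (RingHom.ker (PowerSeries.map (Ideal.Quotient.mk p))).height := by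
  refine height_le_strictMono (fun p => RingHom.ker (PowerSeries.map (Ideal.Quotient.mk p))) ?_ ?_ p
  · intro p hp
    exact RingHom.ker_isPrime _
  · have key : ∀ (p : Ideal A) (f : A⟦X⟧), f ∈ RingHom.ker (PowerSeries.map (Ideal.Quotient.mk p)) ↔ ∀ i, coeff i f ∈ p := by
      intro p f
      rw [RingHom.mem_ker, PowerSeries.ext_iff]
      refine forall_congr' fun i => ?_
      rw [coeff_map, map_zero, Ideal.Quotient.eq_zero_iff_mem]
    intro a b _ _ hab
    refine lt_of_le_of_ne (fun f hf => (key b f).2 fun i => hab.le ((key a f).1 hf i)) fun h => hab.not_ge fun x hx => ?_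
    have h1 : C x ∈ RingHom.ker (PowerSeries.map (Ideal.Quotient.mk b)) := (key b _).2 fun i => by
      rw [coeff_C]; split <;> simp [hx]
    have h2 := (key a _).1 (h.symm ▸ h1) 0
    simpa using h2

theorem JC_ps_reg [IsLocalRing A] [IsNoetherianRing A] [Algebra ℚ A] [IsAdicComplete (maximalIdeal A) A]
    [IsAdicComplete (maximalIdeal A⟦X⟧) A⟦X⟧] (hA : JC A) (P : Ideal A⟦X⟧) (hP : P.IsPrime) (w : A⟦X⟧) (hw : w ∈ P)
    (hreg : w.map (residue A) ≠ 0) :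
    ∃ (h : ℕ) (q : Fin h → A⟦X⟧), P.height = h ∧ (∀ i, q i ∈ P) ∧
      GInd P q ∧ ∃ σ ∉ P, ∀ x ∈ P, σ * x ∈ Ideal.span (Set.range q) := by
  set P0 := P.comap (algebraMap (Polynomial A) A⟦X⟧) with hP0
  have hP0p : P0.IsPrime := Ideal.comap_isPrime _ _
  obtain ⟨⟨h, q, hh, hq, hG, s, hs, hsP⟩, hht⟩ := JC_poly_aux hA P0 hP0p
  obtain ⟨w0, u, hwf⟩ := exists_isWeierstrassFactorization hreg
  have hw0 : (w0 : A⟦X⟧) ∈ P := by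
    have := hwf.eq_mul ▸ hw
    refine (hP.mem_or_mem this).resolve_right fun h => hP.ne_top (Ideal.eq_top_of_isUnit_mem _ h hwf.isUnit)
  have hspan : ∀ x ∈ P0, algebraMap (Polynomial A) A⟦X⟧ s * algebraMap (Polynomial A) A⟦X⟧ x ∈
      Ideal.span (Set.range fun i => algebraMap (Polynomial A) A⟦X⟧ (q i)) := by
    intro x hx
    have := Ideal.mem_map_of_mem (algebraMap (Polynomial A) A⟦X⟧) (hsP x hx)
    rw [Ideal.map_span, ← Set.range_comp, map_mul] at this
    exact this
  have hgen : ∀ x ∈ P, algebraMap (Polynomial A) A⟦X⟧ s * x ∈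
      Ideal.span (Set.range fun i => algebraMap (Polynomial A) A⟦X⟧ (q i)) := by
    intro x hx
    obtain ⟨t, r, hd⟩ := exists_isWeierstrassDivision x hreg
    have hx' := hd.eq_mul_add
    have hr : r ∈ P0 := by
      rw [hP0, Ideal.mem_comap]
      have := sub_mem hx (Ideal.mul_mem_right t _ hw)
      rwa [hx', add_sub_cancel_left] at this
    rw [hx', mul_add]
    refine add_mem ?_ (hspan r hr)
    rw [hwf.eq_mul, mul_assoc, ← mul_assoc]
    exact Ideal.mul_mem_right _ _ (hspan w0 hw0)
  have hle : P.height ≤ h := height_le_of_gen (fun i => algebraMap (Polynomial A) A⟦X⟧ (q i)) hq _ hs hgen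
  refine ⟨h, fun i => algebraMap (Polynomial A) A⟦X⟧ (q i), le_antisymm hle ?_, hq, GInd.ext (derExt_of_dense densePS) P hG, _, hs, hgen⟩
  rw [← hh]
  refine hht.trans ?_
  set p := P0.comap (Polynomial.C : A →+* Polynomial A) with hp
  have hpp : p.IsPrime := Ideal.comap_isPrime _ _
  have h1 := height_ker_map p
  haveI h2 : (RingHom.ker (PowerSeries.map (Ideal.Quotient.mk p))).IsPrime := RingHom.ker_isPrime _
  have h3 : RingHom.ker (PowerSeries.map (Ideal.Quotient.mk p)) < P := by
    refine lt_of_le_of_ne (ker_map_le (IsNoetherian.noetherian p) ?_) ?_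
    · intro a ha
      have : algebraMap (Polynomial A) A⟦X⟧ (Polynomial.C a) ∈ P := ha
      rwa [show algebraMap (Polynomial A) A⟦X⟧ (Polynomial.C a) = C a from Polynomial.coe_C a] at this
    · intro h
      have h4 := RingHom.mem_ker.1 (h.symm ▸ hw0)
      have h5 := congrArg (coeff w0.natDegree) h4
      rw [coeff_map, Polynomial.coeff_coe, Polynomial.coeff_natDegree, hwf.isDistinguishedAt.monic, map_one, map_zero] at h5
      exact one_ne_zero h5
  refine le_trans ?_ (Ideal.height_add_one_le_of_lt_of_isPrime h3)
  gcongr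

end ps

end Part23

section Part24
open IsLocalRing

section mvps
open MvPowerSeries
variable {K : Type} [Field K] {s : Type}

theorem mv_mem_span [Fintype s] (f : MvPowerSeries s K) (n : ℕ) (hf : ∀ d, d.degree < n + 1 → coeff d f = 0) :
    ∃ g : s → MvPowerSeries s K, f = ∑ i, X i * g i ∧ ∀ i d, d.degree < n → coeff d (g i) = 0 := by
  classical
  have hp : ∀ d : s →₀ ℕ, ∃ i : Option s, (d = 0 ∧ i = none) ∨ ∃ j, i = some j ∧ d j ≠ 0 := by
    intro d
    by_cases h : d = 0
    · exact ⟨none, .inl ⟨h, rfl⟩⟩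
    · obtain ⟨j, hj⟩ := DFunLike.ne_iff.1 h
      exact ⟨some j, .inr ⟨j, rfl, hj⟩⟩
  choose pick hpick using hp
  let g : s → MvPowerSeries s K := fun i d => if pick (d + Finsupp.single i 1) = some i then coeff (d + Finsupp.single i 1) f else 0
  have hg : ∀ i d, coeff d (g i) = if pick (d + Finsupp.single i 1) = some i then coeff (d + Finsupp.single i 1) f else 0 :=
    fun i d => rfl
  refine ⟨g, ?_, ?_⟩
  · ext d
    rw [map_sum]
    have : ∀ i, coeff d (X i * g i) = if pick d = some i then coeff d f else 0 := by
      intro i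
      rw [X_def, coeff_monomial_mul, one_mul, hg]
      by_cases h1 : Finsupp.single i 1 ≤ d
      · rw [if_pos h1, tsub_add_cancel_of_le h1]
      · rw [if_neg h1, if_neg]
        intro h2
        rcases hpick d with ⟨_, h⟩ | ⟨j, h, hj⟩
        · rw [h] at h2; cases h2
        · rw [h] at h2; cases h2
          exact h1 (by rw [Finsupp.single_le_iff]; omega)
    rw [Finset.sum_congr rfl fun i _ => this i]
    rcases hpick d with ⟨h0, h⟩ | ⟨j, h, hj⟩
    · rw [hf d (by simp [h0])]; simp
    · simp [h]
  · intro i d hd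
    rw [hg]
    split_ifs
    · exact hf _ (by simp; omega)
    · rfl

theorem mem_pow_of_coeff [Fintype s] (j : ℕ) : ∀ f : MvPowerSeries s K, (∀ d, d.degree < j → coeff d f = 0) →
    f ∈ (Ideal.span (Set.range X) : Ideal (MvPowerSeries s K)) ^ j := by
  induction j with
  | zero => intro f _; simp
  | succ j ih =>
    intro f hf
    obtain ⟨g, rfl, hg⟩ := mv_mem_span f j hf
    refine sum_mem fun i _ => ?_
    rw [pow_succ']
    exact Ideal.mul_mem_mul (Ideal.subset_span ⟨i, rfl⟩) (ih _ (hg i))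

theorem mv_max [Fintype s] : maximalIdeal (MvPowerSeries s K) = Ideal.span (Set.range X) := by
  apply le_antisymm
  · intro f hf
    have h0 : constantCoeff f = 0 := by
      by_contra h
      exact hf (MvPowerSeries.isUnit_iff_constantCoeff.2 (isUnit_iff_ne_zero.2 h))
    have := mem_pow_of_coeff 1 f (fun d hd => by
      have : d = 0 := (Finsupp.degree_eq_zero_iff d).1 (by omega)
      rw [this]; exact h0)
    simpa using this
  · rw [Ideal.span_le]
    rintro _ ⟨i, rfl⟩
    rw [SetLike.mem_coe, mem_maximalIdeal, mem_nonunits_iff, MvPowerSeries.isUnit_iff_constantCoeff]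
    simp

theorem mem_mv_max [Fintype s] (f : MvPowerSeries s K) : f ∈ maximalIdeal (MvPowerSeries s K) ↔ constantCoeff f = 0 := by
  rw [mem_maximalIdeal, mem_nonunits_iff, MvPowerSeries.isUnit_iff_constantCoeff, isUnit_iff_ne_zero, not_not]

theorem mv_mem_pow [Fintype s] (j : ℕ) (f : MvPowerSeries s K) : f ∈ maximalIdeal (MvPowerSeries s K) ^ j ↔
    ∀ d, d.degree < j → coeff d f = 0 := by
  refine ⟨?_, fun h => by rw [mv_max]; exact mem_pow_of_coeff j f h⟩
  have key : ∀ f ∈ maximalIdeal (MvPowerSeries s K) ^ j, (j : ℕ∞) ≤ f.order := by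
    induction j with
    | zero => simp
    | succ j ih =>
      intro f hf
      rw [pow_succ] at hf
      refine Submodule.mul_induction_on hf ?_ ?_
      · intro a ha b hb
        refine le_trans ?_ le_order_mul
        push_cast
        exact add_le_add (ih a ha) (one_le_order_iff_constCoeff_eq_zero.2 ((mem_mv_max b).1 hb))
      · intro a b ha hb
        exact le_trans (le_min ha hb) min_order_le_add
  intro hf d hd
  exact coeff_of_lt_order (lt_of_lt_of_le (by exact_mod_cast hd) (key f hf))

instance mv_complete [Fintype s] : IsAdicComplete (maximalIdeal (MvPowerSeries s K)) (MvPowerSeries s K) := by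
  rw [mv_max]; infer_instance

theorem algMap_mv (p : MvPolynomial s K) : algebraMap (MvPolynomial s K) (MvPowerSeries s K) p = (p : MvPowerSeries s K) := by
  rw [MvPowerSeries.algebraMap_apply']
  ext; simp

theorem denseMv [Fintype s] : DenseBase (MvPolynomial s K) (MvPowerSeries s K) where
  dense f j := by
    refine ⟨truncTotal j f, ?_⟩
    rw [mv_mem_pow]
    intro d hd
    rw [algMap_mv, map_sub, MvPolynomial.coeff_coe, coeff_truncTotal _ hd, sub_self]
  pow b j hb := by
    rw [mv_mem_pow] at hb
    have : b ∈ MvPolynomial.idealOfVars s K ^ j := by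
      rw [MvPolynomial.mem_pow_idealOfVars_iff']
      intro d hd
      rw [← hb d hd, algMap_mv, MvPolynomial.coeff_coe]
    refine Ideal.pow_right_mono ?_ j this
    rw [MvPolynomial.idealOfVars, Ideal.span_le]
    rintro _ ⟨i, rfl⟩
    rw [SetLike.mem_coe, Ideal.mem_comap, mem_mv_max, algMap_mv]
    simp
end mvps

end Part24

section Part25
open IsLocalRing

section jcmv
open MvPowerSeries
variable {K : Type} [Field K]

theorem aeval_homog {L : Type} [Field L] [Algebra K L] {s : Type} [Fintype s] (p : MvPolynomial s K) (d : ℕ)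
    (hp : ∀ e, p.coeff e ≠ 0 → e.degree = d) (c : s → K) :
    MvPolynomial.aeval (fun i => algebraMap K (PowerSeries L) (c i) * PowerSeries.X) p =
      algebraMap K (PowerSeries L) (MvPolynomial.eval c p) * PowerSeries.X ^ d := by
  rw [MvPolynomial.aeval_def, MvPolynomial.eval₂_eq', MvPolynomial.eval_eq', map_sum, Finset.sum_mul]
  refine Finset.sum_congr rfl fun e he => ?_
  have := hp e (MvPolynomial.mem_support_iff.1 he)
  rw [Finsupp.degree_eq_sum] at this
  simp only [mul_pow, Finset.prod_mul_distrib, map_mul, map_prod, map_pow, Finset.prod_pow_eq_pow_sum, this]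
  ring

theorem reg_ne_zero {L : Type} [Field L] [Algebra K L] {s : Type} [Fintype s] (θ : MvPowerSeries s K →ₐ[K] PowerSeries L)
    (c : s → K) (hθ : ∀ i, θ (X i) = algebraMap K (PowerSeries L) (c i) * PowerSeries.X)
    (w : MvPowerSeries s K) (d : ℕ) (p : MvPolynomial s K) (hp : ∀ e, p.coeff e ≠ 0 → e.degree = d)
    (hw : w - p ∈ (Ideal.span (Set.range X) : Ideal (MvPowerSeries s K)) ^ (d + 1))
    (hc : MvPolynomial.eval c p ≠ 0) : θ w ≠ 0 := by
  have h1 : θ p = algebraMap K (PowerSeries L) (MvPolynomial.eval c p) * PowerSeries.X ^ d := by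
    rw [← aeval_homog p d hp c]
    have : θ.comp (MvPolynomial.coeToMvPowerSeries.algHom K) =
      MvPolynomial.aeval (fun i => algebraMap K (PowerSeries L) (c i) * PowerSeries.X) := by
      refine MvPolynomial.algHom_ext fun i => ?_
      simp [hθ]
    rw [← this]
    simp
  have h2 : ∀ j, ∀ r ∈ (Ideal.span (Set.range X) : Ideal (MvPowerSeries s K)) ^ j, (PowerSeries.X : PowerSeries L) ^ j ∣ θ r := by
    intro j r hr
    have := Ideal.mem_map_of_mem θ hr
    rw [Ideal.map_pow] at this
    have h3 : Ideal.map θ (Ideal.span (Set.range X)) ≤ Ideal.span {PowerSeries.X} := by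
      rw [Ideal.map_span, Ideal.span_le]
      rintro _ ⟨_, ⟨i, rfl⟩, rfl⟩
      rw [hθ]
      exact Ideal.mul_mem_left _ _ (Ideal.mem_span_singleton_self _)
    have := Ideal.pow_right_mono h3 j this
    rwa [Ideal.span_singleton_pow, Ideal.mem_span_singleton] at this
  have h3 := h2 _ _ hw
  rw [PowerSeries.X_pow_dvd_iff] at h3
  have h4 := h3 d (Nat.lt_succ_self d)
  intro h0
  rw [map_sub, h0, h1, zero_sub, map_neg, neg_eq_zero, PowerSeries.coeff_mul_X_pow', if_pos le_rfl, Nat.sub_self,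
    PowerSeries.algebraMap_apply, PowerSeries.coeff_zero_eq_constantCoeff_apply, PowerSeries.constantCoeff_C] at h4
  exact hc ((algebraMap K L).injective (by rw [h4, map_zero]))

/-- initial form -/
theorem exists_init {s : Type} [Fintype s] (w : MvPowerSeries s K) (hw : w ≠ 0) : ∃ (d : ℕ) (p : MvPolynomial s K),
    (∀ e, p.coeff e ≠ 0 → e.degree = d) ∧ w - p ∈ (Ideal.span (Set.range X) : Ideal (MvPowerSeries s K)) ^ (d + 1) ∧ p ≠ 0 := by
  have h0 : (w.order.toNat : ℕ∞) = w.order := by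
    refine ENat.coe_toNat fun h => hw (order_eq_top_iff.1 h)
  obtain ⟨e, he, hd⟩ := exists_coeff_ne_zero_and_order h0
  set d := w.order.toNat
  rw [← h0] at hd
  have hd' : e.degree = d := by exact_mod_cast hd
  refine ⟨d, truncTotal (d + 1) w, ?_, mem_pow_of_coeff _ _ ?_, fun h => ?_⟩
  · intro e' he'
    by_contra h
    rcases lt_or_gt_of_ne h with h | h
    · rw [coeff_truncTotal _ (by omega), coeff_of_lt_order (by rw [← h0]; exact_mod_cast h)] at he'
      exact he' rfl
    · rw [coeff_truncTotal_eq_zero _ (by omega)] at he'; exact he' rfl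
  · intro e' he'
    rw [map_sub, MvPolynomial.coeff_coe, coeff_truncTotal _ he', sub_self]
  · have := coeff_truncTotal w (n := d + 1) (x := e) (by omega)
    rw [h, MvPolynomial.coeff_zero] at this
    exact he this.symm

/-- linear coordinate change -/
theorem exists_coord (n : ℕ) (c : Fin (n + 1) → K) (hc : c 0 ≠ 0) : ∃ φ : MvPowerSeries (Fin (n + 1)) K ≃ₐ[K] MvPowerSeries (Fin (n + 1)) K,
    ∀ i, φ (X i) = Fin.cases (C (c 0) * X 0) (fun j => X j.succ + C (c j.succ) * X 0) i := by
  set a : Fin (n + 1) → MvPowerSeries (Fin (n + 1)) K := fun i => Fin.cases (C (c 0) * X 0) (fun j => X j.succ + C (c j.succ) * X 0) i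
  set b : Fin (n + 1) → MvPowerSeries (Fin (n + 1)) K := fun i => Fin.cases (C (c 0)⁻¹ * X 0) (fun j => X j.succ - C (c j.succ * (c 0)⁻¹) * X 0) i
  have ha : HasSubst a := hasSubst_of_constantCoeff_zero fun i => by
    refine Fin.cases ?_ (fun j => ?_) i <;> simp [a]
  have hb : HasSubst b := hasSubst_of_constantCoeff_zero fun i => by
    refine Fin.cases ?_ (fun j => ?_) i <;> simp [b]
  have hsC : ∀ (a : Fin (n + 1) → MvPowerSeries (Fin (n + 1)) K) (ha : HasSubst a) (r : K), substAlgHom (R := K) ha (C r) = C r :=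
    fun a ha r => by rw [c_eq_algebraMap]; exact AlgHom.commutes _ _
  have hc1 : C (σ := Fin (n + 1)) (c 0) * C (c 0)⁻¹ = 1 := by rw [← map_mul, mul_inv_cancel₀ hc, map_one]
  have hab : ∀ f : MvPowerSeries (Fin (n + 1)) K, subst b (subst a f) = f := by
    intro f
    rw [subst_comp_subst_apply ha hb]
    have : (fun s => subst b (a s)) = (X : Fin (n + 1) → MvPowerSeries (Fin (n + 1)) K) := by
      funext i
      rw [← substAlgHom_apply hb]
      refine Fin.cases ?_ (fun j => ?_) i
      · simp only [a, Fin.cases_zero, map_mul, substAlgHom_X, hsC, b]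
        rw [← mul_assoc, hc1, one_mul]
      · simp only [a, Fin.cases_succ, map_mul, map_add, substAlgHom_X, hsC, b, Fin.cases_zero]
        ring
    rw [this, subst_self]; rfl
  have hba : ∀ f : MvPowerSeries (Fin (n + 1)) K, subst a (subst b f) = f := by
    intro f
    rw [subst_comp_subst_apply hb ha]
    have : (fun s => subst a (b s)) = (X : Fin (n + 1) → MvPowerSeries (Fin (n + 1)) K) := by
      funext i
      rw [← substAlgHom_apply ha]
      refine Fin.cases ?_ (fun j => ?_) i
      · simp only [b, Fin.cases_zero, map_mul, substAlgHom_X, hsC, a]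
        rw [← mul_assoc, mul_comm (C (c 0)⁻¹), hc1, one_mul]
      · simp only [b, Fin.cases_succ, map_mul, map_sub, substAlgHom_X, hsC, a, Fin.cases_zero]
        linear_combination (-C (c j.succ) * X 0) * hc1
    rw [this, subst_self]; rfl
  refine ⟨AlgEquiv.ofAlgHom (substAlgHom ha) (substAlgHom hb) ?_ ?_, ?_⟩
  · ext1 f; simp only [AlgHom.comp_apply, substAlgHom_apply, hba, AlgHom.id_apply]
  · ext1 f; simp only [AlgHom.comp_apply, substAlgHom_apply, hab, AlgHom.id_apply]
  · intro i
    simp only [AlgEquiv.ofAlgHom_apply, substAlgHom_X, a]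
end jcmv

end Part25

section Part26
open IsLocalRing

theorem map_maxIdeal_equiv {S T : Type} [CommRing S] [CommRing T] [IsLocalRing S] [IsLocalRing T] (e : S ≃+* T) :
    (maximalIdeal S).map e = maximalIdeal T := by
  ext x
  rw [Ideal.mem_map_of_equiv, ]
  constructor
  · rintro ⟨y, hy, rfl⟩
    rw [mem_maximalIdeal, mem_nonunits_iff] at hy ⊢
    rwa [MulEquiv.isUnit_map]
  · intro hx
    refine ⟨e.symm x, ?_, e.apply_symm_apply x⟩
    rw [mem_maximalIdeal, mem_nonunits_iff] at hx ⊢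
    rwa [MulEquiv.isUnit_map]

theorem complete_equiv {S T : Type} [CommRing S] [CommRing T] [IsLocalRing S] [IsLocalRing T] (e : S ≃+* T)
    [IsAdicComplete (maximalIdeal S) S] : IsAdicComplete (maximalIdeal T) T := by
  rw [← map_maxIdeal_equiv e, IsAdicComplete.congr_ringEquiv]; infer_instance

theorem dp_equiv {S T : Type} [CommRing S] [CommRing T] [IsLocalRing S] [IsLocalRing T] (e : S ≃+* T) (n : ℕ) (h : Dp S n S) :
    Dp T n T := by
  obtain ⟨rs, hl, hm, hr⟩ := h
  refine ⟨rs.map e, by simpa using hl, ?_, ?_⟩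
  · intro r hr
    obtain ⟨a, ha, rfl⟩ := List.mem_map.1 hr
    rw [← map_maxIdeal_equiv e]
    exact Ideal.mem_map_of_mem e (hm a ha)
  · refine (AddEquiv.isRegular_congr (e := e.toAddEquiv) ?_).1 hr
    rw [List.forall₂_map_right_iff]
    exact List.forall₂_same.mpr fun r _ x => by simp

theorem dp_ps {A : Type} [CommRing A] [IsLocalRing A] (n : ℕ) (h : Dp A n A) : Dp (PowerSeries A) (n + 1) (PowerSeries A) := by
  obtain ⟨rs, hl, hm, hr⟩ := h
  refine ⟨PowerSeries.X :: rs.map PowerSeries.C, by simpa using hl, ?_, ?_⟩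
  · intro r hr
    rw [List.mem_cons] at hr
    rcases hr with rfl | hr
    · rw [mem_maxIdeal_ps]; simp
    · obtain ⟨a, ha, rfl⟩ := List.mem_map.1 hr
      rw [mem_maxIdeal_ps]; simpa using hm a ha
  · rw [RingTheory.Sequence.isRegular_cons_iff]
    refine ⟨?_, ?_⟩
    · intro a b hab
      have hab' : (PowerSeries.X : PowerSeries A) * a = PowerSeries.X * b := hab
      ext k
      have := congrArg (PowerSeries.coeff (k + 1)) hab'
      simpa [PowerSeries.coeff_succ_X_mul] using this
    · let f : QuotSMulTop (PowerSeries.X : PowerSeries A) (PowerSeries A) →+ A :=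
        QuotientAddGroup.lift _ (PowerSeries.constantCoeff (R := A)).toAddMonoidHom (by
          intro x hx
          obtain ⟨b, _, rfl⟩ := (Submodule.mem_smul_pointwise_iff_exists _ _ _).1 hx
          simp)
      have hf : ∀ x : PowerSeries A, f (Submodule.Quotient.mk x) = PowerSeries.constantCoeff x := fun x => rfl
      have hbij : Function.Bijective f := by
        constructor
        · rw [injective_iff_map_eq_zero]
          intro x
          obtain ⟨x, rfl⟩ := Submodule.Quotient.mk_surjective _ x
          rw [hf]
          intro h0
          rw [Submodule.Quotient.mk_eq_zero, Submodule.mem_smul_pointwise_iff_exists]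
          obtain ⟨y, hy⟩ := PowerSeries.X_dvd_iff.2 h0
          exact ⟨y, trivial, hy.symm⟩
        · intro a
          exact ⟨Submodule.Quotient.mk (PowerSeries.C a), by rw [hf]; simp⟩
      refine (AddEquiv.isRegular_congr (e := AddEquiv.ofBijective f hbij) ?_).2 hr
      rw [List.forall₂_map_left_iff]
      refine List.forall₂_same.mpr fun r _ x => ?_
      obtain ⟨x, rfl⟩ := Submodule.Quotient.mk_surjective _ x
      rw [← Submodule.Quotient.mk_smul]
      rw [AddEquiv.ofBijective_apply, AddEquiv.ofBijective_apply, hf, hf]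
      simp

theorem height_ps {A : Type} [CommRing A] [IsLocalRing A] (n : ℕ) (h : (n : ℕ∞) ≤ (maximalIdeal A).height) :
    ((n + 1 : ℕ) : ℕ∞) ≤ (maximalIdeal (PowerSeries A)).height := by
  have h1 := h.trans (height_ker_map (maximalIdeal A))
  set Q := RingHom.ker (PowerSeries.map (Ideal.Quotient.mk (maximalIdeal A)))
  have hQ : Q.IsPrime := RingHom.ker_isPrime _
  have hlt : Q < maximalIdeal (PowerSeries A) := by
    refine lt_of_le_of_ne (le_maximalIdeal hQ.ne_top) fun h => ?_
    have hX : (PowerSeries.X : PowerSeries A) ∈ Q := by rw [h, mem_maxIdeal_ps]; simp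
    have : PowerSeries.map (Ideal.Quotient.mk (maximalIdeal A)) PowerSeries.X = 0 := hX
    rw [PowerSeries.map_X] at this
    exact PowerSeries.X_ne_zero this
  have h2 := Ideal.height_add_one_le_of_lt_of_isPrime hlt
  push_cast
  exact (add_le_add_left h1 1).trans h2

section mv
open MvPowerSeries
variable {K : Type} [Field K]

instance mvps_complete (n : ℕ) : IsAdicComplete (maximalIdeal (PowerSeries (MvPowerSeries (Fin n) K))) (PowerSeries (MvPowerSeries (Fin n) K)) :=
  complete_equiv (MvPowerSeries.finSuccEquiv K n).toRingEquiv

theorem dp_mv (n : ℕ) : Dp (MvPowerSeries (Fin n) K) n (MvPowerSeries (Fin n) K) := by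
  induction n with
  | zero => exact ⟨[], rfl, by simp, RingTheory.Sequence.IsRegular.nil _ _⟩
  | succ n ih => exact dp_equiv (MvPowerSeries.finSuccEquiv K n).symm.toRingEquiv _ (dp_ps n ih)

theorem height_mv_ge (n : ℕ) : (n : ℕ∞) ≤ (maximalIdeal (MvPowerSeries (Fin n) K)).height := by
  induction n with
  | zero => simp
  | succ n ih =>
    have := height_ps n ih
    rwa [← map_maxIdeal_equiv (MvPowerSeries.finSuccEquiv K n).toRingEquiv, RingEquiv.height_map] at this

theorem height_mv (n : ℕ) : (maximalIdeal (MvPowerSeries (Fin n) K)).height = n := by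
  refine le_antisymm ?_ (height_mv_ge n)
  refine height_le_of_gen (X : Fin n → MvPowerSeries (Fin n) K) (fun i => by rw [mem_mv_max]; simp) 1
    (fun h => (maximalIdeal.isMaximal _).ne_top ((Ideal.eq_top_iff_one _).2 h)) fun x hx => ?_
  rw [one_mul, ← mv_max]; exact hx

theorem cmp_mv (n : ℕ) : CMp (MvPowerSeries (Fin n) K) := cmp_of_dp n (height_mv n) (dp_mv n)

theorem cmp_mvps (n : ℕ) : CMp (PowerSeries (MvPowerSeries (Fin n) K)) := by
  refine cmp_of_dp (n + 1) ?_ (dp_ps n (dp_mv n))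
  rw [← map_maxIdeal_equiv (MvPowerSeries.finSuccEquiv K n).toRingEquiv, RingEquiv.height_map, height_mv]

theorem JC_mv [Algebra ℚ K] (n : ℕ) : JC (MvPowerSeries (Fin n) K) := by
  induction n with
  | zero => exact JC.of_equiv (isEmptyEquiv (Fin 0) K).symm.toRingEquiv JC_field
  | succ n ih =>
    intro P hP
    by_cases hP0 : P = ⊥
    · subst hP0
      refine ⟨0, Fin.elim0, by simp, fun i => i.elim0, fun l _ k => k.elim0, 1, fun h => hP.ne_top ((Ideal.eq_top_iff_one _).2 h), ?_⟩
      intro x hx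
      rw [Ideal.mem_bot] at hx
      rw [hx, mul_zero]; exact zero_mem _
    obtain ⟨w, hw, hw0⟩ := Submodule.exists_mem_ne_zero_of_ne_bot hP0
    obtain ⟨d, p, hp, hwp, hp0⟩ := exists_init w hw0
    obtain ⟨c, hc⟩ : ∃ c : Fin (n + 1) → K, MvPolynomial.eval c (p * MvPolynomial.X 0) ≠ 0 := by
      by_contra! h
      have : CharZero K := algebraRat.charZero K
      have := MvPolynomial.funext (p := p * MvPolynomial.X 0) (q := 0) (fun c => by rw [h c, map_zero])
      exact mul_ne_zero hp0 (MvPolynomial.X_ne_zero 0) this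
    rw [map_mul, MvPolynomial.eval_X] at hc
    obtain ⟨φ, hφ⟩ := exists_coord n c (right_ne_zero_of_mul hc)
    let E := φ.trans (MvPowerSeries.finSuccEquiv K n)
    refine JCat.of_equiv E.symm.toRingEquiv P hP ?_
    have hPp : (P.comap E.symm.toRingEquiv).IsPrime := Ideal.comap_isPrime _ _
    refine JC_ps_reg ih _ hPp (E w) (by rw [Ideal.mem_comap]; simpa using hw) ?_
    let L := ResidueField (MvPowerSeries (Fin n) K)
    let θ : MvPowerSeries (Fin (n + 1)) K →ₐ[K] PowerSeries L :=
      (PowerSeries.mapAlgHom (IsScalarTower.toAlgHom K (MvPowerSeries (Fin n) K) L)).comp (E : _ →ₐ[K] _)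
    refine reg_ne_zero θ c ?_ w d p hp hwp (left_ne_zero_of_mul hc)
    intro i
    have hθ : ∀ x, θ x = PowerSeries.map (residue (MvPowerSeries (Fin n) K)) (MvPowerSeries.finSuccEquiv K n (φ x)) := fun x => rfl
    have hC : ∀ a : K, PowerSeries.map (residue (MvPowerSeries (Fin n) K)) (MvPowerSeries.finSuccEquiv K n (C a)) =
      algebraMap K (PowerSeries L) a := by
      intro a
      rw [c_eq_algebraMap]
      rw [← θ.commutes a, hθ, AlgEquiv.commutes, AlgEquiv.commutes, AlgEquiv.commutes]
    rw [hθ, hφ]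
    refine Fin.cases ?_ (fun j => ?_) i
    · simp only [Fin.cases_zero, map_mul, hC, finSuccEquiv_X_zero, PowerSeries.map_X]
    · have : residue (MvPowerSeries (Fin n) K) (X j) = 0 := by
        rw [residue_eq_zero_iff, mem_mv_max]; simp
      simp only [Fin.cases_succ, map_add, map_mul, hC, finSuccEquiv_X_zero, PowerSeries.map_X, finSuccEquiv_X_succ,
        PowerSeries.map_C, this, map_zero, zero_add]

theorem JC_mvps [Algebra ℚ K] (n : ℕ) : JC (PowerSeries (MvPowerSeries (Fin n) K)) :=
  JC.of_equiv (MvPowerSeries.finSuccEquiv K n).toRingEquiv (JC_mv (n + 1))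
end mv

end Part26

section Part27
open IsLocalRing MvPolynomial

section homs
variable {B B' Λ Λ' : Type} [CommRing B] [CommRing B'] [CommRing Λ] [CommRing Λ'] [Algebra B Λ] [Algebra B' Λ']

theorem aeval_map_hom {ι : Type} (θ : Λ →+* Λ') (θ0 : B →+* B') (h : ∀ b, algebraMap B' Λ' (θ0 b) = θ (algebraMap B Λ b))
    (w : ι → Λ) (q : MvPolynomial ι B) : aeval (fun i => θ (w i)) (map θ0 q) = θ (aeval w q) := by
  induction q using MvPolynomial.induction_on with
  | C a => simp [h]
  | add p q hp hq => simp [hp, hq]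
  | mul_X p i hp => simp [hp]

theorem dv_map_hom {ι : Type} (θ : Λ →+* Λ') (θ0 : B →+* B') (h : ∀ b, algebraMap B' Λ' (θ0 b) = θ (algebraMap B Λ b))
    (w : ι → Λ) (i : ι) (q : MvPolynomial ι B) : dv (fun i => θ (w i)) i (map θ0 q) = θ (dv w i q) := by
  rw [dv, pderiv_map, aeval_map_hom θ θ0 h, dv]

variable [IsLocalRing Λ] [IsLocalRing Λ']

theorem ind_hom {κ ι : Type} [Fintype κ] [Fintype ι] (θ : Λ →+* Λ') [IsLocalHom θ] (J : κ → ι → Λ)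
    (h : IndepMod (maximalIdeal Λ) J) : IndepMod (maximalIdeal Λ') (fun k i => θ (J k i)) := by
  classical
  obtain ⟨δ, hδ, N, hN⟩ := exists_rightInv_of_indepMod _ J h
  refine indepMod_of_rightInv _ _ (θ δ) ?_ (fun i k => θ (N i k)) fun k k' => ?_
  · intro h
    rw [mem_maximalIdeal, mem_nonunits_iff, not_not] at hδ
    exact h (hδ.map θ)
  · have := congrArg θ (hN k k')
    simp only [map_sum, map_mul] at this
    rw [this]
    split <;> simp

theorem et_hom (θ : Λ →+* Λ') [IsLocalHom θ] (h : ∀ b, θ (algebraMap B Λ b) ∈ etAlg B' Λ') (x : Λ) (hx : x ∈ etAlg B Λ) :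
    θ x ∈ etAlg B' Λ' := by
  obtain ⟨n, w, ⟨Φ, hΦ, hJ⟩, P, rfl⟩ := hx
  let θ0 : B →+* etAlg B' Λ' := (θ.comp (algebraMap B Λ)).codRestrict (etAlg B' Λ').toSubring h
  have h0 : ∀ b, algebraMap (etAlg B' Λ') Λ' (θ0 b) = θ (algebraMap B Λ b) := fun b => rfl
  have hw := hensel_mem_etAlg (fun k => map θ0 (Φ k)) (fun i => θ (w i))
    (fun k => by rw [aeval_map_hom θ θ0 h0, hΦ, map_zero])
    (by
      have := ind_hom θ _ hJ
      simpa only [dv_map_hom θ θ0 h0] using this)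
  rw [← aeval_map_hom θ θ0 h0]
  have : aeval (fun i => θ (w i)) (map θ0 P) = algebraMap (etAlg B' Λ') Λ' (aeval (fun i => (⟨θ (w i), hw i⟩ : etAlg B' Λ')) (map θ0 P)) := by
    rw [← aeval_algebraMap_apply]; rfl
  rw [this]
  exact SetLike.coe_mem _
end homs

section mvhom
variable {K : Type} [Field K] {s t : Type} [Fintype s] [Fintype t]
variable {Λ : Type} [CommRing Λ] [IsLocalRing Λ] [Algebra K Λ]

theorem mvhom_mem (φ : MvPowerSeries s K →ₐ[K] Λ) (h : ∀ i, φ (MvPowerSeries.X i) ∈ maximalIdeal Λ) (j : ℕ)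
    (f : MvPowerSeries s K) (hf : f ∈ maximalIdeal (MvPowerSeries s K) ^ j) : φ f ∈ maximalIdeal Λ ^ j := by
  have h1 : (maximalIdeal (MvPowerSeries s K)).map φ ≤ maximalIdeal Λ := by
    rw [mv_max, Ideal.map_span, Ideal.span_le]
    rintro _ ⟨_, ⟨i, rfl⟩, rfl⟩
    exact h i
  have h2 := Ideal.mem_map_of_mem φ hf
  rw [Ideal.map_pow] at h2
  exact Ideal.pow_right_mono h1 j h2

theorem mvhom_local (φ : MvPowerSeries s K →ₐ[K] Λ) (h : ∀ i, φ (MvPowerSeries.X i) ∈ maximalIdeal Λ) :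
    IsLocalHom (φ : MvPowerSeries s K →+* Λ) := by
  refine ⟨fun a ha => ?_⟩
  by_contra h0
  have := mvhom_mem φ h 1 a (by rw [pow_one]; exact h0)
  rw [pow_one] at this
  exact this ha

theorem mvhom_mem_iff (φ : MvPowerSeries s K →ₐ[K] Λ) (h : ∀ i, φ (MvPowerSeries.X i) ∈ maximalIdeal Λ) (f : MvPowerSeries s K) :
    φ f ∈ maximalIdeal Λ ↔ f ∈ maximalIdeal (MvPowerSeries s K) := by
  constructor
  · intro hf
    by_contra h0
    rw [mem_maximalIdeal, mem_nonunits_iff, not_not] at h0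
    exact hf (h0.map φ)
  · intro hf
    have := mvhom_mem φ h 1 f (by rwa [pow_one])
    rwa [pow_one] at this

theorem mvhom_coe (φ : MvPowerSeries s K →ₐ[K] Λ) (p : MvPolynomial s K) :
    φ (algebraMap (MvPolynomial s K) (MvPowerSeries s K) p) = aeval (fun i => φ (MvPowerSeries.X i)) p := by
  have : φ.comp (IsScalarTower.toAlgHom K (MvPolynomial s K) (MvPowerSeries s K)) = aeval (fun i => φ (MvPowerSeries.X i)) := by
    refine MvPolynomial.algHom_ext fun i => ?_
    simp [algMap_mv]
  rw [← this]; rfl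

theorem hom_close (φ ψ : MvPowerSeries s K →ₐ[K] Λ) (h : ∀ i, φ (MvPowerSeries.X i) ∈ maximalIdeal Λ)
    (h' : ∀ i, ψ (MvPowerSeries.X i) ∈ maximalIdeal Λ) (c : ℕ)
    (hc : ∀ i, φ (MvPowerSeries.X i) - ψ (MvPowerSeries.X i) ∈ maximalIdeal Λ ^ c) (f : MvPowerSeries s K) :
    φ f - ψ f ∈ maximalIdeal Λ ^ c := by
  obtain ⟨p, hp⟩ := denseMv.dense f c
  have h1 := mvhom_mem φ h c _ hp
  have h2 := mvhom_mem ψ h' c _ hp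
  rw [map_sub, mvhom_coe] at h1 h2
  have h3 := aeval_sub_mem (maximalIdeal Λ ^ c) _ _ hc p
  have := add_mem (sub_mem h1 h2) h3
  convert this using 1
  ring

theorem hom_ext_mv [IsNoetherianRing Λ] (φ ψ : MvPowerSeries s K →ₐ[K] Λ) (h : ∀ i, φ (MvPowerSeries.X i) ∈ maximalIdeal Λ)
    (he : ∀ i, φ (MvPowerSeries.X i) = ψ (MvPowerSeries.X i)) : φ = ψ := by
  ext f
  have key : φ f - ψ f ∈ ⨅ c : ℕ, maximalIdeal Λ ^ c := by
    rw [Ideal.mem_iInf]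
    intro c
    exact hom_close φ ψ h (fun i => he i ▸ h i) c (fun i => by rw [he, sub_self]; exact zero_mem _) f
  rw [Ideal.iInf_pow_eq_bot_of_isLocalRing _ (maximalIdeal.isMaximal Λ).ne_top] at key
  exact sub_eq_zero.1 key

/-- etale power series -/
def IsE {s : Type} [Fintype s] (f : MvPowerSeries s K) : Prop := f ∈ etAlg (MvPolynomial s K) (MvPowerSeries s K)

theorem IsE.poly (p : MvPolynomial s K) : IsE (algebraMap (MvPolynomial s K) (MvPowerSeries s K) p) :=
  Subalgebra.algebraMap_mem _ p

theorem IsE.X (i : s) : IsE (MvPowerSeries.X i : MvPowerSeries s K) := by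
  have := IsE.poly (MvPolynomial.X i : MvPolynomial s K)
  rwa [algMap_mv, MvPolynomial.coe_X] at this

theorem IsE.hom (φ : MvPowerSeries s K →ₐ[K] MvPowerSeries t K)
    (h : ∀ i, φ (MvPowerSeries.X i) ∈ maximalIdeal (MvPowerSeries t K)) (hE : ∀ i, IsE (φ (MvPowerSeries.X i)))
    {f : MvPowerSeries s K} (hf : IsE f) : IsE (φ f) := by
  have := mvhom_local φ h
  refine et_hom (φ : MvPowerSeries s K →+* MvPowerSeries t K) ?_ f hf
  intro b
  change φ _ ∈ _
  rw [mvhom_coe]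
  induction b using MvPolynomial.induction_on with
  | C a =>
    rw [aeval_C, IsScalarTower.algebraMap_apply K (MvPolynomial t K)]
    exact Subalgebra.algebraMap_mem _ _
  | add p q hp hq => rw [map_add]; exact add_mem hp hq
  | mul_X p i hp => rw [map_mul, aeval_X]; exact mul_mem hp (hE i)

/-- substitution as algebra hom -/
theorem exists_ev (v : s → MvPowerSeries t K) (hv : ∀ i, v i ∈ maximalIdeal (MvPowerSeries t K)) :
    ∃ φ : MvPowerSeries s K →ₐ[K] MvPowerSeries t K, (∀ i, φ (MvPowerSeries.X i) = v i) ∧ ∀ f, φ f = MvPowerSeries.subst v f := by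
  have hs : MvPowerSeries.HasSubst v := MvPowerSeries.hasSubst_of_constantCoeff_zero fun i => (mem_mv_max _).1 (hv i)
  exact ⟨MvPowerSeries.substAlgHom hs, fun i => MvPowerSeries.substAlgHom_X hs i, fun f => MvPowerSeries.substAlgHom_apply hs f⟩
end mvhom

end Part27

section Part28
open IsLocalRing MvPolynomial

theorem der_aeval_gen {F S M υ : Type} [Field F] [CommRing S] [Algebra F S] [AddCommGroup M] [Module S M] [Module F M] [IsScalarTower F S M]
    [Fintype υ] (D : Derivation F S M) (u : υ → S) (H : MvPolynomial υ F) : D (aeval u H) = ∑ j, dv u j H • D (u j) := by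
  classical
  induction H using MvPolynomial.induction_on with
  | C a => simp
  | add p q hp hq => simp [hp, hq, add_smul, Finset.sum_add_distrib]
  | mul_X p i hp =>
    rw [map_mul, aeval_X, Derivation.leibniz, hp, Finset.smul_sum]
    have : ∀ j, dv u j (p * X i) • D (u j) = (if j = i then aeval u p • D (u j) else 0) + u i • dv u j p • D (u j) := by
      intro j
      rw [dv_mul, add_smul]
      by_cases h : j = i
      · subst h; rw [dv_X_self, if_pos rfl]; simp [smul_smul, add_comm, mul_comm]
      · rw [dv_X_ne _ _ (Ne.symm h), if_neg h]; simp [smul_smul, add_comm, mul_comm]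
    rw [Finset.sum_congr rfl fun j _ => this j, Finset.sum_add_distrib]
    simp

theorem alg_of_jac {F L : Type} [Field F] [Field L] [Algebra F L] {n : ℕ} (w : Fin n → L) (Φ : Fin n → MvPolynomial (Fin n) F)
    (hΦ : ∀ i, aeval w (Φ i) = 0) (N : Fin n → Fin n → L)
    (hN : ∀ k k', ∑ i, N k i * dv w k' (Φ i) = if k = k' then 1 else 0) (i : Fin n) : IsAlgebraic F (w i) := by
  classical
  let S := IntermediateField.adjoin F (Set.range w)
  let v : Fin n → S := fun i => ⟨w i, IntermediateField.subset_adjoin F _ ⟨i, rfl⟩⟩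
  have hcoe : ∀ p : MvPolynomial (Fin n) F, algebraMap S L (aeval v p) = aeval w p := fun p => by
    rw [← aeval_algebraMap_apply]; rfl
  let J : Matrix (Fin n) (Fin n) S := Matrix.of fun i j => dv v j (Φ i)
  have hdet : IsUnit J.det := by
    rw [isUnit_iff_ne_zero]
    intro h0
    have h1 : (J.map (algebraMap S L)).det = 0 := by
      have := RingHom.map_det (algebraMap S L) J
      rw [h0, map_zero] at this
      exact this.symm
    have h2 : Matrix.of N * J.map (algebraMap S L) = 1 := by
      ext k k'
      rw [Matrix.mul_apply, Matrix.one_apply, ← hN k k']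
      refine Finset.sum_congr rfl fun i _ => ?_
      simp only [Matrix.of_apply, Matrix.map_apply, J, dv, hcoe]
    have := congrArg Matrix.det h2
    rw [Matrix.det_mul, h1, mul_zero, Matrix.det_one] at this
    exact zero_ne_one this
  have hinv := Matrix.nonsing_inv_mul J hdet
  let D := KaehlerDifferential.D F S
  have hDv : ∀ i, D (v i) = 0 := by
    intro i
    have h1 : ∀ k, ∑ j, J k j • D (v j) = 0 := by
      intro k
      have := der_aeval_gen D v (Φ k)
      rw [(algebraMap S L).injective ((hcoe _).trans ((hΦ k).trans (map_zero _).symm)), map_zero] at this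
      exact this.symm
    have h2 : ∑ k, J⁻¹ i k • ∑ j, J k j • D (v j) = D (v i) := by
      simp_rw [Finset.smul_sum, smul_smul]
      rw [Finset.sum_comm]
      simp_rw [← Finset.sum_smul]
      have : ∀ j, ∑ k, J⁻¹ i k * J k j = if i = j then 1 else 0 := fun j => by
        have := congrFun (congrFun hinv i) j
        rwa [Matrix.mul_apply, Matrix.one_apply] at this
      simp [this]
    rw [← h2]
    simp [h1]
  have hD : ∀ x : S, D x = 0 := by
    rintro ⟨x, hx⟩
    refine IntermediateField.adjoin_induction (p := fun x hx => D ⟨x, hx⟩ = 0) F ?_ ?_ ?_ ?_ ?_ hx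
    · rintro _ ⟨i, rfl⟩; exact hDv i
    · intro a; exact D.map_algebraMap a
    · intro x y hx hy h1 h2
      have : D ((⟨x, hx⟩ : S) + ⟨y, hy⟩) = 0 := by rw [map_add, h1, h2, add_zero]
      exact this
    · intro x hx h1
      have : D ((⟨x, hx⟩ : S)⁻¹) = 0 := by rw [Derivation.leibniz_inv, h1, smul_zero]
      exact this
    · intro x y hx hy h1 h2
      have : D ((⟨x, hx⟩ : S) * ⟨y, hy⟩) = 0 := by rw [Derivation.leibniz, h1, h2, smul_zero, smul_zero, add_zero]
      exact this
  have : Algebra.FormallyUnramified F S := by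
    refine ⟨?_⟩
    refine (Submodule.subsingleton_iff S).1 (subsingleton_of_bot_eq_top ?_)
    rw [← KaehlerDifferential.span_range_derivation, eq_comm, Submodule.span_eq_bot]
    rintro _ ⟨x, rfl⟩
    exact hD x
  have : Algebra.EssFiniteType F S := by
    rw [IntermediateField.essFiniteType_iff]
    exact IntermediateField.fg_adjoin_of_finite (Set.finite_range w)
  have : Module.Finite F S := Algebra.FormallyUnramified.finite_of_free F S
  have h := Algebra.IsAlgebraic.isAlgebraic (R := F) (v i)
  exact h.algebraMap (A := L)

theorem alg_of_et {B Λ : Type} [CommRing B] [IsDomain B] [CommRing Λ] [IsDomain Λ] [IsLocalRing Λ] [Algebra B Λ]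
    (hinj : Function.Injective (algebraMap B Λ)) (x : Λ) (hx : x ∈ etAlg B Λ) : IsAlgebraic B x := by
  classical
  obtain ⟨n, w, ⟨Φ, hΦ, hJ⟩, P, rfl⟩ := hx
  obtain ⟨N, -, hN⟩ := exists_inv_of_indepMod _ hJ
  let L := FractionRing Λ
  let F := FractionRing B
  have hinjL : Function.Injective (algebraMap B L) := by
    rw [IsScalarTower.algebraMap_eq B Λ L]
    exact (IsFractionRing.injective Λ L).comp hinj
  have : FaithfulSMul B L := (faithfulSMul_iff_algebraMap_injective B L).2 hinjL
  letI : Algebra F L := FractionRing.liftAlgebra B L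
  have hT : IsScalarTower B F L := FractionRing.isScalarTower_liftAlgebra B L
  have hcomm : ∀ b, algebraMap F L (algebraMap B F b) = algebraMap Λ L (algebraMap B Λ b) := fun b => by
    rw [← IsScalarTower.algebraMap_apply, ← IsScalarTower.algebraMap_apply]
  have hw : ∀ i, IsAlgebraic F (algebraMap Λ L (w i)) := by
    refine alg_of_jac (fun i => algebraMap Λ L (w i)) (fun i => map (algebraMap B F) (Φ i)) (fun i => ?_)
      (fun k i => algebraMap Λ L (N k i)) (fun k k' => ?_)
    · rw [aeval_map_hom (algebraMap Λ L) _ hcomm, hΦ, map_zero]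
    · simp only [dv_map_hom (algebraMap Λ L) _ hcomm, ← map_mul, ← map_sum, hN]
      split <;> simp
  have h1 : IsAlgebraic F (algebraMap Λ L (aeval w P)) := by
    rw [← aeval_map_hom (algebraMap Λ L) _ hcomm]
    have : aeval (fun i => algebraMap Λ L (w i)) (map (algebraMap B F) P) ∈ integralClosure F L :=
      (aeval (fun i => (⟨algebraMap Λ L (w i), (hw i).isIntegral⟩ : integralClosure F L)) (map (algebraMap B F) P)).2 |> fun h => by
        convert h using 1
        change _ = algebraMap (integralClosure F L) L _
        rw [← aeval_algebraMap_apply]; rfl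
    exact this.isAlgebraic
  have h2 : IsAlgebraic B (algebraMap Λ L (aeval w P)) := (IsFractionRing.isAlgebraic_iff B F L).2 h1
  exact (isAlgebraic_algebraMap_iff (IsFractionRing.injective Λ L)).1 h2

end Part28

section Part29
open IsLocalRing MvPolynomial

section closure
variable {K : Type} [Field K] [Algebra ℚ K] {s : Type} [Fintype s]

theorem artin_mv {ι κ : Type} [Fintype ι] [Fintype κ] (F : κ → MvPolynomial ι (MvPolynomial s K)) (f : ι → MvPowerSeries s K)
    (hF : ∀ k, aeval f (F k) = 0) (c : ℕ) : Approx (MvPolynomial s K) F f c := by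
  classical
  let e : MvPowerSeries (Fin (Fintype.card s)) K ≃+* MvPowerSeries s K :=
    (MvPowerSeries.renameEquiv K (Fintype.equivFin s)).symm.toRingEquiv
  refine thmB denseMv (JC_mvpoly _) (JC.of_equiv e (JC_mv _)) ?_ F f hF c
  refine cmp_of_dp (Fintype.card s) ?_ (dp_equiv e _ (dp_mv _))
  rw [← map_maxIdeal_equiv e, RingEquiv.height_map, height_mv]

instance mv_domain : IsDomain (MvPowerSeries s K) := NoZeroDivisors.to_isDomain _

theorem algMap_inj : Function.Injective (algebraMap (MvPolynomial s K) (MvPowerSeries s K)) := by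
  intro p q h
  rw [algMap_mv, algMap_mv] at h
  exact MvPolynomial.coe_injective s K h

theorem IsE.div {G G' : MvPowerSeries s K} (p : MvPolynomial s K) (hp : p ≠ 0) (h : G = algebraMap _ _ p * G') (hG : IsE G) :
    IsE G' := by
  classical
  obtain ⟨n, w, ⟨Φ, hΦ, hJ⟩, P, hP⟩ := hG
  let F : Option (Fin n) → MvPolynomial (Option (Fin n)) (MvPolynomial s K) := fun o =>
    o.elim (C p * MvPolynomial.X none - rename some P) (fun i => rename some (Φ i))
  let f : Option (Fin n) → MvPowerSeries s K := fun o => o.elim G' w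
  have hf : ∀ k, aeval f (F k) = 0 := by
    rintro (_ | i)
    · simp only [F, Option.elim, map_sub, map_mul, aeval_C, aeval_X, aeval_rename]
      change _ * G' - aeval w P = 0
      rw [hP, h, sub_self]
    · simp only [F, Option.elim, aeval_rename]
      exact hΦ i
  obtain ⟨f', h1, h2, h3⟩ := artin_mv F f hf 1
  have hw : (fun i => f' (some i)) = w := by
    refine hensel_unique Φ w _ _ hJ (fun i => ?_) (fun i => by rw [sub_self]; exact zero_mem _) fun k => ?_
    · have := h2 (some i); rwa [pow_one] at this
    · rw [hΦ]
      have := h3 (some k)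
      simp only [F, Option.elim, aeval_rename] at this
      exact this
  have h4 := h3 none
  simp only [F, Option.elim, map_sub, map_mul, aeval_C, aeval_X, aeval_rename] at h4
  have h5 : aeval (f' ∘ some) P = G := by rw [← hP, ← hw]; rfl
  rw [h5, h, ← mul_sub] at h4
  have h6 : algebraMap (MvPolynomial s K) (MvPowerSeries s K) p ≠ 0 := fun h0 => hp (algMap_inj (h0.trans (map_zero _).symm))
  have h7 := sub_eq_zero.1 ((mul_eq_zero.1 h4).resolve_left h6)
  rw [← h7]
  exact h1 none

theorem IsE.sub {G G' : MvPowerSeries s K} (h : IsE G) (h' : IsE G') : IsE (G - G') := sub_mem h h'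

theorem isE_coeff (α : ℕ) : ∀ G : MvPowerSeries (Option s) K, IsE G → IsE (PowerSeries.coeff α (MvPowerSeries.optionEquivLeft s K G)) := by
  classical
  let e := MvPowerSeries.optionEquivLeft s K
  let φ : MvPowerSeries (Option s) K →ₐ[K] MvPowerSeries s K :=
    { toRingHom := (PowerSeries.constantCoeff (R := MvPowerSeries s K)).comp (e : MvPowerSeries (Option s) K →+* _)
      commutes' := fun r => by
        change PowerSeries.constantCoeff (e (algebraMap _ _ r)) = _
        rw [AlgEquiv.commutes]
        rfl }
  let ι : MvPowerSeries s K →ₐ[K] MvPowerSeries (Option s) K :=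
    { toRingHom := (e.symm : PowerSeries (MvPowerSeries s K) →+* _).comp (PowerSeries.C (R := MvPowerSeries s K))
      commutes' := fun r => by
        change e.symm (PowerSeries.C (algebraMap _ _ r)) = _
        rw [← AlgEquiv.commutes e.symm, PowerSeries.algebraMap_apply] }
  have hι : ∀ G, e (ι G) = PowerSeries.C G := fun G => e.apply_symm_apply (PowerSeries.C G)
  have hφ0 : ∀ G, φ G = PowerSeries.constantCoeff (e G) := fun G => rfl
  have hφ : ∀ G, IsE G → IsE (φ G) := by
    intro G hG
    have h0 : φ (MvPowerSeries.X none) = 0 := by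
      rw [hφ0, MvPowerSeries.optionEquivLeft_X_none]; simp
    have h1 : ∀ i, φ (MvPowerSeries.X (some i)) = MvPowerSeries.X i := by
      intro i
      rw [hφ0, MvPowerSeries.optionEquivLeft_X_some]; simp
    refine IsE.hom φ ?_ ?_ hG
    · rintro (_ | i)
      · rw [h0]; exact zero_mem _
      · rw [h1, mem_mv_max]; simp
    · rintro (_ | i)
      · rw [h0]; exact zero_mem (etAlg _ _)
      · rw [h1]; exact IsE.X i
  have hιE : ∀ G, IsE G → IsE (ι G) := by
    intro G hG
    have h1 : ∀ i, ι (MvPowerSeries.X i) = MvPowerSeries.X (some i) := by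
      intro i
      apply e.injective
      rw [hι, MvPowerSeries.optionEquivLeft_X_some]
    refine IsE.hom ι ?_ ?_ hG
    · intro i; rw [h1, mem_mv_max]; simp
    · intro i; rw [h1]; exact IsE.X _
  induction α with
  | zero =>
    intro G hG
    rw [PowerSeries.coeff_zero_eq_constantCoeff_apply]
    have := hφ G hG
    rwa [hφ0] at this
  | succ α ih =>
    intro G hG
    have h1 : PowerSeries.X ∣ e (G - ι (φ G)) := by
      rw [PowerSeries.X_dvd_iff, map_sub, hι]
      simp only [map_sub, PowerSeries.constantCoeff_C]
      exact sub_self _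
    obtain ⟨q, hq⟩ := h1
    have h2 : G - ι (φ G) = algebraMap _ _ (X none : MvPolynomial (Option s) K) * e.symm q := by
      apply e.injective
      rw [map_mul, e.apply_symm_apply, hq, algMap_mv, coe_X, MvPowerSeries.optionEquivLeft_X_none]
    have h3 := ih _ (IsE.div _ (X_ne_zero _) h2 (hG.sub (hιE _ (hφ _ hG))))
    have h4 : PowerSeries.coeff (α + 1) (e G) = PowerSeries.coeff α (e (e.symm q)) := by
      rw [map_sub, hι, sub_eq_iff_eq_add] at hq
      rw [hq, e.apply_symm_apply, map_add, PowerSeries.coeff_succ_X_mul, PowerSeries.coeff_C]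
      simp
    change IsE (PowerSeries.coeff (α + 1) (e G))
    rw [h4]; exact h3

theorem IsE.of_alg {G : MvPowerSeries s K} (hG : IsAlgebraic (MvPolynomial s K) G) : IsE G := by
  classical
  obtain ⟨Q, hQ, hQG⟩ := hG
  let Q' := Q.map (algebraMap (MvPolynomial s K) (MvPowerSeries s K))
  have hQ' : Q' ≠ 0 := (Polynomial.map_ne_zero_iff algMap_inj).2 hQ
  have hsep : ∀ r : MvPowerSeries s K, r ≠ G → ∃ c : ℕ, r - G ∉ maximalIdeal (MvPowerSeries s K) ^ c := by
    intro r hr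
    by_contra! h
    have : r - G ∈ ⨅ c : ℕ, maximalIdeal (MvPowerSeries s K) ^ c := by rw [Ideal.mem_iInf]; exact h
    rw [Ideal.iInf_pow_eq_bot_of_isLocalRing _ (maximalIdeal.isMaximal _).ne_top] at this
    exact hr (sub_eq_zero.1 this)
  choose! cc hcc using hsep
  let c := Q'.roots.toFinset.sup cc
  let F : Unit → MvPolynomial Unit (MvPolynomial s K) := fun _ => Polynomial.aeval (MvPolynomial.X ()) Q
  have hae : ∀ f : Unit → MvPowerSeries s K, ∀ k, aeval f (F k) = Polynomial.aeval (f ()) Q := by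
    intro f k
    simp only [F]
    rw [← Polynomial.aeval_algHom_apply, aeval_X]
  obtain ⟨f', h1, h2, h3⟩ := artin_mv F (fun _ => G) (fun k => by rw [hae _ k]; exact hQG) c
  by_cases h : f' () = G
  · rw [← h]; exact h1 ()
  · exfalso
    apply hcc _ h
    refine Ideal.pow_le_pow_right ?_ (h2 ())
    refine Finset.le_sup (f := cc) ?_
    rw [Multiset.mem_toFinset, Polynomial.mem_roots hQ', Polynomial.IsRoot, Polynomial.eval_map_algebraMap, ← hae f' ()]
    exact h3 ()

theorem IsE.alg {G : MvPowerSeries s K} (hG : IsE G) : IsAlgebraic (MvPolynomial s K) G := alg_of_et algMap_inj G hG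
end closure

end Part29

section Part30
open IsLocalRing MvPolynomial

theorem aeval_iter {K Λ σ ν : Type} [Field K] [CommRing Λ] [Algebra K Λ] (θ0 : MvPolynomial σ K →ₐ[K] Λ) (w : ν → Λ)
    (q : MvPolynomial ν (MvPolynomial σ K)) :
    aeval (Sum.elim w (fun i => θ0 (X i))) (iterToSum K ν σ q) = aeval w (map (θ0 : MvPolynomial σ K →+* Λ) q) := by
  induction q using MvPolynomial.induction_on with
  | C a =>
    induction a using MvPolynomial.induction_on with
    | C a =>
      rw [iterToSum_C_C]
      simp
    | add p q hp hq => simp only [map_add, hp, hq]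
    | mul_X p i hp =>
      simp only [map_mul, hp]
      congr 1
      rw [iterToSum_C_X]; simp
  | add p q hp hq => simp only [map_add, hp, hq]
  | mul_X p i hp =>
    simp only [map_mul, hp]
    congr 1
    rw [iterToSum_X]; simp

section A
variable {K : Type} [Field K] {σ : Type} [Fintype σ] {B Λ : Type} [CommRing B] [CommRing Λ] [Algebra B Λ] [IsLocalRing Λ]
  [IsNoetherianRing Λ] [Algebra K Λ] [Algebra K B] [IsScalarTower K B Λ]

theorem lemA_fin
    (hart : ∀ (ι κ : Type) [Fintype ι] [Fintype κ] (F : κ → MvPolynomial ι B) (f : ι → Λ), (∀ k, aeval f (F k) = 0) →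
      ∀ c, Approx B F f c)
    (hev : ∀ v : σ → Λ, (∀ i, v i ∈ maximalIdeal Λ) → ∃ θ' : MvPowerSeries σ K →ₐ[K] Λ, ∀ i, θ' (MvPowerSeries.X i) = v i)
    (θ : MvPowerSeries σ K →ₐ[K] Λ) (hθ : ∀ i, θ (MvPowerSeries.X i) ∈ maximalIdeal Λ)
    (S : Set σ) (b : σ → B) (hb : ∀ i ∈ S, θ (MvPowerSeries.X i) = algebraMap B Λ (b i))
    {J : Type} [Fintype J] (F : J → MvPowerSeries σ K) (hE : ∀ j, IsE (F j)) (hF : ∀ j, θ (F j) = 0) (c : ℕ) :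
    ∃ θ' : MvPowerSeries σ K →ₐ[K] Λ, (∀ i, θ' (MvPowerSeries.X i) ∈ maximalIdeal Λ) ∧
      (∀ i ∈ S, θ' (MvPowerSeries.X i) = θ (MvPowerSeries.X i)) ∧ (∀ i, θ' (MvPowerSeries.X i) ∈ etAlg B Λ) ∧
      (∀ i, θ' (MvPowerSeries.X i) - θ (MvPowerSeries.X i) ∈ maximalIdeal Λ ^ c) ∧ ∀ j, θ' (F j) = 0 := by
  classical
  obtain ⟨N, w, ⟨Φ, hΦ, hJ⟩, P, hP⟩ := IsEt.common' F hE
  let T : MvPolynomial (Fin N) (MvPolynomial σ K) → MvPolynomial (Fin N ⊕ σ) B := fun q =>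
    map (algebraMap K B) (iterToSum K (Fin N) σ q)
  let al (θ : MvPowerSeries σ K →ₐ[K] Λ) : MvPolynomial σ K →ₐ[K] Λ :=
    θ.comp (IsScalarTower.toAlgHom K (MvPolynomial σ K) (MvPowerSeries σ K))
  have hal : ∀ θ i, al θ (X i) = θ (MvPowerSeries.X i) := by
    intro θ i
    change θ (algebraMap _ _ (X i)) = _
    rw [algMap_mv, coe_X]
  have hT : ∀ (θ : MvPowerSeries σ K →ₐ[K] Λ) (w' : Fin N → Λ) (v : σ → Λ) (hv : ∀ i, v i = θ (MvPowerSeries.X i)) q,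
      aeval (Sum.elim w' v) (T q) = aeval w' (map (al θ : MvPolynomial σ K →+* Λ) q) := by
    intro θ w' v hv q
    rw [← aeval_iter, aeval_map_algebraMap]
    congr 3
    funext i
    rw [hv, hal]
  have hTw : ∀ (θ : MvPowerSeries σ K →ₐ[K] Λ) q, aeval (fun i => θ (w i)) (map (al θ : MvPolynomial σ K →+* Λ) q) = θ (aeval w q) :=
    fun θ q => aeval_map_hom (θ : MvPowerSeries σ K →+* Λ) _ (fun b => rfl) w q
  let G : J ⊕ (Fin N ⊕ σ) → MvPolynomial (Fin N ⊕ σ) B :=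
    Sum.elim (fun j => T (P j)) (Sum.elim (fun i => T (Φ i)) (fun i => if i ∈ S then X (Sum.inr i) - C (b i) else 0))
  let f : Fin N ⊕ σ → Λ := Sum.elim (fun i => θ (w i)) (fun i => θ (MvPowerSeries.X i))
  have hG : ∀ k, aeval f (G k) = 0 := by
    rintro (j | i | i)
    · simp only [G, f, Sum.elim_inl]
      rw [hT θ _ _ (fun _ => rfl), hTw, hP, hF]
    · simp only [G, f, Sum.elim_inl, Sum.elim_inr]
      rw [hT θ _ _ (fun _ => rfl), hTw, hΦ, map_zero]
    · simp only [G, f, Sum.elim_inr]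
      split
      · next h => simp [hb i h]
      · simp
  obtain ⟨f', h1, h2, h3⟩ := hart _ _ G f hG (max c 1)
  have h2' : ∀ i, f' i - f i ∈ maximalIdeal Λ := fun i => by
    have := Ideal.pow_le_pow_right (le_max_right c 1) (h2 i)
    rwa [pow_one] at this
  have hm : ∀ i, f' (Sum.inr i) ∈ maximalIdeal Λ := fun i => by
    have := add_mem (h2' (Sum.inr i)) (hθ i)
    simpa [f] using this
  obtain ⟨θ', hθ'⟩ := hev (fun i => f' (Sum.inr i)) hm
  have hθm : ∀ i, θ' (MvPowerSeries.X i) ∈ maximalIdeal Λ := fun i => by rw [hθ']; exact hm i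
  have hf' : f' = Sum.elim (fun i => f' (Sum.inl i)) (fun i => f' (Sum.inr i)) := by
    funext i; cases i <;> rfl
  have hcl : ∀ q, θ' q - θ q ∈ maximalIdeal Λ := fun q => by
    have := hom_close θ' θ hθm hθ 1 (fun i => by rw [hθ', pow_one]; exact h2' (Sum.inr i)) q
    rwa [pow_one] at this
  have hloc := mvhom_local θ' hθm
  have hw : (fun i => f' (Sum.inl i)) = fun i => θ' (w i) := by
    refine hensel_unique (fun i => map (al θ' : MvPolynomial σ K →+* Λ) (Φ i)) (fun i => θ' (w i)) _ _ ?_ (fun i => ?_)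
      (fun i => by rw [sub_self]; exact zero_mem _) fun k => ?_
    · have := ind_hom (θ' : MvPowerSeries σ K →+* Λ) _ hJ
      have h4 := fun k i => dv_map_hom (θ' : MvPowerSeries σ K →+* Λ) (al θ' : MvPolynomial σ K →+* Λ) (fun b => rfl) w i (Φ k)
      simp only [RingHom.coe_coe] at h4 this
      simpa only [h4] using this
    · have := sub_mem (h2' (Sum.inl i)) (hcl (w i))
      simpa [f] using this
    · rw [hTw, hΦ, map_zero, ← hT θ' _ (fun i => f' (Sum.inr i)) (fun i => (hθ' i).symm), ← hf']
      exact h3 (Sum.inr (Sum.inl k))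
  refine ⟨θ', hθm, fun i hi => ?_, fun i => by rw [hθ']; exact h1 _, fun i => ?_, fun j => ?_⟩
  · have := h3 (Sum.inr (Sum.inr i))
    simp only [G, Sum.elim_inr, if_pos hi, map_sub, aeval_X, aeval_C] at this
    rw [hθ', sub_eq_zero.1 this, hb i hi]
  · rw [hθ']
    exact Ideal.pow_le_pow_right (le_max_left c 1) (h2 (Sum.inr i))
  · rw [← hP, ← hTw, ← hw, ← hT θ' _ (fun i => f' (Sum.inr i)) (fun i => (hθ' i).symm), ← hf']
    exact h3 (Sum.inl j)

theorem lemA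
    (hart : ∀ (ι κ : Type) [Fintype ι] [Fintype κ] (F : κ → MvPolynomial ι B) (f : ι → Λ), (∀ k, aeval f (F k) = 0) →
      ∀ c, Approx B F f c)
    (hev : ∀ v : σ → Λ, (∀ i, v i ∈ maximalIdeal Λ) → ∃ θ' : MvPowerSeries σ K →ₐ[K] Λ, ∀ i, θ' (MvPowerSeries.X i) = v i)
    (θ : MvPowerSeries σ K →ₐ[K] Λ) (hθ : ∀ i, θ (MvPowerSeries.X i) ∈ maximalIdeal Λ)
    (S : Set σ) (b : σ → B) (hb : ∀ i ∈ S, θ (MvPowerSeries.X i) = algebraMap B Λ (b i))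
    {J : Type} (F : J → MvPowerSeries σ K) (hE : ∀ j, IsE (F j)) (hF : ∀ j, θ (F j) = 0) (c : ℕ) :
    ∃ θ' : MvPowerSeries σ K →ₐ[K] Λ, (∀ i, θ' (MvPowerSeries.X i) ∈ maximalIdeal Λ) ∧
      (∀ i ∈ S, θ' (MvPowerSeries.X i) = θ (MvPowerSeries.X i)) ∧ (∀ i, θ' (MvPowerSeries.X i) ∈ etAlg B Λ) ∧
      (∀ i, θ' (MvPowerSeries.X i) - θ (MvPowerSeries.X i) ∈ maximalIdeal Λ ^ c) ∧ ∀ j, θ' (F j) = 0 := by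
  classical
  obtain ⟨t, ht, hsp⟩ := (Submodule.fg_span_iff_fg_span_finset_subset (R := MvPowerSeries σ K) (Set.range F)).1
    (IsNoetherian.noetherian _)
  have hsub : ∀ x : t, ∃ j, F j = x.1 := fun x => ht x.2
  choose jj hjj using hsub
  obtain ⟨θ', h1, h2, h3, h4, h5⟩ := lemA_fin hart hev θ hθ S b hb (J := t) (fun x => F (jj x)) (fun x => hE _) (fun x => hF _) c
  refine ⟨θ', h1, h2, h3, h4, fun j => ?_⟩
  have h6 : F j ∈ Submodule.span (MvPowerSeries σ K) (Set.range F) := Submodule.subset_span ⟨j, rfl⟩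
  rw [hsp] at h6
  have h7 : Ideal.span (t : Set (MvPowerSeries σ K)) ≤ RingHom.ker (θ' : MvPowerSeries σ K →+* Λ) := by
    rw [Ideal.span_le]
    intro x hx
    have := h5 ⟨x, hx⟩
    rw [hjj] at this
    exact this
  exact h7 h6
end A

end Part30

section Part31
open IsLocalRing MvPolynomial

theorem IndepMod.congr' {Λ κ ι : Type} [CommRing Λ] [Fintype κ] {Q : Ideal Λ} {J J' : κ → ι → Λ} (h : ∀ k i, J k i - J' k i ∈ Q)
    (hJ : IndepMod Q J) : IndepMod Q J' := by
  intro l hl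
  refine hJ l fun i => ?_
  have : ∑ k, l k * J k i = ∑ k, l k * J' k i + ∑ k, l k * (J k i - J' k i) := by
    rw [← Finset.sum_add_distrib]
    exact Finset.sum_congr rfl fun k _ => by ring
  rw [this]
  exact add_mem (hl i) (sum_mem fun k _ => Ideal.mul_mem_left _ _ (h k i))

theorem poly_lift {K A ν R : Type} [Field K] [CommRing A] [Algebra K A] (ρ : R → A) (q : MvPolynomial ν (Polynomial A))
    (h : ∀ d k, Polynomial.C ((q.coeff d).coeff k) ∈ (aeval (fun o : Option R => o.elim Polynomial.X (fun r => Polynomial.C (ρ r))) : MvPolynomial (Option R) K →ₐ[K] Polynomial A).range) :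
    ∃ q' : MvPolynomial ν (MvPolynomial (Option R) K),
      map ((aeval (fun o : Option R => o.elim Polynomial.X (fun r => Polynomial.C (ρ r))) : MvPolynomial (Option R) K →ₐ[K] Polynomial A) : MvPolynomial (Option R) K →+* Polynomial A) q' = q := by
  classical
  set L := (aeval (fun o : Option R => o.elim Polynomial.X (fun r => Polynomial.C (ρ r))) : MvPolynomial (Option R) K →ₐ[K] Polynomial A)
  have h1 : ∀ d, ∃ b, L b = q.coeff d := by
    intro d
    change q.coeff d ∈ L.range
    rw [Polynomial.as_sum_range_C_mul_X_pow (q.coeff d)]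
    refine sum_mem fun k _ => mul_mem (h d k) (pow_mem (?_ : Polynomial.X ∈ L.range) k)
    refine ⟨X none, ?_⟩
    change L (X none) = _
    simp [L]
  choose b hb using h1
  refine ⟨∑ d ∈ q.support, monomial d (b d), ?_⟩
  rw [map_sum]
  conv_rhs => rw [q.as_sum]
  refine Finset.sum_congr rfl fun d _ => ?_
  rw [map_monomial]
  exact congrArg _ (hb d)

instance tower_ps {K A : Type} [Field K] [CommRing A] [Algebra K A] : IsScalarTower K (Polynomial A) (PowerSeries A) :=
  IsScalarTower.of_algebraMap_eq fun r => by
    rw [PowerSeries.algebraMap_apply', Polynomial.algebraMap_apply, PowerSeries.algebraMap_apply]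
    simp

section B
variable {K : Type} [Field K]

theorem exists_eta {n : ℕ} {R : Type} [Fintype R] (ψ : MvPowerSeries R K →ₐ[K] MvPowerSeries (Fin n) K) :
    ∃ η : MvPowerSeries (Option R) K →ₐ[K] PowerSeries (MvPowerSeries (Fin n) K),
      η (MvPowerSeries.X none) = PowerSeries.X ∧ (∀ r, η (MvPowerSeries.X (some r)) = PowerSeries.C (ψ (MvPowerSeries.X r))) ∧
      ∀ G α, PowerSeries.coeff α (η G) = ψ (PowerSeries.coeff α (MvPowerSeries.optionEquivLeft R K G)) := by
  classical
  refine ⟨(PowerSeries.mapAlgHom ψ).comp (MvPowerSeries.optionEquivLeft R K : MvPowerSeries (Option R) K →ₐ[K] _), ?_, ?_, ?_⟩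
  · simp [MvPowerSeries.optionEquivLeft_X_none, PowerSeries.mapAlgHom_apply]
  · intro r
    simp [MvPowerSeries.optionEquivLeft_X_some, PowerSeries.mapAlgHom_apply]
  · intro G α
    simp [PowerSeries.mapAlgHom_apply]

theorem ps_X_mem {n : ℕ} : (PowerSeries.X : PowerSeries (MvPowerSeries (Fin n) K)) ∈ maximalIdeal _ := by
  rw [mem_maxIdeal_ps]; simp

theorem ps_C_mem {n : ℕ} {a : MvPowerSeries (Fin n) K} (h : a ∈ maximalIdeal (MvPowerSeries (Fin n) K)) :
    PowerSeries.C a ∈ maximalIdeal (PowerSeries (MvPowerSeries (Fin n) K)) := by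
  rw [mem_maxIdeal_ps]; simpa using h

theorem lemB {n : ℕ} {τ : Type} [Fintype τ] (v : τ → PowerSeries (MvPowerSeries (Fin n) K))
    (hv : ∀ t, v t ∈ etAlg (Polynomial (MvPowerSeries (Fin n) K)) (PowerSeries (MvPowerSeries (Fin n) K)))
    (hvm : ∀ t, v t ∈ maximalIdeal (PowerSeries (MvPowerSeries (Fin n) K))) :
    ∃ (R : Type) (_ : Fintype R) (ρ : R → MvPowerSeries (Fin n) K) (H : τ → MvPowerSeries (Option R) K)
      (η : MvPowerSeries (Option R) K →ₐ[K] PowerSeries (MvPowerSeries (Fin n) K)),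
      (∀ r, ρ r ∈ maximalIdeal (MvPowerSeries (Fin n) K)) ∧ (∀ t, IsE (H t)) ∧
      (∀ t, H t ∈ maximalIdeal (MvPowerSeries (Option R) K)) ∧ η (MvPowerSeries.X none) = PowerSeries.X ∧
      (∀ r, η (MvPowerSeries.X (some r)) = PowerSeries.C (ρ r)) ∧ ∀ t, η (H t) = v t := by
  classical
  obtain ⟨N, z, ⟨Φ, hΦ, hJ⟩, P, hP⟩ := IsEt.common' v hv
  let q : Fin N ⊕ τ → MvPolynomial (Fin N) (Polynomial (MvPowerSeries (Fin n) K)) := Sum.elim Φ P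
  let T : Finset (MvPowerSeries (Fin n) K) := Finset.univ.biUnion fun k => (q k).support.biUnion fun d => ((q k).coeff d).coeffs
  let ρ : T → MvPowerSeries (Fin n) K := fun r => r.1 - algebraMap K _ (MvPowerSeries.constantCoeff r.1)
  have hρ : ∀ r, ρ r ∈ maximalIdeal (MvPowerSeries (Fin n) K) := by
    intro r
    rw [mem_mv_max]
    simp [ρ, MvPowerSeries.algebraMap_apply]
  let L := (aeval (fun o : Option T => o.elim Polynomial.X (fun r => Polynomial.C (ρ r))) : MvPolynomial (Option T) K →ₐ[K] Polynomial (MvPowerSeries (Fin n) K))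
  have hlift : ∀ k, ∃ q' : MvPolynomial (Fin N) (MvPolynomial (Option T) K), map (L : MvPolynomial (Option T) K →+* _) q' = q k := by
    intro k
    refine poly_lift ρ (q k) fun d i => ?_
    by_cases h0 : ((q k).coeff d).coeff i = 0
    · rw [h0, map_zero]; exact zero_mem _
    · have hT : ((q k).coeff d).coeff i ∈ T := by
        refine Finset.mem_biUnion.2 ⟨k, Finset.mem_univ _, Finset.mem_biUnion.2 ⟨d, ?_, Polynomial.coeff_mem_coeffs h0⟩⟩
        rw [mem_support_iff]
        intro h; rw [h] at h0; exact h0 (Polynomial.coeff_zero _)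
      refine ⟨X (some ⟨_, hT⟩) + C (MvPowerSeries.constantCoeff (((q k).coeff d).coeff i)), ?_⟩
      change L _ = _
      simp only [L, map_add, aeval_X, Option.elim, ρ, aeval_C, map_sub]
      rw [Polynomial.algebraMap_apply, sub_add_cancel]
  choose q' hq' using hlift
  obtain ⟨ψ, hψ, -⟩ := exists_ev ρ hρ
  obtain ⟨η, hη0, hη1, -⟩ := exists_eta ψ
  simp only [hψ] at hη1
  have hηm : ∀ i, η (MvPowerSeries.X i) ∈ maximalIdeal (PowerSeries (MvPowerSeries (Fin n) K)) := by
    rintro (_ | r)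
    · rw [hη0]; exact ps_X_mem
    · rw [hη1]; exact ps_C_mem (hρ r)
  have hcomp : ∀ p : MvPolynomial (Option T) K, algebraMap (Polynomial (MvPowerSeries (Fin n) K)) (PowerSeries (MvPowerSeries (Fin n) K)) (L p) = η (algebraMap _ _ p) := by
    intro p
    rw [mvhom_coe]
    have : ((IsScalarTower.toAlgHom K (Polynomial (MvPowerSeries (Fin n) K)) (PowerSeries (MvPowerSeries (Fin n) K))).comp L) = aeval (fun i => η (MvPowerSeries.X i)) := by
      refine MvPolynomial.algHom_ext fun i => ?_
      cases i with
      | none => simp [L, hη0, PowerSeries.algebraMap_apply']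
      | some r => simp [L, hη1, PowerSeries.algebraMap_apply']
    rw [← this]; rfl
  have hev : ∀ (w : Fin N → MvPowerSeries (Option T) K) k, η (aeval w (q' k)) = aeval (fun i => η (w i)) (q k) := by
    intro w k
    rw [← hq' k]
    exact (aeval_map_hom (η : MvPowerSeries (Option T) K →+* PowerSeries (MvPowerSeries (Fin n) K)) (L : MvPolynomial (Option T) K →+* Polynomial (MvPowerSeries (Fin n) K)) (fun b => hcomp b) w (q' k)).symm
  have hdv : ∀ (w : Fin N → MvPowerSeries (Option T) K) k i, η (dv w i (q' k)) = dv (fun i => η (w i)) i (q k) := by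
    intro w k i
    rw [← hq' k]
    exact (dv_map_hom (η : MvPowerSeries (Option T) K →+* PowerSeries (MvPowerSeries (Fin n) K)) (L : MvPolynomial (Option T) K →+* Polynomial (MvPowerSeries (Fin n) K)) (fun b => hcomp b) w i (q' k)).symm
  let k0 : Fin N → K := fun i => MvPowerSeries.constantCoeff (PowerSeries.constantCoeff (z i))
  let g0 : Fin N → MvPowerSeries (Option T) K := fun i => algebraMap K _ (k0 i)
  have hg0 : ∀ i, η (g0 i) - z i ∈ maximalIdeal (PowerSeries (MvPowerSeries (Fin n) K)) := by
    intro i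
    rw [mem_maxIdeal_ps, mem_mv_max]
    simp only [g0, k0, AlgHom.commutes, map_sub]
    rw [PowerSeries.algebraMap_apply, PowerSeries.constantCoeff_C, MvPowerSeries.algebraMap_apply]
    simp
  have hcl : ∀ p : MvPolynomial (Fin N) (Polynomial (MvPowerSeries (Fin n) K)), aeval (fun i => η (g0 i)) p - aeval z p ∈ maximalIdeal (PowerSeries (MvPowerSeries (Fin n) K)) :=
    fun p => aeval_sub_mem _ _ _ hg0 p
  have hJ0 : IndepMod (maximalIdeal (MvPowerSeries (Option T) K)) (fun k i => dv g0 i (q' (Sum.inl k))) := by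
    intro l hl k
    rw [← mvhom_mem_iff η hηm]
    have hJ1 : IndepMod (maximalIdeal (PowerSeries (MvPowerSeries (Fin n) K))) (fun k i => dv (fun i => η (g0 i)) i (Φ k)) :=
      IndepMod.congr' (fun k i => by rw [← neg_mem_iff, neg_sub]; exact hcl _) hJ
    refine hJ1 (fun k => η (l k)) (fun i => ?_) k
    have := (mvhom_mem_iff η hηm _).2 (hl i)
    rw [map_sum] at this
    convert this using 2 with k
    rw [map_mul, hdv]
    rfl
  obtain ⟨h, hh, hh0⟩ := hensel_exists (fun k => q' (Sum.inl k)) g0 1 le_rfl (fun k => by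
    rw [pow_one, ← mvhom_mem_iff η hηm, hev]
    have := hcl (Φ k)
    rwa [hΦ, sub_zero] at this) hJ0
  simp only [pow_one] at hh
  have hhz : (fun i => η (h i)) = z := by
    refine hensel_unique Φ z _ _ hJ (fun i => ?_) (fun i => by rw [sub_self]; exact zero_mem _) fun k => ?_
    · have h1 := (mvhom_mem_iff η hηm _).2 (hh i)
      have := add_mem h1 (hg0 i)
      rw [map_sub] at this
      simpa using this
    · rw [hΦ]
      have := hev h (Sum.inl k)
      rw [hh0, map_zero] at this
      exact this.symm
  have hηH : ∀ t, η (aeval h (q' (Sum.inr t))) = v t := by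
    intro t
    rw [hev, hhz, ← hP]
    rfl
  refine ⟨T, inferInstance, ρ, fun t => aeval h (q' (Sum.inr t)), η, hρ, fun t => ?_, fun t => ?_, hη0, hη1, hηH⟩
  · refine ⟨N, h, ⟨fun k => q' (Sum.inl k), hh0, ?_⟩, _, rfl⟩
    refine IndepMod.congr' (fun k i => ?_) hJ0
    refine aeval_sub_mem _ _ _ (fun i => ?_) _
    rw [← neg_mem_iff, neg_sub]; exact hh i
  · rw [← mvhom_mem_iff η hηm, hηH]; exact hvm t
end B

end Part31

section Part32
open IsLocalRing MvPolynomial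

section N
variable {K : Type} [Field K]

def Dep {n : ℕ} (k : ℕ) (g : MvPowerSeries (Fin n) K) : Prop :=
  ∀ d : Fin n →₀ ℕ, (∃ v : Fin n, d v ≠ 0 ∧ (v : ℕ) < k) → MvPowerSeries.coeff d g = 0

theorem Dep.zero {n : ℕ} (g : MvPowerSeries (Fin n) K) : Dep 0 g := by
  rintro d ⟨v, -, h⟩; omega

theorem Dep.succ {n k : ℕ} {g : MvPowerSeries (Fin (n + 1)) K} (h : Dep (k + 1) g) :
    MvPowerSeries.finSuccEquiv K n g = PowerSeries.C (PowerSeries.constantCoeff (MvPowerSeries.finSuccEquiv K n g)) ∧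
      Dep k (PowerSeries.constantCoeff (MvPowerSeries.finSuccEquiv K n g)) := by
  constructor
  · ext i x
    rw [PowerSeries.coeff_C]
    split
    · next hi => rw [hi, PowerSeries.coeff_zero_eq_constantCoeff_apply]
    · next hi =>
      rw [MvPowerSeries.coeff_coeff_finSuccEquiv]
      refine (h _ ⟨0, ?_, by simp⟩).trans (by simp)
      simpa using hi
  · rintro d ⟨v, hv, hk⟩
    rw [← PowerSeries.coeff_zero_eq_constantCoeff_apply, MvPowerSeries.coeff_coeff_finSuccEquiv]
    exact h _ ⟨v.succ, by simpa using hv, by simpa using hk⟩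

theorem Dep.of_C {n k : ℕ} {g : MvPowerSeries (Fin n) K} (h : Dep k g) :
    Dep (k + 1) ((MvPowerSeries.finSuccEquiv K n).symm (PowerSeries.C g)) := by
  rintro d ⟨v, hv, hk⟩
  have h1 := MvPowerSeries.coeff_coeff_finSuccEquiv (R := K) (n := n) ((MvPowerSeries.finSuccEquiv K n).symm (PowerSeries.C g)) (k := d 0) (x := d.tail)
  rw [AlgEquiv.apply_symm_apply, Finsupp.cons_tail] at h1
  rw [← h1, PowerSeries.coeff_C]
  split
  · next h0 =>
    refine h _ ?_
    rcases Fin.eq_zero_or_eq_succ v with rfl | ⟨v, rfl⟩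
    · exact absurd h0 hv
    · exact ⟨v, by simpa [Finsupp.tail_apply] using hv, by simpa using hk⟩
  · simp

def Nested (K : Type) [Field K] (n : ℕ) : Prop :=
  ∀ (U : Type) [Fintype U] (lev : U → ℕ) (J : Type) (F : J → MvPowerSeries (Fin n ⊕ U) K)
    (φ : MvPowerSeries (Fin n ⊕ U) K →ₐ[K] MvPowerSeries (Fin n) K), (∀ j, IsE (F j)) →
    (∀ i, φ (MvPowerSeries.X (Sum.inl i)) = MvPowerSeries.X i) →
    (∀ u, φ (MvPowerSeries.X (Sum.inr u)) ∈ maximalIdeal (MvPowerSeries (Fin n) K)) →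
    (∀ u, Dep (lev u) (φ (MvPowerSeries.X (Sum.inr u)))) → (∀ j, φ (F j) = 0) → ∀ c : ℕ,
    ∃ φ' : MvPowerSeries (Fin n ⊕ U) K →ₐ[K] MvPowerSeries (Fin n) K,
      (∀ i, φ' (MvPowerSeries.X (Sum.inl i)) = MvPowerSeries.X i) ∧
      (∀ u, φ' (MvPowerSeries.X (Sum.inr u)) ∈ maximalIdeal (MvPowerSeries (Fin n) K)) ∧
      (∀ u, Dep (lev u) (φ' (MvPowerSeries.X (Sum.inr u)))) ∧
      (∀ u, IsE (φ' (MvPowerSeries.X (Sum.inr u)))) ∧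
      (∀ u, φ' (MvPowerSeries.X (Sum.inr u)) - φ (MvPowerSeries.X (Sum.inr u)) ∈ maximalIdeal (MvPowerSeries (Fin n) K) ^ c) ∧
      ∀ j, φ' (F j) = 0

theorem nested_zero : Nested K 0 := by
  intro U _ lev J F φ hE hX hm hdep hF c
  refine ⟨φ, hX, hm, hdep, fun u => ?_, fun u => by rw [sub_self]; exact zero_mem _, hF⟩
  have : φ (MvPowerSeries.X (Sum.inr u)) = 0 := by
    ext d
    have h := hm u
    rw [mem_mv_max] at h
    rw [Subsingleton.elim d 0, MvPowerSeries.coeff_zero_eq_constantCoeff_apply, h]; simp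
  rw [this]
  exact zero_mem (etAlg _ _)

theorem mem_equiv_iff {S T : Type} [CommRing S] [CommRing T] [IsLocalRing S] [IsLocalRing T] [Algebra K S] [Algebra K T] (e : S ≃ₐ[K] T)
    (x : S) (c : ℕ) : e x ∈ maximalIdeal T ^ c ↔ x ∈ maximalIdeal S ^ c := by
  have h := map_maxIdeal_equiv e.toRingEquiv
  rw [← h, ← Ideal.map_pow, Ideal.mem_map_of_equiv]
  constructor
  · rintro ⟨y, hy, h⟩
    rwa [← e.injective h]
  · intro h; exact ⟨x, h, rfl⟩

theorem mem_equiv_iff1 {S T : Type} [CommRing S] [CommRing T] [IsLocalRing S] [IsLocalRing T] [Algebra K S] [Algebra K T] (e : S ≃ₐ[K] T)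
    (x : S) : e x ∈ maximalIdeal T ↔ x ∈ maximalIdeal S := by
  have := mem_equiv_iff e x 1
  rwa [pow_one, pow_one] at this

theorem X_mem {s : Type} [Fintype s] (i : s) : (MvPowerSeries.X i : MvPowerSeries s K) ∈ maximalIdeal (MvPowerSeries s K) := by
  rw [mem_mv_max]; simp

theorem nested_succ [Algebra ℚ K] (n : ℕ) (IH : Nested K n) : Nested K (n + 1) := by
  classical
  intro U _ lev J F φ hE hX hm hdep hF c
  let e := MvPowerSeries.finSuccEquiv K n
  have he0 : e (MvPowerSeries.X 0) = PowerSeries.X := MvPowerSeries.finSuccEquiv_X_zero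
  have he1 : ∀ i : Fin n, e (MvPowerSeries.X i.succ) = PowerSeries.C (MvPowerSeries.X i) := fun i => MvPowerSeries.finSuccEquiv_X_succ i
  let θ : MvPowerSeries (Fin (n + 1) ⊕ U) K →ₐ[K] PowerSeries (MvPowerSeries (Fin n) K) :=
    (e : MvPowerSeries (Fin (n + 1)) K →ₐ[K] PowerSeries (MvPowerSeries (Fin n) K)).comp φ
  have hθφ : ∀ x, θ x = e (φ x) := fun x => rfl
  let g : U → MvPowerSeries (Fin n) K := fun u => if lev u = 0 then 0 else PowerSeries.constantCoeff (e (φ (MvPowerSeries.X (Sum.inr u))))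
  have hg : ∀ u, lev u ≠ 0 → θ (MvPowerSeries.X (Sum.inr u)) = PowerSeries.C (g u) ∧ Dep (lev u - 1) (g u) := by
    intro u hu
    obtain ⟨k, hk⟩ := Nat.exists_eq_succ_of_ne_zero hu
    have h := hdep u
    rw [hk] at h
    simp only [g, if_neg hu, hk]
    exact h.succ
  have hθm : ∀ i, θ (MvPowerSeries.X i) ∈ maximalIdeal (PowerSeries (MvPowerSeries (Fin n) K)) := by
    rintro (i | u)
    · rw [hθφ, mem_equiv_iff1, hX]; exact X_mem i
    · rw [hθφ, mem_equiv_iff1]; exact hm u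
  have hgm : ∀ u, g u ∈ maximalIdeal (MvPowerSeries (Fin n) K) := by
    intro u
    by_cases hu : lev u = 0
    · simp only [g, if_pos hu]; exact zero_mem _
    · have := hθm (Sum.inr u)
      rw [(hg u hu).1, mem_maxIdeal_ps] at this
      simpa using this
  let S : Set (Fin (n + 1) ⊕ U) := {i | ∀ u, i = Sum.inr u → lev u ≠ 0}
  let b : Fin (n + 1) ⊕ U → Polynomial (MvPowerSeries (Fin n) K) :=
    Sum.elim (Fin.cases Polynomial.X (fun i => Polynomial.C (MvPowerSeries.X i))) (fun u => Polynomial.C (g u))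
  have hb : ∀ i ∈ S, θ (MvPowerSeries.X i) = algebraMap _ _ (b i) := by
    rintro (i | u) hi
    · rw [hθφ, hX]
      refine Fin.cases ?_ (fun i => ?_) i
      · rw [he0]; simp [b, PowerSeries.algebraMap_apply']
      · rw [he1]; simp [b, PowerSeries.algebraMap_apply']
    · rw [(hg u (hi u rfl)).1]
      simp [b, PowerSeries.algebraMap_apply']
  have hart : ∀ (ι κ : Type) [Fintype ι] [Fintype κ] (F : κ → MvPolynomial ι (Polynomial (MvPowerSeries (Fin n) K)))
      (f : ι → PowerSeries (MvPowerSeries (Fin n) K)), (∀ k, aeval f (F k) = 0) →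
      ∀ c, Approx (Polynomial (MvPowerSeries (Fin n) K)) F f c := by
    intro ι κ _ _ F f hF c
    exact thmB densePS (JC_poly (JC_mv n)) (JC_mvps n) (cmp_mvps n) F f hF c
  have hev : ∀ v : Fin (n + 1) ⊕ U → PowerSeries (MvPowerSeries (Fin n) K), (∀ i, v i ∈ maximalIdeal _) →
      ∃ θ' : MvPowerSeries (Fin (n + 1) ⊕ U) K →ₐ[K] PowerSeries (MvPowerSeries (Fin n) K), ∀ i, θ' (MvPowerSeries.X i) = v i := by
    intro v hv
    obtain ⟨χ, hχ, -⟩ := exists_ev (fun i => e.symm (v i)) (fun i => (mem_equiv_iff1 e.symm _).2 (hv i))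
    refine ⟨(e : MvPowerSeries (Fin (n + 1)) K →ₐ[K] PowerSeries (MvPowerSeries (Fin n) K)).comp χ, fun i => ?_⟩
    change e (χ _) = _
    rw [hχ, e.apply_symm_apply]
  obtain ⟨θ', ht1, ht2, ht3, ht4, ht5⟩ := lemA hart hev θ hθm S b hb F hE (fun j => by rw [hθφ, hF, map_zero]) c
  obtain ⟨R, _, ρ, H, η, hρ, hHE, hHm, hη0, hη1, hηH⟩ := lemB (fun u : U => θ' (MvPowerSeries.X (Sum.inr u))) (fun u => ht3 _) (fun u => ht1 _)
  obtain ⟨ψ, hψ, -⟩ := exists_ev (K := K) (s := Fin n ⊕ (U ⊕ R)) (t := Fin n) (Sum.elim MvPowerSeries.X (Sum.elim g ρ)) (by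
    rintro (i | u | r)
    · exact X_mem i
    · exact hgm u
    · exact hρ r)
  obtain ⟨j, hj, -⟩ := exists_ev (K := K) (s := Option R) (t := Option (Fin n ⊕ (U ⊕ R)))
    (fun o => o.elim (MvPowerSeries.X none) (fun r => MvPowerSeries.X (some (Sum.inr (Sum.inr r))))) (by
    rintro (_ | r)
    · exact X_mem _
    · exact X_mem _)
  have hjm : ∀ i, j (MvPowerSeries.X i) ∈ maximalIdeal (MvPowerSeries (Option (Fin n ⊕ (U ⊕ R))) K) := by
    rintro (_ | r)
    · rw [hj]; exact X_mem _
    · rw [hj]; exact X_mem _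
  have hjH : ∀ u, j (H u) ∈ maximalIdeal (MvPowerSeries (Option (Fin n ⊕ (U ⊕ R))) K) := fun u => (mvhom_mem_iff j hjm _).2 (hHm u)
  have hjE : ∀ u, IsE (j (H u)) := fun u => IsE.hom j hjm (by
    rintro (_ | r)
    · rw [hj]; exact IsE.X _
    · rw [hj]; exact IsE.X _) (hHE u)
  let kv : Fin (n + 1) ⊕ U → MvPowerSeries (Option (Fin n ⊕ (U ⊕ R))) K :=
    Sum.elim (Fin.cases (MvPowerSeries.X none) (fun i => MvPowerSeries.X (some (Sum.inl i))))
      (fun u => if lev u = 0 then j (H u) else MvPowerSeries.X (some (Sum.inr (Sum.inl u))))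
  have hkv : ∀ i, kv i ∈ maximalIdeal (MvPowerSeries (Option (Fin n ⊕ (U ⊕ R))) K) ∧ IsE (kv i) := by
    rintro (i | u)
    · refine Fin.cases ?_ (fun i => ?_) i
      · exact ⟨X_mem _, IsE.X _⟩
      · exact ⟨X_mem _, IsE.X _⟩
    · simp only [kv, Sum.elim_inr]
      split
      · exact ⟨hjH u, hjE u⟩
      · exact ⟨X_mem _, IsE.X _⟩
  obtain ⟨κ, hκ, -⟩ := exists_ev kv (fun i => (hkv i).1)
  have hκm : ∀ i, κ (MvPowerSeries.X i) ∈ maximalIdeal (MvPowerSeries (Option (Fin n ⊕ (U ⊕ R))) K) := fun i => by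
    rw [hκ]; exact (hkv i).1
  have hκE : ∀ G, IsE G → IsE (κ G) := fun G hG => IsE.hom κ hκm (fun i => by rw [hκ]; exact (hkv i).2) hG
  obtain ⟨η2, h20, h21, h2c⟩ := exists_eta ψ
  have h2m : ∀ i, η2 (MvPowerSeries.X i) ∈ maximalIdeal (PowerSeries (MvPowerSeries (Fin n) K)) := by
    rintro (_ | i)
    · rw [h20]; exact ps_X_mem
    · rw [h21, hψ]
      refine ps_C_mem ?_
      rcases i with i | u | r
      · exact X_mem i
      · exact hgm u
      · exact hρ r
  have hcj : η2.comp j = η := by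
    refine hom_ext_mv _ _ (fun i => ?_) fun i => ?_
    · exact (mvhom_mem_iff η2 h2m _).2 (hjm i)
    · rw [AlgHom.comp_apply, hj]
      cases i with
      | none => rw [hη0]; exact h20
      | some r => rw [hη1]; exact (h21 _).trans (by rw [hψ]; rfl)
  have hck : η2.comp κ = θ' := by
    refine hom_ext_mv _ _ (fun i => ?_) fun i => ?_
    · exact (mvhom_mem_iff η2 h2m _).2 (hκm i)
    · rw [AlgHom.comp_apply, hκ]
      rcases i with i | u
      · rw [ht2 (Sum.inl i) (by rintro u ⟨⟩), hθφ, hX]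
        refine Fin.cases ?_ (fun i => ?_) i
        · rw [he0]; exact h20
        · rw [he1]; exact (h21 _).trans (by rw [hψ]; rfl)
      · by_cases hu : lev u = 0
        · simp only [kv, Sum.elim_inr, if_pos hu]
          rw [← AlgHom.comp_apply, hcj, hηH]
        · simp only [kv, Sum.elim_inr, if_neg hu]
          rw [ht2 (Sum.inr u) (by rintro u' h; rwa [← Sum.inr.inj h]), (hg u hu).1, h21, hψ]
          rfl
  obtain ⟨ψ', hi1, hi2, hi3, hi4, hi5, hi6⟩ := IH (U ⊕ R) (Sum.elim (fun u => lev u - 1) (fun _ => 0)) (J × ℕ)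
    (fun p => PowerSeries.coeff p.2 (MvPowerSeries.optionEquivLeft _ K (κ (F p.1)))) ψ
    (fun p => isE_coeff _ _ (hκE _ (hE _))) (fun i => hψ _)
    (by
      rintro (u | r)
      · rw [hψ]; exact hgm u
      · rw [hψ]; exact hρ r)
    (by
      rintro (u | r)
      · rw [hψ]
        by_cases hu : lev u = 0
        · simp only [Sum.elim_inl, hu]; exact Dep.zero _
        · exact (hg u hu).2
      · exact Dep.zero _)
    (by
      rintro ⟨a, α⟩
      change ψ _ = 0
      rw [← h2c, ← AlgHom.comp_apply, hck, ht5, map_zero]) c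
  obtain ⟨η3, h30, h31, h3c⟩ := exists_eta ψ'
  have h3m : ∀ i, η3 (MvPowerSeries.X i) ∈ maximalIdeal (PowerSeries (MvPowerSeries (Fin n) K)) := by
    rintro (_ | i)
    · rw [h30]; exact ps_X_mem
    · rw [h31]
      refine ps_C_mem ?_
      rcases i with i | u
      · rw [hi1]; exact X_mem i
      · exact hi2 u
  let ι : MvPowerSeries (Fin n) K →ₐ[K] MvPowerSeries (Fin (n + 1)) K :=
    { toRingHom := (e.symm : PowerSeries (MvPowerSeries (Fin n) K) →+* MvPowerSeries (Fin (n + 1)) K).comp (PowerSeries.C (R := MvPowerSeries (Fin n) K))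
      commutes' := fun r => by
        change e.symm (PowerSeries.C (algebraMap _ _ r)) = _
        rw [← AlgEquiv.commutes e.symm, PowerSeries.algebraMap_apply] }
  have hι : ∀ a, ι a = e.symm (PowerSeries.C a) := fun a => rfl
  have hιX : ∀ i, ι (MvPowerSeries.X i) = MvPowerSeries.X i.succ := fun i => by
    rw [hι, ← he1, e.symm_apply_apply]
  have hιm : ∀ i, ι (MvPowerSeries.X i) ∈ maximalIdeal (MvPowerSeries (Fin (n + 1)) K) := fun i => by rw [hιX]; exact X_mem _
  have hιE : ∀ a, IsE a → IsE (ι a) := fun a ha => IsE.hom ι hιm (fun i => by rw [hιX]; exact IsE.X _) ha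
  let E2 := (e.symm : PowerSeries (MvPowerSeries (Fin n) K) →ₐ[K] MvPowerSeries (Fin (n + 1)) K).comp η2
  let E3 := (e.symm : PowerSeries (MvPowerSeries (Fin n) K) →ₐ[K] MvPowerSeries (Fin (n + 1)) K).comp η3
  have hE2 : ∀ x, E2 x = e.symm (η2 x) := fun _ => rfl
  have hE3 : ∀ x, E3 x = e.symm (η3 x) := fun _ => rfl
  have hE2m : ∀ i, E2 (MvPowerSeries.X i) ∈ maximalIdeal (MvPowerSeries (Fin (n + 1)) K) := fun i =>
    (mem_equiv_iff1 e.symm _).2 (h2m i)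
  have hE3m : ∀ i, E3 (MvPowerSeries.X i) ∈ maximalIdeal (MvPowerSeries (Fin (n + 1)) K) := fun i =>
    (mem_equiv_iff1 e.symm _).2 (h3m i)
  have hE30 : E3 (MvPowerSeries.X none) = MvPowerSeries.X 0 := by rw [hE3, h30, ← he0, e.symm_apply_apply]
  have hE31 : ∀ i, E3 (MvPowerSeries.X (some i)) = ι (ψ' (MvPowerSeries.X i)) := fun i => by rw [hE3, h31, hι]
  have hE3E : ∀ G, IsE G → IsE (E3 G) := by
    intro G hG
    refine IsE.hom E3 hE3m ?_ hG
    rintro (_ | i | u)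
    · rw [hE30]; exact IsE.X _
    · rw [hE31, hi1]; exact hιE _ (IsE.X _)
    · rw [hE31]; exact hιE _ (hi4 u)
  have hclose : ∀ G, E3 G - E2 G ∈ maximalIdeal (MvPowerSeries (Fin (n + 1)) K) ^ c := by
    refine hom_close E3 E2 hE3m hE2m c ?_
    rintro (_ | i)
    · rw [hE3, hE2, h30, h20, sub_self]; exact zero_mem _
    · rw [hE31, hE2, h21, ← hι, ← map_sub]
      refine mvhom_mem ι hιm c _ ?_
      rcases i with i | u
      · rw [hi1, hψ]; simp
      · exact hi5 u
  refine ⟨E3.comp κ, fun i => ?_, fun u => ?_, fun u => ?_, fun u => ?_, fun u => ?_, fun a => ?_⟩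
  · rw [AlgHom.comp_apply, hκ]
    refine Fin.cases ?_ (fun i => ?_) i
    · exact hE30
    · exact (hE31 _).trans (by rw [hi1, hιX])
  · exact (mvhom_mem_iff E3 hE3m _).2 (hκm _)
  · by_cases hu : lev u = 0
    · rw [hu]; exact Dep.zero _
    · rw [AlgHom.comp_apply, hκ]
      simp only [kv, Sum.elim_inr, if_neg hu]
      rw [hE31, hι]
      have := (hi3 (Sum.inl u)).of_C
      rw [Sum.elim_inl, Nat.sub_add_cancel (Nat.one_le_iff_ne_zero.2 hu)] at this
      exact this
  · rw [AlgHom.comp_apply, hκ]; exact hE3E _ (hkv _).2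
  · have h1 := hclose (κ (MvPowerSeries.X (Sum.inr u)))
    have h2 : E2 (κ (MvPowerSeries.X (Sum.inr u))) - φ (MvPowerSeries.X (Sum.inr u)) ∈ maximalIdeal (MvPowerSeries (Fin (n + 1)) K) ^ c := by
      rw [← mem_equiv_iff e, map_sub, hE2, e.apply_symm_apply, ← hθφ, ← AlgHom.comp_apply, hck]
      exact ht4 _
    have := add_mem h1 h2
    rw [AlgHom.comp_apply]
    simpa using this
  · rw [AlgHom.comp_apply, hE3]
    have : η3 (κ (F a)) = 0 := by
      ext1 α
      rw [h3c, map_zero]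
      exact hi6 (a, α)
    rw [this, map_zero]

theorem nested_all [Algebra ℚ K] (n : ℕ) : Nested K n := by
  induction n with
  | zero => exact nested_zero
  | succ n ih => exact nested_succ n ih
end N

end Part32

section P33

theorem psubst_eq {σ τ : Type} [Fintype σ] [DecidableEq σ] [Fintype τ] (a : σ → MvPowerSeries τ ℝ)
    (ha : ∀ s, MvPowerSeries.constantCoeff (a s) = 0) (f : MvPowerSeries σ ℝ) : psubst a f = MvPowerSeries.subst a f := by
  ext d
  rw [MvPowerSeries.coeff_subst (MvPowerSeries.hasSubst_of_constantCoeff_zero ha)]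
  refine Eq.symm (finsum_eq_sum_of_support_subset _ ?_)
  intro e he
  rw [Finset.coe_Iic, Set.mem_Iic]
  intro s
  by_contra h
  apply he
  have h1 : d.degree < e s := by
    have h2 : (Finsupp.equivFunOnFinite.symm fun _ : σ => d.sum fun _ k => k) s = d.degree := rfl
    rw [h2] at h
    omega
  have h3 : (e.prod fun s k => a s ^ k) ∈ IsLocalRing.maximalIdeal (MvPowerSeries τ ℝ) ^ e s := by
    have h4 : a s ^ e s ∣ e.prod fun s k => a s ^ k :=
      Finset.dvd_prod_of_mem (fun s => a s ^ e s) (Finsupp.mem_support_iff.2 (by omega))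
    exact Ideal.mem_of_dvd _ h4 (Ideal.pow_mem_pow ((mem_mv_max _).2 (ha s)) _)
  change _ • _ = _
  rw [(mv_mem_pow _ _).1 h3 d h1, smul_zero]

theorem exists_order {m : ℕ} (V : Type) [Fintype V] (k : V → Fin m) :
    ∃ (ε : V ≃ Fin (Fintype.card V)) (lev : Fin m → ℕ), ∀ i v, (ε v : ℕ) < lev i ↔ i < k v := by
  classical
  let ε0 := Fintype.equivFin V
  let g : Fin (Fintype.card V) → (Fin m)ᵒᵈ := fun x => OrderDual.toDual (k (ε0.symm x))
  let σ := Tuple.sort g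
  refine ⟨ε0.trans σ.symm, fun i => (Finset.univ.filter fun x => (g ∘ σ) x < OrderDual.toDual i).card, fun i v => ?_⟩
  refine (Tuple.lt_card_lt_iff_apply_lt_of_monotone (Tuple.monotone_sort g)).trans ?_
  change OrderDual.toDual (k (ε0.symm (σ (σ.symm (ε0 v))))) < OrderDual.toDual i ↔ _
  rw [σ.apply_symm_apply, ε0.symm_apply_apply, OrderDual.toDual_lt_toDual]

theorem coeff_ren {σ τ : Type} (ε : σ ≃ τ) (p : MvPowerSeries σ ℝ) (d : σ →₀ ℕ) :
    MvPowerSeries.coeff (d.embDomain ε.toEmbedding) (MvPowerSeries.renameEquiv ℝ ε p) = MvPowerSeries.coeff d p :=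
  MvPowerSeries.coeff_embDomain_rename ε.toEmbedding p d

theorem exists_emb {σ τ : Type} (ε : σ ≃ τ) (d : τ →₀ ℕ) : ∃ d' : σ →₀ ℕ, d'.embDomain ε.toEmbedding = d := by
  refine ⟨d.equivMapDomain ε.symm, ?_⟩
  ext t
  obtain ⟨s, rfl⟩ := ε.surjective t
  have := Finsupp.embDomain_apply_self ε.toEmbedding (d.equivMapDomain ε.symm) s
  rw [Equiv.coe_toEmbedding] at this
  rw [this]; simp

theorem ren_X {σ τ : Type} (ε : σ ≃ τ) (s : σ) : MvPowerSeries.renameEquiv ℝ ε (MvPowerSeries.X s) = MvPowerSeries.X (ε s) :=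
  MvPowerSeries.rename_X ε s

theorem IsE.ren {σ τ : Type} [Fintype σ] [Fintype τ] (ε : σ ≃ τ) {G : MvPowerSeries σ ℝ} (hG : IsE G) :
    IsE (MvPowerSeries.renameEquiv ℝ ε G) := by
  refine IsE.hom (MvPowerSeries.renameEquiv ℝ ε : MvPowerSeries σ ℝ →ₐ[ℝ] MvPowerSeries τ ℝ) (fun i => ?_) (fun i => ?_) hG
  · change MvPowerSeries.renameEquiv ℝ ε _ ∈ _
    rw [ren_X]; exact X_mem _
  · change IsE (MvPowerSeries.renameEquiv ℝ ε _)
    rw [ren_X]; exact IsE.X _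

end P33

/-- Nested Artin approximation for algebraic power series: the variables come in blocks
`x₁, …, xₘ` (of sizes `n₁, …, nₘ`) and `y₁, …, yₘ` (of sizes `l₁, …, lₘ`); a variable is
encoded as a pair `⟨j, t⟩` where `j : Fin m` is the block index.  "`F` involves only the
variables of the blocks `1, …, i`" is expressed by vanishing of all coefficients of
monomials involving a variable of a block `> i`. -/
theorem nested_artin_approximation (m : ℕ) (hm : 1 ≤ m) (n l : Fin m → ℕ)
    (F : (i : Fin m) → MvPowerSeries ((Σ j : Fin m, Fin (n j)) ⊕ (Σ j : Fin m, Fin (l j))) ℝ)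
    (hFalg : ∀ i, IsAlgebraicPS (F i))
    (hFdep : ∀ i d, (∃ v, d v ≠ 0 ∧ i < Sum.elim Sigma.fst Sigma.fst v) →
      MvPowerSeries.coeff d (F i) = 0)
    (f : (i : Fin m) → Fin (l i) → MvPowerSeries (Σ j : Fin m, Fin (n j)) ℝ)
    (hf0 : ∀ i t, MvPowerSeries.constantCoeff (f i t) = 0)
    (hfdep : ∀ i t d, (∃ v, d v ≠ 0 ∧ i < v.1) → MvPowerSeries.coeff d (f i t) = 0)
    (heq : ∀ i, psubst
      (Sum.elim (fun s => MvPowerSeries.X s) (fun p => f p.1 p.2)) (F i) = 0) :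
    ∀ c : ℕ, ∃ ftil : (i : Fin m) → Fin (l i) → MvPowerSeries (Σ j : Fin m, Fin (n j)) ℝ,
      (∀ i t, IsAlgebraicPS (ftil i t)) ∧
      (∀ i t, MvPowerSeries.constantCoeff (ftil i t) = 0) ∧
      (∀ i t d, (∃ v, d v ≠ 0 ∧ i < v.1) → MvPowerSeries.coeff d (ftil i t) = 0) ∧
      (∀ i t d, (d.sum fun _ k => k) < c →
        MvPowerSeries.coeff d (ftil i t - f i t) = 0) ∧
      (∀ i, psubst
        (Sum.elim (fun s => MvPowerSeries.X s) (fun p => ftil p.1 p.2)) (F i) = 0) := by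
  classical
  intro c
  obtain ⟨ε, lev, hlev⟩ := exists_order (Σ j : Fin m, Fin (n j)) Sigma.fst
  let α := MvPowerSeries.renameEquiv ℝ ε
  let ε1 : (Σ j : Fin m, Fin (n j)) ⊕ (Σ j : Fin m, Fin (l j)) ≃ Fin (Fintype.card (Σ j : Fin m, Fin (n j))) ⊕ (Σ j : Fin m, Fin (l j)) :=
    Equiv.sumCongr ε (Equiv.refl _)
  let e1 := MvPowerSeries.renameEquiv ℝ ε1
  have hfm : ∀ i, Sum.elim (fun s => MvPowerSeries.X s) (fun p : (Σ j : Fin m, Fin (l j)) => f p.1 p.2) i ∈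
      IsLocalRing.maximalIdeal (MvPowerSeries (Σ j : Fin m, Fin (n j)) ℝ) := by
    rintro (i | u)
    · exact X_mem i
    · exact (mem_mv_max _).2 (hf0 _ _)
  obtain ⟨φ0, hφ0, hφs⟩ := exists_ev _ hfm
  let φ : MvPowerSeries (Fin (Fintype.card (Σ j : Fin m, Fin (n j))) ⊕ (Σ j : Fin m, Fin (l j))) ℝ →ₐ[ℝ]
      MvPowerSeries (Fin (Fintype.card (Σ j : Fin m, Fin (n j)))) ℝ :=
    ((α : MvPowerSeries (Σ j : Fin m, Fin (n j)) ℝ →ₐ[ℝ] _).comp φ0).comp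
      (e1.symm : _ →ₐ[ℝ] MvPowerSeries ((Σ j : Fin m, Fin (n j)) ⊕ (Σ j : Fin m, Fin (l j))) ℝ)
  have hφ : ∀ x, φ x = α (φ0 (e1.symm x)) := fun x => rfl
  have he1 : ∀ v, e1.symm (MvPowerSeries.X v) = MvPowerSeries.X (ε1.symm v) := fun v => ren_X ε1.symm v
  have hφX : ∀ i, φ (MvPowerSeries.X (Sum.inl i)) = MvPowerSeries.X i := by
    intro i
    rw [hφ, he1, hφ0]
    change α (MvPowerSeries.X (ε.symm i)) = _
    rw [ren_X, ε.apply_symm_apply]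
  have hφu : ∀ u, φ (MvPowerSeries.X (Sum.inr u)) = α (f u.1 u.2) := by
    intro u
    rw [hφ, he1, hφ0]
    rfl
  have hN := nested_all (K := ℝ) (Fintype.card (Σ j : Fin m, Fin (n j)))
  obtain ⟨φ', h1, h2, h3, h4, h5, h6⟩ := hN (Σ j : Fin m, Fin (l j)) (fun u => lev u.1) (Fin m) (fun i => e1 (F i)) φ
    (fun i => (IsE.of_alg (hFalg i)).ren ε1) hφX
    (fun u => by rw [hφu, mem_equiv_iff1]; exact (mem_mv_max _).2 (hf0 _ _))
    (fun u => by
      rw [hφu]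
      rintro d ⟨v, hv, hvl⟩
      obtain ⟨d, rfl⟩ := exists_emb ε d
      obtain ⟨v, rfl⟩ := ε.surjective v
      rw [coeff_ren]
      refine hfdep _ _ _ ⟨v, ?_, (hlev _ _).1 hvl⟩
      have := Finsupp.embDomain_apply_self ε.toEmbedding d v
      rw [Equiv.coe_toEmbedding] at this
      rwa [this] at hv)
    (fun i => by
      rw [hφ, e1.symm_apply_apply, hφs, ← psubst_eq _ (fun s => (mem_mv_max _).1 (hfm s)), heq, map_zero]) c
  let ftil : (i : Fin m) → Fin (l i) → MvPowerSeries (Σ j : Fin m, Fin (n j)) ℝ := fun i t => α.symm (φ' (MvPowerSeries.X (Sum.inr ⟨i, t⟩)))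
  have hftm : ∀ i t, ftil i t ∈ IsLocalRing.maximalIdeal (MvPowerSeries (Σ j : Fin m, Fin (n j)) ℝ) := fun i t =>
    (mem_equiv_iff1 α.symm _).2 (h2 _)
  have hαf : ∀ i t, α (ftil i t) = φ' (MvPowerSeries.X (Sum.inr ⟨i, t⟩)) := fun i t => α.apply_symm_apply _
  refine ⟨ftil, fun i t => ?_, fun i t => (mem_mv_max _).1 (hftm i t), fun i t d hd => ?_, fun i t d hd => ?_, fun i => ?_⟩
  · exact ((h4 ⟨i, t⟩).ren ε.symm).alg
  · obtain ⟨v, hv, hvi⟩ := hd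
    rw [← coeff_ren ε]
    change MvPowerSeries.coeff _ (α _) = 0
    rw [hαf]
    refine h3 ⟨i, t⟩ _ ⟨ε v, ?_, (hlev _ _).2 hvi⟩
    have := Finsupp.embDomain_apply_self ε.toEmbedding d v
    rw [Equiv.coe_toEmbedding] at this
    rwa [this]
  · refine (mv_mem_pow c _).1 ?_ d hd
    rw [← mem_equiv_iff α, map_sub, hαf]
    have := h5 ⟨i, t⟩
    rwa [hφu] at this
  · have hfm' : ∀ i, Sum.elim (fun s => MvPowerSeries.X s) (fun p : (Σ j : Fin m, Fin (l j)) => ftil p.1 p.2) i ∈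
        IsLocalRing.maximalIdeal (MvPowerSeries (Σ j : Fin m, Fin (n j)) ℝ) := by
      rintro (i | u)
      · exact X_mem i
      · exact hftm _ _
    obtain ⟨φ1, hφ1, hφ1s⟩ := exists_ev _ hfm'
    rw [psubst_eq _ (fun s => (mem_mv_max _).1 (hfm' s)), ← hφ1s]
    have hc : φ1 = ((α.symm : _ →ₐ[ℝ] MvPowerSeries (Σ j : Fin m, Fin (n j)) ℝ).comp φ').comp
        (e1 : MvPowerSeries ((Σ j : Fin m, Fin (n j)) ⊕ (Σ j : Fin m, Fin (l j))) ℝ →ₐ[ℝ] _) := by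
      refine hom_ext_mv _ _ (fun i => by rw [hφ1]; exact hfm' i) fun v => ?_
      rw [hφ1]
      change _ = α.symm (φ' (e1 (MvPowerSeries.X v)))
      rw [ren_X]
      rcases v with v | u
      · change _ = α.symm (φ' (MvPowerSeries.X (Sum.inl (ε v))))
        rw [h1]
        change _ = MvPowerSeries.renameEquiv ℝ ε.symm _
        rw [ren_X, ε.symm_apply_apply]
        rfl
      · rfl
    rw [hc]
    change α.symm (φ' (e1 (F i))) = 0
    rw [h6, map_zero]
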